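/- Let ρ : ℝ → ℝ be an even, 2π-periodic, everywhere positive C^∞ function satisfying ρ(θ)ρ''(θ) − 2ρ'(θ)² − ρ(θ)² ≠ 0 for all θ, and let ℬ ⊂ ℝ³ be the body of revolution ℬ = { r·(sin θ cos φ, sin θ sin φ, cos θ) : 0 ≤ θ ≤ π, 0 ≤ φ ≤ 2π, 0 ≤ r ≤ ρ(θ) }. Then the lattice point discrepancy satisfies P_ℬ(t) = Ω₋( t^{1/2} (log t)^{1/3} (log₂ t)^{(2/3)(√2−1)} (log₃ t)^{−2/3} ); that is, there exists a constant c > 0 such that for every T there is a t ≥ T with P_ℬ(t) ≤ −c · t^{1/2} (log t)^{1/3} (log₂ t)^{(2/3)(√2−1)} (log₃ t)^{−2/3}. -/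

import Mathlib

open Real MeasureTheory Pointwise

/-- The lattice point discrepancy of a body `B ⊆ ℝ³`:
number of integer lattice points in `√t • B` minus `vol(B) · t^{3/2}`. -/
noncomputable def latticeDiscrepancy (B : Set (Fin 3 → ℝ)) (t : ℝ) : ℝ :=
  (Nat.card {m : Fin 3 → ℤ // (fun i => (m i : ℝ)) ∈ Real.sqrt t • B} : ℝ)
    - (MeasureTheory.volume B).toReal * t ^ (3 / 2 : ℝ)


/-- Simultaneous Dirichlet approximation for a finite set of real numbers. -/
theorem exists_simultaneous_approx (F : Finset ℝ) (T : ℝ) (Q : ℕ) (hQ : 1 ≤ Q) :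
    ∃ q : ℕ, 1 ≤ q ∧ q ≤ Q ^ F.card ∧ ∀ x ∈ F, ∃ k : ℤ, |(q : ℝ) * T * x - k| ≤ 1 / (Q : ℝ) := by
  classical
  have hQ0 : (0 : ℝ) < Q := by exact_mod_cast hQ
  have hlt : ∀ y : ℝ, ⌊(Q : ℝ) * Int.fract y⌋₊ < Q := by
    intro y
    rw [Nat.floor_lt (by have := Int.fract_nonneg y; positivity)]
    nlinarith [Int.fract_lt_one y]
  let f : ℕ → (F → Fin Q) := fun n x => ⟨⌊(Q : ℝ) * Int.fract ((n : ℝ) * T * x)⌋₊, hlt _⟩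
  obtain ⟨a, ha, b, hb, hne, hab⟩ :=
    Finset.exists_ne_map_eq_of_card_lt_of_maps_to (s := Finset.range (Q ^ F.card + 1))
      (t := (Finset.univ : Finset (F → Fin Q))) (f := f) (by simp) (fun _ _ => by simp)
  wlog hlt' : a < b generalizing a b
  · exact this b hb a ha hne.symm hab.symm (by omega)
  rw [Finset.mem_range] at hb
  refine ⟨b - a, by omega, by omega, fun x hx => ?_⟩
  refine ⟨⌊(b : ℝ) * T * x⌋ - ⌊(a : ℝ) * T * x⌋, ?_⟩
  have h1 := congrArg Fin.val (congrFun hab ⟨x, hx⟩)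
  simp only [f] at h1
  have e1 : (((b - a : ℕ) : ℝ)) * T * x - ((⌊(b : ℝ) * T * x⌋ - ⌊(a : ℝ) * T * x⌋ : ℤ) : ℝ)
      = Int.fract ((b : ℝ) * T * x) - Int.fract ((a : ℝ) * T * x) := by
    rw [Nat.cast_sub hlt'.le, Int.fract, Int.fract]; push_cast; ring
  rw [e1]
  set A := Int.fract ((a : ℝ) * T * x)
  set B := Int.fract ((b : ℝ) * T * x)
  have hA : 0 ≤ (Q : ℝ) * A := mul_nonneg hQ0.le (Int.fract_nonneg _)
  have hB : 0 ≤ (Q : ℝ) * B := mul_nonneg hQ0.le (Int.fract_nonneg _)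
  have a1 := Nat.floor_le hA
  have a2 := Nat.lt_floor_add_one ((Q : ℝ) * A)
  have b1 := Nat.floor_le hB
  have b2 := Nat.lt_floor_add_one ((Q : ℝ) * B)
  rw [h1] at a1 a2
  rw [le_div_iff₀ hQ0]
  rcases abs_cases (B - A) with ⟨h, _⟩ | ⟨h, _⟩ <;> rw [h] <;> nlinarith

theorem sum_cos_sub_eq (L : ℕ) (y : ℝ) :
    ∑ i ∈ Finset.range L, ∑ j ∈ Finset.range L, cos (2 * π * (((i : ℝ) - j) * y))
      = (∑ i ∈ Finset.range L, cos (2 * π * (i * y))) ^ 2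
        + (∑ i ∈ Finset.range L, sin (2 * π * (i * y))) ^ 2 := by
  rw [sq, sq, Finset.sum_mul_sum, Finset.sum_mul_sum, ← Finset.sum_add_distrib]
  refine Finset.sum_congr rfl fun i _ => ?_
  rw [← Finset.sum_add_distrib]
  refine Finset.sum_congr rfl fun j _ => ?_
  rw [← cos_sub]; ring_nf

theorem le_sum_cos_sub (L : ℕ) (hL : 1 ≤ L) (y : ℝ) (k : ℤ) (hy : |y - k| ≤ 1 / (6 * L : ℝ)) :
    (L : ℝ) ^ 2 / 4 ≤
      ∑ i ∈ Finset.range L, ∑ j ∈ Finset.range L, cos (2 * π * (((i : ℝ) - j) * y)) := by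
  rw [sum_cos_sub_eq]
  have hL0 : (0 : ℝ) < L := by exact_mod_cast hL
  have h : (L : ℝ) / 2 ≤ ∑ i ∈ Finset.range L, cos (2 * π * (i * y)) := by
    have : ∑ i ∈ Finset.range L, (1 / 2 : ℝ) = (L : ℝ) / 2 := by simp; ring
    rw [← this]
    refine Finset.sum_le_sum fun i hi => ?_
    have hi' : (i : ℝ) ≤ L := by exact_mod_cast (Finset.mem_range.1 hi).le
    have e : cos (2 * π * (i * y)) = cos (2 * π * (i * (y - k))) := by
      rw [← cos_sub_int_mul_two_pi (2 * π * (i * y)) (i * k)]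
      push_cast; ring_nf
    rw [e, ← cos_abs, ← cos_pi_div_three]
    have hb : |2 * π * (i * (y - k))| ≤ π / 3 := by
      rw [abs_mul (2 * π), abs_mul (i : ℝ), abs_of_pos (by positivity : (0:ℝ) < 2 * π), abs_of_nonneg (by positivity : (0:ℝ) ≤ (i:ℝ))]
      have : (i : ℝ) * |y - k| ≤ L * (1 / (6 * L)) := by gcongr
      have e2 : (L : ℝ) * (1 / (6 * L)) = 1 / 6 := by field_simp
      rw [e2] at this
      nlinarith [pi_pos]
    exact cos_le_cos_of_nonneg_of_le_pi (abs_nonneg _) (by linarith [pi_pos]) hb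
  nlinarith [sq_nonneg (∑ i ∈ Finset.range L, sin (2 * π * (i * y)))]

/-- Soundararajan's lower bound for cosine sums with nonnegative coefficients. -/
theorem exists_cos_sum_large {ι : Type*} [DecidableEq ι] (Ξ M : Finset ι) (hM : M ⊆ Ξ)
    (a l : ι → ℝ) (ha : ∀ i ∈ Ξ, 0 ≤ a i) (T : ℝ) (hT : 0 < T) (L : ℕ) (hL : 2 ≤ L) (K : ℕ)
    (hK : (M.image l).card ≤ K) :
    ∃ x : ℝ, T ≤ x ∧ x ≤ L * (T * (6 * L : ℝ) ^ K) ∧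
      (1 / 4) * ∑ i ∈ M, a i - (∑ i ∈ Ξ, a i) / ((L : ℝ) - 1)
        ≤ ∑ i ∈ Ξ, a i * cos (2 * π * (x * l i)) := by
  obtain ⟨q, hq1, hq2, hq⟩ := exists_simultaneous_approx (M.image l) T (6 * L) (by omega)
  have hL1 : (1 : ℝ) < L := by exact_mod_cast hL
  set x0 : ℝ := q * T with hx0
  have hq1' : (1 : ℝ) ≤ q := by exact_mod_cast hq1
  have hx0T : T ≤ x0 := by nlinarith
  have hx0le : x0 ≤ T * (6 * L : ℝ) ^ K := by
    have : (q : ℝ) ≤ (6 * L : ℝ) ^ K := by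
      have h1 : (q : ℝ) ≤ ((6 * L : ℕ) : ℝ) ^ (M.image l).card := by exact_mod_cast hq2
      refine h1.trans ?_
      push_cast
      exact pow_le_pow_right₀ (by linarith) hK
    rw [hx0, mul_comm]; gcongr
  set S : ℝ → ℝ := fun x => ∑ i ∈ Ξ, a i * cos (2 * π * (x * l i)) with hS
  set R := Finset.range L
  have key : (L : ℝ) ^ 2 / 4 * ∑ i ∈ M, a i ≤ ∑ i ∈ R, ∑ j ∈ R, S (((i : ℝ) - j) * x0) := by
    have e : ∑ i ∈ R, ∑ j ∈ R, S (((i : ℝ) - j) * x0)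
        = ∑ m ∈ Ξ, a m * ∑ i ∈ R, ∑ j ∈ R, cos (2 * π * (((i : ℝ) - j) * (x0 * l m))) := by
      simp only [hS, Finset.mul_sum]
      calc ∑ i ∈ R, ∑ j ∈ R, ∑ m ∈ Ξ, a m * cos (2 * π * (((i : ℝ) - j) * x0 * l m))
          = ∑ i ∈ R, ∑ m ∈ Ξ, ∑ j ∈ R, a m * cos (2 * π * (((i : ℝ) - j) * x0 * l m)) :=
            Finset.sum_congr rfl fun i _ => Finset.sum_comm
        _ = ∑ m ∈ Ξ, ∑ i ∈ R, ∑ j ∈ R, a m * cos (2 * π * (((i : ℝ) - j) * x0 * l m)) :=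
            Finset.sum_comm
        _ = _ := by simp only [mul_assoc]
    rw [e, Finset.mul_sum]
    calc ∑ m ∈ M, (L : ℝ) ^ 2 / 4 * a m
        ≤ ∑ m ∈ M, a m * ∑ i ∈ R, ∑ j ∈ R, cos (2 * π * (((i : ℝ) - j) * (x0 * l m))) := by
          refine Finset.sum_le_sum fun m hm => ?_
          obtain ⟨k, hk⟩ := hq (l m) (Finset.mem_image_of_mem _ hm)
          rw [mul_comm]
          refine mul_le_mul_of_nonneg_left (le_sum_cos_sub L (by omega) _ k ?_) (ha m (hM hm))
          simpa using hk
      _ ≤ _ := by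
          refine Finset.sum_le_sum_of_subset_of_nonneg hM fun m hm _ => mul_nonneg (ha m hm) ?_
          rw [sum_cos_sub_eq]; positivity
  by_contra! hcon
  have hS_even : ∀ x, S (-x) = S x := by
    intro x; simp only [hS]
    refine Finset.sum_congr rfl fun i _ => ?_
    rw [← cos_neg]; ring_nf
  set B := (1 / 4) * ∑ i ∈ M, a i - (∑ i ∈ Ξ, a i) / ((L : ℝ) - 1) with hB
  have hpos : ∀ i j : ℕ, i < j → j < L → S (((j : ℝ) - i) * x0) < B := by
    intro i j hij hj
    have h1 : (1 : ℝ) ≤ (j : ℝ) - i := by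
      have : ((i + 1 : ℕ) : ℝ) ≤ j := by exact_mod_cast hij
      push_cast at this; linarith
    have h2 : (j : ℝ) - i ≤ L := by
      have : (j : ℝ) ≤ L := by exact_mod_cast hj.le
      linarith [(Nat.cast_nonneg i : (0 : ℝ) ≤ i)]
    exact hcon _ (by nlinarith) (by gcongr)
  have hoff : ∀ i ∈ R, ∀ j ∈ R, i ≠ j → S (((i : ℝ) - j) * x0) < B := by
    intro i hi j hj hne
    rcases lt_or_gt_of_ne hne with h | h
    · have := hpos i j h (Finset.mem_range.1 hj)
      rw [← hS_even] at this
      convert this using 2; ring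
    · exact hpos j i h (Finset.mem_range.1 hi)
  have hdiag : S 0 = ∑ i ∈ Ξ, a i := by simp [hS]
  have hrow : ∀ i ∈ R, ∑ j ∈ R, S (((i : ℝ) - j) * x0) < ∑ j ∈ Ξ, a j + ((L : ℝ) - 1) * B := by
    intro i hi
    rw [← Finset.add_sum_erase R _ hi, sub_self, zero_mul, hdiag]
    have hc : ((R.erase i).card : ℝ) = (L : ℝ) - 1 := by
      rw [Finset.card_erase_of_mem hi, Finset.card_range, Nat.cast_sub (by omega)]; simp
    have hne : (R.erase i).Nonempty := by
      rw [← Finset.card_pos, Finset.card_erase_of_mem hi, Finset.card_range]; omega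
    have := Finset.sum_lt_sum_of_nonempty hne (f := fun j : ℕ => S (((i : ℝ) - j) * x0)) (g := fun _ => B)
      (fun j hj => hoff i hi j (Finset.mem_of_mem_erase hj) (Finset.ne_of_mem_erase hj).symm)
    rw [Finset.sum_const, nsmul_eq_mul, hc] at this
    linarith
  have htot := Finset.sum_lt_sum_of_nonempty (s := R) ⟨0, Finset.mem_range.2 (by omega)⟩ hrow
  rw [Finset.sum_const, Finset.card_range, nsmul_eq_mul] at htot
  have h3 : ∑ j ∈ Ξ, a j + ((L : ℝ) - 1) * B = ((L : ℝ) - 1) * ((1 / 4) * ∑ i ∈ M, a i) := by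
    rw [hB]; field_simp [(by linarith : (L : ℝ) - 1 ≠ 0)]; ring
  rw [h3] at htot
  have hMn : 0 ≤ ∑ i ∈ M, a i := Finset.sum_nonneg fun i hi => ha i (hM hi)
  nlinarith

/-- Partial summation against a nonnegative antitone weight. -/
theorem sum_mul_le_of_partial_sums_le {a f : ℕ → ℝ} {C : ℝ} {k N : ℕ} (hkN : k < N)
    (hf : ∀ n, k < n → n < N → f (n + 1) ≤ f n) (hf0 : 0 ≤ f N)
    (ha : ∀ m, k < m → m ≤ N → ∑ n ∈ Finset.Ioc k m, a n ≤ C) :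
    ∑ n ∈ Finset.Ioc k N, a n * f n ≤ C * f (k + 1) := by
  have key : ∀ M, k + 1 ≤ M → M ≤ N → ∑ n ∈ Finset.Ioc k M, a n * f n
      ≤ (∑ n ∈ Finset.Ioc k M, a n) * f M + C * (f (k + 1) - f M) := by
    intro M hM
    induction M, hM using Nat.le_induction with
    | base => intro _; simp
    | succ M hM ih =>
      intro hMN
      rw [Finset.sum_Ioc_succ_top (by omega), Finset.sum_Ioc_succ_top (by omega)]
      have h1 := ih (by omega)
      have h2 := ha M (by omega) (by omega)
      have h3 := hf M (by omega) (by omega)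
      nlinarith
  have h1 := key N hkN le_rfl
  have h2 := ha N hkN le_rfl
  nlinarith

theorem abs_sum_mul_le_of_partial_sums {a f : ℕ → ℝ} {C : ℝ} {k N : ℕ} (hkN : k < N)
    (hf : ∀ n, k < n → n < N → f (n + 1) ≤ f n) (hf0 : 0 ≤ f N)
    (ha : ∀ m, k < m → m ≤ N → |∑ n ∈ Finset.Ioc k m, a n| ≤ C) :
    |∑ n ∈ Finset.Ioc k N, a n * f n| ≤ C * f (k + 1) := by
  rw [abs_le]
  constructor
  · have := sum_mul_le_of_partial_sums_le (a := fun n => - a n) hkN hf hf0 (fun m h1 h2 => by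
      have := (abs_le.1 (ha m h1 h2)).1
      rw [Finset.sum_neg_distrib]; linarith)
    simp only [neg_mul, Finset.sum_neg_distrib] at this
    linarith
  · exact sum_mul_le_of_partial_sums_le hkN hf hf0 (fun m h1 h2 => (abs_le.1 (ha m h1 h2)).2)

/-- The nontrivial character modulo `4`, as a real function. -/
noncomputable def chi (n : ℕ) : ℝ := ((ZMod.χ₄ (n : ZMod 4) : ℤ) : ℝ)

theorem chi_mul (m n : ℕ) : chi (m * n) = chi m * chi n := by
  simp only [chi, Nat.cast_mul, map_mul, Int.cast_mul]

theorem chi_eq (n : ℕ) : chi n = if n % 2 = 0 then 0 else if n % 4 = 1 then 1 else -1 := by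
  rw [chi, ZMod.χ₄_nat_eq_if_mod_four]; split_ifs <;> simp

theorem abs_chi_le (n : ℕ) : |chi n| ≤ 1 := by
  rw [chi_eq]; split_ifs <;> simp

theorem sum_chi (m : ℕ) :
    ∑ n ∈ Finset.Ioc 0 m, chi n = if m % 4 = 1 ∨ m % 4 = 2 then 1 else 0 := by
  induction m with
  | zero => simp
  | succ m ih =>
    rw [Finset.sum_Ioc_succ_top (by omega), ih, chi_eq]
    have : m % 4 = 0 ∨ m % 4 = 1 ∨ m % 4 = 2 ∨ m % 4 = 3 := by omega
    rcases this with h | h | h | h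
    · simp [h, show (m + 1) % 2 ≠ 0 by omega, show (m + 1) % 4 = 1 by omega]
    · simp [h, show (m + 1) % 2 = 0 by omega, show (m + 1) % 4 = 2 by omega]
    · simp [h, show (m + 1) % 2 ≠ 0 by omega, show (m + 1) % 4 = 3 by omega]
    · simp [h, show (m + 1) % 2 = 0 by omega, show (m + 1) % 4 = 0 by omega]

theorem abs_sum_Ioc_chi_le {k m : ℕ} (h : k ≤ m) : |∑ n ∈ Finset.Ioc k m, chi n| ≤ 1 := by
  have e : ∑ n ∈ Finset.Ioc k m, chi n
      = ∑ n ∈ Finset.Ioc 0 m, chi n - ∑ n ∈ Finset.Ioc 0 k, chi n := by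
    rw [← Finset.sum_Ioc_consecutive _ (Nat.zero_le k) h]; ring
  rw [e, sum_chi, sum_chi]; split_ifs <;> norm_num

theorem abs_sum_chi_div_sub_le {k N : ℕ} (h : k ≤ N) :
    |∑ n ∈ Finset.Ioc 0 N, chi n / n - ∑ n ∈ Finset.Ioc 0 k, chi n / n| ≤ 1 / ((k : ℝ) + 1) := by
  rw [← Finset.sum_Ioc_consecutive _ (Nat.zero_le k) h, add_sub_cancel_left]
  rcases h.eq_or_lt with rfl | h
  · simp; positivity
  have := abs_sum_mul_le_of_partial_sums (a := chi) (f := fun n => 1 / (n : ℝ)) h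
    (fun n hn _ => by
      have : (0 : ℝ) < n := by exact_mod_cast (by omega : 0 < n)
      push_cast; gcongr; linarith)
    (by positivity) (fun m hm _ => abs_sum_Ioc_chi_le hm.le)
  simpa [mul_one_div, div_eq_mul_inv] using this

theorem two_thirds_le_sum_chi_div {N : ℕ} (h : 1 ≤ N) :
    2 / 3 ≤ ∑ n ∈ Finset.Ioc 0 N, chi n / n := by
  rcases h.eq_or_lt with rfl | h
  · simp [chi_eq]; norm_num
  · have := abs_sum_chi_div_sub_le (show 2 ≤ N from h)
    have e : ∑ n ∈ Finset.Ioc 0 2, chi n / n = 1 := by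
      simp [Finset.sum_Ioc_succ_top, chi_eq]
    rw [e, abs_le] at this
    push_cast at this
    linarith [this.1]

theorem abs_sum_chi_log_div_le (N : ℕ) : |∑ n ∈ Finset.Ioc 0 N, chi n * log n / n| ≤ 2 := by
  rcases le_or_gt N 2 with h | h
  · interval_cases N <;> simp [Finset.sum_Ioc_succ_top, chi_eq]
  rw [← Finset.sum_Ioc_consecutive _ (Nat.zero_le 2) h.le]
  have e : ∑ n ∈ Finset.Ioc 0 2, chi n * log n / n = 0 := by
    simp [Finset.sum_Ioc_succ_top, chi_eq]
  rw [e, zero_add]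
  have := abs_sum_mul_le_of_partial_sums (a := chi) (f := fun n => log n / (n : ℝ)) h
    (fun n hn _ => by
      have h3 : (3 : ℝ) ≤ n := by exact_mod_cast hn
      have he : rexp 1 ≤ 3 := by linarith [exp_one_lt_d9]
      exact log_div_self_antitoneOn (by simp; linarith) (by simp; linarith) (by simp))
    (by positivity) (fun m hm _ => abs_sum_Ioc_chi_le hm.le)
  have h3 : log ((2 + 1 : ℕ) : ℝ) / ((2 + 1 : ℕ) : ℝ) ≤ 2 := by
    have := log_le_self (show (0 : ℝ) ≤ 3 by norm_num)
    push_cast; linarith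
  simp only [← mul_div_assoc] at this
  rw [one_mul] at this
  exact this.trans (by simpa using h3)

open ArithmeticFunction hiding log in
theorem sum_vonMangoldt_le (N : ℕ) :
    ∑ n ∈ Finset.Ioc 0 N, vonMangoldt n ≤ (log 4 + 4) * N := by
  have := Chebyshev.psi_le_const_mul_self (x := N) (Nat.cast_nonneg N)
  simpa [Chebyshev.psi] using this

open ArithmeticFunction hiding log in
theorem abs_sum_vonMangoldt_div_sub_log_le {N : ℕ} (hN : 1 ≤ N) :
    |∑ n ∈ Finset.Ioc 0 N, vonMangoldt n / n - log N| ≤ 6 := by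
  have hN0 : (0 : ℝ) < N := by exact_mod_cast hN
  have h1 : ∑ n ∈ Finset.Ioc 0 N, vonMangoldt n * ((N / n : ℕ) : ℝ)
      = ∑ n ∈ Finset.Ioc 0 N, log n := by
    rw [← sum_Ioc_mul_zeta_eq_sum, vonMangoldt_mul_zeta]; rfl
  have h2 : ∑ n ∈ Finset.Ioc 0 N, log n = log (N.factorial) := by
    clear hN hN0 h1
    induction N with
    | zero => simp
    | succ N ih =>
      rw [Finset.sum_Ioc_succ_top (by omega), ih, Nat.factorial_succ, Nat.cast_mul, log_mul, add_comm]
      · positivity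
      · positivity
  have h3 := Stirling.le_log_factorial_stirling (n := N) (by omega)
  have h4 : log (N.factorial) ≤ N * log N := by
    rw [← log_pow]
    exact log_le_log (by positivity) (by exact_mod_cast Nat.factorial_le_pow N)
  have h5 : 0 ≤ log N := log_natCast_nonneg N
  have h6 : 0 ≤ log (2 * π) := log_nonneg (by linarith [pi_gt_three])
  have up : ∑ n ∈ Finset.Ioc 0 N, vonMangoldt n * ((N / n : ℕ) : ℝ)
      ≤ N * ∑ n ∈ Finset.Ioc 0 N, vonMangoldt n / n := by
    rw [Finset.mul_sum]
    refine Finset.sum_le_sum fun n _ => ?_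
    have := @Nat.cast_div_le ℝ _ _ _ N n
    calc vonMangoldt n * ((N / n : ℕ) : ℝ) ≤ vonMangoldt n * ((N : ℝ) / n) :=
          mul_le_mul_of_nonneg_left this vonMangoldt_nonneg
      _ = _ := by ring
  have lo : N * ∑ n ∈ Finset.Ioc 0 N, vonMangoldt n / n - ∑ n ∈ Finset.Ioc 0 N, vonMangoldt n
      ≤ ∑ n ∈ Finset.Ioc 0 N, vonMangoldt n * ((N / n : ℕ) : ℝ) := by
    rw [Finset.mul_sum, ← Finset.sum_sub_distrib]
    refine Finset.sum_le_sum fun n hn => ?_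
    have : (N : ℝ) / n < ((N / n : ℕ) : ℝ) + 1 := by
      rw [← Nat.floor_div_eq_div (K := ℝ)]; exact Nat.lt_floor_add_one _
    have h := mul_le_mul_of_nonneg_left this.le (vonMangoldt_nonneg (n := n))
    calc _ = vonMangoldt n * ((N : ℝ) / n) - vonMangoldt n := by ring
      _ ≤ _ := by linarith
  have hpsi := sum_vonMangoldt_le N
  have hl4 : log 4 ≤ 2 := by
    rw [show (4 : ℝ) = 2 ^ 2 by norm_num, log_pow]; push_cast; linarith [log_two_lt_d9]
  rw [h1, h2] at up lo
  rw [abs_le]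
  constructor
  · by_contra! hc
    nlinarith
  · by_contra! hc
    nlinarith

open ArithmeticFunction hiding log in
theorem abs_sum_chi_vonMangoldt_div_le (N : ℕ) :
    |∑ n ∈ Finset.Ioc 0 N, chi n * vonMangoldt n / n| ≤ 12 := by
  rcases Nat.eq_zero_or_pos N with rfl | hN
  · simp
  have hN0 : (0 : ℝ) < N := by exact_mod_cast hN
  let f : ArithmeticFunction ℝ := ⟨fun n => chi n * vonMangoldt n / n, by simp⟩
  let g : ArithmeticFunction ℝ := ⟨fun n => chi n / n, by simp⟩
  have hfg : ∀ n, (f * g) n = chi n * log n / n := by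
    intro n
    rw [ArithmeticFunction.mul_apply]
    have h0 : ∑ x ∈ n.divisorsAntidiagonal, vonMangoldt x.1 = log n := by
      rw [Nat.sum_divisorsAntidiagonal (f := fun i _ => vonMangoldt i), vonMangoldt_sum]
    rw [← h0, Finset.mul_sum, Finset.sum_div]
    refine Finset.sum_congr rfl fun x hx => ?_
    have hx' := (Nat.mem_divisorsAntidiagonal.1 hx).1
    have : (n : ℝ) = x.1 * x.2 := by exact_mod_cast hx'.symm
    simp only [f, g, ArithmeticFunction.coe_mk]
    rw [this, ← hx', chi_mul]
    rw [div_mul_div_comm]; ring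
  have e := sum_Ioc_mul_eq_sum_sum f g N
  rw [Finset.sum_congr rfl fun n _ => hfg n] at e
  set A : ℕ → ℝ := fun k => ∑ n ∈ Finset.Ioc 0 k, chi n / n with hA
  have e2 : A N * ∑ n ∈ Finset.Ioc 0 N, f n - ∑ n ∈ Finset.Ioc 0 N, chi n * log n / n
      = ∑ n ∈ Finset.Ioc 0 N, f n * (A N - A (N / n)) := by
    rw [e, Finset.mul_sum, ← Finset.sum_sub_distrib]
    refine Finset.sum_congr rfl fun n _ => ?_
    simp only [hA, g, ArithmeticFunction.coe_mk]; ring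
  have e3 : |∑ n ∈ Finset.Ioc 0 N, f n * (A N - A (N / n))| ≤ log 4 + 4 := by
    calc _ ≤ ∑ n ∈ Finset.Ioc 0 N, vonMangoldt n / N := by
          refine (Finset.abs_sum_le_sum_abs _ _).trans (Finset.sum_le_sum fun n hn => ?_)
          rw [abs_mul]
          have hn0 : (0 : ℝ) < n := by exact_mod_cast (Finset.mem_Ioc.1 hn).1
          have b1 : |f n| ≤ vonMangoldt n / n := by
            simp only [f, ArithmeticFunction.coe_mk]
            rw [abs_div, abs_mul, abs_of_nonneg vonMangoldt_nonneg, abs_of_pos hn0]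
            gcongr
            exact mul_le_of_le_one_left vonMangoldt_nonneg (abs_chi_le n)
          have b2 : |A N - A (N / n)| ≤ n / N := by
            refine (abs_sum_chi_div_sub_le (Nat.div_le_self N n)).trans ?_
            have : (N : ℝ) / n < ((N / n : ℕ) : ℝ) + 1 := by
              rw [← Nat.floor_div_eq_div (K := ℝ)]; exact Nat.lt_floor_add_one _
            rw [div_le_div_iff₀ (by positivity) hN0]
            rw [div_lt_iff₀ hn0] at this
            linarith
          calc |f n| * |A N - A (N / n)| ≤ (vonMangoldt n / n) * (n / N) := by gcongr
            _ = _ := by field_simp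
      _ ≤ _ := by
          rw [← Finset.sum_div, div_le_iff₀ hN0]; exact sum_vonMangoldt_le N
  have hl4 : log 4 ≤ 2 := by
    rw [show (4 : ℝ) = 2 ^ 2 by norm_num, log_pow]; push_cast; linarith [log_two_lt_d9]
  have e4 := abs_sum_chi_log_div_le N
  have e5 := two_thirds_le_sum_chi_div hN
  change |∑ n ∈ Finset.Ioc 0 N, f n| ≤ 12
  rw [← e2, abs_le] at e3
  rw [abs_le] at e4 ⊢
  change 2 / 3 ≤ A N at e5
  constructor
  · by_contra! hc; nlinarith [e3.1, e3.2, e4.1, e4.2]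
  · by_contra! hc; nlinarith [e3.1, e3.2, e4.1, e4.2]

/-- The primes `p ≡ 1 mod 4` up to `N`. -/
def primesOneMod4 (N : ℕ) : Finset ℕ := {p ∈ Finset.Ioc 0 N | p.Prime ∧ p % 4 = 1}

theorem mem_primesOneMod4 {N p : ℕ} : p ∈ primesOneMod4 N ↔ p ≤ N ∧ p.Prime ∧ p % 4 = 1 := by
  simp only [primesOneMod4, Finset.mem_filter, Finset.mem_Ioc]
  exact ⟨fun h => ⟨h.1.2, h.2⟩, fun h => ⟨⟨h.2.1.pos, h.1⟩, h.2⟩⟩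

open ArithmeticFunction hiding log in
theorem exists_sum_nonprime_vonMangoldt_div_le :
    ∃ C : ℝ, 0 ≤ C ∧ ∀ N : ℕ, ∑ n ∈ Finset.Ioc 0 N, (if n.Prime then 0 else vonMangoldt n) / n ≤ C := by
  obtain ⟨C, hC⟩ := Chebyshev.psi_sub_theta_le_mul_sqrt
  have hC0 : 0 ≤ C := by
    have := hC 1
    have h2 := Chebyshev.theta_le_psi 1
    simp at this; linarith
  refine ⟨3 * C, by positivity, fun N => ?_⟩
  rcases Nat.eq_zero_or_pos N with rfl | hN
  · simp; exact hC0
  have hpart : ∀ m : ℕ, ∑ n ∈ Finset.Ioc 0 m, (if n.Prime then 0 else vonMangoldt n) ≤ C * √m := by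
    intro m
    have := hC m
    rw [Chebyshev.psi, Chebyshev.theta, Nat.floor_natCast, Finset.sum_filter, ← Finset.sum_sub_distrib] at this
    refine le_trans (le_of_eq (Finset.sum_congr rfl fun n _ => ?_)) this
    split_ifs with h
    · rw [vonMangoldt_apply_prime h]; ring
    · ring
  have hsq : ∀ m : ℕ, ∑ n ∈ Finset.Ioc 0 m, C * (√n - √((n : ℝ) - 1)) = C * √m := by
    intro m
    rw [← Finset.mul_sum]
    congr 1
    induction m with
    | zero => simp
    | succ m ih => rw [Finset.sum_Ioc_succ_top (by omega), ih]; simp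
  have h := sum_mul_le_of_partial_sums_le
    (a := fun n => (if n.Prime then 0 else vonMangoldt n) - C * (√n - √((n : ℝ) - 1)))
    (f := fun n => 1 / (n : ℝ)) (C := 0) (k := 0) hN
    (fun n hn _ => by
      have : (0 : ℝ) < n := by exact_mod_cast (by omega : 0 < n)
      push_cast; gcongr; linarith)
    (by positivity) (fun m _ _ => by rw [Finset.sum_sub_distrib, hsq]; linarith [hpart m])
  simp only [sub_mul, Finset.sum_sub_distrib] at h
  have h3 : ∀ M : ℕ, 1 ≤ M → ∑ n ∈ Finset.Ioc 0 M, C * (√n - √((n : ℝ) - 1)) * (1 / (n : ℝ))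
      ≤ C * (3 - 2 / √M) := by
    intro M hM
    induction M, hM using Nat.le_induction with
    | base => simp; linarith
    | succ M hM ih =>
      rw [Finset.sum_Ioc_succ_top (by omega)]
      have hM0 : (0 : ℝ) < M := by exact_mod_cast hM
      push_cast
      rw [add_sub_cancel_right]
      have ha : 0 < √(M : ℝ) := sqrt_pos.2 hM0
      have hb : 0 < √((M : ℝ) + 1) := sqrt_pos.2 (by linarith)
      have ha2 : √(M : ℝ) ^ 2 = M := sq_sqrt hM0.le
      have hb2 : √((M : ℝ) + 1) ^ 2 = M + 1 := sq_sqrt (by linarith)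
      have hab : √(M : ℝ) ≤ √((M : ℝ) + 1) := sqrt_le_sqrt (by linarith)
      have : (√((M : ℝ) + 1) - √(M : ℝ)) * (1 / ((M : ℝ) + 1)) ≤ 2 / √M - 2 / √((M : ℝ) + 1) := by
        have e1 : (√((M : ℝ) + 1) - √(M : ℝ)) * (1 / ((M : ℝ) + 1))
            = (√((M : ℝ) + 1) - √(M : ℝ)) / √((M : ℝ) + 1) ^ 2 := by rw [hb2, mul_one_div]
        have e2 : 2 / √(M : ℝ) - 2 / √((M : ℝ) + 1)
            = (√((M : ℝ) + 1) - √(M : ℝ)) * (2 / (√(M : ℝ) * √((M : ℝ) + 1))) := by field_simp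
        rw [e1, e2, div_eq_mul_one_div]
        refine mul_le_mul_of_nonneg_left ?_ (by linarith)
        rw [div_le_div_iff₀ (by positivity) (by positivity)]
        nlinarith
      nlinarith
  have h4 := h3 N hN
  have h5 : 0 ≤ C * (2 / √N) := by positivity
  have h6 : ∑ n ∈ Finset.Ioc 0 N, (if n.Prime then 0 else vonMangoldt n) / n
      = ∑ n ∈ Finset.Ioc 0 N, (if n.Prime then 0 else vonMangoldt n) * (1 / (n : ℝ)) :=
    Finset.sum_congr rfl fun n _ => by ring
  rw [h6]
  linarith

open ArithmeticFunction hiding log in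
/-- Mertens' theorem for the progression `1 mod 4`. -/
theorem exists_mertens_one_mod_four :
    ∃ C : ℝ, 0 ≤ C ∧ ∀ N : ℕ, 1 ≤ N →
      |∑ p ∈ primesOneMod4 N, log p / p - log N / 2| ≤ C := by
  obtain ⟨C, hC0, hC⟩ := exists_sum_nonprime_vonMangoldt_div_le
  refine ⟨10 + C + 1, by positivity, fun N hN => ?_⟩
  have h1 := abs_le.1 (abs_sum_vonMangoldt_div_sub_log_le hN)
  have h2 := abs_le.1 (abs_sum_chi_vonMangoldt_div_le N)
  have h3 := hC N
  have h30 : 0 ≤ ∑ n ∈ Finset.Ioc 0 N, (if n.Prime then 0 else vonMangoldt n) / n :=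
    Finset.sum_nonneg fun n _ => by
      split_ifs
      · simp
      · exact div_nonneg vonMangoldt_nonneg (by positivity)
  have h4 : |∑ p ∈ primesOneMod4 N, log p / p
      - ((∑ n ∈ Finset.Ioc 0 N, vonMangoldt n / n + ∑ n ∈ Finset.Ioc 0 N, chi n * vonMangoldt n / n) / 2)|
      ≤ ∑ n ∈ Finset.Ioc 0 N, (if n.Prime then 0 else vonMangoldt n) / n
        + ∑ n ∈ Finset.Ioc 0 N, (if n = 2 then log 2 / 2 else 0) := by
    rw [primesOneMod4, Finset.sum_filter, ← Finset.sum_add_distrib, ← Finset.sum_add_distrib, Finset.sum_div,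
      ← Finset.sum_sub_distrib]
    refine (Finset.abs_sum_le_sum_abs _ _).trans (Finset.sum_le_sum fun n _ => ?_)
    have hL := vonMangoldt_nonneg (n := n)
    have hn0 : (0 : ℝ) ≤ n := Nat.cast_nonneg n
    have hl2 : 0 ≤ log 2 := log_nonneg (by norm_num)
    have hq : 0 ≤ vonMangoldt n / n := by positivity
    by_cases hp : n.Prime
    · rw [vonMangoldt_apply_prime hp] at hq ⊢
      simp only [hp, true_and, if_true, zero_div, zero_add, chi_eq]
      rcases hp.eq_two_or_odd with rfl | ho
      · norm_num
        rw [abs_of_nonneg (by positivity)]; linarith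
      · have : n ≠ 2 := by rintro rfl; omega
        have h13 : n % 4 = 1 ∨ n % 4 = 3 := by omega
        rcases h13 with h | h
        · simp [this, ho, h]
        · simp [this, ho, h, neg_div]
    · simp only [hp, false_and, if_false, zero_sub, abs_neg]
      have hchi := abs_le.1 (abs_chi_le n)
      have e : (vonMangoldt n / n + chi n * vonMangoldt n / n) / 2
        = ((1 + chi n) / 2) * (vonMangoldt n / n) := by ring
      rw [e, abs_of_nonneg (mul_nonneg (by linarith) hq)]
      have : ((1 + chi n) / 2) * (vonMangoldt n / n) ≤ 1 * (vonMangoldt n / n) := by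
        gcongr; linarith
      split_ifs <;> linarith [div_nonneg hl2 (by norm_num : (0 : ℝ) ≤ 2)]
  have h5 : ∑ n ∈ Finset.Ioc 0 N, (if n = 2 then log 2 / 2 else 0) ≤ 1 := by
    rw [Finset.sum_ite_eq']
    split_ifs
    · linarith [log_two_lt_d9]
    · norm_num
  rw [abs_le] at h4 ⊢
  constructor <;> linarith [h1.1, h1.2, h2.1, h2.2, h4.1, h4.2]

/-- Lower bound for the sum of reciprocals of primes `p ≡ 1 mod 4`. -/
theorem exists_sum_inv_primesOneMod4_ge :
    ∃ C : ℝ, 0 ≤ C ∧ ∀ N : ℕ, 2 ≤ N →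
      log (log N) / 2 - C ≤ ∑ p ∈ primesOneMod4 N, 1 / (p : ℝ) := by
  obtain ⟨C, hC0, hC⟩ := exists_mertens_one_mod_four
  have hl2 : 0 < log 2 := log_pos (by norm_num)
  refine ⟨(C + 1) / log 2 + 1, by positivity, fun N hN => ?_⟩
  have hl : ∀ n : ℕ, 2 ≤ n → 0 < log n := fun n hn =>
    log_pos (by exact_mod_cast (by omega : 1 < n))
  let a : ℕ → ℝ := fun n => if n.Prime ∧ n % 4 = 1 then log n / n else 0
  have ha : ∀ m, ∑ n ∈ Finset.Ioc 1 m, a n = ∑ p ∈ primesOneMod4 m, log p / p := by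
    intro m
    rw [← Finset.sum_filter]
    refine Finset.sum_congr ?_ fun _ _ => rfl
    ext p
    simp only [Finset.mem_filter, Finset.mem_Ioc, mem_primesOneMod4]
    exact ⟨fun h => ⟨h.1.2, h.2⟩, fun h => ⟨⟨h.2.1.one_lt, h.1⟩, h.2⟩⟩
  have hlog : ∀ m : ℕ, 1 ≤ m → ∑ n ∈ Finset.Ioc 1 m, (log ((n : ℝ) + 1) - log n) / 2 = (log ((m : ℝ) + 1) - log 2) / 2 := by
    intro m hm
    induction m, hm using Nat.le_induction with
    | base => norm_num
    | succ m hm ih => rw [Finset.sum_Ioc_succ_top (by omega), ih]; push_cast; ring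
  have h := sum_mul_le_of_partial_sums_le
    (a := fun n => (log ((n : ℝ) + 1) - log n) / 2 - a n) (C := C + 1)
    (f := fun n => 1 / log n) (k := 1) (N := N) (by omega)
    (fun n hn _ => by
      have := hl n hn
      have h0 : (0 : ℝ) < n := by exact_mod_cast (by omega : 0 < n)
      push_cast; gcongr; linarith)
    (by have := hl N hN; positivity)
    (fun m hm _ => by
      rw [Finset.sum_sub_distrib, hlog m hm.le, ha]
      have h1 := (abs_le.1 (hC m hm.le)).1
      have hm0 : (0 : ℝ) < m := by exact_mod_cast (by omega : 0 < m)
      have hm1 : (1 : ℝ) ≤ m := by exact_mod_cast hm.le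
      have h2 : log ((m : ℝ) + 1) ≤ log 2 + log m := by
        rw [← log_mul (by norm_num) hm0.ne']
        exact log_le_log (by positivity) (by linarith)
      have h3 := log_two_gt_d9
      linarith)
  simp only [sub_mul, Finset.sum_sub_distrib] at h
  have hs : ∑ n ∈ Finset.Ioc 1 N, a n * (1 / log n) = ∑ p ∈ primesOneMod4 N, 1 / (p : ℝ) := by
    have : ∀ n ∈ Finset.Ioc 1 N, a n * (1 / log n) = if n.Prime ∧ n % 4 = 1 then 1 / (n : ℝ) else 0 := by
      intro n hn
      have hn' : 2 ≤ n := (Finset.mem_Ioc.1 hn).1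
      have := hl n hn'
      simp only [a]
      split_ifs
      · field_simp
      · simp
    rw [Finset.sum_congr rfl this, ← Finset.sum_filter]
    refine Finset.sum_congr ?_ fun _ _ => rfl
    ext p
    simp only [Finset.mem_filter, Finset.mem_Ioc, mem_primesOneMod4]
    exact ⟨fun h => ⟨h.1.2, h.2⟩, fun h => ⟨⟨h.2.1.one_lt, h.1⟩, h.2⟩⟩
  rw [hs] at h
  have hll : ∀ m : ℕ, 2 ≤ m → (log (log ((m : ℝ) + 1)) - log (log 2)) / 2
      ≤ ∑ n ∈ Finset.Ioc 1 m, (log ((n : ℝ) + 1) - log n) / 2 * (1 / log n) := by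
    have step : ∀ n : ℕ, 2 ≤ n → (log (log ((n : ℝ) + 1)) - log (log n)) / 2
        ≤ (log ((n : ℝ) + 1) - log n) / 2 * (1 / log n) := by
      intro n hn
      have h0 := hl n hn
      have h1 : 0 < log ((n : ℝ) + 1) := by exact_mod_cast hl (n + 1) (by omega)
      have := log_le_sub_one_of_pos (div_pos h1 h0)
      rw [log_div h1.ne' h0.ne'] at this
      have e : (log ((n : ℝ) + 1) - log n) / 2 * (1 / log n) = (log ((n : ℝ) + 1) / log n - 1) / 2 := by
        field_simp
      rw [e]; linarith
    intro m hm
    induction m, hm using Nat.le_induction with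
    | base => simpa using step 2 le_rfl
    | succ m hm ih =>
      rw [Finset.sum_Ioc_succ_top (by omega)]
      have := step (m + 1) (by omega)
      push_cast at this ⊢
      linarith
  have h1 := hll N hN
  have h2 : log (log N) ≤ log (log ((N : ℝ) + 1)) := by
    have := hl N hN
    have h0 : (0 : ℝ) < N := by exact_mod_cast (by omega : 0 < N)
    apply log_le_log this
    exact log_le_log h0 (by linarith)
  have h3 : log (log 2) ≤ 0 := log_nonpos hl2.le (by linarith [log_two_lt_d9])
  have h4 : (C + 1) * (1 / log ((1 + 1 : ℕ) : ℝ)) = (C + 1) / log 2 := by norm_num [div_eq_mul_inv]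
  rw [h4] at h
  linarith

/-- Chebyshev-type lower bound for the number of primes `p ≡ 1 mod 4`. -/
theorem exists_card_primesOneMod4_sdiff_ge :
    ∃ c : ℝ, 0 < c ∧ ∃ A : ℝ, 1 ≤ A ∧ ∀ z : ℝ, ∀ Y : ℕ, A ≤ z → A * Y ≤ z →
      c * z / log z ≤ ((primesOneMod4 ⌊z⌋₊ \ primesOneMod4 Y).card : ℝ) := by
  obtain ⟨C, hC0, hC⟩ := exists_mertens_one_mod_four
  set A : ℝ := exp (4 * C + 5) with hA
  have hA2 : 2 ≤ A := by
    have := add_one_le_exp (4 * C + 5); linarith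
  refine ⟨1 / A, by positivity, A, by linarith, fun z Y hz hYz => ?_⟩
  have hA0 : 0 < A := by positivity
  have hz0 : 0 < z := by linarith
  have hlz : 0 < log z := log_pos (by linarith)
  set W : ℕ := ⌊z / A⌋₊ with hW
  have hW1 : 1 ≤ W := Nat.le_floor (by rw [le_div_iff₀ hA0]; simpa using hz)
  have hYW : Y ≤ W := Nat.le_floor (by rw [le_div_iff₀ hA0]; linarith)
  have hZ1 : 1 ≤ ⌊z⌋₊ := Nat.le_floor (by simpa using (by linarith : (1 : ℝ) ≤ z))
  have hWZ : W ≤ ⌊z⌋₊ := Nat.floor_mono (div_le_self hz0.le (by linarith))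
  have hsub : primesOneMod4 W ⊆ primesOneMod4 ⌊z⌋₊ := fun p hp => by
    rw [mem_primesOneMod4] at hp ⊢; exact ⟨hp.1.trans hWZ, hp.2⟩
  have hsub' : primesOneMod4 ⌊z⌋₊ \ primesOneMod4 W ⊆ primesOneMod4 ⌊z⌋₊ \ primesOneMod4 Y :=
    Finset.sdiff_subset_sdiff le_rfl fun p hp => by
      rw [mem_primesOneMod4] at hp ⊢; exact ⟨hp.1.trans hYW, hp.2⟩
  have hb1 := (abs_le.1 (hC ⌊z⌋₊ hZ1)).1
  have hb2 := (abs_le.1 (hC W hW1)).2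
  have hs := Finset.sum_sdiff hsub (f := fun p : ℕ => log p / p)
  have hl1 : log z - log 2 ≤ log ⌊z⌋₊ := by
    rw [← log_div hz0.ne' (by norm_num)]
    apply log_le_log (by positivity)
    have := Nat.lt_floor_add_one z
    have h1 : (1 : ℝ) ≤ ⌊z⌋₊ := by exact_mod_cast hZ1
    linarith
  have hl2 : log W ≤ log z - (4 * C + 5) := by
    have : log (z / A) = log z - (4 * C + 5) := by rw [log_div hz0.ne' hA0.ne', hA, log_exp]
    rw [← this]
    exact log_le_log (by exact_mod_cast hW1) (Nat.floor_le (by positivity))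
  have hge : 1 ≤ ∑ p ∈ primesOneMod4 ⌊z⌋₊ \ primesOneMod4 W, log p / (p : ℝ) := by
    linarith [log_two_lt_d9]
  have hle : ∑ p ∈ primesOneMod4 ⌊z⌋₊ \ primesOneMod4 W, log p / (p : ℝ)
      ≤ ∑ p ∈ primesOneMod4 ⌊z⌋₊ \ primesOneMod4 W, log z / (z / A) := by
    refine Finset.sum_le_sum fun p hp => ?_
    rw [Finset.mem_sdiff, mem_primesOneMod4, mem_primesOneMod4] at hp
    have hp1 : W < p := by
      by_contra! hc; exact hp.2 ⟨hc, hp.1.2⟩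
    have hp2 : z / A < p := (Nat.floor_lt (by positivity)).1 hp1
    have hp3 : (p : ℝ) ≤ z := (Nat.le_floor_iff hz0.le).1 hp.1.1
    have hp4 : (0 : ℝ) < p := by exact_mod_cast hp.1.2.1.pos
    exact div_le_div₀ hlz.le (log_le_log hp4 hp3) (by positivity) hp2.le
  rw [Finset.sum_const, nsmul_eq_mul] at hle
  have hcard : ((primesOneMod4 ⌊z⌋₊ \ primesOneMod4 W).card : ℝ)
      ≤ ((primesOneMod4 ⌊z⌋₊ \ primesOneMod4 Y).card : ℝ) := by
    exact_mod_cast Finset.card_le_card hsub'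
  refine le_trans ?_ hcard
  have h1 := hge.trans hle
  have e : ((primesOneMod4 ⌊z⌋₊ \ primesOneMod4 W).card : ℝ) * (log z / (z / A))
    = ((primesOneMod4 ⌊z⌋₊ \ primesOneMod4 W).card : ℝ) * log z * A / z := by field_simp
  rw [e, le_div_iff₀ hz0] at h1
  rw [div_le_iff₀ hlz, one_div, inv_mul_le_iff₀ hA0]
  linarith

section ElementarySymmetric

variable {ι : Type*}

/-- The elementary symmetric sum of degree `j` of the weights `w` over `P`. -/
noncomputable def elemSymm (P : Finset ι) (w : ι → ℝ) (j : ℕ) : ℝ :=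
  ∑ D ∈ P.powersetCard j, ∏ p ∈ D, w p

theorem elemSymm_nonneg {P : Finset ι} {w : ι → ℝ} (hw : ∀ p, 0 ≤ w p) (j : ℕ) :
    0 ≤ elemSymm P w j :=
  Finset.sum_nonneg fun _ _ => Finset.prod_nonneg fun p _ => hw p

theorem elemSymm_mono {P Q : Finset ι} {w : ι → ℝ} (hw : ∀ p, 0 ≤ w p) (h : P ⊆ Q) (j : ℕ) :
    elemSymm P w j ≤ elemSymm Q w j :=
  Finset.sum_le_sum_of_subset_of_nonneg (Finset.powersetCard_mono h)
    fun _ _ _ => Finset.prod_nonneg fun p _ => hw p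

variable [DecidableEq ι]

theorem sum_powersetCard_mem {P : Finset ι} {w : ι → ℝ} {j : ℕ} {p : ι} (hp : p ∈ P) :
    ∑ D ∈ P.powersetCard (j + 1) with p ∈ D, ∏ q ∈ D, w q = w p * elemSymm (P.erase p) w j := by
  rw [elemSymm, Finset.mul_sum]
  symm
  refine Finset.sum_bij (fun D _ => insert p D) ?_ ?_ ?_ ?_
  · intro D hD
    rw [Finset.mem_powersetCard] at hD
    have hpD : p ∉ D := fun h => by simpa using hD.1 h
    rw [Finset.mem_filter, Finset.mem_powersetCard, Finset.card_insert_of_notMem hpD, hD.2]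
    exact ⟨⟨Finset.insert_subset hp (hD.1.trans (Finset.erase_subset _ _)), rfl⟩,
      Finset.mem_insert_self _ _⟩
  · intro D hD E hE h
    rw [Finset.mem_powersetCard] at hD hE
    have hpD : p ∉ D := fun h => by simpa using hD.1 h
    have hpE : p ∉ E := fun h => by simpa using hE.1 h
    rw [← Finset.erase_insert hpD, ← Finset.erase_insert hpE, h]
  · intro D hD
    rw [Finset.mem_filter, Finset.mem_powersetCard] at hD
    refine ⟨D.erase p, ?_, Finset.insert_erase hD.2⟩
    rw [Finset.mem_powersetCard, Finset.card_erase_of_mem hD.2, hD.1.2]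
    exact ⟨Finset.erase_subset_erase _ hD.1.1, rfl⟩
  · intro D hD
    rw [Finset.mem_powersetCard] at hD
    have hpD : p ∉ D := fun h => by simpa using hD.1 h
    rw [Finset.prod_insert hpD]

theorem sum_powersetCard_weighted (P : Finset ι) (w φ : ι → ℝ) (j : ℕ) :
    ∑ D ∈ P.powersetCard (j + 1), (∑ p ∈ D, φ p) * ∏ p ∈ D, w p
      = ∑ p ∈ P, φ p * w p * elemSymm (P.erase p) w j := by
  have h : ∀ p ∈ P, φ p * w p * elemSymm (P.erase p) w j
      = ∑ D ∈ P.powersetCard (j + 1), if p ∈ D then φ p * ∏ q ∈ D, w q else 0 := by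
    intro p hp
    rw [mul_assoc, ← sum_powersetCard_mem hp, Finset.mul_sum, Finset.sum_filter]
  rw [Finset.sum_congr rfl h, Finset.sum_comm]
  refine Finset.sum_congr rfl fun D hD => ?_
  rw [Finset.mem_powersetCard] at hD
  rw [← Finset.sum_filter, Finset.filter_mem_eq_inter, Finset.inter_eq_right.2 hD.1, Finset.sum_mul]

theorem elemSymm_le_erase {P : Finset ι} {w : ι → ℝ} (hw : ∀ p, 0 ≤ w p) {p : ι} (hp : p ∈ P) (j : ℕ) :
    elemSymm P w (j + 1) ≤ elemSymm (P.erase p) w (j + 1) + w p * elemSymm P w j := by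
  have h1 : elemSymm P w (j + 1) = ∑ D ∈ P.powersetCard (j + 1) with p ∈ D, ∏ q ∈ D, w q
      + ∑ D ∈ P.powersetCard (j + 1) with p ∉ D, ∏ q ∈ D, w q :=
    (Finset.sum_filter_add_sum_filter_not _ _ _).symm
  have h2 : {D ∈ P.powersetCard (j + 1) | p ∉ D} = (P.erase p).powersetCard (j + 1) := by
    ext D
    simp only [Finset.mem_filter, Finset.mem_powersetCard, Finset.subset_erase]
    tauto
  rw [h1, h2, sum_powersetCard_mem hp]
  have := mul_le_mul_of_nonneg_left (elemSymm_mono hw (Finset.erase_subset p P) j) (hw p)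
  unfold elemSymm at this ⊢
  linarith

theorem elemSymm_recursion {P : Finset ι} {w : ι → ℝ} (hw : ∀ p, 0 ≤ w p) (j : ℕ) :
    (∑ p ∈ P, w p) * elemSymm P w (j + 1) - (∑ p ∈ P, w p ^ 2) * elemSymm P w j
      ≤ ((j : ℝ) + 2) * elemSymm P w (j + 2) := by
  have h := sum_powersetCard_weighted P w (fun _ => 1) (j + 1)
  have h1 : ∑ D ∈ P.powersetCard (j + 1 + 1), (∑ p ∈ D, (1 : ℝ)) * ∏ p ∈ D, w p
      = ((j : ℝ) + 2) * elemSymm P w (j + 2) := by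
    rw [elemSymm, Finset.mul_sum]
    refine Finset.sum_congr rfl fun D hD => ?_
    rw [Finset.mem_powersetCard] at hD
    rw [Finset.sum_const, hD.2, nsmul_eq_mul, mul_one]; push_cast; ring
  rw [← h1, h, Finset.sum_mul, Finset.sum_mul, ← Finset.sum_sub_distrib]
  refine Finset.sum_le_sum fun p hp => ?_
  have := mul_le_mul_of_nonneg_left (elemSymm_le_erase hw hp j) (hw p)
  nlinarith

theorem elemSymm_ratio {P : Finset ι} {w : ι → ℝ} (hw : ∀ p, 0 ≤ w p) {s : ℝ} {k : ℕ}
    (hs : s + 1 ≤ ∑ p ∈ P, w p) (hs2 : ∑ p ∈ P, w p ^ 2 ≤ 1 / 4)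
    (hk : (k : ℝ) ≤ 4 * s) (j : ℕ) (hj : j < k) :
    s / ((j : ℝ) + 1) * elemSymm P w j ≤ elemSymm P w (j + 1) := by
  induction j with
  | zero =>
    have h0 : elemSymm P w 0 = 1 := by simp [elemSymm]
    have h1 : elemSymm P w 1 = ∑ p ∈ P, w p := by
      simp [elemSymm, Finset.powersetCard_one]
    rw [h0, h1]; push_cast; simp; linarith
  | succ j ih =>
    have h1 := ih (by omega)
    have h2 := elemSymm_recursion (P := P) hw j
    have h3 := elemSymm_nonneg (P := P) hw j
    have h4 := elemSymm_nonneg (P := P) hw (j + 1)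
    have hjk : ((j : ℝ) + 1) ≤ 4 * s := by
      have : ((j + 1 : ℕ) : ℝ) ≤ k := by exact_mod_cast hj.le
      push_cast at this; linarith
    have h5 : elemSymm P w j ≤ 4 * elemSymm P w (j + 1) := by
      rw [div_mul_eq_mul_div, div_le_iff₀ (by positivity)] at h1
      by_contra! hc
      nlinarith
    push_cast
    rw [div_mul_eq_mul_div, div_le_iff₀ (by positivity)]
    nlinarith

theorem elemSymm_ge {P : Finset ι} {w : ι → ℝ} (hw : ∀ p, 0 ≤ w p) {s : ℝ} {k : ℕ}
    (hs0 : 0 < s) (hs : s + 1 ≤ ∑ p ∈ P, w p) (hs2 : ∑ p ∈ P, w p ^ 2 ≤ 1 / 4)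
    (hk : (k : ℝ) ≤ 4 * s) : s ^ k / k.factorial ≤ elemSymm P w k := by
  have : ∀ j, j ≤ k → s ^ j / j.factorial ≤ elemSymm P w j := by
    intro j
    induction j with
    | zero => intro _; simp [elemSymm]
    | succ j ih =>
      intro hj
      refine le_trans ?_ (elemSymm_ratio hw hs hs2 hk j (by omega))
      have := ih (by omega)
      rw [Nat.factorial_succ]; push_cast
      calc s ^ (j + 1) / (((j : ℝ) + 1) * j.factorial) = s / ((j : ℝ) + 1) * (s ^ j / j.factorial) := by
            field_simp; ring
        _ ≤ _ := by gcongr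
  exact this k le_rfl

/-- The contribution of sets with a large value of `∑ φ` is controlled by Markov's inequality. -/
theorem elemSymm_filter_ge {P : Finset ι} {w φ : ι → ℝ} (hw : ∀ p, 0 ≤ w p) (hφ : ∀ p ∈ P, 0 ≤ φ p)
    {s B : ℝ} {k : ℕ} (hs0 : 0 < s) (hs : s + 1 ≤ ∑ p ∈ P, w p) (hs2 : ∑ p ∈ P, w p ^ 2 ≤ 1 / 4)
    (hk : (k : ℝ) ≤ 4 * s) (hk1 : 1 ≤ k) (hB0 : 0 < B) (hB : 8 * ∑ p ∈ P, φ p * w p ≤ B) :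
    s ^ k / k.factorial / 2 ≤ ∑ D ∈ P.powersetCard k with ∑ p ∈ D, φ p ≤ B, ∏ p ∈ D, w p := by
  obtain ⟨j, rfl⟩ : ∃ j, k = j + 1 := ⟨k - 1, by omega⟩
  have h1 := elemSymm_ge hw hs0 hs hs2 hk
  have h2 : elemSymm P w (j + 1) = ∑ D ∈ P.powersetCard (j + 1) with ∑ p ∈ D, φ p ≤ B, ∏ p ∈ D, w p
      + ∑ D ∈ P.powersetCard (j + 1) with ¬ ∑ p ∈ D, φ p ≤ B, ∏ p ∈ D, w p :=
    (Finset.sum_filter_add_sum_filter_not _ _ _).symm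
  have h3 : B * ∑ D ∈ P.powersetCard (j + 1) with ¬ ∑ p ∈ D, φ p ≤ B, ∏ p ∈ D, w p
      ≤ (∑ p ∈ P, φ p * w p) * elemSymm P w j := by
    calc _ ≤ ∑ D ∈ P.powersetCard (j + 1), (∑ p ∈ D, φ p) * ∏ p ∈ D, w p := by
          rw [Finset.mul_sum, Finset.sum_filter]
          refine Finset.sum_le_sum fun D hD => ?_
          have hD' := (Finset.mem_powersetCard.1 hD).1
          have hp : 0 ≤ ∏ p ∈ D, w p := Finset.prod_nonneg fun p _ => hw p
          split_ifs with h
          · exact mul_nonneg (Finset.sum_nonneg fun p hp => hφ p (hD' hp)) hp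
          · exact mul_le_mul_of_nonneg_right (not_le.1 h).le hp
      _ = _ := sum_powersetCard_weighted P w φ j
      _ ≤ _ := by
          rw [Finset.sum_mul]
          refine Finset.sum_le_sum fun p hp => ?_
          exact mul_le_mul_of_nonneg_left (elemSymm_mono hw (Finset.erase_subset _ _) j)
            (mul_nonneg (hφ p hp) (hw p))
  have h4 := elemSymm_ratio hw hs hs2 hk j (by omega)
  have h5 : elemSymm P w j ≤ 4 * elemSymm P w (j + 1) := by
    have := elemSymm_nonneg (P := P) hw (j + 1)
    push_cast at hk
    rw [div_mul_eq_mul_div, div_le_iff₀ (by positivity)] at h4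
    by_contra! hc
    nlinarith
  have h6 : 0 ≤ ∑ p ∈ P, φ p * w p := Finset.sum_nonneg fun p hp => mul_nonneg (hφ p hp) (hw p)
  have h7 : ∑ D ∈ P.powersetCard (j + 1) with ¬ ∑ p ∈ D, φ p ≤ B, ∏ p ∈ D, w p
      ≤ elemSymm P w (j + 1) / 2 := by
    have := elemSymm_nonneg (P := P) hw (j + 1)
    by_contra hc
    rw [not_le] at hc
    nlinarith [mul_le_mul_of_nonneg_left h5 h6, mul_lt_mul_of_pos_left hc hB0]
  linarith

end ElementarySymmetric

/-- A natural number with at least `2 ^ r` representations as a sum of two squares. -/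
def HasManyReps (r n : ℕ) : Prop :=
  ∃ F : Finset (ℤ × ℤ), F.card = 2 ^ r ∧ ∀ z ∈ F, z.1 ^ 2 + z.2 ^ 2 = n

theorem hasManyReps_one : HasManyReps 0 1 := ⟨{(1, 0)}, by simp, by simp⟩

theorem HasManyReps.mul_prime {r n p : ℕ} (h : HasManyReps r n) (hp : p.Prime) (hp4 : p % 4 = 1)
    (hpn : ¬ p ∣ n) : HasManyReps (r + 1) (p * n) := by
  obtain ⟨F, hF, hFn⟩ := h
  have := Fact.mk hp
  obtain ⟨a, b, hab⟩ := Nat.Prime.sq_add_sq (p := p) (by omega)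
  have habZ : (a : ℤ) ^ 2 + (b : ℤ) ^ 2 = p := by exact_mod_cast hab
  have hp0 : (0 : ℤ) < p := by exact_mod_cast hp.pos
  have hcop : IsCoprime (a : ℤ) (b : ℤ) := by
    rw [Nat.isCoprime_iff_coprime]
    have h1 : Nat.gcd a b * Nat.gcd a b ∣ p := by
      rw [← hab, ← sq]
      exact dvd_add (pow_dvd_pow_of_dvd (Nat.gcd_dvd_left a b) 2) (pow_dvd_pow_of_dvd (Nat.gcd_dvd_right a b) 2)
    exact Nat.isUnit_iff.1 (hp.prime.squarefree _ h1)
  let f : ℤ × ℤ → ℤ × ℤ := fun z => (a * z.1 - b * z.2, a * z.2 + b * z.1)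
  let g : ℤ × ℤ → ℤ × ℤ := fun z => (a * z.1 + b * z.2, a * z.2 - b * z.1)
  have hf : Function.Injective f := by
    intro z w h
    simp only [f, Prod.mk.injEq] at h
    have e1 : (p : ℤ) * z.1 = p * w.1 := by rw [← habZ]; linear_combination (a : ℤ) * h.1 + b * h.2
    have e2 : (p : ℤ) * z.2 = p * w.2 := by rw [← habZ]; linear_combination (a : ℤ) * h.2 - b * h.1
    exact Prod.ext (mul_left_cancel₀ hp0.ne' e1) (mul_left_cancel₀ hp0.ne' e2)
  have hg : Function.Injective g := by
    intro z w h
    simp only [g, Prod.mk.injEq] at h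
    have e1 : (p : ℤ) * z.1 = p * w.1 := by rw [← habZ]; linear_combination (a : ℤ) * h.1 - b * h.2
    have e2 : (p : ℤ) * z.2 = p * w.2 := by rw [← habZ]; linear_combination (a : ℤ) * h.2 + b * h.1
    exact Prod.ext (mul_left_cancel₀ hp0.ne' e1) (mul_left_cancel₀ hp0.ne' e2)
  refine ⟨F.image f ∪ F.image g, ?_, ?_⟩
  · rw [Finset.card_union_of_disjoint, Finset.card_image_of_injective _ hf,
      Finset.card_image_of_injective _ hg, hF]
    · ring
    · rw [Finset.disjoint_left]
      intro y hy1 hy2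
      obtain ⟨z, hz, rfl⟩ := Finset.mem_image.1 hy1
      obtain ⟨w, hw, h⟩ := Finset.mem_image.1 hy2
      simp only [f, g, Prod.mk.injEq] at h
      have h1 : (a : ℤ) * (z.1 - w.1) = b * (z.2 + w.2) := by linear_combination -h.1
      have h2 : (a : ℤ) * (z.2 - w.2) = b * (-(z.1 + w.1)) := by linear_combination -h.2
      obtain ⟨s, hs⟩ : (a : ℤ) ∣ z.2 + w.2 := hcop.dvd_of_dvd_mul_left ⟨_, h1.symm⟩
      obtain ⟨t, ht⟩ : (a : ℤ) ∣ -(z.1 + w.1) := hcop.dvd_of_dvd_mul_left ⟨_, h2.symm⟩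
      have hzn := hFn z hz
      have hwn := hFn w hw
      by_cases ha : (a : ℤ) = 0
      · have hb1 : (b : ℤ) ^ 2 = 1 := by
          rw [ha] at hcop
          have := (isCoprime_zero_left.1 hcop)
          rcases Int.isUnit_iff.1 this with h | h <;> rw [h] <;> norm_num
        rw [ha, hb1] at habZ
        exact hp.one_lt.ne (by exact_mod_cast habZ)
      · have e1 : z.1 - w.1 = b * s := by
          apply mul_left_cancel₀ ha; rw [h1, hs]; ring
        have e2 : z.2 - w.2 = b * t := by
          apply mul_left_cancel₀ ha; rw [h2, ht]; ring
        have e4 : 4 * (n : ℤ) = p * (s ^ 2 + t ^ 2) := by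
          have f1 : 2 * z.1 = b * s - a * t := by linarith
          have f2 : 2 * z.2 = b * t + a * s := by linarith
          rw [← hzn, ← habZ]
          linear_combination (2 * z.1 + (b * s - a * t)) * f1 + (2 * z.2 + (b * t + a * s)) * f2
        have h5 : p ∣ 4 * n := Int.natCast_dvd_natCast.1 (by push_cast; exact ⟨_, e4⟩)
        rcases hp.dvd_mul.1 h5 with h6 | h6
        · have := Nat.le_of_dvd (by norm_num) h6
          interval_cases p <;> omega
        · exact hpn h6
  · intro y hy
    rcases Finset.mem_union.1 hy with hy | hy
    · obtain ⟨z, hz, rfl⟩ := Finset.mem_image.1 hy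
      have := hFn z hz
      simp only [f]; push_cast; rw [← this, ← habZ]; ring
    · obtain ⟨z, hz, rfl⟩ := Finset.mem_image.1 hy
      have := hFn z hz
      simp only [g]; push_cast; rw [← this, ← habZ]; ring

theorem hasManyReps_prod {D : Finset ℕ} (hD : ∀ p ∈ D, p.Prime ∧ p % 4 = 1) :
    HasManyReps D.card (∏ p ∈ D, p) := by
  induction D using Finset.induction_on with
  | empty => simpa using hasManyReps_one
  | insert p D hp ih =>
    rw [Finset.card_insert_of_notMem hp, Finset.prod_insert hp]
    have hpp := hD p (Finset.mem_insert_self _ _)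
    refine (ih fun q hq => hD q (Finset.mem_insert_of_mem hq)).mul_prime hpp.1 hpp.2 ?_
    rw [hpp.1.prime.dvd_finsetProd_iff]
    rintro ⟨q, hq, hpq⟩
    have := (Nat.prime_dvd_prime_iff_eq hpp.1 (hD q (Finset.mem_insert_of_mem hq)).1).1 hpq
    exact hp (this ▸ hq)

theorem factorial_le_stirling (k : ℕ) (hk : 1 ≤ k) :
    (k.factorial : ℝ) ≤ exp 1 * √k * (k / exp 1) ^ k := by
  obtain ⟨m, rfl⟩ : ∃ m, k = m + 1 := ⟨k - 1, by omega⟩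
  have h := Stirling.stirlingSeq'_antitone (Nat.zero_le m)
  simp only [Function.comp_apply, Nat.succ_eq_add_one, zero_add, Stirling.stirlingSeq_one] at h
  rw [Stirling.stirlingSeq, div_le_div_iff₀ (by positivity) (by positivity)] at h
  have h2 : √(2 * ((m + 1 : ℕ) : ℝ)) = √2 * √((m + 1 : ℕ) : ℝ) := Real.sqrt_mul (by norm_num) _
  rw [h2] at h
  have h3 : (0 : ℝ) < √2 := by positivity
  refine le_of_mul_le_mul_right ?_ h3
  calc _ ≤ _ := h
    _ = _ := by ring

theorem pow_div_factorial_ge {C : ℝ} (hC : 0 ≤ C) : ∃ c > 0, ∃ L0 : ℝ, ∀ L ≥ L0,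
    c * exp (√2 * (1 - 3 / 2 * log 2) * L) * L ^ (-(1 / 2) : ℝ)
      ≤ (L / 2 - C) ^ ⌊√2 * L⌋₊ / (⌊√2 * L⌋₊).factorial := by
  refine ⟨exp (-(4 * √2 * C)) / (2 * exp 1), by positivity, 4 * C + 1, fun L hL => ?_⟩
  have hL0 : 0 < L := by linarith
  have h2 : 1 ≤ √2 := Real.one_le_sqrt.2 (by norm_num)
  have h2' : √2 ≤ 2 := Real.sqrt_le_iff.2 (by norm_num)
  have hs2 : √2 * √2 = 2 := Real.mul_self_sqrt (by norm_num)
  set k := ⌊√2 * L⌋₊ with hk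
  have hk1 : 1 ≤ k := Nat.one_le_floor_iff _ |>.2 (by nlinarith)
  have hk1' : (1 : ℝ) ≤ k := by exact_mod_cast hk1
  have hkL : (k : ℝ) ≤ √2 * L := Nat.floor_le (by positivity)
  have hf := factorial_le_stirling k hk1
  have hs : 0 < L / 2 - C := by linarith
  have hsq : √k ≤ 2 * √L := by
    calc √k ≤ √(2 ^ 2 * L) := Real.sqrt_le_sqrt (by nlinarith)
      _ = 2 * √L := by rw [Real.sqrt_mul (by norm_num), Real.sqrt_sq (by norm_num)]
  have hmain : exp (√2 * (1 - 3 / 2 * log 2) * L) * exp (-(4 * √2 * C)) * (k / exp 1) ^ k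
      ≤ (L / 2 - C) ^ k := by
    have e1 : (k / exp 1) ^ k = exp (k * (log k - 1)) := by
      rw [mul_comm, Real.exp_mul, Real.exp_sub, Real.exp_log (by linarith), Real.rpow_natCast]
    have e2 : (L / 2 - C) ^ k = exp (k * log (L / 2 - C)) := by
      rw [mul_comm, Real.exp_mul, Real.exp_log hs, Real.rpow_natCast]
    rw [e1, e2, ← Real.exp_add, ← Real.exp_add, Real.exp_le_exp]
    have l1 : log k ≤ log 2 / 2 + log L := by
      calc log k ≤ log (√2 * L) := Real.log_le_log (by linarith) hkL
        _ = _ := by rw [Real.log_mul (by positivity) hL0.ne', Real.log_sqrt (by norm_num)]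
    have l2 : log L - log 2 - 4 * C / L ≤ log (L / 2 - C) := by
      have e3 : L / 2 - C = L * 2⁻¹ * (1 - 2 * C / L) := by field_simp
      have h3 : 2 * C / L ≤ 1 / 2 := by rw [div_le_iff₀ hL0]; linarith
      have h0 : 0 ≤ 2 * C / L := by positivity
      rw [e3, Real.log_mul (by positivity) (by linarith), Real.log_mul hL0.ne' (by norm_num),
        Real.log_inv]
      have := Real.one_sub_inv_le_log_of_pos (x := 1 - 2 * C / L) (by linarith)
      have h4 : (1 - 2 * C / L)⁻¹ ≤ 1 + 2 * (2 * C / L) := by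
        rw [inv_le_iff_one_le_mul₀ (by linarith)]; nlinarith
      have h5 : 4 * C / L = 2 * (2 * C / L) := by ring
      linarith
    have h6 : (k : ℝ) * (4 * C / L) ≤ 4 * √2 * C := by
      calc (k : ℝ) * (4 * C / L) ≤ √2 * L * (4 * C / L) := by gcongr
        _ = _ := by field_simp
    have h7 : 1 - 3 / 2 * log 2 ≤ 0 := by have := Real.log_two_gt_d9; linarith
    have h8 : (√2 * L) * (1 - 3 / 2 * log 2) ≤ k * (1 - 3 / 2 * log 2) :=
      mul_le_mul_of_nonpos_right hkL h7
    have h9 := mul_le_mul_of_nonneg_left l1 (by linarith : (0 : ℝ) ≤ k)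
    have h10 := mul_le_mul_of_nonneg_left l2 (by linarith : (0 : ℝ) ≤ k)
    linarith
  have hL12 : L ^ (-(1 / 2) : ℝ) = (√L)⁻¹ := by rw [Real.rpow_neg hL0.le, Real.sqrt_eq_rpow]
  rw [le_div_iff₀ (by positivity), hL12]
  have hsL : 0 < √L := by positivity
  calc exp (-(4 * √2 * C)) / (2 * exp 1) * exp (√2 * (1 - 3 / 2 * log 2) * L) * (√L)⁻¹ * k.factorial
      ≤ exp (-(4 * √2 * C)) / (2 * exp 1) * exp (√2 * (1 - 3 / 2 * log 2) * L) * (√L)⁻¹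
        * (exp 1 * (2 * √L) * (k / exp 1) ^ k) := by gcongr; exact hf.trans (by gcongr)
    _ = exp (√2 * (1 - 3 / 2 * log 2) * L) * exp (-(4 * √2 * C)) * (k / exp 1) ^ k := by
        field_simp
    _ ≤ _ := hmain

theorem sum_inv_sq_primesOneMod4_le (Y : ℕ) :
    ∑ p ∈ primesOneMod4 Y, (1 / (p : ℝ)) ^ 2 ≤ 1 / 4 := by
  have h1 : ∀ M : ℕ, ∑ p ∈ Finset.Ico 5 (M + 5), (1 / (p : ℝ)) ^ 2 ≤ 1 / 4 - 1 / ((M : ℝ) + 4) := by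
    intro M
    induction M with
    | zero => norm_num
    | succ M ih =>
      rw [show M + 1 + 5 = (M + 5) + 1 by ring, Finset.sum_Ico_succ_top (by omega)]
      have : (1 / ((M + 5 : ℕ) : ℝ)) ^ 2 ≤ 1 / ((M : ℝ) + 4) - 1 / ((M : ℝ) + 1 + 4) := by
        push_cast
        rw [div_sub_div _ _ (by positivity) (by positivity), div_pow,
          div_le_div_iff₀ (by positivity) (by positivity)]
        nlinarith
      push_cast at this ⊢
      linarith
  have h2 : primesOneMod4 Y ⊆ Finset.Ico 5 (Y + 5) := by
    intro p hp
    obtain ⟨a, b, c⟩ := mem_primesOneMod4.1 hp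
    rw [Finset.mem_Ico]
    have := b.two_le
    constructor <;> omega
  refine (Finset.sum_le_sum_of_subset_of_nonneg h2 fun _ _ _ => by positivity).trans
    ((h1 Y).trans ?_)
  have : (0 : ℝ) ≤ 1 / ((Y : ℝ) + 4) := by positivity
  linarith

/-- Many integers up to `N ^ 2` with `k` prime factors below `Y` and one larger prime factor. -/
theorem exists_card_many_reps_ge : ∃ c > 0, ∃ A : ℝ, 1 ≤ A ∧ ∀ (N Y k : ℕ) (s : ℝ),
    A ≤ N → A * Y ≤ N → 0 < s → 2 ≤ N →
    s + 1 ≤ ∑ p ∈ primesOneMod4 Y, 1 / (p : ℝ) → (k : ℝ) ≤ 4 * s → 1 ≤ k →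
    8 * ∑ p ∈ primesOneMod4 Y, log p / p ≤ log N →
    ∃ S : Finset ℕ, (∀ n ∈ S, 1 ≤ n ∧ n ≤ N ^ 2 ∧ HasManyReps (k + 1) n) ∧
      c * (N : ℝ) ^ 2 / log N * (s ^ k / k.factorial) ≤ S.card := by
  obtain ⟨c, hc, A, hA, hcA⟩ := exists_card_primesOneMod4_sdiff_ge
  refine ⟨c / 4, by positivity, A, hA, fun N Y k s hAN hAY hs hN hsum hks hk hlog => ?_⟩
  have hN' : (2 : ℝ) ≤ N := by exact_mod_cast hN
  have hlN : 0 < log N := Real.log_pos (by linarith)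
  have hPp : ∀ p ∈ primesOneMod4 Y, (1 : ℝ) ≤ p := fun p hp => by
    exact_mod_cast (mem_primesOneMod4.1 hp).2.1.one_lt.le
  have hmain := elemSymm_filter_ge (P := primesOneMod4 Y) (w := fun p => 1 / (p : ℝ))
    (φ := fun p => log p) (fun p => by positivity) (fun p hp => Real.log_nonneg (hPp p hp))
    hs hsum (sum_inv_sq_primesOneMod4_le Y) hks hk hlN
    (by simpa [div_eq_mul_inv] using hlog)
  set G : Finset (Finset ℕ) := {D ∈ (primesOneMod4 Y).powersetCard k | ∑ p ∈ D, log ((p : ℕ) : ℝ) ≤ log N} with hG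
  have hGP : ∀ D ∈ G, D ⊆ primesOneMod4 Y ∧ D.card = k := fun D hD =>
    Finset.mem_powersetCard.1 (Finset.mem_filter.1 hD).1
  have hGprime : ∀ D ∈ G, ∀ p ∈ D, p.Prime ∧ p % 4 = 1 := fun D hD p hp =>
    (mem_primesOneMod4.1 ((hGP D hD).1 hp)).2
  have hGpos : ∀ D ∈ G, 0 < ∏ p ∈ D, p := fun D hD =>
    Finset.prod_pos fun p hp => (hGprime D hD p hp).1.pos
  have hGN : ∀ D ∈ G, ((∏ p ∈ D, p : ℕ) : ℝ) ≤ N := fun D hD => by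
    have h := (Finset.mem_filter.1 hD).2
    rw [← Real.log_prod (fun p hp => by
      exact_mod_cast (hGprime D hD p hp).1.pos.ne')] at h
    rw [Real.log_le_log_iff (Finset.prod_pos fun p hp => by
      exact_mod_cast (hGprime D hD p hp).1.pos) (by linarith)] at h
    push_cast
    exact h
  let z : Finset ℕ → ℝ := fun D => (N : ℝ) ^ 2 / ((∏ p ∈ D, p : ℕ) : ℝ)
  let Q : Finset ℕ → Finset ℕ := fun D => primesOneMod4 ⌊z D⌋₊ \ primesOneMod4 Y
  have hQ : ∀ D, ∀ q ∈ Q D, q ≤ ⌊z D⌋₊ ∧ q.Prime ∧ q % 4 = 1 ∧ Y < q := by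
    intro D q hq
    obtain ⟨h1, h2⟩ := Finset.mem_sdiff.1 hq
    obtain ⟨a, b, d⟩ := mem_primesOneMod4.1 h1
    refine ⟨a, b, d, ?_⟩
    by_contra hY
    exact h2 (mem_primesOneMod4.2 ⟨not_lt.1 hY, b, d⟩)
  have hQD : ∀ D ∈ G, ∀ q ∈ Q D, q ∉ D := by
    intro D hD q hq hqD
    have := (mem_primesOneMod4.1 ((hGP D hD).1 hqD)).1
    have := (hQ D q hq).2.2.2
    omega
  have hz : ∀ D ∈ G, (N : ℝ) ≤ z D := by
    intro D hD
    rw [le_div_iff₀ (by exact_mod_cast hGpos D hD)]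
    nlinarith [hGN D hD]
  have hzN : ∀ D ∈ G, z D ≤ (N : ℝ) ^ 2 := by
    intro D hD
    refine div_le_self (by positivity) (by exact_mod_cast hGpos D hD)
  have hprodD : ∀ D ∈ G, ∀ q ∈ Q D, (∏ p ∈ insert q D, p) = q * ∏ p ∈ D, p := fun D hD q hq =>
    Finset.prod_insert (hQD D hD q hq)
  have hprime' : ∀ D ∈ G, ∀ q ∈ Q D, ∀ p ∈ insert q D, p.Prime ∧ p % 4 = 1 := by
    intro D hD q hq p hp
    rcases Finset.mem_insert.1 hp with rfl | hp
    · exact ⟨(hQ D p hq).2.1, (hQ D p hq).2.2.1⟩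
    · exact hGprime D hD p hp
  have hinj : Set.InjOn (fun x : (_ : Finset ℕ) × ℕ => ∏ p ∈ insert x.2 x.1, p)
      (G.sigma Q : Set ((_ : Finset ℕ) × ℕ)) := by
    rintro ⟨D, q⟩ hx ⟨D', q'⟩ hx' h
    obtain ⟨hD, hq⟩ := Finset.mem_sigma.1 hx
    obtain ⟨hD', hq'⟩ := Finset.mem_sigma.1 hx'
    simp only at h hD hq hD' hq'
    have h1 := congrArg Nat.primeFactors h
    rw [Nat.primeFactors_prod fun p hp => (hprime' D hD q hq p hp).1,
      Nat.primeFactors_prod fun p hp => (hprime' D' hD' q' hq' p hp).1] at h1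
    have hsmall : ∀ E ∈ G, ∀ r ∈ Q E, (insert r E).filter (· ≤ Y) = E := by
      intro E hE r hr
      ext p
      simp only [Finset.mem_filter, Finset.mem_insert]
      constructor
      · rintro ⟨rfl | h, h'⟩
        · have := (hQ E p hr).2.2.2
          omega
        · exact h
      · exact fun hp => ⟨Or.inr hp, (mem_primesOneMod4.1 ((hGP E hE).1 hp)).1⟩
    have hDD : D = D' := by rw [← hsmall D hD q hq, ← hsmall D' hD' q' hq', h1]
    subst hDD
    have : q ∈ insert q' D := h1 ▸ Finset.mem_insert_self _ _
    rcases Finset.mem_insert.1 this with rfl | h2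
    · rfl
    · exact absurd h2 (hQD D hD q hq)
  refine ⟨(G.sigma Q).image fun x => ∏ p ∈ insert x.2 x.1, p, ?_, ?_⟩
  · intro n hn
    obtain ⟨⟨D, q⟩, hx, rfl⟩ := Finset.mem_image.1 hn
    obtain ⟨hD, hq⟩ := Finset.mem_sigma.1 hx
    simp only at hD hq ⊢
    refine ⟨Finset.prod_pos fun p hp => (hprime' D hD q hq p hp).1.pos, ?_, ?_⟩
    · rw [hprodD D hD q hq]
      have h1 : (q : ℝ) ≤ z D := (Nat.le_floor_iff (by positivity)).1 (hQ D q hq).1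
      rw [le_div_iff₀ (by exact_mod_cast hGpos D hD)] at h1
      exact_mod_cast h1
    · have := hasManyReps_prod (hprime' D hD q hq)
      rwa [Finset.card_insert_of_notMem (hQD D hD q hq), (hGP D hD).2] at this
  · rw [Finset.card_image_of_injOn hinj, Finset.card_sigma]
    push_cast
    have hcard : ∀ D ∈ G, c * (N : ℝ) ^ 2 / (2 * log N) * ∏ p ∈ D, (1 / (p : ℝ)) ≤ ((Q D).card : ℝ) := by
      intro D hD
      have h1 := hcA (z D) Y (hAN.trans (hz D hD)) (hAY.trans (hz D hD))
      refine le_trans ?_ h1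
      have hlz : log (z D) ≤ 2 * log N := by
        calc log (z D) ≤ log ((N : ℝ) ^ 2) :=
              Real.log_le_log (by linarith [hz D hD]) (hzN D hD)
          _ = _ := by rw [Real.log_pow]; norm_num
      have hlz0 : 0 < log (z D) := Real.log_pos (by linarith [hz D hD])
      have h0 : 0 ≤ z D := by linarith [hz D hD]
      calc c * (N : ℝ) ^ 2 / (2 * log N) * ∏ p ∈ D, (1 / (p : ℝ)) = c * z D / (2 * log N) := by
            simp only [z, one_div, Finset.prod_inv_distrib]
            push_cast
            ring
        _ ≤ _ := by gcongr
    calc c / 4 * (N : ℝ) ^ 2 / log N * (s ^ k / k.factorial)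
        = c * (N : ℝ) ^ 2 / (2 * log N) * (s ^ k / k.factorial / 2) := by field_simp; norm_num
      _ ≤ c * (N : ℝ) ^ 2 / (2 * log N) * ∑ D ∈ G, ∏ p ∈ D, (1 / (p : ℝ)) := by gcongr
      _ ≤ _ := by rw [Finset.mul_sum]; exact Finset.sum_le_sum hcard

theorem exists_many_reps_set : ∃ c > 0, ∃ N0 : ℕ, ∀ N : ℕ, N0 ≤ N → ∃ (r : ℕ) (S : Finset ℕ),
    (∀ n ∈ S, 1 ≤ n ∧ n ≤ N ^ 2 ∧ HasManyReps r n) ∧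
    c * (N : ℝ) ^ 2 * (log N) ^ (√2 * (1 - 3 / 2 * log 2) - 1) * (log (log N)) ^ (-(1 / 2) : ℝ)
      ≤ S.card ∧ c * (log N) ^ (√2 * log 2) ≤ 2 ^ r := by
  obtain ⟨c1, hc1, A, hA, h1⟩ := exists_card_many_reps_ge
  obtain ⟨C2, hC2, h2⟩ := exists_mertens_one_mod_four
  obtain ⟨C3, hC3, h3⟩ := exists_sum_inv_primesOneMod4_ge
  set C := C3 + 1 + log 20 / 2 with hC
  have hC0 : 0 ≤ C := by have := Real.log_nonneg (show (1 : ℝ) ≤ 20 by norm_num); positivity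
  obtain ⟨c4, hc4, L0, h4⟩ := pow_div_factorial_ge hC0
  have hlog : Filter.Tendsto (fun N : ℕ => log (N : ℝ)) Filter.atTop Filter.atTop :=
    Real.tendsto_log_atTop.comp tendsto_natCast_atTop_atTop
  have hloglog : Filter.Tendsto (fun N : ℕ => log (log (N : ℝ))) Filter.atTop Filter.atTop :=
    Real.tendsto_log_atTop.comp hlog
  have hrp : Filter.Tendsto (fun N : ℕ => (N : ℝ) ^ (1 / 10 : ℝ)) Filter.atTop Filter.atTop :=
    (tendsto_rpow_atTop (by norm_num)).comp tendsto_natCast_atTop_atTop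
  have hrp9 : Filter.Tendsto (fun N : ℕ => (N : ℝ) ^ (9 / 10 : ℝ)) Filter.atTop Filter.atTop :=
    (tendsto_rpow_atTop (by norm_num)).comp tendsto_natCast_atTop_atTop
  refine ⟨min (c1 * c4) 1, by positivity, ?_⟩
  suffices ∀ᶠ N : ℕ in Filter.atTop, ∃ (r : ℕ) (S : Finset ℕ),
      (∀ n ∈ S, 1 ≤ n ∧ n ≤ N ^ 2 ∧ HasManyReps r n) ∧
      min (c1 * c4) 1 * (N : ℝ) ^ 2 * (log N) ^ (√2 * (1 - 3 / 2 * log 2) - 1)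
        * (log (log N)) ^ (-(1 / 2) : ℝ) ≤ S.card ∧
      min (c1 * c4) 1 * (log N) ^ (√2 * log 2) ≤ 2 ^ r from
    Filter.eventually_atTop.1 this
  filter_upwards [hlog.eventually_ge_atTop (40 * (C2 + 1) + 40), hloglog.eventually_ge_atTop (max L0 (8 * C + 1)),
    hrp.eventually_ge_atTop 4, hrp9.eventually_ge_atTop A, Filter.eventually_ge_atTop 2,
    (tendsto_natCast_atTop_atTop (R := ℝ)).eventually_ge_atTop A] with N hN1 hN2 hN3 hN4 hN5 hN6
  have hN : (2 : ℝ) ≤ N := by exact_mod_cast hN5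
  have hlN : 0 < log N := Real.log_pos (by linarith)
  set L := log (log (N : ℝ)) with hL
  have hL0 : L0 ≤ L := (le_max_left _ _).trans hN2
  have hL1 : 8 * C + 1 ≤ L := (le_max_right _ _).trans hN2
  set Y := ⌊(N : ℝ) ^ (1 / 10 : ℝ)⌋₊ with hY
  have hYle : (Y : ℝ) ≤ (N : ℝ) ^ (1 / 10 : ℝ) := Nat.floor_le (by positivity)
  have hYge : (N : ℝ) ^ (1 / 10 : ℝ) / 2 ≤ Y := by
    have := Nat.lt_floor_add_one ((N : ℝ) ^ (1 / 10 : ℝ)); linarith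
  have hY2 : (2 : ℝ) ≤ Y := by linarith
  have hlY : log Y ≤ log N / 10 := by
    calc log Y ≤ log ((N : ℝ) ^ (1 / 10 : ℝ)) := Real.log_le_log (by linarith) hYle
      _ = _ := by rw [Real.log_rpow (by linarith)]; ring
  have hlY' : log N / 20 ≤ log Y := by
    calc log N / 20 ≤ log N / 10 - log 2 := by have := Real.log_two_lt_d9; linarith
      _ = log ((N : ℝ) ^ (1 / 10 : ℝ) / 2) := by
        rw [Real.log_div (by positivity) (by norm_num), Real.log_rpow (by linarith)]; ring
      _ ≤ _ := Real.log_le_log (by positivity) hYge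
  have hYN : ∀ M : ℕ, (2 : ℝ) ≤ M → 1 ≤ M := fun M h => by
    have : 2 ≤ M := by exact_mod_cast h
    omega
  have hAY : A * Y ≤ N := by
    calc A * Y ≤ (N : ℝ) ^ (9 / 10 : ℝ) * (N : ℝ) ^ (1 / 10 : ℝ) := by gcongr
      _ = N := by rw [← Real.rpow_add (by linarith)]; norm_num
  have hllY : L - log 20 ≤ log (log Y) := by
    rw [hL, ← Real.log_div hlN.ne' (by norm_num)]
    exact Real.log_le_log (by positivity) hlY'
  have hs2 : √2 ≤ 2 := Real.sqrt_le_iff.2 (by norm_num)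
  have hs2' : √2 ≤ 3 / 2 := Real.sqrt_le_iff.2 (by norm_num)
  have hs1 : 1 ≤ √2 := Real.one_le_sqrt.2 (by norm_num)
  have hkL : (⌊√2 * L⌋₊ : ℝ) ≤ √2 * L := Nat.floor_le (by nlinarith)
  obtain ⟨S, hS, hScard⟩ := h1 N Y ⌊√2 * L⌋₊ (L / 2 - C) hN6 hAY (by linarith) hN5
    (by have := h3 Y (by exact_mod_cast hY2); linarith) (by nlinarith)
    (Nat.one_le_floor_iff _ |>.2 (by nlinarith))
    (by have := (abs_le.1 (h2 Y (hYN Y hY2))).2; linarith)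
  refine ⟨_, S, hS, le_trans ?_ hScard, ?_⟩
  · have h5 := h4 L hL0
    have e1 : exp (√2 * (1 - 3 / 2 * log 2) * L) = (log N) ^ (√2 * (1 - 3 / 2 * log 2)) := by
      rw [Real.rpow_def_of_pos hlN, ← hL]; ring_nf
    rw [Real.rpow_sub hlN, Real.rpow_one]
    rw [e1] at h5
    calc min (c1 * c4) 1 * (N : ℝ) ^ 2 * ((log N) ^ (√2 * (1 - 3 / 2 * log 2)) / log N)
        * L ^ (-(1 / 2) : ℝ)
        ≤ (c1 * c4) * (N : ℝ) ^ 2 * ((log N) ^ (√2 * (1 - 3 / 2 * log 2)) / log N)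
        * L ^ (-(1 / 2) : ℝ) := by
          have : 0 ≤ L ^ (-(1 / 2) : ℝ) := Real.rpow_nonneg (by linarith) _
          gcongr
          exact min_le_left _ _
      _ = c1 * (N : ℝ) ^ 2 / log N * (c4 * (log N) ^ (√2 * (1 - 3 / 2 * log 2)) * L ^ (-(1 / 2) : ℝ)) := by
          ring
      _ ≤ _ := by gcongr
  · calc min (c1 * c4) 1 * (log N) ^ (√2 * log 2) ≤ 1 * (log N) ^ (√2 * log 2) := by
          gcongr
          exact min_le_right _ _
      _ = 2 ^ (√2 * L) := by
          rw [one_mul, Real.rpow_def_of_pos hlN, Real.rpow_def_of_pos (by norm_num), ← hL]; ring_nf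
      _ ≤ 2 ^ ((⌊√2 * L⌋₊ + 1 : ℕ) : ℝ) := by
          apply Real.rpow_le_rpow_of_exponent_le (by norm_num)
          push_cast
          exact (Nat.lt_floor_add_one _).le
      _ = _ := Real.rpow_natCast _ _

/-- The additive character `x ↦ e^{2πix}`. -/
noncomputable def ee (x : ℝ) : ℂ := Complex.exp (2 * π * x * Complex.I)

theorem ee_zero : ee 0 = 1 := by simp [ee]

theorem ee_add (x y : ℝ) : ee (x + y) = ee x * ee y := by
  rw [ee, ee, ee, ← Complex.exp_add]; push_cast; ring_nf

theorem norm_ee (x : ℝ) : ‖ee x‖ = 1 := by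
  rw [ee, show (2 * π * x * Complex.I : ℂ) = ((2 * π * x : ℝ) : ℂ) * Complex.I by push_cast; ring,
    Complex.norm_exp_ofReal_mul_I]

theorem ee_neg (x : ℝ) : ee (-x) = (starRingEnd ℂ) (ee x) := by
  rw [ee, ee, ← Complex.exp_conj]
  congr 1
  simp [Complex.conj_ofNat]

theorem ee_re (x : ℝ) : (ee x).re = cos (2 * π * x) := by
  rw [ee, show (2 * π * x * Complex.I : ℂ) = ((2 * π * x : ℝ) : ℂ) * Complex.I by push_cast; ring,
    Complex.exp_ofReal_mul_I_re]

theorem ee_im (x : ℝ) : (ee x).im = sin (2 * π * x) := by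
  rw [ee, show (2 * π * x * Complex.I : ℂ) = ((2 * π * x : ℝ) : ℂ) * Complex.I by push_cast; ring,
    Complex.exp_ofReal_mul_I_im]

theorem ee_mul_ee_neg (x : ℝ) : ee x * ee (-x) = 1 := by
  rw [← ee_add, add_neg_cancel, ee_zero]

theorem continuous_ee : Continuous ee := by unfold ee; fun_prop

theorem hasDerivAt_ee (x : ℝ) : HasDerivAt ee (2 * π * Complex.I * ee x) x := by
  have h : HasDerivAt (fun x : ℝ => (2 * π * x * Complex.I : ℂ)) (2 * π * Complex.I) x := by
    have := (Complex.ofRealCLM.hasDerivAt (x := x)).const_mul (2 * π : ℂ) |>.mul_const Complex.I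
    simpa using this
  exact h.cexp.congr_deriv (by rw [ee]; ring)

theorem hasDerivAt_ee_comp {f : ℝ → ℝ} {f' x : ℝ} (h : HasDerivAt f f' x) :
    HasDerivAt (fun y => ee (f y)) (2 * π * Complex.I * f' * ee (f x)) x :=
  ((hasDerivAt_ee (f x)).scomp x h).congr_deriv (by rw [Complex.real_smul]; ring)

theorem norm_ee_sub_ee_le (x y : ℝ) : ‖ee x - ee y‖ ≤ 2 * π * |x - y| := by
  have h : ∀ z ∈ Set.univ, ‖(2 * π * Complex.I * ee z : ℂ)‖ ≤ 2 * π := by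
    intro z _
    simp [norm_ee, abs_of_pos Real.pi_pos]
  have := convex_univ.norm_image_sub_le_of_norm_hasDerivWithin_le
    (fun z _ => (hasDerivAt_ee z).hasDerivWithinAt) h (Set.mem_univ y) (Set.mem_univ x)
  simpa [Real.norm_eq_abs] using this

/-- The Fresnel constant `∫_0^∞ e^{-2πiv²} dv`. -/
noncomputable def fresnelConst : ℂ := Complex.exp (-(π / 4 * Complex.I)) / (√8 : ℝ)

theorem fresnelConst_sq : fresnelConst ^ 2 = -Complex.I / 8 := by
  rw [fresnelConst, div_pow, ← Complex.exp_nat_mul, ← Complex.ofReal_pow, Real.sq_sqrt (by norm_num)]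
  congr 1
  · rw [show ((2 : ℕ) : ℂ) * -(π / 4 * Complex.I) = -(π / 2 * Complex.I) by push_cast; ring,
      Complex.exp_neg, Complex.exp_pi_div_two_mul_I, Complex.inv_I]

theorem tendsto_gaussian_const :
    Filter.Tendsto (fun n : ℕ => ((π : ℂ) / ((1 / ((n : ℝ) + 1) ^ 2 : ℝ) + 2 * π * Complex.I)) ^ (1 / 2 : ℂ) / 2)
      Filter.atTop (nhds fresnelConst) := by
  have hz : (π : ℂ) / ((0 : ℝ) + 2 * π * Complex.I) = -Complex.I / 2 := by
    have : (π : ℂ) ≠ 0 := by exact_mod_cast Real.pi_ne_zero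
    have hI := Complex.I_ne_zero
    rw [Complex.ofReal_zero, zero_add, div_eq_div_iff (by simp [this]) (by norm_num)]
    linear_combination (2 * π : ℂ) * Complex.I_sq
  have harg : (-Complex.I / 2 : ℂ).arg = -(π / 2) := by
    rw [show (-Complex.I / 2 : ℂ) = ((1 / 2 : ℝ) : ℂ) * -Complex.I by push_cast; ring,
      Complex.arg_real_mul _ (by norm_num), Complex.arg_neg_I]
  have hval : (-Complex.I / 2 : ℂ) ^ (1 / 2 : ℂ) / 2 = fresnelConst := by
    have hne : (-Complex.I / 2 : ℂ) ≠ 0 := by simp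
    rw [Complex.cpow_def_of_ne_zero hne, Complex.log, harg]
    have hn : ‖(-Complex.I / 2 : ℂ)‖ = 1 / 2 := by simp
    rw [hn, fresnelConst, add_mul, Complex.exp_add]
    have h1 : Complex.exp ((Real.log (1 / 2) : ℝ) * (1 / 2 : ℂ)) = ((√2)⁻¹ : ℝ) := by
      rw [show ((Real.log (1 / 2) : ℝ) * (1 / 2 : ℂ)) = ((Real.log (1 / 2) * (1 / 2) : ℝ) : ℂ) by
        push_cast; ring, ← Complex.ofReal_exp, Real.exp_mul, Real.exp_log (by norm_num),
        ← Real.sqrt_eq_rpow, one_div, Real.sqrt_inv]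
    have h8 : √8 = 2 * √2 := by
      rw [show (8 : ℝ) = 2 ^ 2 * 2 by norm_num, Real.sqrt_mul (by norm_num), Real.sqrt_sq (by norm_num)]
    rw [h1, h8]
    have : ((-(π / 2) : ℝ) : ℂ) * Complex.I * (1 / 2) = -(π / 4 * Complex.I) := by push_cast; ring
    rw [this]
    push_cast
    have h2 : ((√2 : ℝ) : ℂ) ≠ 0 := by exact_mod_cast (by positivity : √2 ≠ 0)
    field_simp
  rw [← hval, ← hz]
  refine Filter.Tendsto.div_const (Filter.Tendsto.cpow ?_ tendsto_const_nhds ?_) _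
  · refine Filter.Tendsto.div tendsto_const_nhds (Filter.Tendsto.add ?_ tendsto_const_nhds) ?_
    · refine (Complex.continuous_ofReal.tendsto 0).comp ?_
      have := (tendsto_one_div_add_atTop_nhds_zero_nat (𝕜 := ℝ)).pow 2
      simpa [one_div, inv_pow] using this
    · simp
  · rw [hz, Complex.mem_slitPlane_iff]; right; simp

theorem continuous_ee_neg_sq : Continuous fun v : ℝ => ee (-v ^ 2) :=
  continuous_ee.comp (by fun_prop)

theorem hasDerivAt_integral_ee_neg_sq (v : ℝ) :
    HasDerivAt (fun A => ∫ v in (0 : ℝ)..A, ee (-v ^ 2)) (ee (-v ^ 2)) v :=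
  intervalIntegral.integral_hasDerivAt_right (continuous_ee_neg_sq.intervalIntegrable _ _)
    continuous_ee_neg_sq.stronglyMeasurable.stronglyMeasurableAtFilter
    continuous_ee_neg_sq.continuousAt

theorem fresnel_limit_eq {l : ℂ}
    (hl : Filter.Tendsto (fun A => ∫ v in (0 : ℝ)..A, ee (-v ^ 2)) Filter.atTop (nhds l)) :
    l = fresnelConst := by
  set P : ℝ → ℂ := fun A => ∫ v in (0 : ℝ)..A, ee (-v ^ 2) with hP
  have hPc : Continuous P := continuous_iff_continuousAt.2 fun v =>
    (hasDerivAt_integral_ee_neg_sq v).continuousAt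
  obtain ⟨B, hB⟩ : ∃ B, ∀ v, 0 ≤ v → ‖P v‖ ≤ B := by
    have h1 := hl.norm.eventually_le_const (lt_add_one ‖l‖)
    obtain ⟨a, ha⟩ := Filter.eventually_atTop.1 h1
    obtain ⟨b, hb⟩ := (isCompact_Icc (a := (0 : ℝ)) (b := a)).exists_bound_of_continuousOn hPc.continuousOn
    refine ⟨max b (‖l‖ + 1), fun v hv => ?_⟩
    by_cases h : v ≤ a
    · exact (hb v ⟨hv, h⟩).trans (le_max_left _ _)
    · exact (ha v (not_le.1 h).le).trans (le_max_right _ _)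
  have key : ∀ n : ℕ, ∫ w in Set.Ioi (0 : ℝ), ((2 * (w * exp (-1 * w ^ 2)) : ℝ) : ℂ) * P (((n : ℝ) + 1) * w)
      = ((π : ℂ) / ((1 / ((n : ℝ) + 1) ^ 2 : ℝ) + 2 * π * Complex.I)) ^ (1 / 2 : ℂ) / 2 := by
    intro n
    set m : ℝ := (n : ℝ) + 1 with hm
    have hm0 : 0 < m := by positivity
    set ε : ℝ := 1 / m ^ 2 with hε
    have hε0 : 0 < ε := by positivity
    have hb : 0 < ((ε : ℂ) + 2 * π * Complex.I).re := by simpa using hε0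
    rw [← integral_gaussian_complex_Ioi hb]
    have hexp : ∀ v : ℝ, Complex.exp (-((ε : ℂ) + 2 * π * Complex.I) * v ^ 2)
        = ((exp (-ε * v ^ 2) : ℝ) : ℂ) * ee (-v ^ 2) := by
      intro v
      rw [ee, Complex.ofReal_exp, ← Complex.exp_add]
      congr 1
      push_cast; ring
    simp_rw [hexp]
    have hu : ∀ v : ℝ, HasDerivAt (fun v : ℝ => ((exp (-ε * v ^ 2) : ℝ) : ℂ))
        ((-(2 * ε * (v * exp (-ε * v ^ 2))) : ℝ) : ℂ) v := by
      intro v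
      have h1 : HasDerivAt (fun v : ℝ => exp (-ε * v ^ 2)) (-(2 * ε * (v * exp (-ε * v ^ 2)))) v := by
        exact (((hasDerivAt_pow 2 v).const_mul (-ε)).exp).congr_deriv (by push_cast; ring)
      exact h1.ofReal_comp
    have hi1 : Integrable (fun v : ℝ => ((exp (-ε * v ^ 2) : ℝ) : ℂ) * ee (-v ^ 2)) := by
      simp_rw [← hexp]
      exact integrable_cexp_neg_mul_sq hb
    have hi2 : IntegrableOn (fun v : ℝ => ((-(2 * ε * (v * exp (-ε * v ^ 2))) : ℝ) : ℂ) * P v)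
        (Set.Ioi 0) := by
      have h0 : Integrable (fun v : ℝ => 2 * ε * (v * exp (-ε * v ^ 2))) :=
        (integrable_mul_exp_neg_mul_sq hε0).const_mul _
      refine Integrable.mono' (h0.norm.const_mul B).integrableOn ?_ ?_
      · exact (Continuous.mul (by fun_prop) hPc).aestronglyMeasurable
      · refine (ae_restrict_iff' measurableSet_Ioi).2 (Filter.Eventually.of_forall fun v hv => ?_)
        rw [norm_mul, Complex.norm_real, norm_neg, mul_comm]
        exact mul_le_mul_of_nonneg_right (hB v (le_of_lt hv)) (norm_nonneg _)
    have hibp := integral_Ioi_mul_deriv_eq_deriv_mul (a := (0 : ℝ)) (a' := (0 : ℂ)) (b' := (0 : ℂ))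
      (fun v _ => hu v) (fun v _ => hasDerivAt_integral_ee_neg_sq v) hi1.integrableOn hi2 ?_ ?_
    · rw [hibp, sub_self, zero_sub, ← integral_neg]
      have hsub := integral_comp_mul_left_Ioi
        (fun v : ℝ => -(((-(2 * ε * (v * exp (-ε * v ^ 2))) : ℝ) : ℂ) * P v)) 0 hm0
      rw [mul_zero] at hsub
      rw [← smul_right_injective ℂ (inv_ne_zero hm0.ne') |>.eq_iff] 
      refine Eq.trans ?_ hsub
      rw [← integral_smul]
      refine setIntegral_congr_fun measurableSet_Ioi fun w _ => ?_
      have e1 : -ε * (m * w) ^ 2 = -1 * w ^ 2 := by rw [hε]; field_simp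
      simp only [e1, Complex.real_smul]
      rw [hε]
      push_cast
      have : (m : ℂ) ≠ 0 := by exact_mod_cast hm0.ne'
      field_simp
    · have hc : Continuous ((fun v : ℝ => ((exp (-ε * v ^ 2) : ℝ) : ℂ)) * P) :=
        Continuous.mul (by fun_prop) hPc
      have := hc.tendsto 0
      simp only [Pi.mul_apply, hP, intervalIntegral.integral_same, mul_zero] at this
      exact this.mono_left nhdsWithin_le_nhds
    · have h1 : Filter.Tendsto (fun v : ℝ => ((exp (-ε * v ^ 2) : ℝ) : ℂ)) Filter.atTop (nhds 0) := by
        rw [← Complex.ofReal_zero]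
        refine (Complex.continuous_ofReal.tendsto 0).comp (Real.tendsto_exp_atBot.comp ?_)
        exact (Filter.tendsto_pow_atTop two_ne_zero).const_mul_atTop_of_neg (neg_lt_zero.2 hε0)
      have := h1.mul hl
      rwa [zero_mul] at this
  have hlim : Filter.Tendsto (fun n : ℕ => ∫ w in Set.Ioi (0 : ℝ),
      ((2 * (w * exp (-1 * w ^ 2)) : ℝ) : ℂ) * P (((n : ℝ) + 1) * w)) Filter.atTop (nhds l) := by
    have h1 : ∫ w in Set.Ioi (0 : ℝ), ((2 * (w * exp (-1 * w ^ 2)) : ℝ) : ℂ) * l = l := by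
      rw [integral_mul_const]
      have := integral_mul_cexp_neg_mul_sq (b := 1) (by simp)
      have h2 : ∫ w in Set.Ioi (0 : ℝ), ((2 * (w * exp (-1 * w ^ 2)) : ℝ) : ℂ) = 1 := by
        calc _ = ∫ w in Set.Ioi (0 : ℝ), 2 * ((w : ℂ) * Complex.exp (-1 * (w : ℂ) ^ 2)) := by
              refine integral_congr_ae (Filter.Eventually.of_forall fun w => ?_)
              push_cast; ring_nf
          _ = 1 := by rw [integral_const_mul, this]; norm_num
      rw [h2, one_mul]
    rw [← h1]
    have h0 : Integrable (fun v : ℝ => 2 * (v * exp (-1 * v ^ 2))) :=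
      (integrable_mul_exp_neg_mul_sq one_pos).const_mul _
    refine tendsto_integral_of_dominated_convergence (fun w => ‖2 * (w * exp (-1 * w ^ 2))‖ * B) ?_
      (h0.norm.mul_const B).integrableOn ?_ ?_
    · intro n
      exact (Continuous.mul (by fun_prop) (hPc.comp (by fun_prop))).aestronglyMeasurable
    · intro n
      refine (ae_restrict_iff' measurableSet_Ioi).2 (Filter.Eventually.of_forall fun v hv => ?_)
      rw [norm_mul, Complex.norm_real]
      have hv' : 0 < v := hv
      exact mul_le_mul_of_nonneg_left (hB _ (by positivity)) (norm_nonneg _)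
    · refine (ae_restrict_iff' measurableSet_Ioi).2 (Filter.Eventually.of_forall fun v hv => ?_)
      have hv' : 0 < v := hv
      refine Filter.Tendsto.const_mul _ (hl.comp ?_)
      exact Filter.Tendsto.atTop_mul_const hv'
        (Filter.tendsto_atTop_add_const_right _ _ tendsto_natCast_atTop_atTop)
  have := tendsto_gaussian_const
  simp_rw [← key] at this
  exact tendsto_nhds_unique hlim this

/-- The incomplete Fresnel integral. -/
theorem fresnel_asymptotic {A : ℝ} (hA : 0 < A) :
    ‖(∫ v in (0 : ℝ)..A, ee (-v ^ 2)) - (fresnelConst - ee (-A ^ 2) / (4 * π * Complex.I * A))‖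
      ≤ 1 / A ^ 3 := by
  set F : ℝ → ℂ := fun A => (∫ v in (0 : ℝ)..A, ee (-v ^ 2))
    + ee (-A ^ 2) * ((4 * π * Complex.I * A)⁻¹ + (16 * (π : ℂ) ^ 2 * (A : ℂ) ^ 3)⁻¹) with hF
  have hpi : (π : ℂ) ≠ 0 := by exact_mod_cast Real.pi_ne_zero
  have hI := Complex.I_ne_zero
  have hd : ∀ v : ℝ, 0 < v → HasDerivAt F (-(3 / (16 * π ^ 2)) * (ee (-v ^ 2) * (((v ^ (-4 : ℝ)) : ℝ) : ℂ))) v := by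
    intro v hv
    have hv0 : (v : ℂ) ≠ 0 := by exact_mod_cast hv.ne'
    have h1 : HasDerivAt (fun v : ℝ => ee (-v ^ 2)) (2 * π * Complex.I * ((-(2 * v) : ℝ) : ℂ) * ee (-v ^ 2)) v := by
      have : HasDerivAt (fun v : ℝ => -v ^ 2) (-(2 * v)) v := by
        exact (hasDerivAt_pow 2 v).neg.congr_deriv (by push_cast; ring)
      exact hasDerivAt_ee_comp this
    have h2 : HasDerivAt (fun v : ℝ => (4 * π * Complex.I * v : ℂ)) (4 * π * Complex.I) v := by
      simpa using (Complex.ofRealCLM.hasDerivAt (x := v)).const_mul (4 * π * Complex.I : ℂ)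
    have h3 : HasDerivAt (fun v : ℝ => (16 * π ^ 2 * (v : ℂ) ^ 3 : ℂ)) (16 * π ^ 2 * (3 * v ^ 2)) v := by
      have := ((Complex.ofRealCLM.hasDerivAt (x := v)).pow 3).const_mul (16 * π ^ 2 : ℂ)
      simpa using this
    have h4 := (hasDerivAt_integral_ee_neg_sq v).add (h1.mul ((h2.inv (by simp [hpi, hv0])).add
      (h3.inv (by simp [hpi, hv0]))))
    refine h4.congr_deriv ?_
    simp only [Pi.add_apply, Pi.inv_apply]
    rw [Real.rpow_neg hv.le, show (4 : ℝ) = ((4 : ℕ) : ℝ) by norm_num, Real.rpow_natCast]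
    push_cast
    have hI2 : Complex.I ^ 2 = -1 := Complex.I_sq
    field_simp
    ring_nf
    simp only [hI2]
    ring
  have hInt : ∀ a : ℝ, 0 < a → IntegrableOn (fun v : ℝ => -(3 / (16 * π ^ 2)) * (ee (-v ^ 2) * (((v ^ (-4 : ℝ)) : ℝ) : ℂ)))
      (Set.Ioi a) := by
    intro a ha
    refine Integrable.const_mul ?_ _
    refine Integrable.mono' (integrableOn_Ioi_rpow_of_lt (a := -4) (by norm_num) ha) ?_ ?_
    · refine ContinuousOn.aestronglyMeasurable ?_ measurableSet_Ioi
      refine continuous_ee_neg_sq.continuousOn.mul (Complex.continuous_ofReal.comp_continuousOn ?_)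
      exact continuousOn_id.rpow_const fun x hx => Or.inl (ha.trans hx).ne'
    · refine (ae_restrict_iff' measurableSet_Ioi).2 (Filter.Eventually.of_forall fun v hv => ?_)
      rw [norm_mul, norm_ee, one_mul, Complex.norm_real,
        Real.norm_of_nonneg (Real.rpow_nonneg (ha.trans hv).le _)]
  have hlim := tendsto_limUnder_of_hasDerivAt_of_integrableOn_Ioi (a := 1)
    (fun v hv => hd v (one_pos.trans hv)) (hInt 1 one_pos)
  set l := Filter.atTop.limUnder F
  have hsmall : Filter.Tendsto (fun A : ℝ => ee (-A ^ 2) * ((4 * π * Complex.I * A)⁻¹ + (16 * (π : ℂ) ^ 2 * (A : ℂ) ^ 3)⁻¹))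
      Filter.atTop (nhds 0) := by
    have hr : Filter.Tendsto (fun A : ℝ => (1 / (4 * π)) * A⁻¹ + (1 / (16 * π ^ 2)) * (A ^ 3)⁻¹) Filter.atTop (nhds 0) := by
      have h1 := (tendsto_inv_atTop_zero (𝕜 := ℝ)).const_mul (1 / (4 * π))
      have h2 := (tendsto_inv_atTop_zero.comp (Filter.tendsto_pow_atTop (α := ℝ) (n := 3) (by norm_num))).const_mul (1 / (16 * π ^ 2))
      simpa using h1.add h2
    refine squeeze_zero_norm' ?_ hr
    filter_upwards [Filter.eventually_gt_atTop (0 : ℝ)] with A hA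
    rw [norm_mul, norm_ee, one_mul]
    refine (norm_add_le _ _).trans (le_of_eq ?_)
    simp only [norm_inv, norm_mul, Complex.norm_I, Complex.norm_real, norm_pow, Real.norm_of_nonneg hA.le,
      Real.norm_of_nonneg Real.pi_pos.le, Complex.norm_ofNat]
    field_simp
  have hP : Filter.Tendsto (fun A => ∫ v in (0 : ℝ)..A, ee (-v ^ 2)) Filter.atTop (nhds l) := by
    have := hlim.sub hsmall
    rw [sub_zero] at this
    refine this.congr fun A => ?_
    simp only [hF]; ring
  have hl := fresnel_limit_eq hP
  rw [hl] at hlim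
  have hFTC := integral_Ioi_of_hasDerivAt_of_tendsto' (a := A)
    (fun v hv => hd v (hA.trans_le hv)) (hInt A hA) hlim
  have hbound : ‖∫ v in Set.Ioi A, -(3 / (16 * (π : ℂ) ^ 2)) * (ee (-v ^ 2) * (((v ^ (-4 : ℝ)) : ℝ) : ℂ))‖
      ≤ 1 / (16 * π ^ 2) * (1 / A ^ 3) := by
    rw [integral_const_mul, norm_mul]
    have h1 : ‖∫ v in Set.Ioi A, (ee (-v ^ 2) * (((v ^ (-4 : ℝ)) : ℝ) : ℂ))‖ ≤ 1 / 3 * (1 / A ^ 3) := by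
      calc _ ≤ ∫ v in Set.Ioi A, v ^ (-4 : ℝ) := by
            refine norm_integral_le_of_norm_le (integrableOn_Ioi_rpow_of_lt (by norm_num) hA) ?_
            refine (ae_restrict_iff' measurableSet_Ioi).2 (Filter.Eventually.of_forall fun v hv => ?_)
            rw [norm_mul, norm_ee, one_mul, Complex.norm_real,
              Real.norm_of_nonneg (Real.rpow_nonneg (hA.trans hv).le _)]
        _ = _ := by
          rw [integral_Ioi_rpow_of_lt (by norm_num) hA, show (-4 + 1 : ℝ) = -((3 : ℕ) : ℝ) by norm_num,
            Real.rpow_neg hA.le, Real.rpow_natCast]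
          push_cast
          ring
    have h2 : ‖-(3 / (16 * (π : ℂ) ^ 2))‖ = 3 / (16 * π ^ 2) := by
      simp [abs_of_pos Real.pi_pos]
    rw [h2]
    calc _ ≤ 3 / (16 * π ^ 2) * (1 / 3 * (1 / A ^ 3)) := by gcongr
      _ = _ := by ring
  rw [hFTC] at hbound
  have e : (∫ v in (0 : ℝ)..A, ee (-v ^ 2)) - (fresnelConst - ee (-A ^ 2) / (4 * π * Complex.I * A))
      = -(fresnelConst - F A) - ee (-A ^ 2) * (16 * (π : ℂ) ^ 2 * (A : ℂ) ^ 3)⁻¹ := by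
    simp only [hF]; ring
  rw [e]
  refine (norm_sub_le _ _).trans ?_
  have h3 : ‖ee (-A ^ 2) * (16 * (π : ℂ) ^ 2 * A ^ 3)⁻¹‖ = 1 / (16 * π ^ 2) * (1 / A ^ 3) := by
    rw [norm_mul, norm_ee, one_mul]
    simp [abs_of_pos Real.pi_pos, abs_of_pos hA]
    ring
  rw [h3, norm_neg]
  have h4 : 1 / (16 * π ^ 2) ≤ 1 / 2 := by
    apply one_div_le_one_div_of_le (by norm_num)
    nlinarith [Real.pi_gt_three]
  have h5 : 0 ≤ 1 / A ^ 3 := by positivity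
  nlinarith [mul_le_mul_of_nonneg_right h4 h5]

theorem norm_fresnelConst_le : ‖fresnelConst‖ ≤ 1 / 2 := by
  have h : ‖fresnelConst‖ ^ 2 = 1 / 8 := by rw [← norm_pow, fresnelConst_sq]; simp
  nlinarith [norm_nonneg fresnelConst]

theorem integral_ee_neg_mul_sq {y : ℝ} (hy : 0 < y) (b : ℝ) :
    ∫ v in (0 : ℝ)..b, ee (-(y * v ^ 2)) = (√y : ℂ)⁻¹ * ∫ v in (0 : ℝ)..(√y * b), ee (-v ^ 2) := by
  have h := intervalIntegral.integral_comp_mul_left (a := 0) (b := b) (fun v => ee (-v ^ 2))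
    (Real.sqrt_pos.2 hy).ne'
  rw [mul_zero] at h
  have e : ∀ v : ℝ, (√y * v) ^ 2 = y * v ^ 2 := fun v => by rw [mul_pow, Real.sq_sqrt hy.le]
  simp_rw [e] at h
  rw [h, Complex.real_smul]
  push_cast
  rfl

theorem fresnel_scaled {y b : ℝ} (hy : 0 < y) (hb : 0 < b) :
    ‖(∫ v in (0 : ℝ)..b, ee (-(y * v ^ 2)))
      - (fresnelConst / √y - ee (-(y * b ^ 2)) / (4 * π * Complex.I * (y * b)))‖ ≤ 1 / (y ^ 2 * b ^ 3) := by
  have hs : 0 < √y := Real.sqrt_pos.2 hy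
  have h := fresnel_asymptotic (A := √y * b) (by positivity)
  have hsq : (√y : ℝ) ^ 2 = y := Real.sq_sqrt hy.le
  have hsqC : ((√y : ℝ) : ℂ) ^ 2 = y := by exact_mod_cast hsq
  have hs0 : ((√y : ℝ) : ℂ) ≠ 0 := by exact_mod_cast hs.ne'
  have hb0 : (b : ℂ) ≠ 0 := by exact_mod_cast hb.ne'
  have hpi : (π : ℂ) ≠ 0 := by exact_mod_cast Real.pi_ne_zero
  have hI := Complex.I_ne_zero
  have e : (∫ v in (0 : ℝ)..b, ee (-(y * v ^ 2)))
      - (fresnelConst / √y - ee (-(y * b ^ 2)) / (4 * π * Complex.I * (y * b)))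
      = (√y : ℂ)⁻¹ * ((∫ v in (0 : ℝ)..(√y * b), ee (-v ^ 2))
        - (fresnelConst - ee (-(√y * b) ^ 2) / (4 * π * Complex.I * ((√y * b : ℝ) : ℂ)))) := by
    rw [integral_ee_neg_mul_sq hy, mul_pow, hsq, ← hsqC]
    push_cast
    field_simp
  rw [e, norm_mul, norm_inv, Complex.norm_real, Real.norm_of_nonneg hs.le]
  calc (√y)⁻¹ * _ ≤ (√y)⁻¹ * (1 / (√y * b) ^ 3) := by gcongr
    _ = 1 / ((√y ^ 2) ^ 2 * b ^ 3) := by field_simp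
    _ = _ := by rw [hsq]

theorem norm_integral_ee_neg_mul_sq_le {y b : ℝ} (hy : 0 < y) (hb : 0 ≤ b) :
    ‖∫ v in (0 : ℝ)..b, ee (-(y * v ^ 2))‖ ≤ 2 / √y := by
  have hs : 0 < √y := Real.sqrt_pos.2 hy
  have key : ∀ A : ℝ, 0 ≤ A → ‖∫ v in (0 : ℝ)..A, ee (-v ^ 2)‖ ≤ 2 := by
    intro A hA
    by_cases h1 : A ≤ 1
    · have := intervalIntegral.norm_integral_le_of_norm_le_const (a := 0) (b := A) (C := 1)
        (f := fun v => ee (-v ^ 2)) (fun v _ => (norm_ee _).le)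
      rw [sub_zero, abs_of_nonneg hA] at this
      linarith
    · rw [not_le] at h1
      have h := fresnel_asymptotic (A := A) (by linarith)
      have h2 : ‖fresnelConst - ee (-A ^ 2) / (4 * π * Complex.I * A)‖ ≤ 1 := by
        refine (norm_sub_le _ _).trans ?_
        have : ‖ee (-A ^ 2) / (4 * π * Complex.I * A)‖ ≤ 1 / 2 := by
          rw [norm_div, norm_ee]
          simp only [norm_mul, Complex.norm_I, Complex.norm_real, Complex.norm_ofNat,
            Real.norm_of_nonneg hA, Real.norm_of_nonneg Real.pi_pos.le]
          apply one_div_le_one_div_of_le (by norm_num)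
          nlinarith [Real.pi_gt_three]
        linarith [norm_fresnelConst_le]
      have h3 : 1 / A ^ 3 ≤ 1 := by
        rw [div_le_one (by positivity)]; exact one_le_pow₀ h1.le
      have := norm_le_norm_add_norm_sub' (∫ v in (0 : ℝ)..A, ee (-v ^ 2)) (fresnelConst - ee (-A ^ 2) / (4 * π * Complex.I * A))
      linarith
  rw [integral_ee_neg_mul_sq hy, norm_mul, norm_inv, Complex.norm_real, Real.norm_of_nonneg hs.le,
    div_eq_inv_mul]
  gcongr
  exact key _ (by positivity)

theorem hasDerivAt_ee_neg_mul_sq (y v : ℝ) :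
    HasDerivAt (fun v => ee (-(y * v ^ 2))) (-(4 * π * Complex.I * y) * (v * ee (-(y * v ^ 2)))) v :=
  (hasDerivAt_ee_comp (f := fun v => -(y * v ^ 2)) (f' := -(2 * y * v))
    (((hasDerivAt_pow 2 v).const_mul y).neg.congr_deriv (by push_cast; ring))).congr_deriv (by push_cast; ring)

theorem continuous_ee_neg_mul_sq (y : ℝ) : Continuous fun v => ee (-(y * v ^ 2)) :=
  continuous_ee.comp (by fun_prop)

theorem norm_integral_mul_ee_sq_le {g g' : ℝ → ℝ} {G y : ℝ} (hy : 0 < y)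
    (hg : ∀ v ∈ Set.Icc (0 : ℝ) 1, HasDerivAt g (g' v) v) (hg' : ContinuousOn g' (Set.Icc 0 1))
    (hG : ∀ v ∈ Set.Icc (0 : ℝ) 1, |g v| ≤ G) (hG' : ∀ v ∈ Set.Icc (0 : ℝ) 1, |g' v| ≤ G) :
    ‖∫ v in (0 : ℝ)..1, (g v : ℂ) * ee (-(y * v ^ 2))‖ ≤ 4 * G / √y := by
  have hs : 0 < √y := Real.sqrt_pos.2 hy
  have hG0 : 0 ≤ G := (abs_nonneg _).trans (hG 0 (by simp))
  have hP : ∀ v, HasDerivAt (fun b => ∫ v in (0 : ℝ)..b, ee (-(y * v ^ 2))) (ee (-(y * v ^ 2))) v := fun v =>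
    intervalIntegral.integral_hasDerivAt_right ((continuous_ee_neg_mul_sq y).intervalIntegrable _ _)
      (continuous_ee_neg_mul_sq y).stronglyMeasurable.stronglyMeasurableAtFilter
      (continuous_ee_neg_mul_sq y).continuousAt
  have hu : Set.uIcc (0 : ℝ) 1 = Set.Icc 0 1 := Set.uIcc_of_le zero_le_one
  have hibp := intervalIntegral.integral_mul_deriv_eq_deriv_mul (a := 0) (b := 1)
    (fun v hv => (hg v (hu ▸ hv)).ofReal_comp) (fun v _ => hP v)
    ((Complex.continuous_ofReal.comp_continuousOn (hu ▸ hg')).intervalIntegrable)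
    ((continuous_ee_neg_mul_sq y).intervalIntegrable _ _)
  rw [hibp, intervalIntegral.integral_same, mul_zero, sub_zero]
  have hb : ∀ b : ℝ, 0 ≤ b → ‖∫ v in (0 : ℝ)..b, ee (-(y * v ^ 2))‖ ≤ 2 / √y := fun b hb =>
    norm_integral_ee_neg_mul_sq_le hy hb
  refine (norm_sub_le _ _).trans ?_
  have h1 : ‖(g 1 : ℂ) * ∫ v in (0 : ℝ)..1, ee (-(y * v ^ 2))‖ ≤ G * (2 / √y) := by
    rw [norm_mul, Complex.norm_real]
    exact mul_le_mul (hG 1 (by simp)) (hb 1 zero_le_one) (norm_nonneg _) hG0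
  have h2 := intervalIntegral.norm_integral_le_of_norm_le_const (a := 0) (b := 1) (C := G * (2 / √y))
    (f := fun x => (g' x : ℂ) * ∫ v in (0 : ℝ)..x, ee (-(y * v ^ 2))) (fun v hv => by
      rw [Set.uIoc_of_le zero_le_one] at hv
      rw [norm_mul, Complex.norm_real]
      exact mul_le_mul (hG' v ⟨hv.1.le, hv.2⟩) (hb v hv.1.le) (norm_nonneg _) hG0)
  simp only [sub_zero, abs_one, mul_one] at h2
  calc _ ≤ G * (2 / √y) + G * (2 / √y) := add_le_add h1 h2
    _ = _ := by ring

theorem integral_mul_ee_sq_by_parts {k k' : ℝ → ℝ} {y : ℝ} (hy : 0 < y)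
    (hk : ∀ v ∈ Set.Icc (0 : ℝ) 1, HasDerivAt k (k' v) v) (hk' : ContinuousOn k' (Set.Icc 0 1)) (hk0 : k 0 = 0) :
    ∫ v in (0 : ℝ)..1, ((v * k v : ℝ) : ℂ) * ee (-(y * v ^ 2))
      = (4 * π * Complex.I * y)⁻¹ * ((∫ v in (0 : ℝ)..1, (k' v : ℂ) * ee (-(y * v ^ 2))) - k 1 * ee (-y)) := by
  have hu : Set.uIcc (0 : ℝ) 1 = Set.Icc 0 1 := Set.uIcc_of_le zero_le_one
  have hibp := intervalIntegral.integral_mul_deriv_eq_deriv_mul (a := 0) (b := 1)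
    (fun v hv => (hk v (hu ▸ hv)).ofReal_comp) (fun v _ => hasDerivAt_ee_neg_mul_sq y v)
    ((Complex.continuous_ofReal.comp_continuousOn (hu ▸ hk')).intervalIntegrable)
    ((Continuous.mul continuous_const (Complex.continuous_ofReal.mul (continuous_ee_neg_mul_sq y))).intervalIntegrable _ _)
  have hc : (4 * π * Complex.I * y : ℂ) ≠ 0 := by
    have hpi : (π : ℂ) ≠ 0 := by exact_mod_cast Real.pi_ne_zero
    have : (y : ℂ) ≠ 0 := by exact_mod_cast hy.ne'
    simp [hpi, this]
  rw [eq_inv_mul_iff_mul_eq₀ hc, ← intervalIntegral.integral_const_mul, ← neg_inj,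
    ← intervalIntegral.integral_neg]
  simp only [hk0, Complex.ofReal_zero, zero_mul, sub_zero, one_pow, mul_one] at hibp
  rw [neg_sub, ← hibp]
  refine intervalIntegral.integral_congr fun v _ => ?_
  push_cast
  ring

/-- Up to normalisation, the Fourier transform of the unit disc. -/
noncomputable def discTransform (y : ℝ) : ℝ := ∫ s in (-1 : ℝ)..1, 2 * √(1 - s ^ 2) * cos (2 * π * (y * s))

section

noncomputable def besselWeight (v : ℝ) : ℝ := (2 - 2 * v ^ 2) / √(2 - v ^ 2)

noncomputable def besselCorrection (v : ℝ) : ℝ :=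
  √2 * v * ((1 / (2 * (1 + √(1 - v ^ 2 / 2))) - 1) / √(1 - v ^ 2 / 2))

theorem discTransform_eq {y : ℝ} (hy : 0 < y) :
    discTransform y = 2 / (π * y) * (ee y * ∫ v in (0 : ℝ)..1, (besselWeight v : ℂ) * ee (-(y * v ^ 2))).im := by
  have hcont : Continuous fun s : ℝ => 2 * √(1 - s ^ 2) * cos (2 * π * (y * s)) := by fun_prop
  have h1 : discTransform y = 2 * ∫ s in (0 : ℝ)..1, 2 * √(1 - s ^ 2) * cos (2 * π * (y * s)) := by
    rw [discTransform, ← intervalIntegral.integral_add_adjacent_intervals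
      (hcont.intervalIntegrable (-1) 0) (hcont.intervalIntegrable 0 1),
      two_mul (∫ s in (0 : ℝ)..1, 2 * √(1 - s ^ 2) * cos (2 * π * (y * s)))]
    congr 1
    have := intervalIntegral.integral_comp_neg (a := (0 : ℝ)) (b := 1) (fun s : ℝ => 2 * √(1 - s ^ 2) * cos (2 * π * (y * s)))
    rw [neg_zero] at this
    rw [← this]
    refine intervalIntegral.integral_congr fun s _ => ?_
    simp only [neg_sq, mul_neg, Real.cos_neg]
  have h2 : ∫ s in (0 : ℝ)..1, 2 * √(1 - s ^ 2) * cos (2 * π * (y * s))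
      = ∫ v in (0 : ℝ)..1, 4 * (v * (v * √(2 - v ^ 2))) * cos (2 * π * (y * (1 - v ^ 2))) := by
    have hsub := intervalIntegral.integral_comp_mul_deriv (a := 0) (b := 1)
      (f := fun v : ℝ => 1 - v ^ 2) (f' := fun v => -(2 * v))
      (g := fun s : ℝ => 2 * √(1 - s ^ 2) * cos (2 * π * (y * s)))
      (fun v _ => ((hasDerivAt_pow 2 v).const_sub 1).congr_deriv (by push_cast; ring))
      (by fun_prop) hcont
    norm_num at hsub
    rw [intervalIntegral.integral_symm, ← hsub, neg_neg]
    refine intervalIntegral.integral_congr fun v hv => ?_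
    rw [Set.uIcc_of_le zero_le_one] at hv
    have e : √(1 - (1 - v ^ 2) ^ 2) = v * √(2 - v ^ 2) := by
      rw [show 1 - (1 - v ^ 2) ^ 2 = v ^ 2 * (2 - v ^ 2) by ring, Real.sqrt_mul (sq_nonneg v), Real.sqrt_sq hv.1]
    simp only [e]
    ring
  have h3 : ∀ v ∈ Set.Icc (0 : ℝ) 1, HasDerivAt (fun v : ℝ => v * √(2 - v ^ 2)) (besselWeight v) v := by
    intro v hv
    have hpos : 0 < 2 - v ^ 2 := by nlinarith [hv.1, hv.2]
    have hd := ((hasDerivAt_pow 2 v).const_sub 2).sqrt hpos.ne'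
    refine ((hasDerivAt_id v).mul hd).congr_deriv ?_
    have hs : 0 < √(2 - v ^ 2) := Real.sqrt_pos.2 hpos
    have hsq : √(2 - v ^ 2) ^ 2 = 2 - v ^ 2 := Real.sq_sqrt hpos.le
    rw [besselWeight]
    simp only [id]
    push_cast
    field_simp
    rw [hsq]; ring
  have hbc : ContinuousOn besselWeight (Set.Icc 0 1) := by
    unfold besselWeight
    refine ContinuousOn.div (by fun_prop) (by fun_prop) fun v hv => ?_
    have hpos : 0 < 2 - v ^ 2 := by nlinarith [hv.1, hv.2]
    exact (Real.sqrt_pos.2 hpos).ne'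
  have h4 := integral_mul_ee_sq_by_parts hy h3 hbc (by simp)
  have h5 : ∫ v in (0 : ℝ)..1, 4 * (v * (v * √(2 - v ^ 2))) * cos (2 * π * (y * (1 - v ^ 2)))
      = 4 * (ee y * ∫ v in (0 : ℝ)..1, ((v * (v * √(2 - v ^ 2)) : ℝ) : ℂ) * ee (-(y * v ^ 2))).re := by
    rw [← intervalIntegral.integral_const_mul]
    have hci : IntervalIntegrable (fun v : ℝ => ee y * (((v * (v * √(2 - v ^ 2)) : ℝ) : ℂ) * ee (-(y * v ^ 2))))
        volume 0 1 := by
      refine Continuous.intervalIntegrable ?_ _ _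
      exact continuous_const.mul ((Complex.continuous_ofReal.comp (by fun_prop)).mul (continuous_ee_neg_mul_sq y))
    have := Complex.reCLM.intervalIntegral_comp_comm hci
    simp only [Complex.reCLM_apply] at this
    rw [← this, ← intervalIntegral.integral_const_mul]
    refine intervalIntegral.integral_congr fun v _ => ?_
    have e : ee y * (((v * (v * √(2 - v ^ 2)) : ℝ) : ℂ) * ee (-(y * v ^ 2)))
        = ((v * (v * √(2 - v ^ 2)) : ℝ) : ℂ) * ee (y * (1 - v ^ 2)) := by
      rw [show y * (1 - v ^ 2) = y + -(y * v ^ 2) by ring, ee_add]; ring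
    simp only [e, Complex.re_ofReal_mul, ee_re]
    ring
  rw [h1, h2, h5, h4]
  set I := ∫ v in (0 : ℝ)..1, (besselWeight v : ℂ) * ee (-(y * v ^ 2))
  have e : ee y * ((4 * π * Complex.I * y)⁻¹ * (I - ((1 * √(2 - 1 ^ 2) : ℝ) : ℂ) * ee (-y)))
      = ((4 * π * y : ℝ) : ℂ)⁻¹ * (-Complex.I * (ee y * I - 1)) := by
    have := ee_mul_ee_neg y
    have hI : (4 * π * Complex.I * y : ℂ)⁻¹ = ((4 * π * y : ℝ) : ℂ)⁻¹ * -Complex.I := by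
      rw [← Complex.inv_I, ← mul_inv]; push_cast; ring_nf
    rw [hI]
    norm_num
    linear_combination (-((π : ℂ)⁻¹ * (y : ℂ)⁻¹ * Complex.I * 4⁻¹)) * this
  rw [e, ← Complex.ofReal_inv, Complex.re_ofReal_mul]
  simp
  ring

theorem besselWeight_eq {v : ℝ} (hv : v ∈ Set.Icc (0 : ℝ) 1) :
    besselWeight v = √2 + v * besselCorrection v := by
  have hpos : 0 < 1 - v ^ 2 / 2 := by nlinarith [hv.1, hv.2]
  rw [besselWeight, besselCorrection, show 2 - v ^ 2 = 2 * (1 - v ^ 2 / 2) by ring,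
    Real.sqrt_mul (by norm_num)]
  have hs : 0 < √(1 - v ^ 2 / 2) := Real.sqrt_pos.2 hpos
  have hsq : √(1 - v ^ 2 / 2) ^ 2 = 1 - v ^ 2 / 2 := Real.sq_sqrt hpos.le
  have h2 : √2 ^ 2 = 2 := Real.sq_sqrt (by norm_num)
  have h20 : 0 < √2 := by positivity
  set σ := √(1 - v ^ 2 / 2)
  have hv2 : v ^ 2 = 2 - 2 * σ ^ 2 := by linarith
  have e1 : v * (√2 * v * ((1 / (2 * (1 + σ)) - 1) / σ)) = √2 * v ^ 2 * ((1 / (2 * (1 + σ)) - 1) / σ) := by ring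
  rw [e1, hv2]
  field_simp
  rw [h2]
  ring

theorem contDiffOn_besselCorrection : ContDiffOn ℝ 2 besselCorrection (Set.Ioo (-(5 / 4)) (5 / 4)) := by
  have hpos : ∀ v ∈ Set.Ioo (-(5 / 4) : ℝ) (5 / 4), 0 < 1 - v ^ 2 / 2 := fun v hv => by
    nlinarith [hv.1, hv.2]
  have hσ : ContDiffOn ℝ 2 (fun v : ℝ => √(1 - v ^ 2 / 2)) (Set.Ioo (-(5 / 4)) (5 / 4)) :=
    ContDiffOn.sqrt (by fun_prop) fun v hv => (hpos v hv).ne'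
  unfold besselCorrection
  refine ContDiffOn.mul (by fun_prop) (ContDiffOn.div (ContDiffOn.sub (ContDiffOn.div contDiffOn_const
    (contDiffOn_const.mul (contDiffOn_const.add hσ)) ?_) contDiffOn_const) hσ ?_)
  · intro v _; positivity
  · intro v hv; exact (Real.sqrt_pos.2 (hpos v hv)).ne'

theorem discTransform_asymptotic : ∃ C, 0 < C ∧ ∀ y, 0 < y →
    |discTransform y - 2 * √2 / (π * y * √y) * (ee y * fresnelConst).im| ≤ C / (y ^ 2 * √y) := by
  have hU : IsOpen (Set.Ioo (-(5 / 4) : ℝ) (5 / 4)) := isOpen_Ioo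
  have hsub : Set.Icc (0 : ℝ) 1 ⊆ Set.Ioo (-(5 / 4) : ℝ) (5 / 4) := fun v hv =>
    ⟨by linarith [hv.1], by linarith [hv.2]⟩
  have hk2 := contDiffOn_besselCorrection
  have hk1 : ContDiffOn ℝ 1 (deriv besselCorrection) (Set.Ioo (-(5 / 4)) (5 / 4)) :=
    hk2.deriv_of_isOpen hU (by norm_num)
  have hk0 : ContDiffOn ℝ 0 (deriv (deriv besselCorrection)) (Set.Ioo (-(5 / 4)) (5 / 4)) :=
    hk1.deriv_of_isOpen hU (by norm_num)
  obtain ⟨G1, hG1⟩ := isCompact_Icc.exists_bound_of_continuousOn (hk1.continuousOn.mono hsub)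
  obtain ⟨G2, hG2⟩ := isCompact_Icc.exists_bound_of_continuousOn (hk0.continuousOn.mono hsub)
  have hdk : ∀ v ∈ Set.Icc (0 : ℝ) 1, HasDerivAt besselCorrection (deriv besselCorrection v) v := fun v hv =>
    ((hk2.differentiableOn (by norm_num)).differentiableAt (hU.mem_nhds (hsub hv))).hasDerivAt
  have hdk' : ∀ v ∈ Set.Icc (0 : ℝ) 1, HasDerivAt (deriv besselCorrection) (deriv (deriv besselCorrection) v) v :=
    fun v hv => ((hk1.differentiableOn (by norm_num)).differentiableAt (hU.mem_nhds (hsub hv))).hasDerivAt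
  set G := max G1 G2 with hG
  have hG0 : 0 ≤ G := (norm_nonneg _).trans ((hG1 0 (by simp)).trans (le_max_left _ _))
  refine ⟨100 + 10 * G, by positivity, fun y hy => ?_⟩
  have hs : 0 < √y := Real.sqrt_pos.2 hy
  have hsq : √y ^ 2 = y := Real.sq_sqrt hy.le
  have h2 : √2 ≤ 2 := Real.sqrt_le_iff.2 (by norm_num)
  have h20 : 0 < √2 := by positivity
  have hpi := Real.pi_gt_three
  by_cases hy1 : y ≤ 1
  · have hj : |discTransform y| ≤ 4 := by
      have := intervalIntegral.norm_integral_le_of_norm_le_const (a := -1) (b := 1) (C := 2)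
        (f := fun s : ℝ => 2 * √(1 - s ^ 2) * cos (2 * π * (y * s))) (fun s _ => by
          rw [Real.norm_eq_abs, abs_mul, abs_mul, abs_of_nonneg (Real.sqrt_nonneg _), abs_two]
          have e1 : √(1 - s ^ 2) ≤ 1 := Real.sqrt_le_one.2 (by nlinarith [sq_nonneg s])
          have e2 := Real.abs_cos_le_one (2 * π * (y * s))
          nlinarith [Real.sqrt_nonneg (1 - s ^ 2), abs_nonneg (cos (2 * π * (y * s)))])
      rw [Real.norm_eq_abs] at this
      rw [discTransform]
      norm_num at this
      linarith
    have him : |(ee y * fresnelConst).im| ≤ 1 / 2 := by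
      refine (Complex.abs_im_le_norm _).trans ?_
      rw [norm_mul, norm_ee, one_mul]
      exact norm_fresnelConst_le
    have hs1 : √y ≤ 1 := Real.sqrt_le_one.2 hy1
    rw [le_div_iff₀ (by positivity)]
    calc _ ≤ (4 + 2 * √2 / (π * y * √y) * (1 / 2)) * (y ^ 2 * √y) := by
          gcongr
          refine (abs_sub _ _).trans (add_le_add hj ?_)
          rw [abs_mul, abs_of_nonneg (by positivity)]
          gcongr
      _ = 4 * (y ^ 2 * √y) + √2 / π * y := by field_simp
      _ ≤ 4 * (1 ^ 2 * 1) + 2 / 1 * 1 := by gcongr; linarith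
      _ ≤ _ := by linarith
  · rw [not_le] at hy1
    set I := ∫ v in (0 : ℝ)..1, (besselWeight v : ℂ) * ee (-(y * v ^ 2)) with hI
    have hsplit : I = √2 * (∫ v in (0 : ℝ)..1, ee (-(y * v ^ 2)))
        + ∫ v in (0 : ℝ)..1, ((v * besselCorrection v : ℝ) : ℂ) * ee (-(y * v ^ 2)) := by
      rw [← intervalIntegral.integral_const_mul, ← intervalIntegral.integral_add]
      · refine intervalIntegral.integral_congr fun v hv => ?_
        rw [Set.uIcc_of_le zero_le_one] at hv
        simp only [besselWeight_eq hv]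
        push_cast; ring
      · exact (continuous_const.mul (continuous_ee_neg_mul_sq y)).intervalIntegrable _ _
      · refine ContinuousOn.intervalIntegrable ?_
        rw [Set.uIcc_of_le zero_le_one]
        refine ContinuousOn.mul (Complex.continuous_ofReal.comp_continuousOn ?_) (continuous_ee_neg_mul_sq y).continuousOn
        exact continuousOn_id.mul (hk2.continuousOn.mono hsub)
    rw [integral_mul_ee_sq_by_parts hy hdk (hk1.continuousOn.mono hsub) (by simp [besselCorrection])] at hsplit
    have hb1 : besselCorrection 1 = -√2 := by
      have := besselWeight_eq (v := 1) (by simp)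
      simp only [besselWeight] at this
      norm_num at this
      linarith
    have hosc := norm_integral_mul_ee_sq_le hy hdk' (hk0.continuousOn.mono hsub)
      (fun v hv => (hG1 v hv).trans (le_max_left _ _)) (fun v hv => (hG2 v hv).trans (le_max_right G1 G2))
    have hfr := fresnel_scaled (b := 1) hy one_pos
    simp only [one_pow, mul_one] at hfr
    set K := ∫ v in (0 : ℝ)..1, ((deriv besselCorrection v : ℝ) : ℂ) * ee (-(y * v ^ 2))
    set F := ∫ v in (0 : ℝ)..1, ee (-(y * v ^ 2))
    have hmain : ‖I - √2 * fresnelConst / √y‖ ≤ √2 * (1 / y ^ 2) + 1 / (12 * y) * (4 * G / √y) := by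
      have e : I - √2 * fresnelConst / √y
          = √2 * (F - (fresnelConst / √y - ee (-y) / (4 * π * Complex.I * (y * (1 : ℝ))))) + (4 * π * Complex.I * y)⁻¹ * K := by
        rw [hsplit, hb1]; push_cast; ring
      rw [e]
      refine (norm_add_le _ _).trans (add_le_add ?_ ?_)
      · rw [norm_mul, Complex.norm_real, Real.norm_of_nonneg (by positivity)]
        gcongr
      · rw [norm_mul, norm_inv]
        simp only [norm_mul, Complex.norm_I, Complex.norm_real, Complex.norm_ofNat,
          Real.norm_of_nonneg hy.le, Real.norm_of_nonneg Real.pi_pos.le]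
        rw [mul_one, ← one_div]
        gcongr
        linarith
    have e : discTransform y - 2 * √2 / (π * y * √y) * (ee y * fresnelConst).im
        = 2 / (π * y) * (ee y * (I - √2 * fresnelConst / √y)).im := by
      rw [discTransform_eq hy, ← hI, mul_sub, Complex.sub_im,
        show ee y * (√2 * fresnelConst / √y) = ((√2 / √y : ℝ) : ℂ) * (ee y * fresnelConst) by push_cast; ring,
        Complex.im_ofReal_mul]
      field_simp
    have hs1 : 1 ≤ √y := Real.one_le_sqrt.2 hy1.le
    rw [e, abs_mul, abs_of_nonneg (by positivity), le_div_iff₀ (by positivity)]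
    calc _ ≤ 2 / (3 * y) * (√2 * (1 / y ^ 2) + 1 / (12 * y) * (4 * G / √y)) * (y ^ 2 * √y) := by
          gcongr
          refine (Complex.abs_im_le_norm _).trans ?_
          rw [norm_mul, norm_ee, one_mul]
          exact hmain
      _ = 2 / 3 * √2 * (√y / y) + 2 / 9 * G := by field_simp; ring
      _ ≤ 2 / 3 * 2 * 1 + 2 / 9 * G := by
          gcongr
          rw [div_le_one hy]
          nlinarith
      _ ≤ _ := by linarith

end

theorem integral_one_div_sq {a b : ℝ} (ha : 0 < a) (hab : a ≤ b) :
    ∫ x in a..b, 1 / x ^ 2 = 1 / a - 1 / b := by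
  have hne : ∀ x ∈ Set.uIcc a b, x ≠ 0 := fun x hx => by
    rw [Set.uIcc_of_le hab] at hx; exact (ha.trans_le hx.1).ne'
  rw [intervalIntegral.integral_eq_sub_of_hasDerivAt (f := fun x => -x⁻¹)]
  · ring
  · intro x hx
    exact (hasDerivAt_inv (hne x hx)).neg.congr_deriv (by ring)
  · refine ContinuousOn.intervalIntegrable (ContinuousOn.div (by fun_prop) (by fun_prop) ?_)
    intro x hx
    have := hne x hx
    positivity

/-- Non-stationary part of an oscillatory integral. -/
theorem norm_integral_mul_ee_le {f f' f'' g g' : ℝ → ℝ} {a b m M G Λ : ℝ} (ha : 0 < a) (hab : a ≤ b) (hm : 0 < m)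
    (hm1 : m ≤ 1) (hM : 1 ≤ M) (hG : 0 ≤ G)
    (hf : ∀ x ∈ Set.Icc a b, HasDerivAt f (f' x) x) (hf' : ∀ x ∈ Set.Icc a b, HasDerivAt f' (f'' x) x)
    (hf'' : ContinuousOn f'' (Set.Icc a b)) (hlow : ∀ x ∈ Set.Icc a b, m * x ≤ f' x)
    (hup : ∀ x ∈ Set.Icc a b, |f'' x| ≤ M)
    (hg : ∀ x ∈ Set.Icc a b, HasDerivAt g (g' x) x) (hg' : ContinuousOn g' (Set.Icc a b))
    (hgG : ∀ x ∈ Set.Icc a b, |g x| ≤ G) (hgG' : ∀ x ∈ Set.Icc a b, |g' x| ≤ G) (hΛ : 0 < Λ) :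
    ‖∫ x in a..b, (g x : ℂ) * ee (-(Λ * f x))‖ ≤ (3 + b) * G * M / m ^ 2 / (Λ * a) := by
  have hu : Set.uIcc a b = Set.Icc a b := Set.uIcc_of_le hab
  have hx0 : ∀ x ∈ Set.Icc a b, 0 < x := fun x hx => ha.trans_le hx.1
  have hpos : ∀ x ∈ Set.Icc a b, 0 < f' x := fun x hx => (mul_pos hm (hx0 x hx)).trans_le (hlow x hx)
  have hfc : ContinuousOn f (Set.Icc a b) := fun x hx => (hf x hx).continuousAt.continuousWithinAt
  have hf'c : ContinuousOn f' (Set.Icc a b) := fun x hx => (hf' x hx).continuousAt.continuousWithinAt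
  have hgc : ContinuousOn g (Set.Icc a b) := fun x hx => (hg x hx).continuousAt.continuousWithinAt
  set q' : ℝ → ℝ := fun x => (g' x * f' x - g x * f'' x) / f' x ^ 2 with hq'
  have hq : ∀ x ∈ Set.Icc a b, HasDerivAt (fun x => g x / f' x) (q' x) x := fun x hx =>
    (hg x hx).div (hf' x hx) (hpos x hx).ne'
  have hq'c : ContinuousOn q' (Set.Icc a b) :=
    ((hg'.mul hf'c).sub (hgc.mul hf'')).div (hf'c.pow 2) fun x hx => (pow_pos (hpos x hx) 2).ne'
  have he : ∀ x ∈ Set.Icc a b, HasDerivAt (fun x => ee (-(Λ * f x)))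
      (-(2 * π * Complex.I * Λ) * (f' x * ee (-(Λ * f x)))) x := fun x hx =>
    (hasDerivAt_ee_comp (f := fun x => -(Λ * f x)) (f' := -(Λ * f' x)) (((hf x hx).const_mul Λ).neg)).congr_deriv
      (by push_cast; ring)
  have hec : ContinuousOn (fun x => ee (-(Λ * f x))) (Set.Icc a b) :=
    fun x hx => (he x hx).continuousAt.continuousWithinAt
  have hibp := intervalIntegral.integral_mul_deriv_eq_deriv_mul (a := a) (b := b)
    (fun v hv => (hq v (hu ▸ hv)).ofReal_comp) (fun v hv => he v (hu ▸ hv))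
    ((Complex.continuous_ofReal.comp_continuousOn (hu ▸ hq'c)).intervalIntegrable)
    (ContinuousOn.intervalIntegrable (hu ▸ (continuousOn_const.mul
      ((Complex.continuous_ofReal.comp_continuousOn hf'c).mul hec))))
  have hpi : (π : ℂ) ≠ 0 := by exact_mod_cast Real.pi_ne_zero
  have hΛ' : (Λ : ℂ) ≠ 0 := by exact_mod_cast hΛ.ne'
  have e1 : ∫ x in a..b, ((g x / f' x : ℝ) : ℂ) * (-(2 * π * Complex.I * Λ) * (f' x * ee (-(Λ * f x))))
      = -(2 * π * Complex.I * Λ) * ∫ x in a..b, (g x : ℂ) * ee (-(Λ * f x)) := by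
    rw [← intervalIntegral.integral_const_mul]
    refine intervalIntegral.integral_congr fun x hx => ?_
    have : (f' x : ℂ) ≠ 0 := by exact_mod_cast (hpos x (hu ▸ hx)).ne'
    push_cast
    field_simp
  rw [e1] at hibp
  have hn : ‖-(2 * π * Complex.I * Λ : ℂ)‖ = 2 * π * Λ := by
    rw [norm_neg]
    simp only [norm_mul, Complex.norm_I, Complex.norm_real, Complex.norm_ofNat,
      Real.norm_of_nonneg hΛ.le, Real.norm_of_nonneg Real.pi_pos.le, mul_one]
  have hqb : ∀ x ∈ Set.Icc a b, ‖((g x / f' x : ℝ) : ℂ) * ee (-(Λ * f x))‖ ≤ G / (m * a) := fun x hx => by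
    rw [norm_mul, norm_ee, mul_one, Complex.norm_real, norm_div, Real.norm_eq_abs, Real.norm_of_nonneg (hpos x hx).le]
    refine div_le_div₀ hG (hgG x hx) (by positivity) (le_trans ?_ (hlow x hx))
    exact mul_le_mul_of_nonneg_left hx.1 hm.le
  have hInt : ‖∫ x in a..b, (q' x : ℂ) * ee (-(Λ * f x))‖ ≤ ∫ x in a..b, (G / (m * a) + G * M / m ^ 2 * (1 / x ^ 2)) := by
    refine intervalIntegral.norm_integral_le_of_norm_le hab ?_ ?_
    · refine Filter.Eventually.of_forall fun x hx => ?_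
      replace hx : x ∈ Set.Icc a b := ⟨hx.1.le, hx.2⟩
      have h0 := hx0 x hx
      have hp := hpos x hx
      rw [norm_mul, norm_ee, mul_one, Complex.norm_real, Real.norm_eq_abs]
      have : q' x = g' x / f' x - g x * f'' x / f' x ^ 2 := by
        simp only [hq']; field_simp
      rw [this]
      refine (abs_sub _ _).trans (add_le_add ?_ ?_)
      · rw [abs_div, abs_of_pos hp]
        refine div_le_div₀ hG (hgG' x hx) (by positivity) (le_trans ?_ (hlow x hx))
        exact mul_le_mul_of_nonneg_left hx.1 hm.le
      · rw [abs_div, abs_mul, abs_of_pos (pow_pos hp 2), div_mul_div_comm, mul_one, ← mul_pow]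
        have hl := hlow x hx
        have h3 := hup x hx
        have h4 := hgG x hx
        gcongr
    · refine ContinuousOn.intervalIntegrable (continuousOn_const.add (continuousOn_const.mul
        (ContinuousOn.div (by fun_prop) (by fun_prop) ?_)))
      intro x hx
      exact (pow_pos (hx0 x (hu ▸ hx)) 2).ne'
  have hint2 : ∫ x in a..b, (G / (m * a) + G * M / m ^ 2 * (1 / x ^ 2)) ≤ (b + 1) * (G * M / m ^ 2 / a) := by
    rw [intervalIntegral.integral_add (by simp), intervalIntegral.integral_const_mul, integral_one_div_sq ha hab,
      intervalIntegral.integral_const, smul_eq_mul]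
    · have hb : 0 < b := ha.trans_le hab
      have h1 : G / (m * a) ≤ G * M / m ^ 2 / a := by
        rw [← div_div]
        gcongr ?_ / a
        rw [div_le_div_iff₀ hm (by positivity)]
        have : m ^ 2 ≤ M * m := by nlinarith
        nlinarith
      have h2 : G * M / m ^ 2 * (1 / a - 1 / b) ≤ G * M / m ^ 2 / a := by
        have : 0 < 1 / b := by positivity
        rw [div_eq_mul_one_div (G * M / m ^ 2) a]
        exact mul_le_mul_of_nonneg_left (by linarith) (by positivity)
      have h3 : (b - a) * (G / (m * a)) ≤ b * (G * M / m ^ 2 / a) := by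
        gcongr; linarith
      linarith
    · refine ContinuousOn.intervalIntegrable (continuousOn_const.mul
        (ContinuousOn.div (by fun_prop) (by fun_prop) ?_))
      intro x hx
      exact (pow_pos (hx0 x (hu ▸ hx)) 2).ne'
  have hfin : 2 * π * Λ * ‖∫ x in a..b, (g x : ℂ) * ee (-(Λ * f x))‖ ≤ (3 + b) * (G * M / m ^ 2 / a) := by
    rw [← hn, ← norm_mul, hibp]
    have h1 : G / (m * a) ≤ G * M / m ^ 2 / a := by
        rw [← div_div]
        gcongr ?_ / a
        rw [div_le_div_iff₀ hm (by positivity)]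
        have : m ^ 2 ≤ M * m := by nlinarith
        nlinarith
    have := hqb b ⟨hab, le_rfl⟩
    have := hqb a ⟨le_rfl, hab⟩
    refine (norm_sub_le _ _).trans ?_
    have := norm_sub_le (((g b / f' b : ℝ) : ℂ) * ee (-(Λ * f b))) (((g a / f' a : ℝ) : ℂ) * ee (-(Λ * f a)))
    linarith
  have e2 : (3 + b) * G * M / m ^ 2 / (Λ * a) = (3 + b) * (G * M / m ^ 2 / a) / Λ := by
    field_simp
  rw [e2, le_div_iff₀ hΛ]
  have := mul_nonneg hΛ.le (norm_nonneg (∫ x in a..b, (g x : ℂ) * ee (-(Λ * f x))))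
  nlinarith [Real.pi_gt_three]

/-- One-sided stationary phase at an end point. -/
theorem stationary_phase_endpoint {f f' f'' g g' : ℝ → ℝ} {b κ m M G Λ δ : ℝ} (hm : 0 < m)
    (hm1 : m ≤ 1) (hM : 1 ≤ M) (hG : 0 ≤ G) (hκ : m ≤ κ)
    (hf : ∀ x ∈ Set.Icc 0 b, HasDerivAt f (f' x) x) (hf' : ∀ x ∈ Set.Icc 0 b, HasDerivAt f' (f'' x) x)
    (hf'' : ContinuousOn f'' (Set.Icc 0 b)) (hlow : ∀ x ∈ Set.Icc 0 b, m * x ≤ f' x)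
    (hup : ∀ x ∈ Set.Icc 0 b, |f'' x| ≤ M) (htay : ∀ x ∈ Set.Icc 0 b, |f x - κ / 2 * x ^ 2| ≤ M * x ^ 3)
    (hg : ∀ x ∈ Set.Icc 0 b, HasDerivAt g (g' x) x) (hg' : ContinuousOn g' (Set.Icc 0 b))
    (hgG : ∀ x ∈ Set.Icc 0 b, |g x| ≤ G) (hgG' : ∀ x ∈ Set.Icc 0 b, |g' x| ≤ G) (hΛ : 0 < Λ)
    (hδ : 0 < δ) (hδb : δ ≤ b) :
    ‖(∫ x in (0 : ℝ)..b, (g x : ℂ) * ee (-(Λ * f x))) - g 0 * (fresnelConst / √(Λ * κ / 2))‖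
      ≤ (8 + b) * G * M / m ^ 2 * (δ ^ 2 + Λ * δ ^ 4 + 1 / (Λ * δ) + 1 / (Λ ^ 2 * δ ^ 3)) := by
  have hb : 0 < b := hδ.trans_le hδb
  have hfc : ContinuousOn f (Set.Icc 0 b) := fun x hx => (hf x hx).continuousAt.continuousWithinAt
  have hgc : ContinuousOn g (Set.Icc 0 b) := fun x hx => (hg x hx).continuousAt.continuousWithinAt
  have hic : ContinuousOn (fun x => (g x : ℂ) * ee (-(Λ * f x))) (Set.Icc 0 b) :=
    (Complex.continuous_ofReal.comp_continuousOn hgc).mul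
      (continuous_ee.comp_continuousOn (continuousOn_const.mul hfc).neg)
  have hsub1 : Set.Icc 0 δ ⊆ Set.Icc 0 b := Set.Icc_subset_Icc_right hδb
  have hsub2 : Set.Icc δ b ⊆ Set.Icc 0 b := Set.Icc_subset_Icc_left hδ.le
  have hi1 : IntervalIntegrable (fun x => (g x : ℂ) * ee (-(Λ * f x))) volume 0 δ :=
    ContinuousOn.intervalIntegrable ((Set.uIcc_of_le hδ.le).symm ▸ hic.mono hsub1)
  have hi2 : IntervalIntegrable (fun x => (g x : ℂ) * ee (-(Λ * f x))) volume δ b :=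
    ContinuousOn.intervalIntegrable ((Set.uIcc_of_le hδb).symm ▸ hic.mono hsub2)
  have hfar := norm_integral_mul_ee_le hδ hδb hm hm1 hM hG (fun x hx => hf x (hsub2 hx)) (fun x hx => hf' x (hsub2 hx))
    (hf''.mono hsub2) (fun x hx => hlow x (hsub2 hx)) (fun x hx => hup x (hsub2 hx)) (fun x hx => hg x (hsub2 hx))
    (hg'.mono hsub2) (fun x hx => hgG x (hsub2 hx)) (fun x hx => hgG' x (hsub2 hx)) hΛ
  have hκ0 : 0 < κ := hm.trans_le hκ
  set y := Λ * κ / 2 with hy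
  have hy0 : 0 < y := by positivity
  have hmain := fresnel_scaled hy0 hδ
  set Fr := ∫ v in (0 : ℝ)..δ, ee (-(y * v ^ 2)) with hFr
  have hyi : IntervalIntegrable (fun v => (g 0 : ℂ) * ee (-(y * v ^ 2))) volume 0 δ :=
    ((continuous_ee_neg_mul_sq y).intervalIntegrable _ _).const_mul _
  have hlip : ∀ x ∈ Set.Icc 0 b, |g x - g 0| ≤ G * x := fun x hx => by
    have := (convex_Icc 0 b).norm_image_sub_le_of_norm_hasDerivWithin_le (f := g) (C := G)
      (fun x hx => (hg x hx).hasDerivWithinAt) hgG' (x := 0) (y := x) ⟨le_rfl, hb.le⟩ hx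
    rw [Real.norm_eq_abs, Real.norm_eq_abs, sub_zero, abs_of_nonneg hx.1] at this
    exact this
  have hnear : ‖(∫ x in (0 : ℝ)..δ, (g x : ℂ) * ee (-(Λ * f x))) - g 0 * Fr‖
      ≤ (G * δ + G * (7 * (Λ * (M * δ ^ 3)))) * δ := by
    rw [hFr, ← intervalIntegral.integral_const_mul, ← intervalIntegral.integral_sub hi1 hyi]
    have := intervalIntegral.norm_integral_le_of_norm_le_const (a := 0) (b := δ)
      (C := G * δ + G * (7 * (Λ * (M * δ ^ 3))))
      (f := fun x => (g x : ℂ) * ee (-(Λ * f x)) - g 0 * ee (-(y * x ^ 2))) (fun x hx => ?_)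
    · rwa [sub_zero, abs_of_pos hδ] at this
    rw [Set.uIoc_of_le hδ.le] at hx
    have hxb : x ∈ Set.Icc 0 b := ⟨hx.1.le, hx.2.trans hδb⟩
    have e : (g x : ℂ) * ee (-(Λ * f x)) - g 0 * ee (-(y * x ^ 2))
        = ((g x - g 0 : ℝ) : ℂ) * ee (-(Λ * f x)) + g 0 * (ee (-(Λ * f x)) - ee (-(y * x ^ 2))) := by
      push_cast; ring
    rw [e]
    refine (norm_add_le _ _).trans (add_le_add ?_ ?_)
    · rw [norm_mul, norm_ee, mul_one, Complex.norm_real, Real.norm_eq_abs]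
      exact (hlip x hxb).trans (mul_le_mul_of_nonneg_left hx.2 hG)
    · rw [norm_mul, Complex.norm_real, Real.norm_eq_abs]
      refine mul_le_mul (hgG 0 ⟨le_rfl, hb.le⟩) ((norm_ee_sub_ee_le _ _).trans ?_) (norm_nonneg _) hG
      have e3 : -(Λ * f x) - -(y * x ^ 2) = -(Λ * (f x - κ / 2 * x ^ 2)) := by rw [hy]; ring
      rw [e3, abs_neg, abs_mul, abs_of_pos hΛ]
      have hpi : 2 * π ≤ 7 := by linarith [Real.pi_lt_d2]
      have ht := htay x hxb
      have hx3 : x ^ 3 ≤ δ ^ 3 := by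
        have := hx.1.le
        gcongr
        exact hx.2
      have : |f x - κ / 2 * x ^ 2| ≤ M * δ ^ 3 := ht.trans (by gcongr)
      gcongr
  rw [← intervalIntegral.integral_add_adjacent_intervals hi1 hi2]
  have hsplit : (∫ x in (0 : ℝ)..δ, (g x : ℂ) * ee (-(Λ * f x))) + (∫ x in δ..b, (g x : ℂ) * ee (-(Λ * f x)))
      - g 0 * (fresnelConst / √y)
      = ((∫ x in (0 : ℝ)..δ, (g x : ℂ) * ee (-(Λ * f x))) - g 0 * Fr)
        + (∫ x in δ..b, (g x : ℂ) * ee (-(Λ * f x)))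
        + g 0 * (Fr - (fresnelConst / √y - ee (-(y * δ ^ 2)) / (4 * π * Complex.I * (y * δ))))
        - g 0 * (ee (-(y * δ ^ 2)) / (4 * π * Complex.I * (y * δ))) := by ring
  rw [hsplit]
  have hg0 : ‖(g 0 : ℂ)‖ ≤ G := by
    rw [Complex.norm_real]; exact hgG 0 ⟨le_rfl, hb.le⟩
  have h3 : ‖g 0 * (Fr - (fresnelConst / √y - ee (-(y * δ ^ 2)) / (4 * π * Complex.I * (y * δ))))‖
      ≤ G * (1 / (y ^ 2 * δ ^ 3)) := by
    rw [norm_mul]; exact mul_le_mul hg0 hmain (norm_nonneg _) hG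
  have h4 : ‖g 0 * (ee (-(y * δ ^ 2)) / (4 * π * Complex.I * (y * δ)))‖ ≤ G * (1 / (12 * (y * δ))) := by
    rw [norm_mul]
    refine mul_le_mul hg0 ?_ (norm_nonneg _) hG
    rw [norm_div, norm_ee]
    simp only [norm_mul, Complex.norm_I, Complex.norm_real, Complex.norm_ofNat,
      Real.norm_of_nonneg hy0.le, Real.norm_of_nonneg hδ.le, Real.norm_of_nonneg Real.pi_pos.le, mul_one]
    gcongr
    linarith [Real.pi_gt_three]
  refine (norm_sub_le _ _).trans ((add_le_add ((norm_add_le _ _).trans (add_le_add ((norm_add_le _ _).trans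
    (add_le_add hnear hfar)) h3)) h4).trans ?_)
  have hGM : G ≤ G * M / m ^ 2 := by
    rw [le_div_iff₀ (by positivity)]
    have : m ^ 2 ≤ 1 := pow_le_one₀ hm.le hm1
    nlinarith
  have hyΛ : Λ * m / 2 ≤ y := by rw [hy]; gcongr
  have i1 : G * (1 / (y ^ 2 * δ ^ 3)) ≤ 4 * (G * M / m ^ 2) * (1 / (Λ ^ 2 * δ ^ 3)) := by
    calc G * (1 / (y ^ 2 * δ ^ 3)) ≤ G * (1 / ((Λ * m / 2) ^ 2 * δ ^ 3)) := by gcongr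
      _ = 4 * (G * 1 / m ^ 2) * (1 / (Λ ^ 2 * δ ^ 3)) := by field_simp; norm_num
      _ ≤ _ := by gcongr
  have i2 : G * (1 / (12 * (y * δ))) ≤ (G * M / m ^ 2) * (1 / (Λ * δ)) := by
    calc G * (1 / (12 * (y * δ))) ≤ G * (1 / (2 * ((Λ * m / 2) * δ))) := by gcongr; norm_num
      _ = (G * 1 / m ^ 1) * (1 / (Λ * δ)) := by field_simp
      _ ≤ _ := by
        gcongr ?_ * _
        have : m ^ 2 ≤ m ^ 1 := pow_le_pow_of_le_one hm.le hm1 (by norm_num)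
        gcongr G * ?_ / ?_
  have i3 : (G * δ + G * (7 * (Λ * (M * δ ^ 3)))) * δ ≤ 7 * (G * M / m ^ 2) * (δ ^ 2 + Λ * δ ^ 4) := by
    have i5 : G * M ≤ G * M / m ^ 2 := by
      rw [le_div_iff₀ (by positivity)]
      have : m ^ 2 ≤ 1 := pow_le_one₀ hm.le hm1
      have : 0 ≤ G * M := by positivity
      nlinarith
    calc (G * δ + G * (7 * (Λ * (M * δ ^ 3)))) * δ = G * δ ^ 2 + 7 * (G * M) * (Λ * δ ^ 4) := by ring
      _ ≤ 7 * (G * M / m ^ 2) * δ ^ 2 + 7 * (G * M / m ^ 2) * (Λ * δ ^ 4) := by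
        gcongr
        have : 0 ≤ G * M / m ^ 2 := by positivity
        linarith
      _ = _ := by ring
  have i4 : (3 + b) * G * M / m ^ 2 / (Λ * δ) = (3 + b) * (G * M / m ^ 2) * (1 / (Λ * δ)) := by
    field_simp
  have i6 : (8 + b) * G * M / m ^ 2 = (8 + b) * (G * M / m ^ 2) := by ring
  rw [i4, i6]
  set Q := G * M / m ^ 2
  have hQ : 0 ≤ Q := by positivity
  have j1 : 0 ≤ 1 / (Λ * δ) := by positivity
  have j2 : 0 ≤ 1 / (Λ ^ 2 * δ ^ 3) := by positivity
  have j3 : 0 ≤ δ ^ 2 + Λ * δ ^ 4 := by positivity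
  nlinarith [mul_nonneg hQ j1, mul_nonneg hQ j2, mul_nonneg hQ j3, mul_nonneg hb.le (mul_nonneg hQ j1),
    mul_nonneg hb.le (mul_nonneg hQ j2), mul_nonneg hb.le (mul_nonneg hQ j3)]

section PoissonSummation

/-- The character `x ↦ e(-n·x)` integrated against `G`. -/
noncomputable def fourierAt (G : (Fin 3 → ℝ) → ℂ) (n : Fin 3 → ℤ) : ℂ := ∫ x : Fin 3 → ℝ, ee (-(∑ i, (n i : ℝ) * x i)) * G x

noncomputable def intVec (m : Fin 3 → ℤ) : Fin 3 → ℝ := fun i => (m i : ℝ)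

theorem intVec_add (m n : Fin 3 → ℤ) : intVec (m + n) = intVec m + intVec n := by
  ext i; simp [intVec]

theorem ee_intCast (n : ℤ) : ee n = 1 := by
  rw [ee, Complex.exp_eq_one_iff]
  exact ⟨n, by push_cast; ring⟩

theorem mFourier_neg_coe (n : Fin 3 → ℤ) (x : Fin 3 → ℝ) :
    UnitAddTorus.mFourier (-n) (fun i => (x i : UnitAddCircle)) = ee (-(∑ i, n i * x i)) := by
  simp only [UnitAddTorus.mFourier, ContinuousMap.coe_mk, fourier_coe_apply, Pi.neg_apply, ee,
    ← Complex.exp_sum]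
  congr 1
  push_cast
  rw [← Finset.sum_neg_distrib, Finset.mul_sum, Finset.sum_mul]
  exact Finset.sum_congr rfl fun i _ => by ring

/-- Lattice vectors relevant on a ball. -/
theorem exists_finset_translates {G : (Fin 3 → ℝ) → ℂ} {R : ℝ} (hR : ∀ x, G x ≠ 0 → ‖x‖ ≤ R) (R' : ℝ) :
    ∃ F : Finset (Fin 3 → ℤ), ∀ x : Fin 3 → ℝ, ‖x‖ ≤ R' → ∀ m ∉ F, G (x + intVec m) = 0 := by
  refine ⟨Finset.Icc (fun _ => -⌈R + R'⌉) (fun _ => ⌈R + R'⌉), fun x hx m hm => ?_⟩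
  by_contra h
  refine hm ?_
  have h1 : ‖intVec m‖ ≤ R + R' := by
    have := norm_sub_le (x + intVec m) x
    rw [add_sub_cancel_left] at this
    linarith [hR _ h]
  have h2 : ∀ i, |m i| ≤ ⌈R + R'⌉ := fun i => by
    have h3 : |(m i : ℝ)| ≤ R + R' := (norm_le_pi_norm (intVec m) i).trans h1
    have h4 : ((|m i| : ℤ) : ℝ) ≤ (⌈R + R'⌉ : ℤ) := by
      push_cast; exact h3.trans (Int.le_ceil _)
    exact_mod_cast h4
  rw [Finset.mem_Icc]
  exact ⟨fun i => (abs_le.1 (h2 i)).1, fun i => (abs_le.1 (h2 i)).2⟩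

noncomputable def periodization (G : (Fin 3 → ℝ) → ℂ) (x : Fin 3 → ℝ) : ℂ := ∑' m : Fin 3 → ℤ, G (x + intVec m)

theorem periodization_add_intVec (G : (Fin 3 → ℝ) → ℂ) (x : Fin 3 → ℝ) (n : Fin 3 → ℤ) :
    periodization G (x + intVec n) = periodization G x := by
  rw [periodization, periodization, ← (Equiv.addLeft n).tsum_eq (fun m => G (x + intVec m))]
  simp [intVec_add, add_assoc]

theorem continuous_periodization {G : (Fin 3 → ℝ) → ℂ} (hG : Continuous G) {R : ℝ} (hR : ∀ x, G x ≠ 0 → ‖x‖ ≤ R) :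
    Continuous (periodization G) := by
  rw [continuous_iff_continuousAt]
  intro x
  obtain ⟨F, hF⟩ := exists_finset_translates hR (‖x‖ + 1)
  have hc : ContinuousAt (fun y => ∑ m ∈ F, G (y + intVec m)) x := by fun_prop
  refine hc.congr ?_
  filter_upwards [Metric.ball_mem_nhds x one_pos] with y hy
  rw [periodization, tsum_eq_sum (s := F)]
  refine hF y ?_
  have := norm_le_norm_add_norm_sub' y x
  rw [Metric.mem_ball, dist_eq_norm] at hy
  linarith

theorem integral_eq_sum_cube {h : (Fin 3 → ℝ) → ℂ} (hi : Integrable h) {F : Finset (Fin 3 → ℤ)}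
    (hF : ∀ x : Fin 3 → ℝ, ‖x‖ ≤ 1 → ∀ m ∉ F, h (x + intVec m) = 0) :
    ∫ x, h x = ∑ m ∈ F, ∫ x in {x : Fin 3 → ℝ | ∀ i, x i ∈ Set.Ioc (0 : ℝ) (0 + 1)}, h (x + intVec m) := by
  set U : (Fin 3 → ℤ) → Set (Fin 3 → ℝ) := fun m => {x | ∀ i, x i ∈ Set.Ioc (m i : ℝ) (m i + 1)} with hU
  have hUm : ∀ m, MeasurableSet (U m) := fun m => by
    have : U m = Set.pi Set.univ fun i => Set.Ioc (m i : ℝ) (m i + 1) := by ext; simp [hU]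
    rw [this]
    exact MeasurableSet.univ_pi fun i => measurableSet_Ioc
  have hdis : Pairwise (Function.onFun Disjoint U) := by
    intro m n hmn
    rw [Function.onFun, Set.disjoint_left]
    intro x hx hx'
    refine hmn (funext fun i => ?_)
    have h1 := hx i
    have h2 := hx' i
    have h3 : (m i : ℝ) < n i + 1 := h1.1.trans_le h2.2
    have h4 : (n i : ℝ) < m i + 1 := h2.1.trans_le h1.2
    have h5 : m i < n i + 1 := by exact_mod_cast h3
    have h6 : n i < m i + 1 := by exact_mod_cast h4
    omega
  have hcov : ⋃ m, U m = Set.univ := by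
    refine Set.eq_univ_of_forall fun x => Set.mem_iUnion.2 ⟨fun i => ⌈x i⌉ - 1, fun i => ?_⟩
    constructor
    · push_cast; linarith [Int.ceil_lt_add_one (x i)]
    · push_cast; linarith [Int.le_ceil (x i)]
  have hsh : ∀ m, ∫ x in U m, h x = ∫ x in {x : Fin 3 → ℝ | ∀ i, x i ∈ Set.Ioc (0 : ℝ) (0 + 1)}, h (x + intVec m) := by
    intro m
    have := (measurePreserving_add_right (volume : Measure (Fin 3 → ℝ)) (intVec m)).setIntegral_preimage_emb
      (measurableEmbedding_addRight _) h (U m)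
    rw [← this]
    congr 2
    ext x
    simp only [hU, Set.mem_preimage, Set.mem_ofPred_eq, Pi.add_apply, intVec, Set.mem_Ioc]
    refine forall_congr' fun i => ?_
    constructor <;> rintro ⟨h1, h2⟩ <;> constructor <;> linarith
  have hs := hasSum_integral_iUnion hUm hdis hi.integrableOn
  rw [hcov, setIntegral_univ] at hs
  rw [← hs.tsum_eq, tsum_eq_sum (s := F)]
  · exact Finset.sum_congr rfl fun m _ => hsh m
  · intro m hm
    rw [hsh m]
    refine setIntegral_eq_zero_of_forall_eq_zero fun x hx => hF x ?_ m hm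
    rw [pi_norm_le_iff_of_nonneg zero_le_one]
    intro i
    rw [Real.norm_eq_abs, abs_of_pos (hx i).1]
    linarith [(hx i).2]

theorem poisson_summation {G : (Fin 3 → ℝ) → ℂ} (hG : Continuous G) {R : ℝ} (hR : ∀ x, G x ≠ 0 → ‖x‖ ≤ R)
    (hs : Summable (fourierAt G)) : ∑' m : Fin 3 → ℤ, G (intVec m) = ∑' n, fourierAt G n := by
  have hq : IsOpenQuotientMap (Pi.map fun (_ : Fin 3) (x : ℝ) => (x : UnitAddCircle)) :=
    IsOpenQuotientMap.piMap fun _ => QuotientAddGroup.isOpenQuotientMap_mk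
  set P : UnitAddTorus (Fin 3) → ℂ := fun t => periodization G fun i => Quotient.out (t i) with hP
  have hPπ : ∀ x : Fin 3 → ℝ, P (fun i => (x i : UnitAddCircle)) = periodization G x := by
    intro x
    have : ∀ i, ∃ k : ℤ, (Quotient.out (x i : UnitAddCircle) : ℝ) = x i + k := fun i => by
      have h1 : ((Quotient.out (x i : UnitAddCircle) : ℝ) : UnitAddCircle) = (x i : UnitAddCircle) := Quotient.out_eq _
      obtain ⟨k, hk⟩ := AddSubgroup.mem_zmultiples_iff.1 (QuotientAddGroup.eq.1 h1.symm)
      refine ⟨k, ?_⟩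
      rw [zsmul_eq_mul, mul_one] at hk
      linarith
    choose k hk using this
    rw [← periodization_add_intVec G x k]
    exact congrArg (periodization G) (funext hk)
  have hPc : Continuous P := by
    rw [hq.isQuotientMap.continuous_iff]
    exact (continuous_periodization hG hR).congr fun x => (hPπ x).symm
  obtain ⟨F, hF⟩ := exists_finset_translates hR 1
  have hcoef : UnitAddTorus.mFourierCoeff P = fourierAt G := by
    funext n
    rw [UnitAddTorus.mFourierCoeff_eq_integral P n 0, fourierAt]
    have hcomp : HasCompactSupport fun x : Fin 3 → ℝ => ee (-(∑ i, n i * x i)) * G x := by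
      refine HasCompactSupport.of_support_subset_isCompact (isCompact_closedBall (0 : Fin 3 → ℝ) R) fun x hx => ?_
      rw [mem_closedBall_zero_iff]
      exact hR x fun h => hx (by simp [h])
    have hcont : Continuous fun x : Fin 3 → ℝ => ee (-(∑ i, n i * x i)) * G x :=
      (continuous_ee.comp (by fun_prop)).mul hG
    rw [integral_eq_sum_cube (hcont.integrable_of_hasCompactSupport hcomp) (F := F)]
    · simp only [mFourier_neg_coe, hPπ, Pi.zero_apply, smul_eq_mul]
      rw [← integral_finsetSum]
      · refine setIntegral_congr_fun ?_ fun x hx => ?_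
        · have : {x : Fin 3 → ℝ | ∀ i, x i ∈ Set.Ioc (0 : ℝ) (0 + 1)} = Set.pi Set.univ fun i => Set.Ioc (0 : ℝ) (0 + 1) := by
            ext; simp
          rw [this]
          exact MeasurableSet.univ_pi fun i => measurableSet_Ioc
        · have hx1 : ‖x‖ ≤ 1 := by
            rw [pi_norm_le_iff_of_nonneg zero_le_one]
            intro i
            rw [Real.norm_eq_abs, abs_of_pos (hx i).1]
            linarith [(hx i).2]
          rw [periodization, tsum_eq_sum (s := F) (hF x hx1), Finset.mul_sum]
          refine Finset.sum_congr rfl fun m _ => ?_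
          congr 1
          have : -(∑ i, (n i : ℝ) * (x + intVec m) i) = -(∑ i, (n i : ℝ) * x i) + ((-∑ i, n i * m i : ℤ) : ℝ) := by
            push_cast
            rw [← neg_add, ← Finset.sum_add_distrib]
            simp only [Pi.add_apply, intVec, mul_add]
          rw [this, ee_add, ee_intCast, mul_one]
      · intro m _
        exact ((hcont.integrable_of_hasCompactSupport hcomp).comp_add_right (intVec m)).integrableOn
    · intro x hx m hm
      rw [hF x hx m hm, mul_zero]
  have := UnitAddTorus.hasSum_mFourier_series_apply_of_summable (f := ⟨P, hPc⟩) (by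
    simpa [hcoef] using hs) (fun _ => ((0 : ℝ) : UnitAddCircle))
  simp only [ContinuousMap.coe_mk, hcoef] at this
  rw [hPπ fun _ => 0] at this
  have h1 : ∀ n : Fin 3 → ℤ, UnitAddTorus.mFourier n (fun _ => ((0 : ℝ) : UnitAddCircle)) = 1 := fun n => by
    have := mFourier_neg_coe (-n) (0 : Fin 3 → ℝ)
    simpa [ee_zero] using this
  simp only [h1, smul_eq_mul, mul_one] at this
  rw [this.tsum_eq, periodization]
  simp only [show (fun _ : Fin 3 => (0 : ℝ)) = 0 from rfl, zero_add]

end PoissonSummation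

section DivisionLemma

open Topology Filter

theorem hasDerivAt_moment {h : ℝ → ℝ} (hh : ContDiff ℝ (⊤ : ℕ∞) h) (m : ℕ) (x : ℝ) :
    HasDerivAt (fun θ => ∫ s in (0 : ℝ)..1, s ^ m * h (s * θ)) (∫ s in (0 : ℝ)..1, s ^ (m + 1) * deriv h (s * x)) x := by
  have hc := hh.continuous
  have hd : Continuous (deriv h) := hh.continuous_deriv (by norm_cast)
  obtain ⟨C, hC⟩ := (isCompact_closedBall (0 : ℝ) (|x| + 1)).exists_bound_of_continuousOn hd.continuousOn
  have := intervalIntegral.hasDerivAt_integral_of_dominated_loc_of_deriv_le (μ := volume) (a := (0 : ℝ)) (b := 1)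
    (F := fun θ s => s ^ m * h (s * θ)) (F' := fun θ s => s ^ (m + 1) * deriv h (s * θ)) (x₀ := x)
    (bound := fun _ => C) (s := Metric.ball x 1) (Metric.ball_mem_nhds x one_pos)
    (Eventually.of_forall fun θ => by
      have : Continuous fun s : ℝ => s ^ m * h (s * θ) := by fun_prop
      exact this.aestronglyMeasurable)
    (by
      have : Continuous fun s : ℝ => s ^ m * h (s * x) := by fun_prop
      exact this.intervalIntegrable _ _)
    (by
      have : Continuous fun s : ℝ => s ^ (m + 1) * deriv h (s * x) := by fun_prop
      exact this.aestronglyMeasurable)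
    (Eventually.of_forall fun s hs θ hθ => by
      rw [Set.uIoc_of_le zero_le_one] at hs
      rw [norm_mul, Real.norm_of_nonneg (pow_nonneg hs.1.le _)]
      have h1 : ‖deriv h (s * θ)‖ ≤ C := hC _ (by
        rw [mem_closedBall_zero_iff, Real.norm_eq_abs, abs_mul, abs_of_pos hs.1]
        rw [Metric.mem_ball, Real.dist_eq] at hθ
        have h2 : |θ| ≤ |x| + 1 := by
          have := abs_sub_abs_le_abs_sub θ x
          linarith
        nlinarith [abs_nonneg θ, hs.1, hs.2])
      have h2 : s ^ (m + 1) ≤ 1 := pow_le_one₀ hs.1.le hs.2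
      nlinarith [norm_nonneg (deriv h (s * θ))])
    (by simp)
    (Eventually.of_forall fun s _ θ _ => by
      have h1 : HasDerivAt h (deriv h (s * θ)) (s * θ) := ((hh.differentiable (by simp)) _).hasDerivAt
      have h2 : HasDerivAt (fun θ => s * θ) s θ := by simpa using (hasDerivAt_id θ).const_mul s
      exact ((h1.comp θ h2).const_mul (s ^ m)).congr_deriv (by ring))
  exact this.2

theorem contDiff_deriv_of_top {h : ℝ → ℝ} (hh : ContDiff ℝ (⊤ : ℕ∞) h) : ContDiff ℝ (⊤ : ℕ∞) (deriv h) :=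
  (contDiff_infty_iff_deriv.1 hh).2

theorem contDiff_moment (n : ℕ) : ∀ (m : ℕ) {h : ℝ → ℝ}, ContDiff ℝ (⊤ : ℕ∞) h →
    ContDiff ℝ n (fun θ => ∫ s in (0 : ℝ)..1, s ^ m * h (s * θ)) := by
  induction n with
  | zero =>
    intro m h hh
    have : Differentiable ℝ (fun θ => ∫ s in (0 : ℝ)..1, s ^ m * h (s * θ)) := fun x =>
      (hasDerivAt_moment hh m x).differentiableAt
    exact contDiff_zero.2 this.continuous
  | succ n ih =>
    intro m h hh
    rw [Nat.cast_succ, contDiff_succ_iff_deriv]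
    refine ⟨fun x => (hasDerivAt_moment hh m x).differentiableAt, by simp, ?_⟩
    rw [show deriv (fun θ => ∫ s in (0 : ℝ)..1, s ^ m * h (s * θ)) = _ from
      funext fun x => (hasDerivAt_moment hh m x).deriv]
    exact ih (m + 1) (contDiff_deriv_of_top hh)

/-- Hadamard's lemma on the line. -/
theorem exists_eq_mul_of_eq_zero {h : ℝ → ℝ} (hh : ContDiff ℝ (⊤ : ℕ∞) h) (h0 : h 0 = 0) :
    ∃ k : ℝ → ℝ, ContDiff ℝ (⊤ : ℕ∞) k ∧ (∀ θ, h θ = θ * k θ) ∧ k 0 = deriv h 0 := by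
  refine ⟨fun θ => ∫ s in (0 : ℝ)..1, s ^ 0 * deriv h (s * θ), ?_, fun θ => ?_, by simp⟩
  · rw [contDiff_infty]
    exact fun n => contDiff_moment n 0 (contDiff_deriv_of_top hh)
  · have h1 : ∀ s ∈ Set.uIcc (0 : ℝ) 1, HasDerivAt (fun s => h (s * θ)) (θ * (s ^ 0 * deriv h (s * θ))) s := fun s _ => by
      have h1 : HasDerivAt h (deriv h (s * θ)) (s * θ) := ((hh.differentiable (by simp)) _).hasDerivAt
      have h2 : HasDerivAt (fun s => s * θ) θ s := by simpa using (hasDerivAt_id s).mul_const θ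
      exact (h1.comp s h2).congr_deriv (by ring)
    have h2 := intervalIntegral.integral_eq_sub_of_hasDerivAt h1 (by
      have := (contDiff_deriv_of_top hh).continuous
      exact Continuous.intervalIntegrable (by fun_prop) _ _)
    rw [intervalIntegral.integral_const_mul] at h2
    simp only [h2, one_mul, zero_mul, h0, sub_zero]

/-- The quotient of a function by the sine, with removable singularities removed. -/
noncomputable def divSin (h : ℝ → ℝ) (θ : ℝ) : ℝ := if sin θ = 0 then deriv h θ / cos θ else h θ / sin θ

theorem divSin_of_ne {h : ℝ → ℝ} {θ : ℝ} (hθ : sin θ ≠ 0) : divSin h θ = h θ / sin θ := if_neg hθ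

theorem sin_mul_divSin {h : ℝ → ℝ} (h0 : ∀ θ, sin θ = 0 → h θ = 0) (θ : ℝ) : sin θ * divSin h θ = h θ := by
  by_cases hθ : sin θ = 0
  · rw [hθ, zero_mul, h0 θ hθ]
  · rw [divSin_of_ne hθ]; field_simp

theorem contDiff_divSin {h : ℝ → ℝ} (hh : ContDiff ℝ (⊤ : ℕ∞) h) (h0 : ∀ θ, sin θ = 0 → h θ = 0) :
    ContDiff ℝ (⊤ : ℕ∞) (divSin h) := by
  rw [contDiff_iff_contDiffAt]
  intro θ
  by_cases hθ : sin θ = 0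
  · have hcos : cos θ ≠ 0 := fun hc => by
      have := sin_sq_add_cos_sq θ
      rw [hθ, hc] at this; norm_num at this
    have ht : ContDiff ℝ (⊤ : ℕ∞) fun x : ℝ => θ + x := by fun_prop
    obtain ⟨a, ha, haeq, ha0⟩ := exists_eq_mul_of_eq_zero (hh.comp ht) (by simp [h0 θ hθ])
    obtain ⟨b, hb, hbeq, hb0⟩ := exists_eq_mul_of_eq_zero (Real.contDiff_sin.comp ht) (by simp [hθ])
    have ha0' : a 0 = deriv h θ := by
      rw [ha0]; simpa [Function.comp_def] using deriv_comp_const_add (f := h) θ 0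
    have hb0' : b 0 = cos θ := by
      rw [hb0]; simpa [Function.comp_def] using deriv_comp_const_add (f := sin) θ 0
    have hq : ContDiffAt ℝ (⊤ : ℕ∞) (fun x => a (x - θ) / b (x - θ)) θ := by
      have hsub : ContDiff ℝ (⊤ : ℕ∞) fun x : ℝ => x - θ := by fun_prop
      refine (ha.comp hsub).contDiffAt.div (hb.comp hsub).contDiffAt ?_
      simp [hb0', hcos]
    refine hq.congr_of_eventuallyEq ?_
    have hne : ∀ᶠ x in 𝓝 θ, b (x - θ) ≠ 0 := by
      have : ContinuousAt (fun x => b (x - θ)) θ := (hb.continuous.comp (by fun_prop)).continuousAt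
      refine this.eventually_ne ?_
      simp [hb0', hcos]
    filter_upwards [hne] with x hx
    by_cases hxθ : x = θ
    · subst hxθ; simp [divSin, hθ, ha0', hb0']
    · have h1 : x - θ ≠ 0 := sub_ne_zero.2 hxθ
      have h2 := hbeq (x - θ)
      have h3 := haeq (x - θ)
      simp only [Function.comp_apply, add_sub_cancel] at h2 h3
      have h4 : sin x ≠ 0 := by rw [h2]; exact mul_ne_zero h1 hx
      rw [divSin_of_ne h4, h2, h3]
      field_simp
  · refine (hh.contDiffAt.div Real.contDiff_sin.contDiffAt hθ).congr_of_eventuallyEq ?_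
    filter_upwards [Real.continuous_sin.continuousAt.eventually_ne hθ] with x hx
    exact divSin_of_ne hx

theorem deriv_odd_of_even {g : ℝ → ℝ} (hg : ∀ x, g (-x) = g x) (x : ℝ) : deriv g (-x) = -deriv g x := by
  have := deriv_comp_neg g x
  simp only [hg] at this
  linarith

theorem deriv_even_of_odd {g : ℝ → ℝ} (hg : ∀ x, g (-x) = -g x) (x : ℝ) : deriv g (-x) = deriv g x := by
  have := deriv_comp_neg g x
  simp only [hg, deriv.fun_neg] at this
  linarith

theorem periodic_deriv {g : ℝ → ℝ} {c : ℝ} (hg : Function.Periodic g c) : Function.Periodic (deriv g) c := fun x => by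
  rw [← deriv_comp_add_const]
  exact congrArg (fun f => deriv f x) (funext hg)

theorem odd_periodic_eq_zero {h : ℝ → ℝ} (hodd : ∀ x, h (-x) = -h x) (hper : Function.Periodic h (2 * π)) {θ : ℝ}
    (hθ : sin θ = 0) : h θ = 0 := by
  obtain ⟨n, rfl⟩ := Real.sin_eq_zero_iff.1 hθ
  have h1 := hper.int_mul n (-(n * π))
  rw [show -((n : ℝ) * π) + n * (2 * π) = n * π by ring, hodd] at h1
  linarith

/-- Derivative with respect to the cosine. -/
noncomputable def cosDeriv (g : ℝ → ℝ) : ℝ → ℝ := divSin fun θ => -deriv g θ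

theorem contDiff_cosDeriv {g : ℝ → ℝ} (hg : ContDiff ℝ (⊤ : ℕ∞) g) (heven : ∀ x, g (-x) = g x)
    (hper : Function.Periodic g (2 * π)) : ContDiff ℝ (⊤ : ℕ∞) (cosDeriv g) :=
  contDiff_divSin (contDiff_deriv_of_top hg).neg fun _ hθ => by
    rw [odd_periodic_eq_zero (deriv_odd_of_even heven) (periodic_deriv hper) hθ, neg_zero]

theorem sin_mul_cosDeriv {g : ℝ → ℝ} (heven : ∀ x, g (-x) = g x)
    (hper : Function.Periodic g (2 * π)) (θ : ℝ) : sin θ * cosDeriv g θ = -deriv g θ :=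
  sin_mul_divSin (h := fun θ => -deriv g θ) (fun θ hθ => by
    rw [odd_periodic_eq_zero (deriv_odd_of_even heven) (periodic_deriv hper) hθ, neg_zero]) θ

theorem cosDeriv_even {g : ℝ → ℝ} (heven : ∀ x, g (-x) = g x) (x : ℝ) : cosDeriv g (-x) = cosDeriv g x := by
  have h1 := deriv_odd_of_even heven
  have h2 := deriv_even_of_odd (g := fun θ => -deriv g θ) (fun x => by rw [h1])
  simp only [cosDeriv, divSin, sin_neg, cos_neg, neg_eq_zero, h1, h2, neg_div_neg_eq]

theorem periodic_cosDeriv {g : ℝ → ℝ} (hper : Function.Periodic g (2 * π)) :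
    Function.Periodic (cosDeriv g) (2 * π) := fun x => by
  have h1 := periodic_deriv hper
  have h2 : Function.Periodic (deriv fun θ => -deriv g θ) (2 * π) :=
    periodic_deriv fun x => congrArg Neg.neg (h1 x)
  simp only [cosDeriv, divSin, sin_add_two_pi, cos_add_two_pi, h1 x, h2 x]

theorem hasDerivWithinAt_comp_arccos {g : ℝ → ℝ} (hg : ContDiff ℝ (⊤ : ℕ∞) g) (heven : ∀ x, g (-x) = g x)
    (hper : Function.Periodic g (2 * π)) {x : ℝ} (hx : x ∈ Set.Icc (-1 : ℝ) 1) :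
    HasDerivWithinAt (fun x => g (arccos x)) (cosDeriv g (arccos x)) (Set.Icc (-1) 1) x := by
  have hc : Continuous fun x => cosDeriv g (arccos x) :=
    (contDiff_cosDeriv hg heven hper).continuous.comp continuous_arccos
  have heq : ∀ y ∈ Set.Icc (-1 : ℝ) 1, g (arccos y) = g (arccos (-1)) + ∫ t in (-1 : ℝ)..y, cosDeriv g (arccos t) := by
    intro y hy
    rw [intervalIntegral.integral_eq_sub_of_hasDerivAt_of_le (f := fun x => g (arccos x)) hy.1]
    · ring
    · exact (hg.continuous.comp continuous_arccos).continuousOn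
    · intro t ht
      have h1 : t ≠ -1 := ht.1.ne'
      have h2 : t ≠ 1 := (ht.2.trans_le hy.2).ne
      have h3 := ((hg.differentiable (by simp)) (arccos t)).hasDerivAt.comp t (hasDerivAt_arccos h1 h2)
      refine h3.congr_deriv ?_
      have h4 := sin_mul_cosDeriv heven hper (arccos t)
      rw [sin_arccos] at h4
      have h5 : 0 < √(1 - t ^ 2) := Real.sqrt_pos.2 (by nlinarith [ht.1, ht.2, hy.2])
      have h6 : deriv g (arccos t) = -(√(1 - t ^ 2) * cosDeriv g (arccos t)) := by linarith
      rw [h6]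
      field_simp
    · exact hc.intervalIntegrable _ _
  have hd : HasDerivAt (fun y => g (arccos (-1)) + ∫ t in (-1 : ℝ)..y, cosDeriv g (arccos t)) (cosDeriv g (arccos x)) x :=
    (intervalIntegral.integral_hasDerivAt_right (hc.intervalIntegrable _ _)
      hc.stronglyMeasurable.stronglyMeasurableAtFilter hc.continuousAt).const_add _
  exact hd.hasDerivWithinAt.congr heq (heq x hx)

/-- A smooth even `2π`-periodic function is a smooth function of the cosine. -/
theorem contDiffOn_comp_arccos (n : ℕ) : ∀ {g : ℝ → ℝ}, ContDiff ℝ (⊤ : ℕ∞) g → (∀ x, g (-x) = g x) →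
    Function.Periodic g (2 * π) → ContDiffOn ℝ n (fun x => g (arccos x)) (Set.Icc (-1) 1) := by
  have hu : UniqueDiffOn ℝ (Set.Icc (-1 : ℝ) 1) := uniqueDiffOn_Icc (by norm_num)
  induction n with
  | zero =>
    intro g hg _ _
    exact contDiffOn_zero.2 (hg.continuous.comp continuous_arccos).continuousOn
  | succ n ih =>
    intro g hg heven hper
    have hd := fun x hx => hasDerivWithinAt_comp_arccos hg heven hper (x := x) hx
    rw [Nat.cast_succ, contDiffOn_succ_iff_derivWithin hu]
    refine ⟨fun x hx => (hd x hx).differentiableWithinAt, by simp, ?_⟩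
    exact (ih (contDiff_cosDeriv hg heven hper) (cosDeriv_even heven) (periodic_cosDeriv hper)).congr
      fun x hx => (hd x hx).derivWithin (hu x hx)

end DivisionLemma

section StationaryPhase

theorem norm_sub_le_of_hasDerivAt {h h' : ℝ → ℝ} {b C : ℝ} (hh : ∀ x, HasDerivAt h (h' x) x)
    (hb : ∀ x ∈ Set.Icc 0 b, |h' x| ≤ C) {x : ℝ} (hx : x ∈ Set.Icc 0 b) : |h x - h 0| ≤ C * x := by
  have := (convex_Icc (0 : ℝ) b).norm_image_sub_le_of_norm_hasDerivWithin_le (f := h) (f' := h') (C := C)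
    (fun y _ => (hh y).hasDerivWithinAt) hb (Set.left_mem_Icc.2 (hx.1.trans hx.2)) hx
  simpa [abs_of_nonneg hx.1] using this

theorem abs_sub_quadratic_le {f f' f'' f''' : ℝ → ℝ} {b κ M : ℝ} (hM : 0 ≤ M)
    (hf : ∀ x, HasDerivAt f (f' x) x) (hf' : ∀ x, HasDerivAt f' (f'' x) x) (hf'' : ∀ x, HasDerivAt f'' (f''' x) x)
    (h0 : f 0 = 0) (h1 : f' 0 = 0) (h2 : f'' 0 = κ) (hb : ∀ x ∈ Set.Icc 0 b, |f''' x| ≤ M) {x : ℝ}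
    (hx : x ∈ Set.Icc 0 b) : |f x - κ / 2 * x ^ 2| ≤ M * x ^ 3 := by
  have s1 : ∀ y ∈ Set.Icc 0 b, |f'' y - κ| ≤ M * y := fun y hy => by
    have := norm_sub_le_of_hasDerivAt hf'' hb hy
    rwa [h2] at this
  have s2 : ∀ y ∈ Set.Icc 0 b, |f' y - κ * y| ≤ M * y ^ 2 := fun y hy => by
    have := norm_sub_le_of_hasDerivAt (h := fun y => f' y - κ * y) (h' := fun y => f'' y - κ) (b := y) (C := M * y)
      (fun z => ((hf' z).sub ((hasDerivAt_id z).const_mul κ)).congr_deriv (by ring))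
      (fun z hz => (s1 z ⟨hz.1, hz.2.trans hy.2⟩).trans (mul_le_mul_of_nonneg_left hz.2 hM)) ⟨hy.1, le_rfl⟩
    simp only [h1, mul_zero, sub_zero] at this
    rwa [pow_two, ← mul_assoc]
  have := norm_sub_le_of_hasDerivAt (h := fun y => f y - κ / 2 * y ^ 2) (h' := fun y => f' y - κ * y) (b := x)
    (C := M * x ^ 2)
    (fun z => ((hf z).sub ((hasDerivAt_pow 2 z).const_mul (κ / 2))).congr_deriv (by push_cast; ring))
    (fun z hz => (s2 z ⟨hz.1, hz.2.trans hx.2⟩).trans (mul_le_mul_of_nonneg_left (by nlinarith [hz.1, hz.2]) hM))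
    ⟨hx.1, le_rfl⟩
  simp only [h0] at this
  calc _ ≤ M * x ^ 2 * x := by simpa using this
    _ = _ := by ring

theorem stationary_phase_half {f f1 f2 f3 g g' : ℝ → ℝ} {b m M G Λ δ : ℝ} (c : ℝ) {σ : ℝ} (hσ : σ = 1 ∨ σ = -1)
    (hm : 0 < m) (hm1 : m ≤ 1) (hM : 1 ≤ M) (hG : 0 ≤ G) (hκ : m ≤ -f2 c)
    (hf : ∀ x, HasDerivAt f (f1 x) x) (hf1 : ∀ x, HasDerivAt f1 (f2 x) x) (hf2 : ∀ x, HasDerivAt f2 (f3 x) x)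
    (hc : f1 c = 0) (hlow : ∀ x ∈ Set.Icc 0 b, m * x ≤ -(σ * f1 (c + σ * x)))
    (hM2 : ∀ x ∈ Set.Icc 0 b, |f2 (c + σ * x)| ≤ M) (hM3 : ∀ x ∈ Set.Icc 0 b, |f3 (c + σ * x)| ≤ M)
    (hg : ∀ x, HasDerivAt g (g' x) x) (hg' : Continuous g')
    (hgG : ∀ x ∈ Set.Icc 0 b, |g (c + σ * x)| ≤ G) (hgG' : ∀ x ∈ Set.Icc 0 b, |g' (c + σ * x)| ≤ G) (hΛ : 0 < Λ)
    (hδ : 0 < δ) (hδb : δ ≤ b) :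
    ‖(∫ x in (0 : ℝ)..b, (g (c + σ * x) : ℂ) * ee (-(Λ * f (c + σ * x))))
        - g c * ((starRingEnd ℂ) fresnelConst / √(Λ * (-f2 c) / 2)) * ee (-(Λ * f c))‖
      ≤ (8 + b) * G * M / m ^ 2 * (δ ^ 2 + Λ * δ ^ 4 + 1 / (Λ * δ) + 1 / (Λ ^ 2 * δ ^ 3)) := by
  have hσ2 : σ * σ = 1 := by rcases hσ with rfl | rfl <;> norm_num
  have hσa : |σ| = 1 := by rcases hσ with rfl | rfl <;> norm_num
  have hl : ∀ x, HasDerivAt (fun x => c + σ * x) σ x := fun x => by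
    simpa using ((hasDerivAt_id x).const_mul σ).const_add c
  have d0 : ∀ x, HasDerivAt (fun x => f c - f (c + σ * x)) (-(σ * f1 (c + σ * x))) x := fun x =>
    (((hf _).comp x (hl x)).const_sub (f c)).congr_deriv (by ring)
  have d1 : ∀ x, HasDerivAt (fun x => -(σ * f1 (c + σ * x))) (-f2 (c + σ * x)) x := fun x =>
    (((hf1 _).comp x (hl x)).const_mul σ).neg.congr_deriv (by linear_combination -f2 (c + σ * x) * hσ2)
  have d2 : ∀ x, HasDerivAt (fun x => -f2 (c + σ * x)) (-(σ * f3 (c + σ * x))) x := fun x =>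
    ((hf2 _).comp x (hl x)).neg.congr_deriv (by ring)
  have dg : ∀ x, HasDerivAt (fun x => g (c + σ * x)) (σ * g' (c + σ * x)) x := fun x =>
    ((hg _).comp x (hl x)).congr_deriv (by ring)
  have c2 : Continuous fun x => -f2 (c + σ * x) := continuous_iff_continuousAt.2 fun x => (d2 x).continuousAt
  have key := stationary_phase_endpoint (f := fun x => f c - f (c + σ * x)) (f' := fun x => -(σ * f1 (c + σ * x)))
    (f'' := fun x => -f2 (c + σ * x)) (g := fun x => g (c + σ * x)) (g' := fun x => σ * g' (c + σ * x)) (b := b)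
    (κ := -f2 c) hm hm1 hM hG hκ (fun x _ => d0 x) (fun x _ => d1 x) c2.continuousOn hlow
    (fun x hx => by rw [abs_neg]; exact hM2 x hx)
    (fun x hx => abs_sub_quadratic_le (zero_le_one.trans hM) d0 d1 d2 (by simp) (by simp [hc]) (by simp)
      (fun x hx => by rw [abs_neg, abs_mul, hσa, one_mul]; exact hM3 x hx) hx)
    (fun x _ => dg x) (by fun_prop) hgG (fun x hx => by rw [abs_mul, hσa, one_mul]; exact hgG' x hx) hΛ hδ hδb
  have e1 : (∫ x in (0 : ℝ)..b, (g (c + σ * x) : ℂ) * ee (-(Λ * f (c + σ * x))))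
      = (starRingEnd ℂ) (∫ x in (0 : ℝ)..b, (g (c + σ * x) : ℂ) * ee (-(Λ * (f c - f (c + σ * x))))) *
        ee (-(Λ * f c)) := by
    rw [intervalIntegral.integral_of_le (hδ.le.trans hδb), intervalIntegral.integral_of_le (hδ.le.trans hδb),
      ← integral_conj, ← integral_mul_const]
    congr 1
    ext x
    rw [map_mul, Complex.conj_ofReal, ← ee_neg, mul_assoc, ← ee_add]
    congr 2
    ring
  have e2 : (g c : ℂ) * ((starRingEnd ℂ) fresnelConst / √(Λ * (-f2 c) / 2))
      = (starRingEnd ℂ) ((g c : ℂ) * (fresnelConst / √(Λ * (-f2 c) / 2))) := by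
    rw [map_mul, map_div₀, Complex.conj_ofReal, Complex.conj_ofReal]
  rw [e1, e2, ← sub_mul, ← map_sub, norm_mul, norm_ee, mul_one, RCLike.norm_conj]
  simpa using key

/-- Stationary phase at an interior nondegenerate maximum. -/
theorem stationary_phase_max {f f1 f2 f3 g g' : ℝ → ℝ} {a b c m M G Λ δ : ℝ}
    (hm : 0 < m) (hm1 : m ≤ 1) (hM : 1 ≤ M) (hG : 0 ≤ G) (hκ : m ≤ -f2 c)
    (hf : ∀ x, HasDerivAt f (f1 x) x) (hf1 : ∀ x, HasDerivAt f1 (f2 x) x) (hf2 : ∀ x, HasDerivAt f2 (f3 x) x)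
    (hc : f1 c = 0) (hlow : ∀ x ∈ Set.Icc a c, m * (c - x) ≤ f1 x) (hhigh : ∀ x ∈ Set.Icc c b, m * (x - c) ≤ -f1 x)
    (hM2 : ∀ x ∈ Set.Icc a b, |f2 x| ≤ M) (hM3 : ∀ x ∈ Set.Icc a b, |f3 x| ≤ M)
    (hg : ∀ x, HasDerivAt g (g' x) x) (hg' : Continuous g')
    (hgG : ∀ x ∈ Set.Icc a b, |g x| ≤ G) (hgG' : ∀ x ∈ Set.Icc a b, |g' x| ≤ G) (hΛ : 0 < Λ)
    (hδ : 0 < δ) (hδa : δ ≤ c - a) (hδb : δ ≤ b - c) :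
    ‖(∫ x in a..b, (g x : ℂ) * ee (-(Λ * f x)))
        - 2 * g c * ((starRingEnd ℂ) fresnelConst / √(Λ * (-f2 c) / 2)) * ee (-(Λ * f c))‖
      ≤ 2 * (8 + (b - a)) * G * M / m ^ 2 * (δ ^ 2 + Λ * δ ^ 4 + 1 / (Λ * δ) + 1 / (Λ ^ 2 * δ ^ 3)) := by
  have hcont : Continuous fun x => (g x : ℂ) * ee (-(Λ * f x)) := by
    have h1 : Continuous f := continuous_iff_continuousAt.2 fun x => (hf x).continuousAt
    have h2 : Continuous g := continuous_iff_continuousAt.2 fun x => (hg x).continuousAt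
    exact (Complex.continuous_ofReal.comp h2).mul (continuous_ee.comp (by fun_prop))
  have mem1 : ∀ x ∈ Set.Icc 0 (b - c), c + 1 * x ∈ Set.Icc a b := fun x hx =>
    ⟨by linarith [hx.1], by linarith [hx.2]⟩
  have mem2 : ∀ x ∈ Set.Icc 0 (c - a), c + (-1) * x ∈ Set.Icc a b := fun x hx =>
    ⟨by linarith [hx.2], by linarith [hx.1]⟩
  have k1 := stationary_phase_half (b := b - c) (m := m) (M := M) (G := G) (Λ := Λ) (δ := δ) c (Or.inl rfl) hm hm1 hM hG hκ hf hf1 hf2 hc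
    (fun x hx => by
      have := hhigh (c + 1 * x) ⟨by linarith [hx.1], (mem1 x hx).2⟩
      linarith)
    (fun x hx => hM2 _ (mem1 x hx)) (fun x hx => hM3 _ (mem1 x hx)) hg hg' (fun x hx => hgG _ (mem1 x hx))
    (fun x hx => hgG' _ (mem1 x hx)) hΛ hδ hδb
  have k2 := stationary_phase_half (b := c - a) (m := m) (M := M) (G := G) (Λ := Λ) (δ := δ) c (Or.inr rfl) hm hm1 hM hG hκ hf hf1 hf2 hc
    (fun x hx => by
      have := hlow (c + (-1) * x) ⟨(mem2 x hx).1, by linarith [hx.1]⟩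
      linarith)
    (fun x hx => hM2 _ (mem2 x hx)) (fun x hx => hM3 _ (mem2 x hx)) hg hg' (fun x hx => hgG _ (mem2 x hx))
    (fun x hx => hgG' _ (mem2 x hx)) hΛ hδ hδa
  have e1 : (∫ x in (0 : ℝ)..(b - c), (g (c + 1 * x) : ℂ) * ee (-(Λ * f (c + 1 * x))))
      = ∫ x in c..b, (g x : ℂ) * ee (-(Λ * f x)) := by
    simp only [one_mul]
    rw [intervalIntegral.integral_comp_add_left (fun x => (g x : ℂ) * ee (-(Λ * f x)))]
    simp
  have e2 : (∫ x in (0 : ℝ)..(c - a), (g (c + (-1) * x) : ℂ) * ee (-(Λ * f (c + (-1) * x))))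
      = ∫ x in a..c, (g x : ℂ) * ee (-(Λ * f x)) := by
    simp only [neg_one_mul, ← sub_eq_add_neg]
    rw [intervalIntegral.integral_comp_sub_left (fun x => (g x : ℂ) * ee (-(Λ * f x)))]
    simp
  rw [e1] at k1
  rw [e2] at k2
  rw [← intervalIntegral.integral_add_adjacent_intervals (hcont.intervalIntegrable a c) (hcont.intervalIntegrable c b)]
  refine le_trans (le_of_eq (congrArg norm ?_)) ((norm_add_le_of_le k1 k2).trans ?_)
  · ring
  · set E := δ ^ 2 + Λ * δ ^ 4 + 1 / (Λ * δ) + 1 / (Λ ^ 2 * δ ^ 3)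
    have hE : 0 ≤ G * M / m ^ 2 * E := by positivity
    have : b - c + (c - a) ≤ 2 * (b - a) := by linarith
    calc _ = (16 + (b - c + (c - a))) * (G * M / m ^ 2 * E) := by ring
      _ ≤ (16 + 2 * (b - a)) * (G * M / m ^ 2 * E) := by gcongr
      _ = _ := by ring

end StationaryPhase

section MeridianCurve

/-- The hypotheses on the polar profile of the body of revolution. -/
structure IsProfile (ρ : ℝ → ℝ) : Prop where
  even : ∀ θ, ρ (-θ) = ρ θ
  per : Function.Periodic ρ (2 * π)
  pos : ∀ θ, 0 < ρ θ
  smooth : ContDiff ℝ (⊤ : ℕ∞) ρ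
  curv : ∀ θ, ρ θ * deriv (deriv ρ) θ - 2 * (deriv ρ θ) ^ 2 - (ρ θ) ^ 2 ≠ 0

/-- Distance of the meridian point from the axis. -/
noncomputable def meridianX (ρ : ℝ → ℝ) (θ : ℝ) : ℝ := ρ θ * sin θ

/-- Height of the meridian point. -/
noncomputable def meridianZ (ρ : ℝ → ℝ) (θ : ℝ) : ℝ := ρ θ * cos θ

/-- Speed of the meridian. -/
noncomputable def meridianSpeed (ρ : ℝ → ℝ) (θ : ℝ) : ℝ := √(ρ θ ^ 2 + deriv ρ θ ^ 2)

/-- Angle of the outer normal of the meridian. -/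
noncomputable def normalAngle (ρ : ℝ → ℝ) (θ : ℝ) : ℝ := θ - arctan (deriv ρ θ / ρ θ)

/-- Derivative of the normal angle. -/
noncomputable def normalAngleDeriv (ρ : ℝ → ℝ) (θ : ℝ) : ℝ :=
  (ρ θ ^ 2 + 2 * deriv ρ θ ^ 2 - ρ θ * deriv (deriv ρ) θ) / (ρ θ ^ 2 + deriv ρ θ ^ 2)

/-- The function `√X · (-Z')`. -/
noncomputable def meridianWeight (ρ : ℝ → ℝ) (θ : ℝ) : ℝ :=
  √(ρ θ) * cosDeriv (meridianZ ρ) θ * sin θ ^ (3 / 2 : ℝ)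

variable {ρ : ℝ → ℝ}

theorem exists_bounds_of_pos {f : ℝ → ℝ} (hf : Continuous f) (hpos : ∀ x ∈ Set.Icc 0 π, 0 < f x) :
    ∃ c C : ℝ, 0 < c ∧ 0 < C ∧ ∀ x ∈ Set.Icc 0 π, c ≤ f x ∧ f x ≤ C := by
  have hne : (Set.Icc (0 : ℝ) π).Nonempty := ⟨0, le_rfl, pi_pos.le⟩
  obtain ⟨a, ha, hmin⟩ := isCompact_Icc.exists_isMinOn hne hf.continuousOn
  obtain ⟨b, hb, hmax⟩ := isCompact_Icc.exists_isMaxOn hne hf.continuousOn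
  exact ⟨f a, f b, hpos a ha, hpos b hb, fun x hx => ⟨hmin hx, hmax hx⟩⟩

theorem exists_abs_bound {f : ℝ → ℝ} (hf : Continuous f) : ∃ C : ℝ, 0 < C ∧ ∀ x ∈ Set.Icc 0 π, |f x| ≤ C := by
  obtain ⟨c, C, _, hC, h⟩ := exists_bounds_of_pos (f := fun x => |f x| + 1) (by fun_prop) (fun x _ => by positivity)
  exact ⟨C, hC, fun x hx => by linarith [(h x hx).2]⟩

namespace IsProfile

theorem contDiff_X (h : IsProfile ρ) : ContDiff ℝ (⊤ : ℕ∞) (meridianX ρ) := h.smooth.mul contDiff_sin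

theorem contDiff_Z (h : IsProfile ρ) : ContDiff ℝ (⊤ : ℕ∞) (meridianZ ρ) := h.smooth.mul contDiff_cos

theorem Z_even (h : IsProfile ρ) (θ : ℝ) : meridianZ ρ (-θ) = meridianZ ρ θ := by
  simp [meridianZ, h.even]

theorem Z_periodic (h : IsProfile ρ) : Function.Periodic (meridianZ ρ) (2 * π) := fun θ => by
  simp [meridianZ, h.per θ]

theorem hasDerivAt (h : IsProfile ρ) (θ : ℝ) : HasDerivAt ρ (deriv ρ θ) θ :=
  (h.smooth.differentiable (by simp) θ).hasDerivAt

theorem contDiff_deriv (h : IsProfile ρ) : ContDiff ℝ (⊤ : ℕ∞) (deriv ρ) := contDiff_deriv_of_top h.smooth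

theorem hasDerivAt_deriv (h : IsProfile ρ) (θ : ℝ) : HasDerivAt (deriv ρ) (deriv (deriv ρ) θ) θ :=
  (h.contDiff_deriv.differentiable (by simp) θ).hasDerivAt

theorem deriv_eq_zero (h : IsProfile ρ) {θ : ℝ} (hθ : sin θ = 0) : deriv ρ θ = 0 :=
  odd_periodic_eq_zero (deriv_odd_of_even h.even) (periodic_deriv h.per) hθ

theorem normSq_pos (h : IsProfile ρ) (θ : ℝ) : 0 < ρ θ ^ 2 + deriv ρ θ ^ 2 := by
  have := h.pos θ
  positivity

theorem speed_pos (h : IsProfile ρ) (θ : ℝ) : 0 < meridianSpeed ρ θ := Real.sqrt_pos.2 (h.normSq_pos θ)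

theorem speed_mul_cos (h : IsProfile ρ) (θ : ℝ) :
    meridianSpeed ρ θ * cos (arctan (deriv ρ θ / ρ θ)) = ρ θ := by
  have h0 := h.pos θ
  have h1 : 1 + (deriv ρ θ / ρ θ) ^ 2 = (ρ θ ^ 2 + deriv ρ θ ^ 2) / ρ θ ^ 2 := by field_simp
  have h2 := h.speed_pos θ
  rw [cos_arctan, h1, Real.sqrt_div' _ (by positivity), Real.sqrt_sq h0.le, one_div_div, ← meridianSpeed]
  field_simp

theorem speed_mul_sin (h : IsProfile ρ) (θ : ℝ) :
    meridianSpeed ρ θ * sin (arctan (deriv ρ θ / ρ θ)) = deriv ρ θ := by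
  have h1 := h.speed_mul_cos θ
  have h2 := tan_mul_cos (cos_arctan_pos (deriv ρ θ / ρ θ)).ne'
  rw [tan_arctan] at h2
  have h0 := (h.pos θ).ne'
  rw [← h2, mul_left_comm, h1, div_mul_cancel₀ _ h0]

theorem hasDerivAt_X (h : IsProfile ρ) (θ : ℝ) :
    HasDerivAt (meridianX ρ) (meridianSpeed ρ θ * cos (normalAngle ρ θ)) θ :=
  ((h.hasDerivAt θ).mul (hasDerivAt_sin θ)).congr_deriv <| by
    rw [normalAngle, cos_sub]
    linear_combination (-cos θ) * h.speed_mul_cos θ - sin θ * h.speed_mul_sin θ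

theorem hasDerivAt_Z (h : IsProfile ρ) (θ : ℝ) :
    HasDerivAt (meridianZ ρ) (-(meridianSpeed ρ θ * sin (normalAngle ρ θ))) θ :=
  ((h.hasDerivAt θ).mul (hasDerivAt_cos θ)).congr_deriv <| by
    rw [normalAngle, sin_sub]
    linear_combination sin θ * h.speed_mul_cos θ - cos θ * h.speed_mul_sin θ

theorem sin_mul_cosDeriv_Z (h : IsProfile ρ) (θ : ℝ) :
    sin θ * cosDeriv (meridianZ ρ) θ = meridianSpeed ρ θ * sin (normalAngle ρ θ) := by
  rw [sin_mul_cosDeriv h.Z_even h.Z_periodic, (h.hasDerivAt_Z θ).deriv, neg_neg]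

theorem hasDerivAt_normalAngle (h : IsProfile ρ) (θ : ℝ) :
    HasDerivAt (normalAngle ρ) (normalAngleDeriv ρ θ) θ := by
  have h0 := h.pos θ
  have h3 := h.normSq_pos θ
  refine ((hasDerivAt_id θ).sub (((h.hasDerivAt_deriv θ).div (h.hasDerivAt θ) h0.ne').arctan)).congr_deriv ?_
  rw [normalAngleDeriv]
  have h4 : 1 + (deriv ρ θ / ρ θ) ^ 2 = (ρ θ ^ 2 + deriv ρ θ ^ 2) / ρ θ ^ 2 := by field_simp
  rw [Pi.div_apply, h4]
  field_simp
  ring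

theorem continuous_normalAngleDeriv (h : IsProfile ρ) : Continuous (normalAngleDeriv ρ) := by
  have h1 := h.smooth.continuous
  have h2 := h.contDiff_deriv.continuous
  have h3 := (contDiff_deriv_of_top h.contDiff_deriv).continuous
  exact Continuous.div (by fun_prop) (by fun_prop) fun θ => (h.normSq_pos θ).ne'

theorem normalAngle_zero (h : IsProfile ρ) : normalAngle ρ 0 = 0 := by
  simp [normalAngle, h.deriv_eq_zero sin_zero]

theorem normalAngle_pi (h : IsProfile ρ) : normalAngle ρ π = π := by
  simp [normalAngle, h.deriv_eq_zero sin_pi]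

theorem normalAngleDeriv_pos (h : IsProfile ρ) (θ : ℝ) : 0 < normalAngleDeriv ρ θ := by
  have hne : ∀ x, normalAngleDeriv ρ x ≠ 0 := fun x =>
    div_ne_zero (fun h0 => h.curv x (by linarith)) (h.normSq_pos x).ne'
  by_contra hle
  obtain ⟨x, _, hx⟩ := exists_hasDerivAt_eq_slope (normalAngle ρ) (normalAngleDeriv ρ) pi_pos
    (fun x _ => (h.hasDerivAt_normalAngle x).continuousAt.continuousWithinAt)
    (fun x _ => h.hasDerivAt_normalAngle x)
  rw [h.normalAngle_pi, h.normalAngle_zero, sub_zero, div_self pi_ne_zero] at hx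
  obtain ⟨y, hy⟩ := mem_range_of_exists_le_of_exists_ge h.continuous_normalAngleDeriv ⟨θ, not_lt.1 hle⟩
    ⟨x, hx.symm ▸ zero_le_one⟩
  exact hne y hy

theorem strictMono_normalAngle (h : IsProfile ρ) : StrictMono (normalAngle ρ) :=
  strictMono_of_deriv_pos fun θ => by
    rw [(h.hasDerivAt_normalAngle θ).deriv]
    exact h.normalAngleDeriv_pos θ

theorem normalAngle_mem (h : IsProfile ρ) {θ : ℝ} (hθ : θ ∈ Set.Ioo 0 π) : normalAngle ρ θ ∈ Set.Ioo 0 π :=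
  ⟨h.normalAngle_zero ▸ h.strictMono_normalAngle hθ.1, (h.strictMono_normalAngle hθ.2).trans_eq h.normalAngle_pi⟩

theorem contDiff_cosDeriv_Z (h : IsProfile ρ) : ContDiff ℝ (⊤ : ℕ∞) (cosDeriv (meridianZ ρ)) :=
  contDiff_cosDeriv h.contDiff_Z h.Z_even h.Z_periodic

theorem contDiff_speed (h : IsProfile ρ) : ContDiff ℝ (⊤ : ℕ∞) (meridianSpeed ρ) :=
  ((h.smooth.pow 2).add (h.contDiff_deriv.pow 2)).sqrt fun θ => (h.normSq_pos θ).ne'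

theorem hasDerivAt_speed (h : IsProfile ρ) (θ : ℝ) :
    HasDerivAt (meridianSpeed ρ) (deriv (meridianSpeed ρ) θ) θ :=
  (h.contDiff_speed.differentiable (by simp) θ).hasDerivAt

theorem cos_mul_cosDeriv_Z (h : IsProfile ρ) {θ : ℝ} (hθ : sin θ = 0) (hτ : sin (normalAngle ρ θ) = 0) :
    cos θ * cosDeriv (meridianZ ρ) θ = meridianSpeed ρ θ * (cos (normalAngle ρ θ) * normalAngleDeriv ρ θ) := by
  have hL := (h.contDiff_cosDeriv_Z.differentiable (by simp) θ).hasDerivAt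
  have h1 := (hasDerivAt_sin θ).mul hL
  have h2 := (h.hasDerivAt_speed θ).mul (h.hasDerivAt_normalAngle θ).sin
  have h3 : (sin * cosDeriv (meridianZ ρ)) = (meridianSpeed ρ * fun x => sin (normalAngle ρ x)) :=
    funext fun x => h.sin_mul_cosDeriv_Z x
  rw [h3] at h1
  have := h1.unique h2
  rw [hθ, hτ] at this
  linarith

theorem cosDeriv_Z_pos (h : IsProfile ρ) {θ : ℝ} (hθ : θ ∈ Set.Icc 0 π) : 0 < cosDeriv (meridianZ ρ) θ := by
  have hp := mul_pos (h.speed_pos θ) (h.normalAngleDeriv_pos θ)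
  rcases hθ.1.eq_or_lt with rfl | h0
  · have := h.cos_mul_cosDeriv_Z sin_zero (by rw [h.normalAngle_zero, sin_zero])
    rw [h.normalAngle_zero, cos_zero] at this
    linarith
  rcases hθ.2.eq_or_lt with rfl | h1
  · have := h.cos_mul_cosDeriv_Z sin_pi (by rw [h.normalAngle_pi, sin_pi])
    rw [h.normalAngle_pi, cos_pi] at this
    linarith
  have hτ := h.normalAngle_mem ⟨h0, h1⟩
  have := mul_pos (h.speed_pos θ) (sin_pos_of_pos_of_lt_pi hτ.1 hτ.2)
  rw [← h.sin_mul_cosDeriv_Z] at this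
  exact (pos_iff_pos_of_mul_pos this).1 (sin_pos_of_pos_of_lt_pi h0 h1)

theorem exists_normalAngle_eq (h : IsProfile ρ) {α : ℝ} (hα : α ∈ Set.Ioo 0 π) :
    ∃ θ ∈ Set.Ioo 0 π, normalAngle ρ θ = α := by
  have hc : ContinuousOn (normalAngle ρ) (Set.Icc 0 π) :=
    fun x _ => (h.hasDerivAt_normalAngle x).continuousAt.continuousWithinAt
  have := intermediate_value_Ioo pi_pos.le hc
  rw [h.normalAngle_zero, h.normalAngle_pi] at this
  exact this hα

theorem support_eq (h : IsProfile ρ) (θ : ℝ) :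
    sin (normalAngle ρ θ) * meridianX ρ θ + cos (normalAngle ρ θ) * meridianZ ρ θ = ρ θ ^ 2 / meridianSpeed ρ θ := by
  have h1 := h.speed_mul_cos θ
  have h2 := h.speed_pos θ
  have h3 : cos (arctan (deriv ρ θ / ρ θ)) = cos (θ - normalAngle ρ θ) := by rw [normalAngle, sub_sub_cancel]
  rw [h3, cos_sub] at h1
  rw [eq_div_iff h2.ne', meridianX, meridianZ]
  linear_combination ρ θ * h1

theorem mul_le_sin {y α : ℝ} (hα : α ∈ Set.Ioo 0 π) (h0 : 0 ≤ y) (hy : y ≤ α) : sin α / π * y ≤ sin y := by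
  have hs := sin_pos_of_pos_of_lt_pi hα.1 hα.2
  have hconc := strictConcaveOn_sin_Icc.concaveOn.2 ⟨le_rfl, pi_pos.le⟩ ⟨hα.1.le, hα.2.le⟩
    (sub_nonneg.2 ((div_le_one hα.1).2 hy)) (div_nonneg h0 hα.1.le) (sub_add_cancel 1 (y / α))
  have e : y / α * α = y := div_mul_cancel₀ y hα.1.ne'
  simp only [smul_eq_mul, mul_zero, sin_zero, zero_add, e] at hconc
  refine le_trans ?_ hconc
  rw [div_mul_eq_mul_div, div_mul_eq_mul_div, mul_comm y]
  exact div_le_div_of_nonneg_left (by positivity) hα.1 hα.2.le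

theorem hasDerivAt_weight (h : IsProfile ρ) : ∃ g' : ℝ → ℝ, Continuous g' ∧
    ∀ θ, HasDerivAt (meridianWeight ρ) (g' θ) θ := by
  have h1 : ContDiff ℝ (⊤ : ℕ∞) fun θ => √(ρ θ) * cosDeriv (meridianZ ρ) θ :=
    (h.smooth.sqrt fun θ => (h.pos θ).ne').mul h.contDiff_cosDeriv_Z
  have h2 := fun θ => (h1.differentiable (by simp) θ).hasDerivAt
  have h3 := (contDiff_deriv_of_top h1).continuous
  have h4 := h1.continuous
  refine ⟨_, ?_, fun θ => (h2 θ).mul ((hasDerivAt_sin θ).rpow_const (p := 3 / 2) (Or.inr (by norm_num)))⟩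
  have h5 : Continuous fun θ : ℝ => sin θ ^ (3 / 2 : ℝ) := continuous_sin.rpow_const fun _ => Or.inr (by norm_num)
  have h6 : Continuous fun θ : ℝ => sin θ ^ (3 / 2 - 1 : ℝ) := continuous_sin.rpow_const fun _ => Or.inr (by norm_num)
  fun_prop

theorem stationary_error_le {Λ : ℝ} (hΛ : 1 ≤ Λ) :
    (Λ ^ (-(2 / 5) : ℝ)) ^ 2 + Λ * (Λ ^ (-(2 / 5) : ℝ)) ^ 4 + 1 / (Λ * Λ ^ (-(2 / 5) : ℝ))
      + 1 / (Λ ^ 2 * (Λ ^ (-(2 / 5) : ℝ)) ^ 3) ≤ 4 * Λ ^ (-(3 / 5) : ℝ) := by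
  have h0 : 0 < Λ := by linarith
  have e1 : (Λ ^ (-(2 / 5) : ℝ)) ^ 2 = Λ ^ (-(4 / 5) : ℝ) := by
    rw [← rpow_natCast, ← rpow_mul h0.le]; norm_num
  have e2 : Λ * (Λ ^ (-(2 / 5) : ℝ)) ^ 4 = Λ ^ (-(3 / 5) : ℝ) := by
    rw [← rpow_natCast, ← rpow_mul h0.le]
    nth_rewrite 1 [← rpow_one Λ]
    rw [← rpow_add h0]; norm_num
  have e3 : 1 / (Λ * Λ ^ (-(2 / 5) : ℝ)) = Λ ^ (-(3 / 5) : ℝ) := by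
    nth_rewrite 1 [← rpow_one Λ]
    rw [← rpow_add h0, one_div, ← rpow_neg h0.le]; norm_num
  have e4 : 1 / (Λ ^ 2 * (Λ ^ (-(2 / 5) : ℝ)) ^ 3) = Λ ^ (-(4 / 5) : ℝ) := by
    rw [← rpow_natCast, ← rpow_natCast, ← rpow_mul h0.le, ← rpow_add h0, one_div, ← rpow_neg h0.le]; norm_num
  have e5 : Λ ^ (-(4 / 5) : ℝ) ≤ Λ ^ (-(3 / 5) : ℝ) := rpow_le_rpow_of_exponent_le hΛ (by norm_num)
  rw [e1, e2, e3, e4]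
  linarith

theorem mul_sub_le_normalAngle_sub (h : IsProfile ρ) {c : ℝ} (hc : ∀ x ∈ Set.Icc 0 π, c ≤ normalAngleDeriv ρ x)
    {x y : ℝ} (hx : x ∈ Set.Icc 0 π) (hy : y ∈ Set.Icc 0 π) (hxy : x ≤ y) :
    c * (y - x) ≤ normalAngle ρ y - normalAngle ρ x :=
  (convex_Icc 0 π).mul_sub_le_image_sub_of_le_deriv
    (fun z _ => (h.hasDerivAt_normalAngle z).continuousAt.continuousWithinAt)
    (fun z _ => (h.hasDerivAt_normalAngle z).differentiableAt.differentiableWithinAt)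
    (fun z hz => by
      rw [(h.hasDerivAt_normalAngle z).deriv]
      exact hc z (interior_subset hz)) x hx y hy hxy

/-- The quantitative stationary phase estimate for the meridian integral. -/
theorem exists_meridian_stationary (h : IsProfile ρ) : ∃ c C : ℝ, 0 < c ∧ 0 < C ∧
    ∀ θ ∈ Set.Ioo 0 π, ∀ Λ : ℝ, 1 ≤ Λ → Λ ^ (-(2 / 5) : ℝ) ≤ c * sin (normalAngle ρ θ) →
        ‖(∫ x in (0 : ℝ)..π, (meridianWeight ρ x : ℂ) *
            ee (-(Λ * (sin (normalAngle ρ θ) * meridianX ρ x + cos (normalAngle ρ θ) * meridianZ ρ x))))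
          - 2 * meridianWeight ρ θ * ((starRingEnd ℂ) fresnelConst /
              √(Λ * (meridianSpeed ρ θ * normalAngleDeriv ρ θ) / 2)) *
            ee (-(Λ * (ρ θ ^ 2 / meridianSpeed ρ θ)))‖ ≤ C / sin (normalAngle ρ θ) ^ 2 * Λ ^ (-(3 / 5) : ℝ) := by
  obtain ⟨cr, Cr, hcr, hCr, hr⟩ := exists_bounds_of_pos h.contDiff_speed.continuous fun θ _ => h.speed_pos θ
  obtain ⟨ct, Ct, hct, hCt, ht⟩ := exists_bounds_of_pos h.continuous_normalAngleDeriv fun θ _ => h.normalAngleDeriv_pos θ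
  obtain ⟨cl, Cl, hcl, hCl, hl⟩ := exists_bounds_of_pos h.contDiff_cosDeriv_Z.continuous fun θ => h.cosDeriv_Z_pos
  have sX1 := contDiff_deriv_of_top h.contDiff_X
  have sX2 := contDiff_deriv_of_top sX1
  have sX3 := contDiff_deriv_of_top sX2
  have sZ1 := contDiff_deriv_of_top h.contDiff_Z
  have sZ2 := contDiff_deriv_of_top sZ1
  have sZ3 := contDiff_deriv_of_top sZ2
  have dd : ∀ {k : ℝ → ℝ}, ContDiff ℝ (⊤ : ℕ∞) k → ∀ x, HasDerivAt k (deriv k x) x := fun hk x =>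
    (hk.differentiable (by simp) x).hasDerivAt
  obtain ⟨a2, ha2, hX2⟩ := exists_abs_bound sX2.continuous
  obtain ⟨a3, ha3, hX3⟩ := exists_abs_bound sX3.continuous
  obtain ⟨b2, hb2, hZ2⟩ := exists_abs_bound sZ2.continuous
  obtain ⟨b3, hb3, hZ3⟩ := exists_abs_bound sZ3.continuous
  obtain ⟨g', hg', dg⟩ := h.hasDerivAt_weight
  have hg : Continuous (meridianWeight ρ) := continuous_iff_continuousAt.2 fun x => (dg x).continuousAt
  obtain ⟨G0, hG0, hgG0⟩ := exists_abs_bound hg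
  obtain ⟨G1, hG1, hgG1⟩ := exists_abs_bound hg'
  set m0 := min 1 (cr * ct / π) with hm0
  have hm0p : 0 < m0 := lt_min one_pos (by positivity)
  set M := 1 + a2 + a3 + b2 + b3 with hM
  set G := G0 + G1 with hG
  refine ⟨cr / Cl, 2 * (8 + π) * G * M / m0 ^ 2 * 4, by positivity, by positivity, ?_⟩
  intro θ hθ Λ hΛ hδ
  have hθ' : θ ∈ Set.Icc 0 π := ⟨hθ.1.le, hθ.2.le⟩
  set α := normalAngle ρ θ with hα
  have hαm : α ∈ Set.Ioo 0 π := h.normalAngle_mem hθ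
  have hs : 0 < sin α := sin_pos_of_pos_of_lt_pi hαm.1 hαm.2
  have hsθ : 0 < sin θ := sin_pos_of_pos_of_lt_pi hθ.1 hθ.2
  have hlow : cr / Cl * sin α ≤ sin θ := by
    have h1 := h.sin_mul_cosDeriv_Z θ
    have h2 : sin θ * cosDeriv (meridianZ ρ) θ ≤ sin θ * Cl := mul_le_mul_of_nonneg_left (hl θ hθ').2 hsθ.le
    have h3 : cr * sin α ≤ meridianSpeed ρ θ * sin α := mul_le_mul_of_nonneg_right (hr θ hθ').1 hs.le
    rw [div_mul_eq_mul_div, div_le_iff₀ hCl]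
    linarith
  have hf1 : ∀ x, sin α * deriv (meridianX ρ) x + cos α * deriv (meridianZ ρ) x
      = meridianSpeed ρ x * sin (α - normalAngle ρ x) := fun x => by
    rw [(h.hasDerivAt_X x).deriv, (h.hasDerivAt_Z x).deriv, sin_sub]
    ring
  have hκ : -(sin α * deriv (deriv (meridianX ρ)) θ + cos α * deriv (deriv (meridianZ ρ)) θ)
      = meridianSpeed ρ θ * normalAngleDeriv ρ θ := by
    have h1 := ((dd sX1 θ).const_mul (sin α)).add ((dd sZ1 θ).const_mul (cos α))
    have h2 := (h.hasDerivAt_speed θ).mul ((h.hasDerivAt_normalAngle θ).const_sub α).sin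
    have h3 : ((fun x => sin α * deriv (meridianX ρ) x) + fun x => cos α * deriv (meridianZ ρ) x)
      = (meridianSpeed ρ * fun x => sin (α - normalAngle ρ x)) := funext hf1
    rw [h3] at h1
    rw [h1.unique h2, ← hα, sub_self, sin_zero, cos_zero]
    ring
  have hmκ : m0 * sin α ≤ meridianSpeed ρ θ * normalAngleDeriv ρ θ := by
    have h1 : cr * ct ≤ meridianSpeed ρ θ * normalAngleDeriv ρ θ :=
      mul_le_mul (hr θ hθ').1 (ht θ hθ').1 hct.le (hcr.le.trans (hr θ hθ').1)
    have h2 : m0 ≤ cr * ct := (min_le_right _ _).trans (div_le_self (by positivity) (by linarith [pi_gt_three]))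
    nlinarith [sin_le_one α]
  have hmono : ∀ x ∈ Set.Icc 0 π, ∀ y, ∀ z, y ∈ Set.Ioo 0 π → sin y = sin α → 0 ≤ z → 0 ≤ ct * z → ∀ w, ct * z ≤ w → w ≤ y →
      m0 * sin α * z ≤ meridianSpeed ρ x * sin w := by
    intro x hx y z hy hys hz hz0 w hw hwy
    have h1 := mul_le_sin hy (hz0.trans hw) hwy
    rw [hys] at h1
    have h2 : m0 ≤ cr * ct / π := min_le_right _ _
    calc m0 * sin α * z ≤ cr * ct / π * sin α * z := by gcongr
      _ = cr * (sin α / π * (ct * z)) := by ring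
      _ ≤ cr * (sin α / π * w) := by gcongr
      _ ≤ cr * sin w := by gcongr
      _ ≤ _ := mul_le_mul_of_nonneg_right (hr x hx).1 (le_trans (by have := hz0.trans hw; positivity) h1)
  have key := stationary_phase_max (f := fun x => sin α * meridianX ρ x + cos α * meridianZ ρ x)
    (f1 := fun x => sin α * deriv (meridianX ρ) x + cos α * deriv (meridianZ ρ) x)
    (f2 := fun x => sin α * deriv (deriv (meridianX ρ)) x + cos α * deriv (deriv (meridianZ ρ)) x)
    (f3 := fun x => sin α * deriv (deriv (deriv (meridianX ρ))) x + cos α * deriv (deriv (deriv (meridianZ ρ))) x)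
    (g := meridianWeight ρ) (g' := g') (a := 0) (b := π) (c := θ) (m := m0 * sin α) (M := M) (G := G) (Λ := Λ)
    (δ := Λ ^ (-(2 / 5) : ℝ)) (by positivity) (mul_le_one₀ (min_le_left _ _) hs.le (sin_le_one α))
    (by rw [hM]; linarith) (by positivity) (by rw [hκ]; exact hmκ)
    (fun x => ((dd h.contDiff_X x).const_mul _).add ((dd h.contDiff_Z x).const_mul _))
    (fun x => ((dd sX1 x).const_mul _).add ((dd sZ1 x).const_mul _))
    (fun x => ((dd sX2 x).const_mul _).add ((dd sZ2 x).const_mul _))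
    (by simp only [hf1, ← hα, sub_self, sin_zero, mul_zero])
    (fun x hx => by
      have hx' : x ∈ Set.Icc 0 π := ⟨hx.1, hx.2.trans hθ'.2⟩
      rw [hf1]
      refine hmono x hx' α _ hαm rfl (sub_nonneg.2 hx.2) (mul_nonneg hct.le (sub_nonneg.2 hx.2)) _
        (h.mul_sub_le_normalAngle_sub (fun y hy => (ht y hy).1) hx' hθ' hx.2) ?_
      have := h.strictMono_normalAngle.monotone hx.1
      rw [h.normalAngle_zero] at this
      linarith)
    (fun x hx => by
      have hx' : x ∈ Set.Icc 0 π := ⟨hθ'.1.trans hx.1, hx.2⟩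
      rw [hf1, ← mul_neg, ← sin_neg, neg_sub]
      refine hmono x hx' (π - α) _ ⟨by linarith [hαm.2], by linarith [hαm.1]⟩ (sin_pi_sub α) (sub_nonneg.2 hx.1)
        (mul_nonneg hct.le (sub_nonneg.2 hx.1)) _
        (h.mul_sub_le_normalAngle_sub (fun y hy => (ht y hy).1) hθ' hx' hx.1) ?_
      have := h.strictMono_normalAngle.monotone hx.2
      rw [h.normalAngle_pi] at this
      linarith)
    (fun x hx => by
      have h1 := abs_add_le (sin α * deriv (deriv (meridianX ρ)) x) (cos α * deriv (deriv (meridianZ ρ)) x)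
      rw [abs_mul, abs_mul] at h1
      have h2 := mul_le_of_le_one_left (abs_nonneg (deriv (deriv (meridianX ρ)) x)) (abs_sin_le_one α)
      have h3 := mul_le_of_le_one_left (abs_nonneg (deriv (deriv (meridianZ ρ)) x)) (abs_cos_le_one α)
      linarith [hX2 x hx, hZ2 x hx])
    (fun x hx => by
      have h1 := abs_add_le (sin α * deriv (deriv (deriv (meridianX ρ))) x) (cos α * deriv (deriv (deriv (meridianZ ρ))) x)
      rw [abs_mul, abs_mul] at h1
      have h2 := mul_le_of_le_one_left (abs_nonneg (deriv (deriv (deriv (meridianX ρ))) x)) (abs_sin_le_one α)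
      have h3 := mul_le_of_le_one_left (abs_nonneg (deriv (deriv (deriv (meridianZ ρ))) x)) (abs_cos_le_one α)
      linarith [hX3 x hx, hZ3 x hx])
    dg hg' (fun x hx => (hgG0 x hx).trans (by linarith)) (fun x hx => (hgG1 x hx).trans (by linarith))
    (by linarith) (by positivity)
    (by linarith [sin_le hθ'.1])
    (by
      have := sin_le (sub_nonneg.2 hθ'.2)
      rw [sin_pi_sub] at this
      linarith)
  have hsup := h.support_eq θ
  rw [← hα] at hsup
  simp only [hκ, hsup, sub_zero] at key
  refine key.trans ?_
  have hE := stationary_error_le hΛ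
  calc _ ≤ 2 * (8 + π) * G * M / (m0 * sin α) ^ 2 * (4 * Λ ^ (-(3 / 5) : ℝ)) := by gcongr
    _ = _ := by rw [mul_pow]; field_simp

/-- Asymptotics of the oscillatory integral over the meridian. -/
theorem exists_meridian_asymptotic (h : IsProfile ρ) : ∃ (A H : ℝ → ℝ) (c C : ℝ), 0 < c ∧ 0 < C ∧
    ∀ α ∈ Set.Ioo 0 π, c * sin α ^ (3 / 2 : ℝ) ≤ A α ∧ A α ≤ C * sin α ^ (3 / 2 : ℝ) ∧ c ≤ H α ∧ H α ≤ C ∧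
      ∀ Λ : ℝ, 1 ≤ Λ → Λ ^ (-(2 / 5) : ℝ) ≤ c * sin α →
        ‖(∫ θ in (0 : ℝ)..π, (meridianWeight ρ θ : ℂ) *
            ee (-(Λ * (sin α * meridianX ρ θ + cos α * meridianZ ρ θ))))
          - A α / √Λ * (starRingEnd ℂ) fresnelConst * ee (-(Λ * H α))‖ ≤ C / sin α ^ 2 * Λ ^ (-(3 / 5) : ℝ) := by
  choose! θc hθc hτ using fun α (hα : α ∈ Set.Ioo 0 π) => h.exists_normalAngle_eq hα
  obtain ⟨cr, Cr, hcr, hCr, hr⟩ := exists_bounds_of_pos h.contDiff_speed.continuous fun θ _ => h.speed_pos θ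
  obtain ⟨ct, Ct, hct, hCt, ht⟩ := exists_bounds_of_pos h.continuous_normalAngleDeriv fun θ _ => h.normalAngleDeriv_pos θ
  obtain ⟨cl, Cl, hcl, hCl, hl⟩ := exists_bounds_of_pos h.contDiff_cosDeriv_Z.continuous fun θ => h.cosDeriv_Z_pos
  obtain ⟨cp, Cp, hcp, hCp, hp⟩ := exists_bounds_of_pos h.smooth.continuous fun θ _ => h.pos θ
  obtain ⟨cs, Cs, hcs, hCs, hstat⟩ := h.exists_meridian_stationary
  set k1 := 2 * √2 * (√cp * cl * (cr / Cl) ^ (3 / 2 : ℝ)) / √(Cr * Ct) with hk1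
  set k2 := 2 * √2 * (√Cp * Cl * (Cr / cl) ^ (3 / 2 : ℝ)) / √(cr * ct) with hk2
  refine ⟨fun α => 2 * √2 * meridianWeight ρ (θc α) / √(meridianSpeed ρ (θc α) * normalAngleDeriv ρ (θc α)),
    fun α => ρ (θc α) ^ 2 / meridianSpeed ρ (θc α), min cs (min k1 (cp ^ 2 / Cr)), max Cs (max k2 (Cp ^ 2 / cr)),
    lt_min hcs (lt_min (by positivity) (by positivity)), lt_max_of_lt_left hCs, ?_⟩
  intro α hα
  beta_reduce
  have hs : 0 < sin α := sin_pos_of_pos_of_lt_pi hα.1 hα.2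
  obtain ⟨hθ, hτα⟩ := And.intro (hθc α hα) (hτ α hα)
  generalize θc α = θ at hθ hτα
  have hθ' : θ ∈ Set.Icc 0 π := ⟨hθ.1.le, hθ.2.le⟩
  have hsθ : 0 < sin θ := sin_pos_of_pos_of_lt_pi hθ.1 hθ.2
  have hid := h.sin_mul_cosDeriv_Z θ
  rw [hτα] at hid
  obtain ⟨hl1, hl2⟩ := hl θ hθ'
  obtain ⟨hr1, hr2⟩ := hr θ hθ'
  obtain ⟨hp1, hp2⟩ := hp θ hθ'
  obtain ⟨ht1, ht2⟩ := ht θ hθ'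
  have hL := h.cosDeriv_Z_pos hθ'
  have hlow : cr / Cl * sin α ≤ sin θ := by
    rw [div_mul_eq_mul_div, div_le_iff₀ hCl]
    nlinarith
  have hupp : sin θ ≤ Cr / cl * sin α := by
    rw [div_mul_eq_mul_div, le_div_iff₀ hcl]
    nlinarith
  have hw1 : √cp * cl * (cr / Cl) ^ (3 / 2 : ℝ) * sin α ^ (3 / 2 : ℝ) ≤ meridianWeight ρ θ := by
    rw [mul_assoc, ← mul_rpow (by positivity) hs.le, meridianWeight]
    gcongr
  have hw2 : meridianWeight ρ θ ≤ √Cp * Cl * (Cr / cl) ^ (3 / 2 : ℝ) * sin α ^ (3 / 2 : ℝ) := by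
    rw [mul_assoc, ← mul_rpow (by positivity) hs.le, meridianWeight]
    gcongr
  have hspos := h.speed_pos θ
  have htpos := h.normalAngleDeriv_pos θ
  have hw0 : 0 ≤ meridianWeight ρ θ := le_trans (by positivity) hw1
  have hsα : 0 < sin α ^ (3 / 2 : ℝ) := rpow_pos_of_pos hs _
  refine ⟨?_, ?_, ?_, ?_, ?_⟩
  · refine (mul_le_mul_of_nonneg_right ((min_le_right _ _).trans (min_le_left _ _)) hsα.le).trans ?_
    calc k1 * sin α ^ (3 / 2 : ℝ)
        = 2 * √2 * (√cp * cl * (cr / Cl) ^ (3 / 2 : ℝ) * sin α ^ (3 / 2 : ℝ)) / √(Cr * Ct) := by rw [hk1]; ring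
      _ ≤ _ := by gcongr
  · refine le_trans ?_ (mul_le_mul_of_nonneg_right ((le_max_left _ _).trans (le_max_right _ _)) hsα.le)
    calc _ ≤ 2 * √2 * (√Cp * Cl * (Cr / cl) ^ (3 / 2 : ℝ) * sin α ^ (3 / 2 : ℝ)) / √(cr * ct) := by gcongr
      _ = _ := by rw [hk2]; ring
  · refine ((min_le_right _ _).trans (min_le_right _ _)).trans ?_
    gcongr
  · refine le_trans ?_ ((le_max_right _ _).trans (le_max_right _ _))
    gcongr
    exact (h.pos θ).le
  · intro Λ hΛ hδ
    have hst := hstat θ hθ Λ hΛ (by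
      rw [hτα]
      exact hδ.trans (mul_le_mul_of_nonneg_right (min_le_left _ _) hs.le))
    rw [hτα] at hst
    have e : ((2 * √2 * meridianWeight ρ θ / √(meridianSpeed ρ θ * normalAngleDeriv ρ θ) : ℝ) : ℂ) / (√Λ : ℝ)
        * (starRingEnd ℂ) fresnelConst = 2 * meridianWeight ρ θ * ((starRingEnd ℂ) fresnelConst /
              (√(Λ * (meridianSpeed ρ θ * normalAngleDeriv ρ θ) / 2) : ℝ)) := by
      have hκ : 0 < meridianSpeed ρ θ * normalAngleDeriv ρ θ := by positivity
      generalize meridianSpeed ρ θ * normalAngleDeriv ρ θ = κ at hκ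
      rw [Real.sqrt_div' _ (by norm_num), Real.sqrt_mul (by linarith)]
      push_cast
      field_simp
    rw [e]
    refine hst.trans ?_
    gcongr
    exact le_max_left _ _

end IsProfile

end MeridianCurve

section BodyGauge

/-- Euclidean length in coordinates. -/
noncomputable def euNorm (x : Fin 3 → ℝ) : ℝ := √(x 0 ^ 2 + x 1 ^ 2 + x 2 ^ 2)

/-- Angle with the third axis. -/
noncomputable def polarAngle (x : Fin 3 → ℝ) : ℝ := arccos (x 2 / euNorm x)

/-- Minkowski functional of the body with polar profile `ρ`. -/
noncomputable def bodyGauge (ρ : ℝ → ℝ) (x : Fin 3 → ℝ) : ℝ := euNorm x / ρ (polarAngle x)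

theorem euNorm_nonneg (x : Fin 3 → ℝ) : 0 ≤ euNorm x := Real.sqrt_nonneg _

theorem euNorm_sq (x : Fin 3 → ℝ) : euNorm x ^ 2 = x 0 ^ 2 + x 1 ^ 2 + x 2 ^ 2 := Real.sq_sqrt (by positivity)

theorem norm_le_euNorm (x : Fin 3 → ℝ) : ‖x‖ ≤ euNorm x := by
  refine (pi_norm_le_iff_of_nonneg (euNorm_nonneg x)).2 fun i => ?_
  rw [Real.norm_eq_abs]
  refine Real.abs_le_sqrt ?_
  fin_cases i <;> simp <;> linarith [sq_nonneg (x 0), sq_nonneg (x 1), sq_nonneg (x 2)]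

theorem euNorm_le (x : Fin 3 → ℝ) : euNorm x ≤ 2 * ‖x‖ := by
  refine Real.sqrt_le_iff.2 ⟨by positivity, ?_⟩
  have h : ∀ i, x i ^ 2 ≤ ‖x‖ ^ 2 := fun i => by
    rw [← sq_abs]
    exact pow_le_pow_left₀ (abs_nonneg _) (norm_le_pi_norm x i) 2
  nlinarith [h 0, h 1, h 2, sq_nonneg ‖x‖]

theorem euNorm_pos {x : Fin 3 → ℝ} (hx : x ≠ 0) : 0 < euNorm x := (norm_pos_iff.2 hx).trans_le (norm_le_euNorm x)

theorem euNorm_smul {s : ℝ} (hs : 0 ≤ s) (x : Fin 3 → ℝ) : euNorm (s • x) = s * euNorm x := by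
  rw [euNorm, euNorm, ← Real.sqrt_sq hs, ← Real.sqrt_mul (by positivity), Real.sqrt_sq hs]
  simp only [Pi.smul_apply, smul_eq_mul]
  ring_nf

theorem continuous_euNorm : Continuous euNorm := by unfold euNorm; fun_prop

theorem polarAngle_smul {s : ℝ} (hs : 0 < s) (x : Fin 3 → ℝ) : polarAngle (s • x) = polarAngle x := by
  rw [polarAngle, polarAngle, euNorm_smul hs.le, Pi.smul_apply, smul_eq_mul, mul_div_mul_left _ _ hs.ne']

theorem div_euNorm_mem (x : Fin 3 → ℝ) : x 2 / euNorm x ∈ Set.Icc (-1 : ℝ) 1 := by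
  have h : |x 2 / euNorm x| ≤ 1 := by
    rw [abs_div, abs_of_nonneg (euNorm_nonneg x)]
    exact div_le_one_of_le₀ ((norm_le_pi_norm x 2).trans (norm_le_euNorm x)) (euNorm_nonneg x)
  exact abs_le.1 h

theorem polarAngle_mem (x : Fin 3 → ℝ) : polarAngle x ∈ Set.Icc 0 π := ⟨arccos_nonneg _, arccos_le_pi _⟩

theorem euNorm_mul_cos (x : Fin 3 → ℝ) : euNorm x * cos (polarAngle x) = x 2 := by
  rcases eq_or_ne x 0 with rfl | hx
  · simp [euNorm]
  have h := div_euNorm_mem x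
  rw [polarAngle, cos_arccos h.1 h.2, mul_div_cancel₀ _ (euNorm_pos hx).ne']

theorem sq_euNorm_mul_sin (x : Fin 3 → ℝ) : (euNorm x * sin (polarAngle x)) ^ 2 = x 0 ^ 2 + x 1 ^ 2 := by
  have h1 := euNorm_mul_cos x
  have h2 := euNorm_sq x
  have h3 := sin_sq_add_cos_sq (polarAngle x)
  rw [← h1] at h2
  linear_combination (euNorm x) ^ 2 * h3 + h2

theorem sin_polarAngle_nonneg (x : Fin 3 → ℝ) : 0 ≤ sin (polarAngle x) :=
  sin_nonneg_of_mem_Icc (polarAngle_mem x)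

variable {ρ : ℝ → ℝ}

namespace IsProfile

theorem bodyGauge_smul {s : ℝ} (hs : 0 ≤ s) (x : Fin 3 → ℝ) : bodyGauge ρ (s • x) = s * bodyGauge ρ x := by
  rcases hs.eq_or_lt with rfl | hs
  · simp [bodyGauge, euNorm]
  · rw [bodyGauge, bodyGauge, euNorm_smul hs.le, polarAngle_smul hs, mul_div_assoc]

theorem bodyGauge_nonneg (h : IsProfile ρ) (x : Fin 3 → ℝ) : 0 ≤ bodyGauge ρ x :=
  div_nonneg (euNorm_nonneg x) (h.pos _).le

theorem exists_gauge_bounds (h : IsProfile ρ) : ∃ c C : ℝ, 0 < c ∧ 0 < C ∧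
    ∀ x, c * ‖x‖ ≤ bodyGauge ρ x ∧ bodyGauge ρ x ≤ C * ‖x‖ := by
  obtain ⟨c, C, hc, hC, hb⟩ := exists_bounds_of_pos h.smooth.continuous fun θ _ => h.pos θ
  refine ⟨1 / C, 2 / c, by positivity, by positivity, fun x => ?_⟩
  obtain ⟨h1, h2⟩ := hb _ (polarAngle_mem x)
  have h3 := h.pos (polarAngle x)
  constructor
  · rw [bodyGauge, one_div_mul_eq_div]
    exact div_le_div₀ (euNorm_nonneg x) (norm_le_euNorm x) h3 h2
  · rw [bodyGauge, div_mul_eq_mul_div]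
    exact div_le_div₀ (by positivity) (euNorm_le x) hc h1

theorem continuous_bodyGauge (h : IsProfile ρ) : Continuous (bodyGauge ρ) := by
  rw [continuous_iff_continuousAt]
  intro x
  rcases eq_or_ne x 0 with rfl | hx
  · obtain ⟨c, C, hc, hC, hb⟩ := h.exists_gauge_bounds
    have h0 : bodyGauge ρ 0 = 0 := by simp [bodyGauge, euNorm]
    rw [ContinuousAt, h0]
    refine squeeze_zero (fun x => h.bodyGauge_nonneg x) (fun x => (hb x).2) ?_
    have : Continuous fun x : Fin 3 → ℝ => C * ‖x‖ := by fun_prop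
    simpa using this.tendsto 0
  · have h1 : ContinuousAt (fun x : Fin 3 → ℝ => x 2 / euNorm x) x :=
      (continuous_apply 2).continuousAt.div continuous_euNorm.continuousAt (euNorm_pos hx).ne'
    exact continuous_euNorm.continuousAt.div
      ((h.smooth.continuous.comp continuous_arccos).continuousAt.comp h1) (h.pos _).ne'

theorem contDiffOn_bodyGauge (h : IsProfile ρ) (n : ℕ) : ContDiffOn ℝ n (bodyGauge ρ) {x | x ≠ 0} := by
  have h1 : ContDiffOn ℝ n euNorm {x | x ≠ 0} := by
    refine ContDiffOn.sqrt (by fun_prop) fun x hx => ?_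
    rw [← euNorm_sq]
    exact (pow_pos (euNorm_pos hx) 2).ne'
  have h2 : ContDiffOn ℝ n (fun x : Fin 3 → ℝ => x 2 / euNorm x) {x | x ≠ 0} :=
    ContDiffOn.div (by fun_prop) h1 fun x hx => (euNorm_pos hx).ne'
  exact h1.div ((contDiffOn_comp_arccos n h.smooth h.even h.per).comp h2 fun x _ => div_euNorm_mem x)
    fun x _ => (h.pos _).ne'

theorem strictAntiOn_Z (h : IsProfile ρ) : StrictAntiOn (meridianZ ρ) (Set.Icc 0 π) := by
  refine strictAntiOn_of_deriv_neg (convex_Icc 0 π) h.contDiff_Z.continuous.continuousOn fun θ hθ => ?_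
  rw [interior_Icc] at hθ
  have hτ := h.normalAngle_mem hθ
  rw [(h.hasDerivAt_Z θ).deriv]
  exact neg_neg_of_pos (mul_pos (h.speed_pos θ) (sin_pos_of_pos_of_lt_pi hτ.1 hτ.2))

theorem bodyGauge_le_one_iff (h : IsProfile ρ) (x : Fin 3 → ℝ) :
    bodyGauge ρ x ≤ 1 ↔ euNorm x ≤ ρ (polarAngle x) := div_le_one (h.pos _)

theorem meridianX_nonneg (h : IsProfile ρ) {θ : ℝ} (hθ : θ ∈ Set.Icc 0 π) : 0 ≤ meridianX ρ θ :=
  mul_nonneg (h.pos θ).le (sin_nonneg_of_mem_Icc hθ)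

theorem eq_pi_div_two {θ : ℝ} (hθ : θ ∈ Set.Icc 0 π) (hc : cos θ = 0) : θ = π / 2 :=
  injOn_cos hθ ⟨by positivity, by linarith [pi_pos]⟩ (hc.trans cos_pi_div_two.symm)

/-- Horizontal slices of the body are discs. -/
theorem bodyGauge_le_one_iff_slice (h : IsProfile ρ) (x : Fin 3 → ℝ) : bodyGauge ρ x ≤ 1 ↔
    ∃ θ ∈ Set.Icc 0 π, x 2 = meridianZ ρ θ ∧ x 0 ^ 2 + x 1 ^ 2 ≤ meridianX ρ θ ^ 2 := by
  rw [h.bodyGauge_le_one_iff, ← sq_euNorm_mul_sin x, ← euNorm_mul_cos x]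
  have hψ := polarAngle_mem x
  have hs := euNorm_nonneg x
  have hsin := sin_polarAngle_nonneg x
  generalize polarAngle x = ψ at *
  rcases hs.eq_or_lt with h0 | hs'
  · rw [← h0]
    refine iff_of_true (h.pos ψ).le ⟨π / 2, ⟨by positivity, by linarith [pi_pos]⟩, by simp [meridianZ], ?_⟩
    rw [zero_mul, zero_pow two_ne_zero]
    positivity
  generalize euNorm x = s at *
  have hZc := h.contDiff_Z.continuous
  have hZ0 : meridianZ ρ (π / 2) = 0 := by simp [meridianZ]
  constructor
  · intro hle
    rcases lt_trichotomy (cos ψ) 0 with hc | hc | hc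
    · have hψ2 : π / 2 ≤ ψ := by
        by_contra hlt
        exact hc.not_ge (cos_nonneg_of_mem_Icc ⟨by linarith [hψ.1, pi_pos], by linarith⟩)
      obtain ⟨θ, hθ, he⟩ := intermediate_value_Icc' hψ2 hZc.continuousOn (show s * cos ψ ∈ _ from
        ⟨mul_le_mul_of_nonpos_right hle hc.le, by rw [hZ0]; nlinarith⟩)
      have hθ' : θ ∈ Set.Icc 0 π := ⟨by linarith [hθ.1, pi_pos], hθ.2.trans hψ.2⟩
      refine ⟨θ, hθ', he.symm, pow_le_pow_left₀ (by positivity) ?_ 2⟩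
      have hsn := sin_nonneg_of_mem_Icc (x := ψ - θ) ⟨by linarith [hθ.2], by linarith [hψ.2, hθ'.1]⟩
      rw [sin_sub] at hsn
      have hk := mul_nonneg (h.pos θ).le hsn
      rw [meridianZ] at he
      rw [meridianX]
      by_contra hlt
      nlinarith [mul_pos_of_neg_of_neg hc (sub_neg.2 (not_le.1 hlt))]
    · obtain rfl := eq_pi_div_two hψ hc
      refine ⟨π / 2, hψ, by rw [hc, hZ0, mul_zero], ?_⟩
      simpa [meridianX] using pow_le_pow_left₀ hs'.le hle 2
    · have hψ2 : ψ ≤ π / 2 := by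
        by_contra hlt
        exact hc.not_ge (cos_nonpos_of_pi_div_two_le_of_le (by linarith) (by linarith [hψ.2, pi_pos]))
      obtain ⟨θ, hθ, he⟩ := intermediate_value_Icc' hψ2 hZc.continuousOn (show s * cos ψ ∈ _ from
        ⟨by rw [hZ0]; positivity, mul_le_mul_of_nonneg_right hle hc.le⟩)
      have hθ' : θ ∈ Set.Icc 0 π := ⟨hψ.1.trans hθ.1, by linarith [hθ.2, pi_pos]⟩
      refine ⟨θ, hθ', he.symm, pow_le_pow_left₀ (by positivity) ?_ 2⟩
      have hsn := sin_nonneg_of_mem_Icc (x := θ - ψ) ⟨by linarith [hθ.1], by linarith [hψ.1, hθ'.2]⟩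
      rw [sin_sub] at hsn
      have hk := mul_nonneg (h.pos θ).le hsn
      rw [meridianZ] at he
      rw [meridianX]
      by_contra hlt
      nlinarith [mul_pos hc (sub_pos.2 (not_le.1 hlt))]
  · rintro ⟨θ, hθ, he, hX⟩
    have hX' : s * sin ψ ≤ meridianX ρ θ := (sq_le_sq₀ (by positivity) (h.meridianX_nonneg hθ)).1 hX
    have hp := h.pos θ
    rcases lt_trichotomy (cos ψ) 0 with hc | hc | hc
    · have hle : θ ≤ ψ := by
        by_contra hlt
        have hn := sin_pos_of_pos_of_lt_pi (x := θ - ψ) (by linarith) (by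
          rcases hψ.1.eq_or_lt with h0 | h0
          · rw [← h0, cos_zero] at hc; linarith
          · linarith [hθ.2])
        rw [sin_sub] at hn
        rw [meridianX] at hX'
        rw [meridianZ] at he
        nlinarith [mul_pos hp hn]
      have := h.strictAntiOn_Z.antitoneOn hθ hψ hle
      rw [← he, meridianZ] at this
      exact (mul_le_mul_right_of_neg hc).1 this
    · rw [hc, mul_zero, meridianZ] at he
      have hcθ : cos θ = 0 := (mul_eq_zero.1 he.symm).resolve_left hp.ne'
      obtain rfl := eq_pi_div_two hψ hc
      obtain rfl := eq_pi_div_two hθ hcθ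
      simpa [meridianX] using hX'
    · have hle : ψ ≤ θ := by
        by_contra hlt
        have hn := sin_pos_of_pos_of_lt_pi (x := ψ - θ) (by linarith) (by
          rcases hψ.2.eq_or_lt with h0 | h0
          · rw [h0, cos_pi] at hc; linarith
          · linarith [hθ.1])
        rw [sin_sub] at hn
        rw [meridianX] at hX'
        rw [meridianZ] at he
        nlinarith [mul_pos hp hn]
      have := h.strictAntiOn_Z.antitoneOn hψ hθ hle
      rw [← he, meridianZ] at this
      exact (mul_le_mul_iff_of_pos_right hc).1 this

theorem body_eq (h : IsProfile ρ) : {x : Fin 3 → ℝ | ∃ θ φ r : ℝ,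
      0 ≤ θ ∧ θ ≤ π ∧ 0 ≤ φ ∧ φ ≤ 2 * π ∧ 0 ≤ r ∧ r ≤ ρ θ ∧
      x = ![r * (sin θ * cos φ), r * (sin θ * sin φ), r * cos θ]} = {x | bodyGauge ρ x ≤ 1} := by
  ext x
  simp only [Set.mem_ofPred_eq]
  rw [h.bodyGauge_le_one_iff]
  constructor
  · rintro ⟨θ, φ, r, h0, h1, -, -, hr, hrρ, rfl⟩
    have hn : euNorm ![r * (sin θ * cos φ), r * (sin θ * sin φ), r * cos θ] = r := by
      rw [euNorm, Real.sqrt_eq_iff_mul_self_eq (by positivity) hr]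
      simp
      linear_combination r ^ 2 * sin θ ^ 2 * sin_sq_add_cos_sq φ + r ^ 2 * sin_sq_add_cos_sq θ
    rcases hr.eq_or_lt with h2 | h2
    · rw [hn, ← h2]
      exact (h.pos _).le
    · rw [polarAngle, hn]
      simp [mul_div_cancel_left₀ _ h2.ne', arccos_cos h0 h1, hrρ]
  · intro hle
    set z : ℂ := ⟨x 0, x 1⟩ with hz
    have hq : ‖z‖ = euNorm x * sin (polarAngle x) := by
      rw [← abs_of_nonneg (norm_nonneg z), ← abs_of_nonneg (mul_nonneg (euNorm_nonneg x) (sin_polarAngle_nonneg x)),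
        ← sq_eq_sq_iff_abs_eq_abs, sq_euNorm_mul_sin, Complex.sq_norm, Complex.normSq_apply]
      simp only [hz]
      ring
    have e0 : euNorm x * (sin (polarAngle x) * cos z.arg) = x 0 := by
      rw [← mul_assoc, ← hq, Complex.norm_mul_cos_arg]
    have e1 : euNorm x * (sin (polarAngle x) * sin z.arg) = x 1 := by
      rw [← mul_assoc, ← hq, Complex.norm_mul_sin_arg]
    have hm := polarAngle_mem x
    rcases le_or_gt 0 z.arg with ha | ha
    · refine ⟨polarAngle x, z.arg, euNorm x, hm.1, hm.2, ha, by linarith [Complex.arg_le_pi z, pi_pos],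
        euNorm_nonneg x, hle, ?_⟩
      rw [e0, e1, euNorm_mul_cos]
      ext i
      fin_cases i <;> rfl
    · refine ⟨polarAngle x, z.arg + 2 * π, euNorm x, hm.1, hm.2, by linarith [Complex.neg_pi_lt_arg z, pi_pos],
        by linarith, euNorm_nonneg x, hle, ?_⟩
      rw [cos_add_two_pi, sin_add_two_pi, e0, e1, euNorm_mul_cos]
      ext i
      fin_cases i <;> rfl

end IsProfile

end BodyGauge

section BodyFourier

/-- The vector with horizontal part `w` and height `z`. -/
noncomputable def vecOf (p : ℝ × ℂ) : Fin 3 → ℝ := ![p.2.re, p.2.im, p.1]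

theorem exists_measurableEquiv_vecOf : ∃ e : ℝ × ℂ ≃ᵐ (Fin 3 → ℝ), (∀ p, e p = vecOf p) ∧
    MeasurePreserving e := by
  have h1 := volume_preserving_piFinSuccAbove (fun _ : Fin 3 => ℝ) 2
  have h2 := (MeasurePreserving.id (volume : Measure ℝ)).prod Complex.volume_preserving_equiv_pi
  refine ⟨((MeasurableEquiv.refl ℝ).prodCongr Complex.measurableEquivPi).trans
    (MeasurableEquiv.piFinSuccAbove (fun _ : Fin 3 => ℝ) 2).symm, fun p => ?_, h1.symm.comp h2⟩
  ext i
  fin_cases i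
  · rfl
  · rfl
  · rfl

theorem integral_vecOf {f : (Fin 3 → ℝ) → ℂ} (hf : Integrable f) :
    ∫ x, f x = ∫ z : ℝ, ∫ w : ℂ, f (vecOf (z, w)) := by
  obtain ⟨e, he, hm⟩ := exists_measurableEquiv_vecOf
  rw [← hm.integral_comp' (g := f)]
  have hi : Integrable (fun p => f (e p)) := (hm.integrable_comp_emb e.measurableEmbedding).2 hf
  simp_rw [he] at hi ⊢
  exact integral_prod _ hi

theorem integral_disc_height {R : ℝ} (hR : 0 ≤ R) (g : ℝ → ℂ) (hg : Continuous g) :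
    ∫ w in Metric.closedBall (0 : ℂ) R, g w.re = ∫ x in (-R)..R, ((2 * √(R ^ 2 - x ^ 2) : ℝ) : ℂ) * g x := by
  have hset : ∀ x y : ℝ, (⟨x, y⟩ : ℂ) ∈ Metric.closedBall (0 : ℂ) R ↔ x ^ 2 + y ^ 2 ≤ R ^ 2 := fun x y => by
    rw [mem_closedBall_zero_iff, ← sq_le_sq₀ (norm_nonneg _) hR, Complex.sq_norm, Complex.normSq_apply]
    simp only [sq]
  have hm := Complex.volume_preserving_equiv_real_prod.symm
  have hInt : Integrable ((Metric.closedBall (0 : ℂ) R).indicator fun w => g w.re) := by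
    rw [integrable_indicator_iff Metric.isClosed_closedBall.measurableSet]
    exact (hg.comp Complex.continuous_re).continuousOn.integrableOn_compact (isCompact_closedBall _ _)
  rw [← integral_indicator Metric.isClosed_closedBall.measurableSet, ← hm.integral_comp',
    Measure.volume_eq_prod,
    integral_prod _ (by exact (hm.integrable_comp_emb (MeasurableEquiv.measurableEmbedding _)).2 hInt)]
  have hin : ∀ x : ℝ, (∫ y : ℝ, (Metric.closedBall (0 : ℂ) R).indicator (fun w => g w.re)
      (Complex.measurableEquivRealProd.symm (x, y))) =
      (Set.Icc (-R) R).indicator (fun x => ((2 * √(R ^ 2 - x ^ 2) : ℝ) : ℂ) * g x) x := fun x => by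
    have e1 : (fun y : ℝ => (Metric.closedBall (0 : ℂ) R).indicator (fun w => g w.re)
        (Complex.measurableEquivRealProd.symm (x, y))) =
        {y : ℝ | x ^ 2 + y ^ 2 ≤ R ^ 2}.indicator fun _ => g x := by
      ext y
      have e2 : Complex.measurableEquivRealProd.symm (x, y) = ⟨x, y⟩ := rfl
      rw [e2]
      by_cases hy : x ^ 2 + y ^ 2 ≤ R ^ 2
      · rw [Set.indicator_of_mem ((hset x y).2 hy), Set.indicator_of_mem (by exact hy)]
      · rw [Set.indicator_of_notMem (fun h => hy ((hset x y).1 h)), Set.indicator_of_notMem (by exact hy)]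
    rw [e1]
    by_cases hx : x ∈ Set.Icc (-R) R
    · have hx2 : 0 ≤ R ^ 2 - x ^ 2 := by nlinarith [hx.1, hx.2]
      have e3 : {y : ℝ | x ^ 2 + y ^ 2 ≤ R ^ 2} = Set.Icc (-√(R ^ 2 - x ^ 2)) (√(R ^ 2 - x ^ 2)) := by
        ext y
        rw [Set.mem_ofPred_eq, Set.mem_Icc, ← abs_le, Real.le_sqrt (abs_nonneg y), sq_abs]
        · constructor <;> intro h <;> linarith
        · exact hx2
      rw [Set.indicator_of_mem hx, e3, integral_indicator measurableSet_Icc, setIntegral_const,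
        Measure.real, Real.volume_Icc, ENNReal.toReal_ofReal (by linarith [Real.sqrt_nonneg (R ^ 2 - x ^ 2)]),
        Complex.real_smul]
      congr 2
      ring
    · have e3 : {y : ℝ | x ^ 2 + y ^ 2 ≤ R ^ 2} = ∅ := by
        ext y
        simp only [Set.mem_ofPred_eq, Set.mem_empty_iff_false, iff_false]
        intro h
        exact hx (abs_le.1 (abs_le_of_sq_le_sq (by nlinarith [sq_nonneg y]) hR))
      rw [Set.indicator_of_notMem hx, e3]
      simp
  simp_rw [hin]
  rw [integral_indicator measurableSet_Icc, integral_Icc_eq_integral_Ioc,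
    intervalIntegral.integral_of_le (by linarith)]

theorem integral_disc_axis {R : ℝ} (hR : 0 ≤ R) (q : ℝ) :
    ∫ w in Metric.closedBall (0 : ℂ) R, ee (-(q * w.re)) = ((R ^ 2 * discTransform (q * R) : ℝ) : ℂ) := by
  rw [integral_disc_height hR (fun x => ee (-(q * x))) (continuous_ee.comp (by fun_prop))]
  rcases hR.eq_or_lt with rfl | hR0
  · simp
  have h1 := intervalIntegral.integral_comp_mul_left (a := -1) (b := 1)
    (fun x => ((2 * √(R ^ 2 - x ^ 2) : ℝ) : ℂ) * ee (-(q * x))) hR0.ne'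
  rw [mul_neg, mul_one, eq_inv_smul_iff₀ hR0.ne'] at h1
  rw [← h1]
  have e1 : ∀ s : ℝ, ((2 * √(R ^ 2 - (R * s) ^ 2) : ℝ) : ℂ) * ee (-(q * (R * s))) =
      R * (((2 * √(1 - s ^ 2) : ℝ) : ℂ) * ee (-(q * R * s))) := fun s => by
    rw [show R ^ 2 - (R * s) ^ 2 = R ^ 2 * (1 - s ^ 2) by ring, Real.sqrt_mul (sq_nonneg R), Real.sqrt_sq hR]
    push_cast
    ring_nf
  simp_rw [e1]
  rw [intervalIntegral.integral_const_mul, Complex.real_smul]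
  set y := q * R
  have hc : Continuous fun s : ℝ => ((2 * √(1 - s ^ 2) : ℝ) : ℂ) * ee (-(y * s)) :=
    (by fun_prop : Continuous fun s : ℝ => ((2 * √(1 - s ^ 2) : ℝ) : ℂ)).mul (continuous_ee.comp (by fun_prop))
  have h2 := intervalIntegral.integral_comp_neg (a := -1) (b := 1)
    (fun s => ((2 * √(1 - s ^ 2) : ℝ) : ℂ) * ee (-(y * s)))
  rw [neg_neg] at h2
  have h3 : (∫ s in (-1 : ℝ)..1, ((2 * √(1 - s ^ 2) : ℝ) : ℂ) * ee (-(y * s))) = (discTransform y : ℂ) := by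
    have h4 : (∫ s in (-1 : ℝ)..1, ((2 * √(1 - s ^ 2) : ℝ) : ℂ) * ee (-(y * s)))
        + (∫ s in (-1 : ℝ)..1, ((2 * √(1 - (-s) ^ 2) : ℝ) : ℂ) * ee (-(y * -s))) = 2 * (discTransform y : ℂ) := by
      rw [← intervalIntegral.integral_add (hc.intervalIntegrable _ _) (by exact (hc.comp continuous_neg).intervalIntegrable _ _),
        discTransform, ← intervalIntegral.integral_ofReal, ← intervalIntegral.integral_const_mul]
      refine intervalIntegral.integral_congr fun s _ => ?_
      have e3 : ee (-(y * s)) + ee (-(y * -s)) = ((2 * cos (2 * π * (y * s)) : ℝ) : ℂ) := by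
        rw [show -(y * -s) = y * s by ring, ee_neg, ← ee_re, add_comm, Complex.add_conj]
      simp only [neg_sq]
      rw [← mul_add, e3]
      push_cast
      ring
    rw [h2] at h4
    linear_combination h4 / 2
  rw [h3]
  push_cast
  ring

theorem integral_disc {R : ℝ} (hR : 0 ≤ R) (a b : ℝ) :
    ∫ w in Metric.closedBall (0 : ℂ) R, ee (-(a * w.re + b * w.im)) =
      ((R ^ 2 * discTransform (√(a ^ 2 + b ^ 2) * R) : ℝ) : ℂ) := by
  rw [← integral_disc_axis hR]
  set z : ℂ := ⟨a, b⟩ with hz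
  have hq : √(a ^ 2 + b ^ 2) = ‖z‖ := by
    rw [Complex.norm_def, Complex.normSq_apply]
    simp only [hz, sq]
  have hm := (rotation (Circle.exp z.arg)).measurePreserving
  have hball : (rotation (Circle.exp z.arg)) ⁻¹' Metric.closedBall (0 : ℂ) R = Metric.closedBall 0 R := by
    ext w
    rw [Set.mem_preimage, mem_closedBall_zero_iff, mem_closedBall_zero_iff, LinearIsometryEquiv.norm_map]
  have h1 := hm.setIntegral_preimage_emb (rotation (Circle.exp z.arg)).toHomeomorph.measurableEmbedding
    (fun w => ee (-(a * w.re + b * w.im))) (Metric.closedBall (0 : ℂ) R)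
  rw [hball] at h1
  rw [← h1]
  congr 1
  ext w
  congr 2
  have ha : a = ‖z‖ * cos z.arg := by rw [Complex.norm_mul_cos_arg]
  have hb : b = ‖z‖ * sin z.arg := by rw [Complex.norm_mul_sin_arg]
  rw [rotation_apply, Circle.coe_exp, Complex.exp_mul_I, ← Complex.ofReal_cos, ← Complex.ofReal_sin, hq, ha, hb]
  have e : ‖(⟨‖z‖ * cos z.arg, ‖z‖ * sin z.arg⟩ : ℂ)‖ = ‖z‖ := by rw [← ha, ← hb]
  simp only [Complex.mul_re, Complex.mul_im, Complex.add_re, Complex.add_im, Complex.ofReal_re,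
    Complex.ofReal_im, Complex.I_re, Complex.I_im]
  linear_combination ‖z‖ * w.re * sin_sq_add_cos_sq z.arg

namespace IsProfile

variable {ρ : ℝ → ℝ}

theorem isCompact_body (h : IsProfile ρ) (u : ℝ) : IsCompact {x | bodyGauge ρ x ≤ u} := by
  obtain ⟨c, C, hc, hC, hb⟩ := h.exists_gauge_bounds
  refine Metric.isCompact_of_isClosed_isBounded (isClosed_le h.continuous_bodyGauge continuous_const) ?_
  refine (Metric.isBounded_closedBall (x := (0 : Fin 3 → ℝ)) (r := u / c)).subset fun x hx => ?_
  rw [mem_closedBall_zero_iff, le_div_iff₀ hc]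
  linarith [(hb x).1, show bodyGauge ρ x ≤ u from hx]

theorem slice_eq (h : IsProfile ρ) {θ : ℝ} (hθ : θ ∈ Set.Icc 0 π) (w : ℂ) :
    bodyGauge ρ (vecOf (meridianZ ρ θ, w)) ≤ 1 ↔ w ∈ Metric.closedBall (0 : ℂ) (meridianX ρ θ) := by
  rw [mem_closedBall_zero_iff, ← sq_le_sq₀ (norm_nonneg _) (h.meridianX_nonneg hθ), Complex.sq_norm,
    Complex.normSq_apply, h.bodyGauge_le_one_iff_slice]
  simp only [vecOf, Matrix.cons_val_zero, Matrix.cons_val_one, Matrix.cons_val]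
  constructor
  · rintro ⟨θ', hθ', he, hX⟩
    obtain rfl := h.strictAntiOn_Z.injOn hθ hθ' he
    linarith
  · exact fun hw => ⟨θ, hθ, rfl, by linarith⟩

/-- Fourier transform of the body as an integral over the meridian. -/
theorem body_fourier (h : IsProfile ρ) (ξ : Fin 3 → ℝ) :
    ∫ x in {x | bodyGauge ρ x ≤ 1}, ee (-(∑ i, ξ i * x i)) =
      ∫ θ in (0 : ℝ)..π, ((-deriv (meridianZ ρ) θ * (meridianX ρ θ ^ 2 *
        discTransform (√(ξ 0 ^ 2 + ξ 1 ^ 2) * meridianX ρ θ)) : ℝ) : ℂ) * ee (-(ξ 2 * meridianZ ρ θ)) := by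
  have hK := h.isCompact_body 1
  have hInt : Integrable ({x | bodyGauge ρ x ≤ 1}.indicator fun x => ee (-(∑ i, ξ i * x i))) := by
    rw [integrable_indicator_iff hK.measurableSet]
    exact (continuous_ee.comp (by fun_prop)).continuousOn.integrableOn_compact hK
  rw [← integral_indicator hK.measurableSet, integral_vecOf hInt]
  set φ : ℝ → ℂ := fun z => ∫ w : ℂ, {x | bodyGauge ρ x ≤ 1}.indicator (fun x => ee (-(∑ i, ξ i * x i))) (vecOf (z, w))
  have hφ0 : ∀ z, z ∉ meridianZ ρ '' Set.Icc 0 π → φ z = 0 := fun z hz => by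
    simp only [φ]
    rw [← integral_zero ℂ ℂ]
    congr 1
    ext w
    refine Set.indicator_of_notMem (fun hw => hz ?_) _
    obtain ⟨θ, hθ, he, -⟩ := (h.bodyGauge_le_one_iff_slice _).1 hw
    exact ⟨θ, hθ, by simpa [vecOf] using he.symm⟩
  have hφ1 : ∀ θ ∈ Set.Icc 0 π, φ (meridianZ ρ θ) = ((meridianX ρ θ ^ 2 *
        discTransform (√(ξ 0 ^ 2 + ξ 1 ^ 2) * meridianX ρ θ) : ℝ) : ℂ) * ee (-(ξ 2 * meridianZ ρ θ)) := fun θ hθ => by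
    rw [← integral_disc (h.meridianX_nonneg hθ), ← integral_mul_const,
      ← integral_indicator Metric.isClosed_closedBall.measurableSet]
    simp only [φ]
    congr 1
    ext w
    by_cases hw : w ∈ Metric.closedBall (0 : ℂ) (meridianX ρ θ)
    · rw [Set.indicator_of_mem hw, Set.indicator_of_mem (by exact (h.slice_eq hθ w).2 hw), ← ee_add]
      congr 1
      simp only [Fin.sum_univ_three, vecOf, Matrix.cons_val_zero, Matrix.cons_val_one, Matrix.cons_val]
      ring
    · rw [Set.indicator_of_notMem hw, Set.indicator_of_notMem (by exact fun hh => hw ((h.slice_eq hθ w).1 hh))]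
  rw [← setIntegral_eq_integral_of_forall_compl_eq_zero hφ0,
    integral_image_eq_integral_abs_deriv_smul measurableSet_Icc (fun θ _ => (h.hasDerivAt_Z θ).hasDerivWithinAt)
      h.strictAntiOn_Z.injOn, intervalIntegral.integral_of_le pi_pos.le, ← integral_Icc_eq_integral_Ioc]
  refine setIntegral_congr_fun measurableSet_Icc fun θ hθ => ?_
  rw [hφ1 θ hθ, ← (h.hasDerivAt_Z θ).deriv, abs_of_nonpos, Complex.real_smul]
  · push_cast
    ring
  · have h1 := h.cosDeriv_Z_pos hθ
    have h2 := sin_nonneg_of_mem_Icc hθ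
    have h3 := sin_mul_cosDeriv h.Z_even h.Z_periodic θ
    nlinarith [mul_nonneg h2 h1.le]

/-- Scaling of the Fourier transform of the dilated body. -/
theorem body_fourier_scaled (ρ : ℝ → ℝ) {u : ℝ} (hu : 0 < u) (ξ : Fin 3 → ℝ) :
    ∫ x in {x | bodyGauge ρ x ≤ u}, ee (-(∑ i, ξ i * x i)) =
      (u ^ 3 : ℝ) * ∫ x in {x | bodyGauge ρ x ≤ 1}, ee (-(∑ i, (u • ξ) i * x i)) := by
  have h1 := Measure.setIntegral_comp_smul_of_pos (volume : Measure (Fin 3 → ℝ))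
    (fun x => ee (-(∑ i, ξ i * x i))) {x | bodyGauge ρ x ≤ 1} hu
  have h2 : u • {x | bodyGauge ρ x ≤ 1} = {x | bodyGauge ρ x ≤ u} := by
    ext x
    rw [Set.mem_smul_set_iff_inv_smul_mem₀ hu.ne', Set.mem_ofPred_eq, Set.mem_ofPred_eq,
      IsProfile.bodyGauge_smul (inv_nonneg.2 hu.le), inv_mul_le_one₀ hu]
  rw [h2] at h1
  have h3 : ∀ x : Fin 3 → ℝ, ∑ i, (u • ξ) i * x i = ∑ i, ξ i * (u • x) i := fun x =>
    Finset.sum_congr rfl fun i _ => by simp only [Pi.smul_apply, smul_eq_mul]; ring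
  simp_rw [h3]
  rw [h1, Complex.real_smul, ← mul_assoc]
  have h4 : ((u ^ 3 : ℝ) : ℂ) * (((u ^ Module.finrank ℝ (Fin 3 → ℝ))⁻¹ : ℝ) : ℂ) = 1 := by
    rw [Module.finrank_fin_fun, ← Complex.ofReal_mul, mul_inv_cancel₀ (by positivity), Complex.ofReal_one]
  rw [h4, one_mul]

end IsProfile

end BodyFourier

section BodyAsymptotic

/-- Fourier transform of the body dilated by `u`. -/
noncomputable def bodyFT (ρ : ℝ → ℝ) (u : ℝ) (ξ : Fin 3 → ℝ) : ℂ :=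
  ∫ x in {x | bodyGauge ρ x ≤ u}, ee (-(∑ i, ξ i * x i))

namespace IsProfile

variable {ρ : ℝ → ℝ}

theorem bodyFT_eq (h : IsProfile ρ) {u : ℝ} (hu : 0 < u) (ξ : Fin 3 → ℝ) :
    bodyFT ρ u ξ = (u ^ 3 : ℝ) * ∫ θ in (0 : ℝ)..π, ((-deriv (meridianZ ρ) θ * (meridianX ρ θ ^ 2 *
        discTransform (u * √(ξ 0 ^ 2 + ξ 1 ^ 2) * meridianX ρ θ)) : ℝ) : ℂ) * ee (-(u * ξ 2 * meridianZ ρ θ)) := by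
  rw [bodyFT, body_fourier_scaled ρ hu, h.body_fourier]
  have e : √((u • ξ) 0 ^ 2 + (u • ξ) 1 ^ 2) = u * √(ξ 0 ^ 2 + ξ 1 ^ 2) := by
    simp only [Pi.smul_apply, smul_eq_mul]
    rw [show (u * ξ 0) ^ 2 + (u * ξ 1) ^ 2 = u ^ 2 * (ξ 0 ^ 2 + ξ 1 ^ 2) by ring, Real.sqrt_mul (sq_nonneg u),
      Real.sqrt_sq hu.le]
  rw [e]
  rfl

theorem neg_deriv_Z (h : IsProfile ρ) (θ : ℝ) : -deriv (meridianZ ρ) θ = sin θ * cosDeriv (meridianZ ρ) θ :=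
  (sin_mul_cosDeriv h.Z_even h.Z_periodic θ).symm

theorem continuous_deriv_Z (h : IsProfile ρ) : Continuous (deriv (meridianZ ρ)) :=
  (contDiff_deriv_of_top h.contDiff_Z).continuous

theorem continuous_deriv_X (h : IsProfile ρ) : Continuous (deriv (meridianX ρ)) :=
  (contDiff_deriv_of_top h.contDiff_X).continuous

theorem integral_deriv_Z_mul_ee (h : IsProfile ρ) {g g' : ℝ → ℝ} (hg : ∀ θ ∈ Set.Icc 0 π, HasDerivAt g (g' θ) θ)
    (hg' : ContinuousOn g' (Set.Icc 0 π)) (k : ℝ) :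
    2 * π * Complex.I * k * ∫ θ in (0 : ℝ)..π, ((g θ * -deriv (meridianZ ρ) θ : ℝ) : ℂ) * ee (-(k * meridianZ ρ θ)) =
      g π * ee (-(k * meridianZ ρ π)) - g 0 * ee (-(k * meridianZ ρ 0))
        - ∫ θ in (0 : ℝ)..π, (g' θ : ℂ) * ee (-(k * meridianZ ρ θ)) := by
  have hI : Set.uIcc 0 π = Set.Icc 0 π := Set.uIcc_of_le pi_pos.le
  have hZ := fun θ => (h.contDiff_Z.differentiable (by simp) θ).hasDerivAt
  have he : ∀ θ, HasDerivAt (fun y => ee (-(k * meridianZ ρ y)))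
      (2 * π * Complex.I * ((-(k * deriv (meridianZ ρ) θ) : ℝ) : ℂ) * ee (-(k * meridianZ ρ θ))) θ := fun θ =>
    hasDerivAt_ee_comp (f := fun y => -(k * meridianZ ρ y)) ((hZ θ).const_mul k).neg
  have hee : Continuous fun θ => ee (-(k * meridianZ ρ θ)) :=
    continuous_ee.comp (continuous_const.mul h.contDiff_Z.continuous).neg
  have h1 := intervalIntegral.integral_mul_deriv_eq_deriv_mul (a := 0) (b := π) (u := fun θ => (g θ : ℂ))
    (v := fun y => ee (-(k * meridianZ ρ y)))
    (fun θ hθ => (hg θ (hI ▸ hθ)).ofReal_comp) (fun θ _ => he θ)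
    (ContinuousOn.intervalIntegrable (by rw [hI]; exact Complex.continuous_ofReal.comp_continuousOn hg'))
    (Continuous.intervalIntegrable (((continuous_const.mul (Complex.continuous_ofReal.comp
      (continuous_const.mul h.continuous_deriv_Z).neg))).mul hee) _ _)
  rw [← h1, ← intervalIntegral.integral_const_mul]
  refine intervalIntegral.integral_congr fun θ _ => ?_
  push_cast
  ring

/-- Decay of the Fourier transform in the axial direction. -/
theorem exists_bodyFT_axis_le (h : IsProfile ρ) : ∃ C : ℝ, 0 < C ∧ ∀ ξ : Fin 3 → ℝ, ξ 0 ^ 2 + ξ 1 ^ 2 = 0 → ξ 2 ≠ 0 →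
    ∀ u, 0 < u → ‖bodyFT ρ u ξ‖ ≤ C * u / ξ 2 ^ 2 := by
  have hX := fun θ => (h.contDiff_X.differentiable (by simp) θ).hasDerivAt
  have hX' := fun θ => ((contDiff_deriv_of_top h.contDiff_X).differentiable (by simp) θ).hasDerivAt
  have hL := fun θ => (h.contDiff_cosDeriv_Z.differentiable (by simp) θ).hasDerivAt
  have hL0 : ∀ θ ∈ Set.Icc 0 π, cosDeriv (meridianZ ρ) θ ≠ 0 := fun θ hθ => (h.cosDeriv_Z_pos hθ).ne'
  set g : ℝ → ℝ := fun θ => 2 * ρ θ * deriv (meridianX ρ) θ / cosDeriv (meridianZ ρ) θ with hg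
  obtain ⟨g', hgd, hgc⟩ : ∃ g' : ℝ → ℝ, (∀ θ ∈ Set.Icc 0 π, HasDerivAt g (g' θ) θ) ∧ ContinuousOn g' (Set.Icc 0 π) := by
    refine ⟨_, fun θ hθ => (((h.hasDerivAt θ).const_mul 2).mul (hX' θ)).div (hL θ) (hL0 θ hθ), ?_⟩
    refine ContinuousOn.div (Continuous.continuousOn ?_) (h.contDiff_cosDeriv_Z.continuous.pow 2).continuousOn
      fun θ hθ => pow_ne_zero 2 (hL0 θ hθ)
    have c1 := h.contDiff_cosDeriv_Z.continuous
    have c2 := (contDiff_deriv_of_top h.contDiff_cosDeriv_Z).continuous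
    have c3 := h.continuous_deriv_X
    have c4 := (contDiff_deriv_of_top (contDiff_deriv_of_top h.contDiff_X)).continuous
    have c5 := h.smooth.continuous
    have c6 := h.contDiff_deriv.continuous
    fun_prop
  obtain ⟨M, hM⟩ := isCompact_Icc.exists_bound_of_continuousOn hgc
  have hM0 : 0 ≤ M := (norm_nonneg _).trans (hM 0 ⟨le_rfl, pi_pos.le⟩)
  set D := |discTransform 0|
  refine ⟨(|g π| + |g 0| + M * π + 1) * (D + 1), by positivity, fun ξ hξ hξ2 u hu => ?_⟩
  set k := u * ξ 2 with hk
  have hee : ∀ θ, ‖ee (-(k * meridianZ ρ θ))‖ = 1 := fun θ => norm_ee _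
  have hXd : ∀ θ ∈ Set.Icc 0 π, HasDerivAt (fun θ => meridianX ρ θ ^ 2) (2 * meridianX ρ θ * deriv (meridianX ρ) θ) θ :=
    fun θ _ => ((hX θ).pow 2).congr_deriv (by push_cast; ring)
  have i1 := h.integral_deriv_Z_mul_ee hXd (by
    have := h.contDiff_X.continuous
    have := h.continuous_deriv_X
    fun_prop) k
  have i2 := h.integral_deriv_Z_mul_ee hgd hgc k
  have e0 : meridianX ρ 0 = 0 := by simp [meridianX]
  have eπ : meridianX ρ π = 0 := by simp [meridianX]
  have e1 : (∫ θ in (0 : ℝ)..π, ((2 * meridianX ρ θ * deriv (meridianX ρ) θ : ℝ) : ℂ) * ee (-(k * meridianZ ρ θ)))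
      = ∫ θ in (0 : ℝ)..π, ((g θ * -deriv (meridianZ ρ) θ : ℝ) : ℂ) * ee (-(k * meridianZ ρ θ)) := by
    refine intervalIntegral.integral_congr fun θ hθ => ?_
    rw [Set.uIcc_of_le pi_pos.le] at hθ
    have h0 := hL0 θ hθ
    simp only [hg, h.neg_deriv_Z]
    congr 2
    rw [show meridianX ρ θ = ρ θ * sin θ from rfl]
    field_simp
  rw [e1, e0, eπ] at i1
  simp only [ne_eq, OfNat.ofNat_ne_zero, not_false_eq_true, zero_pow, Complex.ofReal_zero, zero_mul, sub_zero, zero_sub] at i1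
  have hb : ‖∫ θ in (0 : ℝ)..π, (g' θ : ℂ) * ee (-(k * meridianZ ρ θ))‖ ≤ M * π := by
    have := intervalIntegral.norm_integral_le_of_norm_le_const (a := 0) (b := π) (C := M)
      (f := fun θ => (g' θ : ℂ) * ee (-(k * meridianZ ρ θ))) fun θ hθ => by
        rw [Set.uIoc_of_le pi_pos.le] at hθ
        rw [norm_mul, hee, mul_one, Complex.norm_real]
        exact hM θ ⟨hθ.1.le, hθ.2⟩
    rwa [sub_zero, abs_of_pos pi_pos] at this
  set J := ∫ θ in (0 : ℝ)..π, ((meridianX ρ θ ^ 2 * -deriv (meridianZ ρ) θ : ℝ) : ℂ) * ee (-(k * meridianZ ρ θ)) with hJ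
  have n2 : ‖(2 * π * Complex.I * k : ℂ)‖ = 2 * π * |k| := by
    simp [abs_of_pos pi_pos]
  have n1 : (2 * π * |k|) ^ 2 * ‖J‖ ≤ |g π| + |g 0| + M * π := by
    have e3 : (2 * π * Complex.I * k : ℂ) ^ 2 * J = -(g π * ee (-(k * meridianZ ρ π)) - g 0 * ee (-(k * meridianZ ρ 0))
        - ∫ θ in (0 : ℝ)..π, (g' θ : ℂ) * ee (-(k * meridianZ ρ θ))) := by
      rw [← i2]
      linear_combination (2 * π * Complex.I * k : ℂ) * i1
    have e4 := congrArg norm e3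
    rw [norm_mul, norm_pow, n2, norm_neg] at e4
    rw [e4]
    refine (norm_sub_le _ _).trans (add_le_add ((norm_sub_le _ _).trans_eq ?_) hb)
    rw [norm_mul, norm_mul, hee, hee, mul_one, mul_one, Complex.norm_real, Complex.norm_real, Real.norm_eq_abs,
      Real.norm_eq_abs]
  have hkk : k ^ 2 * ‖J‖ ≤ |g π| + |g 0| + M * π := by
    refine le_trans (mul_le_mul_of_nonneg_right ?_ (norm_nonneg _)) n1
    rw [mul_pow _ |k|, sq_abs]
    exact le_mul_of_one_le_left (sq_nonneg k) (by nlinarith [pi_gt_three])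
  have hF : bodyFT ρ u ξ = ((u ^ 3 * discTransform 0 : ℝ) : ℂ) * J := by
    rw [h.bodyFT_eq hu, hξ, hJ, Complex.ofReal_mul, mul_assoc, ← intervalIntegral.integral_const_mul (discTransform 0 : ℂ)]
    congr 2
    ext θ
    simp only [Real.sqrt_zero, mul_zero, zero_mul]
    push_cast
    ring
  rw [hF, norm_mul, Complex.norm_real, norm_mul, Real.norm_eq_abs, Real.norm_eq_abs, abs_of_pos (pow_pos hu 3),
    le_div_iff₀ (by positivity)]
  have hD : 0 ≤ D := abs_nonneg _
  calc u ^ 3 * D * ‖J‖ * ξ 2 ^ 2 = D * (k ^ 2 * ‖J‖) * u := by rw [hk]; ring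
    _ ≤ (D + 1) * (|g π| + |g 0| + M * π + 1) * u := by gcongr <;> linarith
    _ = _ := by ring

/-- The contribution of the leading Bessel asymptotics. -/
theorem meridian_main_eq (h : IsProfile ρ) (lam α : ℝ) :
    ∫ θ in (0 : ℝ)..π, ((meridianWeight ρ θ * (ee (lam * sin α * meridianX ρ θ) * fresnelConst).im : ℝ) : ℂ) *
        ee (-(lam * cos α * meridianZ ρ θ)) =
      (2 * Complex.I)⁻¹ * (fresnelConst * (starRingEnd ℂ) (∫ θ in (0 : ℝ)..π, (meridianWeight ρ θ : ℂ) *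
            ee (-(lam * (sin (π - α) * meridianX ρ θ + cos (π - α) * meridianZ ρ θ))))
        - (starRingEnd ℂ) fresnelConst * ∫ θ in (0 : ℝ)..π, (meridianWeight ρ θ : ℂ) *
            ee (-(lam * (sin α * meridianX ρ θ + cos α * meridianZ ρ θ)))) := by
  obtain ⟨w', -, hw⟩ := h.hasDerivAt_weight
  have hwc : Continuous (meridianWeight ρ) := continuous_iff_continuousAt.2 fun θ => (hw θ).continuousAt
  have hX := h.contDiff_X.continuous
  have hZ := h.contDiff_Z.continuous
  have hI : ∀ a b : ℝ, Continuous fun θ => (meridianWeight ρ θ : ℂ) *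
      ee (-(lam * (a * meridianX ρ θ + b * meridianZ ρ θ))) := fun a b =>
    (Complex.continuous_ofReal.comp hwc).mul (continuous_ee.comp (by fun_prop))
  rw [← intervalIntegral.intervalIntegral_conj, ← intervalIntegral.integral_const_mul,
    ← intervalIntegral.integral_const_mul, ← intervalIntegral.integral_sub
      (by exact (continuous_const.mul (Complex.continuous_conj.comp (hI _ _))).intervalIntegrable _ _)
      (by exact (continuous_const.mul (hI _ _)).intervalIntegrable _ _), ← intervalIntegral.integral_const_mul]
  refine intervalIntegral.integral_congr fun θ _ => ?_
  have e1 : ee (-(lam * (sin α * meridianX ρ θ + cos α * meridianZ ρ θ))) =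
      (starRingEnd ℂ) (ee (lam * sin α * meridianX ρ θ)) * ee (-(lam * cos α * meridianZ ρ θ)) := by
    rw [← ee_neg, ← ee_add]
    ring_nf
  have e2 : (starRingEnd ℂ) (ee (-(lam * (sin (π - α) * meridianX ρ θ + cos (π - α) * meridianZ ρ θ)))) =
      ee (lam * sin α * meridianX ρ θ) * ee (-(lam * cos α * meridianZ ρ θ)) := by
    rw [← ee_neg, ← ee_add, sin_pi_sub, cos_pi_sub]
    ring_nf
  simp only [map_mul, Complex.conj_ofReal, e1, e2]
  set E := ee (lam * sin α * meridianX ρ θ)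
  have e3 : (((E * fresnelConst).im : ℝ) : ℂ) = (2 * Complex.I)⁻¹ * (E * fresnelConst - (starRingEnd ℂ) (E * fresnelConst)) := by
    rw [Complex.sub_conj]
    field_simp
    push_cast
    ring
  rw [Complex.ofReal_mul, e3, map_mul]
  ring

theorem exists_bessel_error_le (h : IsProfile ρ) : ∃ C : ℝ, 0 < C ∧ ∀ K k : ℝ, 0 < K →
    ‖(∫ θ in (0 : ℝ)..π, ((-deriv (meridianZ ρ) θ * (meridianX ρ θ ^ 2 *
        discTransform (K * meridianX ρ θ)) : ℝ) : ℂ) * ee (-(k * meridianZ ρ θ)))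
      - ((2 * √2 / (π * K * √K) : ℝ) : ℂ) * ∫ θ in (0 : ℝ)..π,
        ((meridianWeight ρ θ * (ee (K * meridianX ρ θ) * fresnelConst).im : ℝ) : ℂ) * ee (-(k * meridianZ ρ θ))‖
      ≤ C / (K ^ 2 * √K) := by
  obtain ⟨Cb, hCb, hb⟩ := discTransform_asymptotic
  obtain ⟨Cl, hCl, hl⟩ := exists_abs_bound h.contDiff_cosDeriv_Z.continuous
  obtain ⟨cp, Cp, hcp, hCp, hp⟩ := exists_bounds_of_pos h.smooth.continuous fun θ _ => h.pos θ
  obtain ⟨w', -, hw⟩ := h.hasDerivAt_weight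
  have hwc : Continuous (meridianWeight ρ) := continuous_iff_continuousAt.2 fun θ => (hw θ).continuousAt
  have hX := h.contDiff_X.continuous
  have hZ := h.contDiff_Z.continuous
  have hdZ := h.continuous_deriv_Z
  have hj : Continuous discTransform := by
    unfold discTransform
    fun_prop
  refine ⟨Cl * Cb / √cp * π, by positivity, fun K k hK => ?_⟩
  have c1 : Continuous fun θ => ((-deriv (meridianZ ρ) θ * (meridianX ρ θ ^ 2 *
        discTransform (K * meridianX ρ θ)) : ℝ) : ℂ) * ee (-(k * meridianZ ρ θ)) :=
    (Complex.continuous_ofReal.comp (by fun_prop)).mul (continuous_ee.comp (by fun_prop))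
  have c2 : Continuous fun θ => ((meridianWeight ρ θ * (ee (K * meridianX ρ θ) * fresnelConst).im : ℝ) : ℂ) *
      ee (-(k * meridianZ ρ θ)) :=
    (Complex.continuous_ofReal.comp (hwc.mul (Complex.continuous_im.comp
      ((continuous_ee.comp (by fun_prop)).mul continuous_const)))).mul (continuous_ee.comp (by fun_prop))
  rw [← intervalIntegral.integral_const_mul, ← intervalIntegral.integral_sub (c1.intervalIntegrable _ _)
    (by exact (continuous_const.mul c2).intervalIntegrable _ _)]
  have hmain := intervalIntegral.norm_integral_le_of_norm_le_const (a := 0) (b := π)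
    (C := Cl * Cb / √cp / (K ^ 2 * √K)) (f := fun θ => ((-deriv (meridianZ ρ) θ * (meridianX ρ θ ^ 2 *
        discTransform (K * meridianX ρ θ)) : ℝ) : ℂ) * ee (-(k * meridianZ ρ θ)) -
      ((2 * √2 / (π * K * √K) : ℝ) : ℂ) *
        (((meridianWeight ρ θ * (ee (K * meridianX ρ θ) * fresnelConst).im : ℝ) : ℂ) * ee (-(k * meridianZ ρ θ))))
    fun θ hθ => ?_
  · refine hmain.trans_eq ?_
    rw [sub_zero, abs_of_pos pi_pos]
    ring
  rw [Set.uIoc_of_le pi_pos.le] at hθ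
  have hθI : θ ∈ Set.Icc 0 π := ⟨hθ.1.le, hθ.2⟩
  rw [← mul_assoc ((2 * √2 / (π * K * √K) : ℝ) : ℂ), ← sub_mul, norm_mul, norm_ee, mul_one, ← Complex.ofReal_mul, ← Complex.ofReal_sub, Complex.norm_real,
    Real.norm_eq_abs, h.neg_deriv_Z]
  set L := cosDeriv (meridianZ ρ) θ with hL
  have hLb : |L| ≤ Cl := hl θ hθI
  rcases hθ.2.eq_or_lt with rfl | hθπ
  · have : (0 : ℝ) ^ (3 / 2 : ℝ) = 0 := Real.zero_rpow (by norm_num)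
    simp only [meridianWeight, sin_pi, zero_mul, this, mul_zero, sub_zero, abs_zero]
    positivity
  have hs : 0 < sin θ := sin_pos_of_pos_of_lt_pi hθ.1 hθπ
  have hρ := h.pos θ
  have hρc := (hp θ hθI).1
  have hX0 : 0 < meridianX ρ θ := mul_pos hρ hs
  have hb1 := hb (K * meridianX ρ θ) (by positivity)
  have hs32 : sin θ ^ (3 / 2 : ℝ) = sin θ * √(sin θ) := by
    rw [Real.sqrt_eq_rpow, show (3 / 2 : ℝ) = 1 + 1 / 2 by norm_num, Real.rpow_add hs, Real.rpow_one]
  have hwX : meridianWeight ρ θ * (K * √K)⁻¹ = sin θ * L * meridianX ρ θ ^ 2 * (K * meridianX ρ θ * √(K * meridianX ρ θ))⁻¹ := by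
    have hsx : √(ρ θ * sin θ) ≠ 0 := (Real.sqrt_pos.2 (mul_pos hρ hs)).ne'
    have hsk : √K ≠ 0 := (Real.sqrt_pos.2 hK).ne'
    have hxx : √(ρ θ * sin θ) * √(ρ θ * sin θ) = ρ θ * sin θ := Real.mul_self_sqrt (by positivity)
    rw [meridianWeight, hs32, Real.sqrt_mul hK.le, show meridianX ρ θ = ρ θ * sin θ from rfl]
    have e : √(ρ θ) * √(sin θ) = √(ρ θ * sin θ) := (Real.sqrt_mul hρ.le _).symm
    rw [show √(ρ θ) * cosDeriv (meridianZ ρ) θ * (sin θ * √(sin θ)) = L * sin θ * (√(ρ θ) * √(sin θ)) by rw [hL]; ring, e]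
    generalize √(ρ θ * sin θ) = S at hsx hxx ⊢
    field_simp
    linear_combination L * hxx
  have hfac : sin θ * L * (meridianX ρ θ ^ 2 * discTransform (K * meridianX ρ θ)) - 2 * √2 / (π * K * √K) *
      (meridianWeight ρ θ * (ee (K * meridianX ρ θ) * fresnelConst).im) =
      sin θ * L * meridianX ρ θ ^ 2 * (discTransform (K * meridianX ρ θ) - 2 * √2 / (π * (K * meridianX ρ θ) *
        √(K * meridianX ρ θ)) * (ee (K * meridianX ρ θ) * fresnelConst).im) := by
    have e1 : 2 * √2 / (π * K * √K) = 2 * √2 / π * (K * √K)⁻¹ := by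
      rw [mul_assoc, div_mul_eq_div_div, div_eq_mul_inv _ (K * √K)]
    have e2 : 2 * √2 / (π * (K * meridianX ρ θ) * √(K * meridianX ρ θ)) =
        2 * √2 / π * (K * meridianX ρ θ * √(K * meridianX ρ θ))⁻¹ := by
      rw [mul_assoc, div_mul_eq_div_div, div_eq_mul_inv _ (_ * √(K * meridianX ρ θ))]
    rw [e1, e2]
    linear_combination (-(2 * √2 / π * (ee (K * meridianX ρ θ) * fresnelConst).im)) * hwX
  rw [hfac, abs_mul, abs_mul, abs_mul, abs_of_pos hs, abs_of_nonneg (sq_nonneg (meridianX ρ θ))]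
  refine (mul_le_mul_of_nonneg_left hb1 (by positivity)).trans ?_
  have hsx : √(meridianX ρ θ) ^ 2 = meridianX ρ θ := Real.sq_sqrt hX0.le
  have hsp : 0 < √(meridianX ρ θ) := Real.sqrt_pos.2 hX0
  have hcpp : 0 < √cp := Real.sqrt_pos.2 hcp
  have hkey : sin θ * √cp ≤ √(meridianX ρ θ) := by
    have h1 : sin θ ^ 2 * cp ≤ meridianX ρ θ := by
      rw [show meridianX ρ θ = ρ θ * sin θ from rfl]
      nlinarith [sin_le_one θ, mul_le_mul_of_nonneg_left (sin_le_one θ) hs.le, mul_le_mul_of_nonneg_left hρc hs.le]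
    have h2 := Real.sqrt_le_sqrt h1
    rwa [Real.sqrt_mul (sq_nonneg _), Real.sqrt_sq hs.le] at h2
  rw [Real.sqrt_mul hK.le]
  have hK' : 0 < √K := Real.sqrt_pos.2 hK
  calc sin θ * |L| * meridianX ρ θ ^ 2 * (Cb / ((K * meridianX ρ θ) ^ 2 * (√K * √(meridianX ρ θ))))
      = |L| * Cb * (sin θ / √(meridianX ρ θ)) / (K ^ 2 * √K) := by field_simp
    _ ≤ Cl * Cb * (1 / √cp) / (K ^ 2 * √K) := by
        gcongr ?_ * _ * ?_ / _
        rw [div_le_div_iff₀ hsp hcpp]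
        linarith
    _ = _ := by ring

theorem asymptotic_main_term {u q N D : ℝ} (hu0 : 0 < u) (hq0 : 0 < q) (hN : 0 < N) (A₁ A₂ h₁ h₂ : ℝ)
    (hD : q * √q * √N = D) :
    (u ^ 3 : ℝ) * (((2 * √2 / (π * (u * q) * √(u * q)) : ℝ) : ℂ) * ((2 * Complex.I)⁻¹ *
      (fresnelConst * (starRingEnd ℂ) (A₂ / √(u * N) * (starRingEnd ℂ) fresnelConst * ee (-(u * N * h₂)))
        - (starRingEnd ℂ) fresnelConst * (A₁ / √(u * N) * (starRingEnd ℂ) fresnelConst * ee (-(u * N * h₁)))))) =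
      -(u * (((√2 / (8 * π) / D * A₁ : ℝ) : ℂ) * ee (-(u * (N * h₁)))
        + ((√2 / (8 * π) / D * A₂ : ℝ) : ℂ) * ee (u * (N * h₂)))) := by
  have hl2 := fresnelConst_sq
  have hl2' : (starRingEnd ℂ) fresnelConst ^ 2 = Complex.I / 8 := by
    rw [← map_pow, hl2, map_div₀, map_neg, Complex.conj_I, neg_neg, map_ofNat]
  have hreal : u ^ 3 * (2 * √2 / (π * (u * q) * √(u * q)) / √(u * N)) / 16 = u * (√2 / (8 * π) / D) := by
    have t : π * (u * q) * √(u * q) * √(u * N) = π * u ^ 2 * D := by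
      rw [← hD, Real.sqrt_mul hu0.le, Real.sqrt_mul hu0.le]
      linear_combination (π * u * q * √q * √N) * Real.sq_sqrt hu0.le
    have hD0 : D ≠ 0 := by
      rw [← hD]
      positivity
    rw [div_div, t]
    field_simp
    norm_num
  rw [mul_assoc u N h₁, mul_assoc u N h₂]
  generalize 2 * √2 / (π * (u * q) * √(u * q)) = k at *
  generalize √2 / (8 * π) / D = d at *
  generalize √(u * N) = v at *
  simp only [map_mul, map_div₀, Complex.conj_ofReal, Complex.conj_conj]
  rw [← ee_neg (-(u * (N * h₂))), neg_neg]
  generalize ee (u * (N * h₂)) = E₂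
  generalize ee (-(u * (N * h₁))) = E₁
  generalize fresnelConst = l at *
  generalize (starRingEnd ℂ) l = l' at *
  have hrC : (u : ℂ) ^ 3 * (k / v) / 16 = u * d := by exact_mod_cast hreal
  have hI : (2 * Complex.I)⁻¹ = -Complex.I / 2 := by
    rw [mul_inv, Complex.inv_I]
    ring
  rw [hI]
  push_cast
  linear_combination (-(A₁ * E₁ + A₂ * E₂) : ℂ) * hrC
    + ((u : ℂ) ^ 3 * k * (-Complex.I / 2) * (A₂ / v) * E₂) * hl2
    - ((u : ℂ) ^ 3 * k * (-Complex.I / 2) * (A₁ / v) * E₁) * hl2'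
    + ((u : ℂ) ^ 3 * k / v / 16 * (A₁ * E₁ + A₂ * E₂)) * Complex.I_sq

theorem asymptotic_error_le {u q N C Cb σ : ℝ} (hu : 1 ≤ u) (hq1 : 1 ≤ q) (hN1 : 1 ≤ N) (hqN : q = N * σ)
    (hC : 0 ≤ C) (hCb : 0 ≤ Cb) :
    u ^ 3 * (Cb / ((u * q) ^ 2 * √(u * q)) + 2 * √2 / (π * (u * q) * √(u * q)) *
      (1 / 2 * (1 / 2 * (C / σ ^ 2 * (u * N) ^ (-(3 / 5) : ℝ)) + 1 / 2 * (C / σ ^ 2 * (u * N) ^ (-(3 / 5) : ℝ)))))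
      ≤ (√2 / π * C + Cb) * (u ^ (9 / 10 : ℝ) * N ^ 2) := by
  have hu0 : 0 < u := by linarith
  have hσ : 0 < σ := by
    by_contra hn
    nlinarith
  have hKu : u ≤ u * q := le_mul_of_one_le_right hu0.le hq1
  have hulam : u ≤ u * N := le_mul_of_one_le_right hu0.le hN1
  generalize u * q = K at *
  have hK0 : 0 < K := by linarith
  have hKs : √u ≤ √K := Real.sqrt_le_sqrt hKu
  have hinv : 1 / σ ^ 2 ≤ N ^ 2 := by
    rw [div_le_iff₀ (by positivity)]
    calc 1 ≤ q ^ 2 := one_le_pow₀ hq1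
      _ = _ := by rw [hqN]; ring
  have hl35 : (u * N) ^ (-(3 / 5) : ℝ) ≤ u ^ (-(3 / 5) : ℝ) := Real.rpow_le_rpow_of_nonpos hu0 hulam (by norm_num)
  have hu35 : 0 < u ^ (-(3 / 5) : ℝ) := Real.rpow_pos_of_pos hu0 _
  have hl36 : 0 < (u * N) ^ (-(3 / 5) : ℝ) := Real.rpow_pos_of_pos (by positivity) _
  generalize (u * N) ^ (-(3 / 5) : ℝ) = e at *
  have hsu : 0 < √u := Real.sqrt_pos.2 hu0
  have b1 : u ^ 3 * (Cb / (K ^ 2 * √K)) ≤ Cb * (u ^ (9 / 10 : ℝ) * N ^ 2) := by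
    have e1 : √u ≤ u ^ (9 / 10 : ℝ) := by
      rw [Real.sqrt_eq_rpow]
      exact Real.rpow_le_rpow_of_exponent_le hu (by norm_num)
    calc u ^ 3 * (Cb / (K ^ 2 * √K)) ≤ u ^ 3 * (Cb / (u ^ 2 * √u)) := by gcongr
      _ = Cb * (u / √u) := by field_simp
      _ = Cb * √u := by rw [Real.div_sqrt]
      _ ≤ Cb * (u ^ (9 / 10 : ℝ) * 1) := by rw [mul_one]; gcongr
      _ ≤ _ := by
        gcongr
        exact one_le_pow₀ hN1
  have hE' : C / σ ^ 2 * e ≤ C * N ^ 2 * u ^ (-(3 / 5) : ℝ) := by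
    rw [div_eq_mul_one_div]
    gcongr
  have hE0 : 0 ≤ C / σ ^ 2 * e := by positivity
  generalize C / σ ^ 2 * e = E at *
  have e2 : u ^ 3 * (u * √u)⁻¹ * u ^ (-(3 / 5) : ℝ) = u ^ (9 / 10 : ℝ) := by
    have t1 : (u * √u) = u ^ (3 / 2 : ℝ) := by
      rw [Real.sqrt_eq_rpow, show (3 / 2 : ℝ) = 1 + 1 / 2 by norm_num, Real.rpow_add hu0, Real.rpow_one]
    rw [t1, ← Real.rpow_neg hu0.le, ← Real.rpow_natCast, ← Real.rpow_add hu0, ← Real.rpow_add hu0]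
    norm_num
  calc _ = u ^ 3 * (Cb / (K ^ 2 * √K)) + √2 / π * (u ^ 3 * (K * √K)⁻¹ * E) := by
        have : √K ≠ 0 := (Real.sqrt_pos.2 hK0).ne'
        rw [mul_add]
        congr 1
        field_simp
        ring
    _ ≤ Cb * (u ^ (9 / 10 : ℝ) * N ^ 2) + √2 / π * (u ^ 3 * (u * √u)⁻¹ * (C * N ^ 2 * u ^ (-(3 / 5) : ℝ))) := by gcongr
    _ = Cb * (u ^ (9 / 10 : ℝ) * N ^ 2) + √2 / π * C * (N ^ 2 * (u ^ 3 * (u * √u)⁻¹ * u ^ (-(3 / 5) : ℝ))) := by ring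
    _ = _ := by rw [e2]; ring

/-- Leading asymptotics of the Fourier transform of the dilated body off the axis. -/
theorem exists_bodyFT_asymptotic (h : IsProfile ρ) : ∃ (a H : ℝ → ℝ → ℝ) (c C : ℝ), 0 < c ∧ 0 < C ∧
    ∀ ξ : Fin 3 → ℝ, 1 ≤ ξ 0 ^ 2 + ξ 1 ^ 2 →
      c / euNorm ξ ^ 2 ≤ a (ξ 0 ^ 2 + ξ 1 ^ 2) (ξ 2) ∧ a (ξ 0 ^ 2 + ξ 1 ^ 2) (ξ 2) ≤ C / euNorm ξ ^ 2 ∧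
      c * euNorm ξ ≤ H (ξ 0 ^ 2 + ξ 1 ^ 2) (ξ 2) ∧ H (ξ 0 ^ 2 + ξ 1 ^ 2) (ξ 2) ≤ C * euNorm ξ ∧
      ∀ u : ℝ, 1 ≤ u → euNorm ξ ≤ c * u ^ (2 / 5 : ℝ) →
        ‖bodyFT ρ u ξ + u * (a (ξ 0 ^ 2 + ξ 1 ^ 2) (ξ 2) * ee (-(u * H (ξ 0 ^ 2 + ξ 1 ^ 2) (ξ 2)))
            + a (ξ 0 ^ 2 + ξ 1 ^ 2) (-ξ 2) * ee (u * H (ξ 0 ^ 2 + ξ 1 ^ 2) (-ξ 2)))‖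
          ≤ C * (u ^ (9 / 10 : ℝ) * euNorm ξ ^ 2) := by
  obtain ⟨A, H, c, C, hc, hC, hm⟩ := h.exists_meridian_asymptotic
  obtain ⟨Cb, hCb, hb⟩ := h.exists_bessel_error_le
  refine ⟨fun Q z => √2 / (8 * π) / (√Q * √√Q * √√(Q + z ^ 2)) * A (arccos (z / √(Q + z ^ 2))),
    fun Q z => √(Q + z ^ 2) * H (arccos (z / √(Q + z ^ 2))), min c (√2 / (8 * π) * c),
    C + √2 / (8 * π) * C + √2 / π * C + Cb, by positivity, by positivity, fun ξ hξ => ?_⟩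
  beta_reduce
  rw [neg_sq, show √(ξ 0 ^ 2 + ξ 1 ^ 2 + ξ 2 ^ 2) = euNorm ξ from rfl, neg_div, arccos_neg]
  have hne : ξ ≠ 0 := by
    rintro rfl
    norm_num at hξ
  have hN := euNorm_pos hne
  have hsq := euNorm_sq ξ
  have hc' := euNorm_mul_cos ξ
  have hs' := sq_euNorm_mul_sin ξ
  have hα0 := polarAngle_mem ξ
  have hsin0 := sin_polarAngle_nonneg ξ
  rw [show arccos (ξ 2 / euNorm ξ) = polarAngle ξ from rfl]
  set N := euNorm ξ
  set α := polarAngle ξ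
  set Q := ξ 0 ^ 2 + ξ 1 ^ 2
  set q := √Q with hq
  have hq1 : 1 ≤ q := Real.one_le_sqrt.2 hξ
  have hq0 : 0 < q := by linarith
  have hqN : q = N * sin α := by rw [hq, ← hs', Real.sqrt_sq (by positivity)]
  have hsin : 0 < sin α := by
    by_contra hn
    have : sin α = 0 := le_antisymm (not_lt.1 hn) hsin0
    rw [this, mul_zero] at hqN
    linarith
  have hα : α ∈ Set.Ioo 0 π := by
    refine ⟨lt_of_le_of_ne hα0.1 fun hh => ?_, lt_of_le_of_ne hα0.2 fun hh => ?_⟩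
    · rw [← hh, sin_zero] at hsin; exact lt_irrefl _ hsin
    · rw [hh, sin_pi] at hsin; exact lt_irrefl _ hsin
  have hN1 : 1 ≤ N := by nlinarith [sin_le_one α]
  have hα' : π - α ∈ Set.Ioo 0 π := ⟨by linarith [hα.2], by linarith [hα.1]⟩
  obtain ⟨hA1, hA2, hH1, hH2, hJ⟩ := hm α hα
  obtain ⟨-, -, -, -, hJ'⟩ := hm (π - α) hα'
  have h32 : sin α ^ (3 / 2 : ℝ) = sin α * √(sin α) := by
    rw [Real.sqrt_eq_rpow, show (3 / 2 : ℝ) = 1 + 1 / 2 by norm_num, Real.rpow_add hsin, Real.rpow_one]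
  have hsN : 0 < √N := Real.sqrt_pos.2 hN
  have hss : 0 < √(sin α) := Real.sqrt_pos.2 hsin
  have hsNN : √N ^ 2 = N := Real.sq_sqrt hN.le
  have hden : q * √q * √N = N ^ 2 * sin α ^ (3 / 2 : ℝ) := by
    rw [h32, hqN, Real.sqrt_mul hN.le]
    linear_combination N * sin α * √(sin α) * hsNN
  set s32 := sin α ^ (3 / 2 : ℝ) with hs32
  have hs32p : 0 < s32 := Real.rpow_pos_of_pos hsin _
  have hk0 : 0 < √2 / (8 * π) := by positivity
  rw [hden]
  set κ := √2 / (8 * π) with hκ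
  refine ⟨?_, ?_, ?_, ?_, fun u hu huN => ?_⟩
  · calc min c (κ * c) / N ^ 2 ≤ κ * c / N ^ 2 := by gcongr; exact min_le_right _ _
      _ = κ / (N ^ 2 * s32) * (c * s32) := by field_simp
      _ ≤ _ := mul_le_mul_of_nonneg_left hA1 (by positivity)
  · calc κ / (N ^ 2 * s32) * A α ≤ κ / (N ^ 2 * s32) * (C * s32) := mul_le_mul_of_nonneg_left hA2 (by positivity)
      _ = κ * C / N ^ 2 := by field_simp
      _ ≤ _ := by
        gcongr
        have : 0 < √2 / π * C := by positivity
        linarith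
  · rw [mul_comm]
    exact mul_le_mul_of_nonneg_left ((min_le_left _ _).trans hH1) hN.le
  · rw [mul_comm]
    refine mul_le_mul_of_nonneg_right (hH2.trans ?_) hN.le
    have : 0 < √2 / π * C := by positivity
    have : 0 < κ * C := by positivity
    linarith
  have hu0 : 0 < u := by linarith
  set lam := u * N with hlam
  have hlam1 : 1 ≤ lam := one_le_mul_of_one_le_of_one_le hu hN1
  have hlam0 : 0 < lam := by linarith
  have hulam : u ≤ lam := le_mul_of_one_le_right hu0.le hN1
  have hcond : lam ^ (-(2 / 5) : ℝ) ≤ c * sin α := by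
    have h1 : lam ^ (-(2 / 5) : ℝ) ≤ u ^ (-(2 / 5) : ℝ) :=
      Real.rpow_le_rpow_of_nonpos hu0 hulam (by norm_num)
    have h2 : u ^ (-(2 / 5) : ℝ) * u ^ (2 / 5 : ℝ) = 1 := by
      rw [← Real.rpow_add hu0]; norm_num
    have h3 : 0 < u ^ (2 / 5 : ℝ) := Real.rpow_pos_of_pos hu0 _
    have h4 : N ≤ c * u ^ (2 / 5 : ℝ) := huN.trans (by gcongr; exact min_le_left _ _)
    refine h1.trans ?_
    have h5 : 1 ≤ c * sin α * u ^ (2 / 5 : ℝ) := by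
      have := mul_le_mul_of_nonneg_right h4 hsin.le
      rw [hqN] at hq1
      linarith
    by_contra hlt
    have := mul_lt_mul_of_pos_right (not_le.1 hlt) h3
    linarith
  have hJ1 := hJ lam hlam1 hcond
  have hJ2 := hJ' lam hlam1 (by rwa [sin_pi_sub])
  have hK0 : 0 < u * q := by positivity
  have hKl : u * q = lam * sin α := by rw [hqN, hlam]; ring
  have hkl : u * ξ 2 = lam * cos α := by rw [← hc', hlam]; ring
  have hB := hb (u * q) (u * ξ 2) hK0
  rw [h.bodyFT_eq hu0]
  rw [hkl] at hB ⊢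
  have hme := h.meridian_main_eq lam α
  rw [← hKl] at hme
  rw [hme] at hB
  rw [sin_pi_sub (α)] at hJ2
  rw [sin_pi_sub (α)] at hB
  set J1 := ∫ θ in (0 : ℝ)..π, (meridianWeight ρ θ : ℂ) * ee (-(lam * (sin α * meridianX ρ θ + cos α * meridianZ ρ θ)))
  set J2 := ∫ θ in (0 : ℝ)..π, (meridianWeight ρ θ : ℂ) * ee (-(lam * (sin α * meridianX ρ θ + cos (π - α) * meridianZ ρ θ)))
  set I0 := ∫ θ in (0 : ℝ)..π, ((-deriv (meridianZ ρ) θ * (meridianX ρ θ ^ 2 *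
        discTransform (u * q * meridianX ρ θ)) : ℝ) : ℂ) * ee (-(lam * cos α * meridianZ ρ θ))
  set l := fresnelConst with hl
  set P1 : ℂ := A α / √lam * (starRingEnd ℂ) l * ee (-(lam * H α)) with hP1
  set P2 : ℂ := A (π - α) / √lam * (starRingEnd ℂ) l * ee (-(lam * H (π - α))) with hP2
  set K := u * q with hK
  set kk : ℝ := 2 * √2 / (π * K * √K) with hkk
  have hkk0 : 0 < kk := by positivity
  set E := C / sin α ^ 2 * lam ^ (-(3 / 5) : ℝ) with hE
  have hmain := asymptotic_main_term hu0 hq0 hN (A α) (A (π - α)) (H α) (H (π - α)) hden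
  rw [← sub_neg_eq_add, ← hmain, ← mul_sub, norm_mul, Complex.norm_real, Real.norm_eq_abs, abs_of_pos (pow_pos hu0 3)]
  have hdiff : ‖I0 - (kk : ℂ) * ((2 * Complex.I)⁻¹ * (l * (starRingEnd ℂ) P2 - (starRingEnd ℂ) l * P1))‖ ≤
      Cb / (K ^ 2 * √K) + kk * (1 / 2 * (1 / 2 * E + 1 / 2 * E)) := by
    have e : I0 - (kk : ℂ) * ((2 * Complex.I)⁻¹ * (l * (starRingEnd ℂ) P2 - (starRingEnd ℂ) l * P1)) =
        (I0 - (kk : ℂ) * ((2 * Complex.I)⁻¹ * (l * (starRingEnd ℂ) J2 - (starRingEnd ℂ) l * J1))) +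
        (kk : ℂ) * ((2 * Complex.I)⁻¹ * (l * (starRingEnd ℂ) (J2 - P2) - (starRingEnd ℂ) l * (J1 - P1))) := by
      rw [map_sub]; ring
    rw [e]
    refine (norm_add_le _ _).trans (add_le_add hB ?_)
    rw [norm_mul, norm_mul, Complex.norm_real, Real.norm_eq_abs, abs_of_pos hkk0]
    have hi : ‖(2 * Complex.I)⁻¹‖ = 1 / 2 := by simp
    rw [hi]
    gcongr
    refine (norm_sub_le _ _).trans ?_
    rw [norm_mul, norm_mul, Complex.norm_conj, Complex.norm_conj]
    have hln : ‖l‖ ≤ 1 / 2 := norm_fresnelConst_le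
    gcongr
  refine (mul_le_mul_of_nonneg_left hdiff (by positivity)).trans ?_
  have b := asymptotic_error_le hu hq1 hN1 hqN hC.le hCb.le
  have hX : 0 ≤ u ^ (9 / 10 : ℝ) * N ^ 2 := by positivity
  have h3 : 0 ≤ (C + κ * C) * (u ^ (9 / 10 : ℝ) * N ^ 2) := by positivity
  refine b.trans ?_
  linarith

end IsProfile

end BodyAsymptotic

/-- A smooth even bump, the factor of the smoothing kernel. -/
noncomputable def halfBump : ContDiffBump (0 : ℝ) := ⟨1 / 4, 1 / 2, by norm_num, by norm_num⟩

noncomputable def halfKernel : ℝ → ℝ := halfBump.normed volume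

theorem halfKernel_nonneg (x : ℝ) : 0 ≤ halfKernel x := halfBump.nonneg_normed x

theorem halfKernel_neg (x : ℝ) : halfKernel (-x) = halfKernel x := halfBump.normed_neg x

theorem contDiff_halfKernel : ContDiff ℝ (⊤ : ℕ∞) halfKernel := halfBump.contDiff_normed

theorem hasCompactSupport_halfKernel : HasCompactSupport halfKernel :=
  halfBump.hasCompactSupport_normed

theorem integrable_halfKernel : Integrable halfKernel := halfBump.integrable_normed

theorem support_halfKernel : Function.support halfKernel = Metric.ball 0 (1 / 2) :=
  halfBump.support_normed_eq

theorem halfKernel_eq_zero {x : ℝ} (hx : 1 / 2 ≤ |x|) : halfKernel x = 0 := by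
  have : x ∉ Function.support halfKernel := by
    rw [support_halfKernel]; simpa using hx
  simpa using this

theorem integral_halfKernel : ∫ x, halfKernel x = 1 := halfBump.integral_normed

/-- The Fourier transform of `halfKernel`. -/
noncomputable def halfKernelFT (s : ℝ) : ℝ := ∫ v, halfKernel v * cos (2 * π * (s * v))

theorem integrable_halfKernel_mul_ee (s : ℝ) :
    Integrable fun v => (halfKernel v : ℂ) * ee (s * v) := by
  refine Integrable.mul_bdd (c := 1) integrable_halfKernel.ofReal ?_ (ae_of_all _ fun v => by
    rw [norm_ee])
  exact (continuous_ee.comp (continuous_const.mul continuous_id)).aestronglyMeasurable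

theorem integral_halfKernel_mul_ee (s : ℝ) :
    ∫ v, (halfKernel v : ℂ) * ee (s * v) = halfKernelFT s := by
  have hi := integrable_halfKernel_mul_ee s
  apply Complex.ext
  · rw [← RCLike.re_eq_complex_re, ← integral_re hi]
    simp [halfKernelFT, ee_re]
  · rw [← RCLike.im_eq_complex_im, ← integral_im hi]
    have h := integral_neg_eq_self (fun v => halfKernel v * sin (2 * π * (s * v))) volume
    have h2 : ∀ v, halfKernel (-v) * sin (2 * π * (s * -v))
        = -(halfKernel v * sin (2 * π * (s * v))) := by
      intro v; rw [halfKernel_neg, show 2 * π * (s * -v) = -(2 * π * (s * v)) by ring, sin_neg]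
      ring
    simp only [h2, integral_neg] at h
    simp [ee_im]
    linarith

theorem abs_halfKernelFT_le_one (s : ℝ) : |halfKernelFT s| ≤ 1 := by
  rw [← norm_eq_abs, ← Complex.norm_real, ← integral_halfKernel_mul_ee]
  refine (norm_integral_le_integral_norm _).trans (le_of_eq ?_)
  rw [← integral_halfKernel]
  refine integral_congr_ae (ae_of_all _ fun v => ?_)
  simp [norm_ee, abs_of_nonneg (halfKernel_nonneg v)]

theorem one_sub_le_halfKernelFT (s : ℝ) : 1 - π * |s| ≤ halfKernelFT s := by
  have hi := integrable_halfKernel_mul_ee s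
  have h1 : ‖(halfKernelFT s : ℂ) - 1‖ ≤ π * |s| := by
    have : ((halfKernelFT s : ℂ) - 1) = ∫ v, (halfKernel v : ℂ) * (ee (s * v) - 1) := by
      simp only [mul_sub, mul_one]
      rw [integral_sub hi (by exact integrable_halfKernel.ofReal), integral_halfKernel_mul_ee,
        integral_complex_ofReal, integral_halfKernel, Complex.ofReal_one]
    rw [this]
    calc _ ≤ ∫ v, halfKernel v * (π * |s|) := by
          refine norm_integral_le_of_norm_le (integrable_halfKernel.mul_const _)
            (ae_of_all _ fun v => ?_)
          rw [norm_mul, Complex.norm_real, norm_of_nonneg (halfKernel_nonneg v)]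
          rcases le_or_gt (1 / 2) |v| with hv | hv
          · simp [halfKernel_eq_zero hv]
          · refine mul_le_mul_of_nonneg_left ?_ (halfKernel_nonneg v)
            have := norm_ee_sub_ee_le (s * v) 0
            rw [ee_zero, sub_zero, abs_mul] at this
            have h3 : |s| * |v| ≤ |s| * (1 / 2) :=
              mul_le_mul_of_nonneg_left hv.le (abs_nonneg s)
            nlinarith [pi_pos]
      _ = _ := by rw [integral_mul_const, integral_halfKernel, one_mul]
  rw [← Complex.ofReal_one, ← Complex.ofReal_sub, Complex.norm_real, norm_eq_abs] at h1
  linarith [neg_abs_le (halfKernelFT s - 1)]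

theorem exists_abs_halfKernelFT_le : ∃ C, 0 < C ∧ ∀ s, s ≠ 0 → |halfKernelFT s| ≤ C / |s| := by
  have hd : ∀ v, HasDerivAt halfKernel (deriv halfKernel v) v := fun v =>
    (contDiff_halfKernel.differentiable (by simp) v).hasDerivAt
  have hdi : Integrable (deriv halfKernel) :=
    (contDiff_halfKernel.continuous_deriv (by simp)).integrable_of_hasCompactSupport
      hasCompactSupport_halfKernel.deriv
  refine ⟨(∫ v, ‖deriv halfKernel v‖) / (2 * π) + 1, by positivity, fun s hs => ?_⟩
  have hi := integrable_halfKernel_mul_ee s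
  have hee : ∀ v, HasDerivAt (fun v : ℝ => ee (s * v)) (2 * π * s * Complex.I * ee (s * v)) v := by
    intro v
    exact ((hasDerivAt_ee_comp ((hasDerivAt_id v).const_mul s))).congr_deriv (by simp [mul_assoc, mul_left_comm])
  have hdi' : Integrable fun v => ((deriv halfKernel v : ℝ) : ℂ) * ee (s * v) := by
    refine Integrable.mul_bdd (c := 1) hdi.ofReal ?_ (ae_of_all _ fun v => by rw [norm_ee])
    exact (continuous_ee.comp (continuous_const.mul continuous_id)).aestronglyMeasurable
  have key := integral_mul_deriv_eq_deriv_mul_of_integrable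
    (u := fun v => (halfKernel v : ℂ)) (u' := fun v => ((deriv halfKernel v : ℝ) : ℂ))
    (v := fun v : ℝ => ee (s * v)) (v' := fun v => 2 * π * s * Complex.I * ee (s * v))
    (fun v _ => (hd v).ofReal_comp) (fun v _ => hee v)
    ((hi.const_mul (2 * π * s * Complex.I)).congr (ae_of_all _ fun v => by
      simp only [Pi.mul_apply]; ring)) hdi' hi
  have key2 : (2 * π * s * Complex.I) * (halfKernelFT s : ℂ)
      = - ∫ v, ((deriv halfKernel v : ℝ) : ℂ) * ee (s * v) := by
    rw [← key, ← integral_halfKernel_mul_ee, ← integral_const_mul]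
    refine integral_congr_ae (ae_of_all _ fun v => ?_)
    simp only; ring
  have key3 : 2 * π * |s| * |halfKernelFT s| ≤ ∫ v, ‖deriv halfKernel v‖ := by
    have := congrArg norm key2
    rw [norm_neg] at this
    simp only [norm_mul, Complex.norm_real, Complex.norm_I, Complex.norm_ofNat, norm_eq_abs,
      mul_one, abs_of_pos pi_pos] at this
    rw [this]
    refine (norm_integral_le_integral_norm _).trans (le_of_eq ?_)
    refine integral_congr_ae (ae_of_all _ fun v => ?_)
    simp [norm_ee]
  have hs' : 0 < |s| := abs_pos.2 hs
  rw [le_div_iff₀ hs']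
  have : |halfKernelFT s| * |s| ≤ (∫ v, ‖deriv halfKernel v‖) / (2 * π) := by
    rw [le_div_iff₀ (by positivity)]; linarith
  linarith

/-- The smoothing kernel. -/
noncomputable def kernel : ℝ → ℝ :=
  MeasureTheory.convolution halfKernel halfKernel (ContinuousLinearMap.mul ℝ ℝ) volume

theorem kernel_apply (x : ℝ) : kernel x = ∫ t, halfKernel t * halfKernel (x - t) := by
  simp [kernel, convolution_def]

theorem contDiff_kernel : ContDiff ℝ (⊤ : ℕ∞) kernel :=
  hasCompactSupport_halfKernel.contDiff_convolution_left _ contDiff_halfKernel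
    integrable_halfKernel.locallyIntegrable

theorem kernel_nonneg (x : ℝ) : 0 ≤ kernel x := by
  rw [kernel_apply]
  exact integral_nonneg fun t => mul_nonneg (halfKernel_nonneg _) (halfKernel_nonneg _)

theorem kernel_eq_zero {x : ℝ} (hx : 1 ≤ |x|) : kernel x = 0 := by
  rw [kernel_apply]
  refine integral_eq_zero_of_ae (ae_of_all _ fun t => ?_)
  rcases le_or_gt (1 / 2) |t| with ht | ht
  · simp [halfKernel_eq_zero ht]
  · have : 1 / 2 ≤ |x - t| := by linarith [abs_sub_abs_le_abs_sub x t]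
    simp [halfKernel_eq_zero this]

theorem hasCompactSupport_kernel : HasCompactSupport kernel :=
  HasCompactSupport.intro (isCompact_Icc (a := (-1 : ℝ)) (b := 1)) fun x hx => kernel_eq_zero (by
    by_contra! h; exact hx (abs_le.1 h.le))

theorem integrable_kernel : Integrable kernel :=
  contDiff_kernel.continuous.integrable_of_hasCompactSupport hasCompactSupport_kernel

theorem integral_kernel : ∫ x, kernel x = 1 := by
  rw [kernel, integral_convolution _ integrable_halfKernel integrable_halfKernel]
  simp [integral_halfKernel]

theorem integral_kernel_mul_ee (s : ℝ) :
    ∫ v, (kernel v : ℂ) * ee (s * v) = ((halfKernelFT s ^ 2 : ℝ) : ℂ) := by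
  have hi := integrable_halfKernel_mul_ee s
  have h := integral_convolution (ContinuousLinearMap.mul ℝ ℂ) hi hi
  rw [integral_halfKernel_mul_ee] at h
  rw [Complex.ofReal_pow, sq]
  refine Eq.trans ?_ h
  refine integral_congr_ae (ae_of_all _ fun v => ?_)
  simp only [convolution_def, ContinuousLinearMap.mul_apply']
  rw [kernel_apply, ← integral_complex_ofReal, ← integral_mul_const]
  refine integral_congr_ae (ae_of_all _ fun t => ?_)
  simp only
  rw [show s * v = s * t + s * (v - t) by ring, ee_add]
  push_cast
  ring

/-- The smoothed indicator function of `(-∞, 0]` obtained from `kernel`. -/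
noncomputable def smoothStep (v : ℝ) : ℝ := ∫ s in Set.Ioi v, kernel s

theorem smoothStep_eq (v : ℝ) : smoothStep v = smoothStep 0 - ∫ s in (0 : ℝ)..v, kernel s := by
  have := intervalIntegral.integral_interval_add_Ioi (a := 0) (b := v)
    integrable_kernel.integrableOn integrable_kernel.integrableOn
  rw [smoothStep, smoothStep, ← this]; ring

theorem contDiff_smoothStep : ContDiff ℝ (⊤ : ℕ∞) smoothStep := by
  have hd : ∀ v, HasDerivAt smoothStep (-kernel v) v := by
    intro v
    have := (intervalIntegral.integral_hasDerivAt_right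
      (contDiff_kernel.continuous.intervalIntegrable 0 v)
      contDiff_kernel.continuous.stronglyMeasurable.stronglyMeasurableAtFilter
      contDiff_kernel.continuous.continuousAt).const_sub (smoothStep 0)
    exact this.congr_of_eventuallyEq (Filter.Eventually.of_forall smoothStep_eq)
  rw [contDiff_infty_iff_deriv]
  refine ⟨fun v => (hd v).differentiableAt, ?_⟩
  rw [show deriv smoothStep = fun v => -kernel v from funext fun v => (hd v).deriv]
  exact contDiff_kernel.neg

theorem smoothStep_of_le {v : ℝ} (hv : v ≤ -1) : smoothStep v = 1 := by
  rw [← integral_kernel]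
  refine setIntegral_eq_integral_of_forall_compl_eq_zero fun s hs => kernel_eq_zero ?_
  rw [le_abs]; right
  have : s ≤ v := by simpa using hs
  linarith

theorem smoothStep_of_ge {v : ℝ} (hv : 1 ≤ v) : smoothStep v = 0 := by
  refine setIntegral_eq_zero_of_forall_eq_zero fun s hs => kernel_eq_zero ?_
  have : v < s := hs
  rw [le_abs]; left; linarith

theorem smoothStep_eq_integral (N X y : ℝ) (hN : 0 < N) :
    ∫ u, (if y ≤ u then N * kernel (N * (u - X)) else 0) = smoothStep (N * (y - X)) := by
  have h1 : ∀ u, (if y ≤ u then N * kernel (N * (u - X)) else 0)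
      = N * (fun v => (Set.Ici (N * (y - X))).indicator kernel v) (N * (u - X)) := by
    intro u
    have : N * (u - X) ∈ Set.Ici (N * (y - X)) ↔ y ≤ u := by
      simp [hN]
    by_cases h : y ≤ u
    · rw [if_pos h]; simp only; rw [Set.indicator_of_mem (this.2 h)]
    · rw [if_neg h]; simp only; rw [Set.indicator_of_notMem (fun hh => h (this.1 hh)), mul_zero]
  simp_rw [h1]
  rw [integral_const_mul,
    integral_sub_right_eq_self
      (fun u => (fun v => (Set.Ici (N * (y - X))).indicator kernel v) (N * u)) X,
    Measure.integral_comp_mul_left, integral_indicator measurableSet_Ici, integral_Ici_eq_integral_Ioi]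
  rw [smoothStep, abs_of_pos (by positivity), smul_eq_mul, ← mul_assoc, mul_inv_cancel₀ hN.ne',
    one_mul]

theorem exists_iteratedDeriv_smoothStep_le (n : ℕ) :
    ∃ B, 1 ≤ B ∧ ∀ i ≤ n, ∀ v, |iteratedDeriv i smoothStep v| ≤ B := by
  have h1 : ∀ i : ℕ, ∃ B, ∀ v ∈ Set.Icc (-1 : ℝ) 1, ‖iteratedDeriv i smoothStep v‖ ≤ B := fun i =>
    isCompact_Icc.exists_bound_of_continuousOn
      (contDiff_smoothStep.continuous_iteratedDeriv i (by exact_mod_cast le_top)).continuousOn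
  choose B hB using h1
  have hB' : ∀ i, ∀ v, |iteratedDeriv i smoothStep v| ≤ |B i| + 1 := by
    intro i v
    have hc : ∀ c : ℝ, |c| ≤ 1 → |iteratedDeriv i (fun _ : ℝ => c) v| ≤ |B i| + 1 := by
      intro c hc
      rw [iteratedDeriv_const]
      split_ifs
      · linarith [abs_nonneg (B i)]
      · simp; positivity
    rcases lt_or_ge v (-1) with h | h
    · have : smoothStep =ᶠ[nhds v] fun _ => 1 := by
        filter_upwards [Iio_mem_nhds h] with s hs using smoothStep_of_le (le_of_lt hs)
      rw [this.iteratedDeriv_eq i]; exact hc 1 (by simp)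
    rcases lt_or_ge 1 v with h' | h'
    · have : smoothStep =ᶠ[nhds v] fun _ => 0 := by
        filter_upwards [Ioi_mem_nhds h'] with s hs using smoothStep_of_ge (le_of_lt hs)
      rw [this.iteratedDeriv_eq i]; exact hc 0 (by simp)
    · have := hB i v ⟨h, h'⟩
      rw [norm_eq_abs] at this
      linarith [le_abs_self (B i)]
  refine ⟨1 + ∑ i ∈ Finset.range (n + 1), (|B i| + 1), ?_, fun i hi v => ?_⟩
  · have : 0 ≤ ∑ i ∈ Finset.range (n + 1), (|B i| + 1) := Finset.sum_nonneg fun i _ => by positivity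
    linarith
  · have := Finset.single_le_sum (f := fun i => |B i| + 1) (fun i _ => by positivity)
      (Finset.mem_range.2 (Nat.lt_succ_of_le hi))
    linarith [hB' i v]

theorem exists_iteratedDeriv_smoothStep_scaled_le (n : ℕ) :
    ∃ B, 1 ≤ B ∧ ∀ Λ : ℝ, 1 ≤ Λ → ∀ i ≤ n, ∀ v,
      |iteratedDeriv i (fun v => smoothStep (Λ * (v - 1))) v| ≤ B * Λ ^ n := by
  obtain ⟨B, hB1, hB⟩ := exists_iteratedDeriv_smoothStep_le n
  refine ⟨B, hB1, fun Λ hΛ i hi v => ?_⟩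
  have h1 := congrFun (iteratedDeriv_comp_sub_const i (fun v => smoothStep (Λ * v)) 1) v
  have h2 := congrFun (iteratedDeriv_comp_const_mul (n := i) (f := smoothStep)
    (contDiff_smoothStep.of_le (by exact_mod_cast le_top)) Λ) (v - 1)
  rw [h1]
  rw [h2, abs_mul, abs_of_nonneg (by positivity), mul_comm]
  exact mul_le_mul (hB i hi _) (pow_le_pow_right₀ hΛ hi) (by positivity) (by linarith)

variable {ρ : ℝ → ℝ}

theorem IsProfile.contDiff_comp_bodyGauge (h : IsProfile ρ) {ψ : ℝ → ℝ}
    (hψ : ContDiff ℝ (⊤ : ℕ∞) ψ) (h1 : ∀ v ≤ 1 / 2, ψ v = 1) :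
    ContDiff ℝ (⊤ : ℕ∞) fun x => ψ (bodyGauge ρ x) := by
  rw [contDiff_iff_contDiffAt]
  intro x
  rcases lt_or_ge (bodyGauge ρ x) (1 / 2) with hx | hx
  · have : (fun x => ψ (bodyGauge ρ x)) =ᶠ[nhds x] fun _ => 1 := by
      filter_upwards [h.continuous_bodyGauge.continuousAt.eventually_lt_const hx] with y hy
      exact h1 _ (le_of_lt hy)
    exact contDiffAt_const.congr_of_eventuallyEq this
  · have hx0 : x ≠ 0 := by
      rintro rfl
      have := IsProfile.bodyGauge_smul (ρ := ρ) le_rfl (0 : Fin 3 → ℝ)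
      rw [zero_smul, zero_mul] at this
      linarith
    have := (contDiffOn_infty.2 h.contDiffOn_bodyGauge).contDiffAt (isOpen_ne.mem_nhds hx0)
    exact hψ.contDiffAt.comp x this

theorem IsProfile.exists_iteratedFDeriv_comp_le (h : IsProfile ρ) (n : ℕ) :
    ∃ C, 0 < C ∧ ∀ (ψ : ℝ → ℝ) (A : ℝ), ContDiff ℝ (⊤ : ℕ∞) ψ → (∀ v ≤ 1 / 2, ψ v = 1) →
      (∀ i ≤ n, ∀ v, |iteratedDeriv i ψ v| ≤ A) → ∀ x, bodyGauge ρ x ≤ 3 / 2 → ∀ i ≤ n,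
      ‖iteratedFDeriv ℝ i (fun x => ψ (bodyGauge ρ x)) x‖ ≤ C * A := by
  have hopen : IsOpen {x : Fin 3 → ℝ | x ≠ 0} := isOpen_ne
  have hcont : ∀ i : ℕ, ContinuousOn (iteratedFDeriv ℝ i (bodyGauge ρ)) {x | x ≠ 0} := fun i =>
    ((contDiffOn_infty.2 h.contDiffOn_bodyGauge).continuousOn_iteratedFDerivWithin
      (by exact_mod_cast le_top) hopen.uniqueDiffOn).congr fun x hx =>
        (iteratedFDerivWithin_of_isOpen i hopen hx).symm
  have hne : ∀ x : Fin 3 → ℝ, 1 / 2 ≤ bodyGauge ρ x → x ≠ 0 := by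
    rintro x hx rfl
    have := IsProfile.bodyGauge_smul (ρ := ρ) le_rfl (0 : Fin 3 → ℝ)
    rw [zero_smul, zero_mul] at this
    linarith
  have hK : IsCompact ({x | bodyGauge ρ x ≤ 3 / 2} ∩ {x | 1 / 2 ≤ bodyGauge ρ x}) :=
    (h.isCompact_body _).inter_right (isClosed_le continuous_const h.continuous_bodyGauge)
  have hb : ∀ i : ℕ, ∃ B, ∀ x ∈ {x | bodyGauge ρ x ≤ 3 / 2} ∩ {x | 1 / 2 ≤ bodyGauge ρ x},
      ‖iteratedFDeriv ℝ i (bodyGauge ρ) x‖ ≤ B := fun i =>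
    hK.exists_bound_of_continuousOn ((hcont i).mono fun x hx => hne x hx.2)
  choose B hB using hb
  set D := 1 + ∑ i ∈ Finset.range (n + 1), |B i| with hD
  have hD0 : 0 ≤ ∑ i ∈ Finset.range (n + 1), |B i| := Finset.sum_nonneg fun i _ => abs_nonneg _
  have hBD : ∀ i ≤ n, B i ≤ D := fun i hi => by
    have := Finset.single_le_sum (f := fun i => |B i|) (fun i _ => abs_nonneg _)
      (Finset.mem_range.2 (Nat.lt_succ_of_le hi))
    linarith [le_abs_self (B i)]
  have hD1 : 1 ≤ D := by linarith
  refine ⟨n.factorial * D ^ n, by positivity, fun ψ A hψ h1 hA x hx i hi => ?_⟩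
  have hA1 : 1 ≤ A := by
    have := hA 0 (Nat.zero_le _) 0
    simpa [h1 0 (by norm_num)] using this
  have hfac : (1 : ℝ) ≤ n.factorial := by exact_mod_cast Nat.factorial_pos n
  have hDn : 1 ≤ D ^ n := one_le_pow₀ hD1
  rcases lt_or_ge (bodyGauge ρ x) (1 / 2) with hx2 | hx2
  · have : (fun x => ψ (bodyGauge ρ x)) =ᶠ[nhds x] fun _ => 1 := by
      filter_upwards [h.continuous_bodyGauge.continuousAt.eventually_lt_const hx2] with y hy
      exact h1 _ (le_of_lt hy)
    rw [(this.iteratedFDeriv ℝ i).eq_of_nhds]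
    have h2 : ‖iteratedFDeriv ℝ i (fun _ : Fin 3 → ℝ => (1 : ℝ)) x‖ ≤ 1 := by
      rcases Nat.eq_zero_or_pos i with rfl | hi0
      · rw [norm_iteratedFDeriv_zero]; simp
      · rw [iteratedFDeriv_const_of_ne hi0.ne']; simp
    nlinarith [mul_le_mul hfac hDn zero_le_one (by positivity)]
  · have hmem : x ∈ {x : Fin 3 → ℝ | x ≠ 0} := hne x hx2
    have key := norm_iteratedFDerivWithin_comp_le (g := ψ) (f := bodyGauge ρ) (n := i)
      (s := {x | x ≠ 0}) (t := Set.univ) (x := x) (C := A) (D := D)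
      (hψ.contDiffOn) (contDiffOn_infty.2 h.contDiffOn_bodyGauge) (by exact_mod_cast le_top)
      uniqueDiffOn_univ hopen.uniqueDiffOn (Set.mapsTo_univ _ _) hmem
      (fun j hj => by
        rw [iteratedFDerivWithin_univ, norm_iteratedFDeriv_eq_norm_iteratedDeriv]
        exact hA j (hj.trans hi) _)
      (fun j hj1 hj => by
        rw [iteratedFDerivWithin_of_isOpen j hopen hmem]
        exact ((hB j x ⟨hx, hx2⟩).trans (hBD j (hj.trans hi))).trans
          (le_self_pow₀ hD1 (by omega)))
    rw [iteratedFDerivWithin_of_isOpen i hopen hmem] at key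
    refine key.trans ?_
    have e1 : (i.factorial : ℝ) ≤ n.factorial := by exact_mod_cast Nat.factorial_le hi
    have e2 : D ^ i ≤ D ^ n := pow_le_pow_right₀ hD1 hi
    calc (i.factorial : ℝ) * A * D ^ i ≤ n.factorial * A * D ^ n := by gcongr
      _ = _ := by ring

theorem IsProfile.exists_fourier_comp_bodyGauge_le (h : IsProfile ρ) (n : ℕ) :
    ∃ C, 0 < C ∧ ∀ (ψ : ℝ → ℝ) (A : ℝ), ContDiff ℝ (⊤ : ℕ∞) ψ → (∀ v ≤ 1 / 2, ψ v = 1) →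
      (∀ v, 3 / 2 ≤ v → ψ v = 0) → (∀ i ≤ n, ∀ v, |iteratedDeriv i ψ v| ≤ A) →
      ∀ (η : Fin 3 → ℝ) (i : Fin 3),
      |η i| ^ n * ‖∫ x : Fin 3 → ℝ, ee (-(∑ j, η j * x j)) * (ψ (bodyGauge ρ x) : ℂ)‖ ≤ C * A := by
  obtain ⟨C, hC, hb⟩ := h.exists_iteratedFDeriv_comp_le n
  set V := volume.real {x : Fin 3 → ℝ | bodyGauge ρ x ≤ 3 / 2} with hV
  refine ⟨2 ^ n * ((n + 1) * (C * V)) + 1, by positivity, fun ψ A hψ h1 h0 hA η i => ?_⟩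
  have hA1 : 1 ≤ A := by
    have := hA 0 (Nat.zero_le _) 0
    simpa [h1 0 (by norm_num)] using this
  have hbody := h.isCompact_body (3 / 2)
  have hg := h.contDiff_comp_bodyGauge hψ h1
  set g : (Fin 3 → ℝ) → ℂ := fun x => (ψ (bodyGauge ρ x) : ℂ) with hgdef
  have hgC : ContDiff ℝ (⊤ : ℕ∞) g := Complex.ofRealCLM.contDiff.comp hg
  have hzero : ∀ x, x ∉ {x : Fin 3 → ℝ | bodyGauge ρ x ≤ 3 / 2} → g x = 0 := by
    intro x hx
    have : 3 / 2 < bodyGauge ρ x := by simpa using hx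
    simp [hgdef, h0 _ this.le]
  have hcs : HasCompactSupport g := HasCompactSupport.intro hbody hzero
  have hnorm : ∀ j ≤ n, ∀ x, ‖iteratedFDeriv ℝ j g x‖
      ≤ {x : Fin 3 → ℝ | bodyGauge ρ x ≤ 3 / 2}.indicator (fun _ => C * A) x := by
    intro j hj x
    by_cases hx : x ∈ {x : Fin 3 → ℝ | bodyGauge ρ x ≤ 3 / 2}
    · rw [Set.indicator_of_mem hx]
      have := Complex.ofRealLI.norm_iteratedFDeriv_comp_left (x := x) (i := j)
        hg.contDiffAt (by exact_mod_cast le_top)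
      have e : (⇑Complex.ofRealLI ∘ fun x => ψ (bodyGauge ρ x)) = g := rfl
      rw [e] at this
      rw [this]
      exact hb ψ A hψ h1 hA x hx j hj
    · rw [Set.indicator_of_notMem hx]
      have hx' : x ∉ tsupport g := fun hh =>
        hx (closure_minimal (fun y hy => by by_contra hc; exact hy (hzero y hc)) hbody.isClosed hh)
      have : iteratedFDeriv ℝ j g x = 0 := by
        by_contra hc
        exact hx' (support_iteratedFDeriv_subset j hc)
      rw [this, norm_zero]
  have hInt : ∀ k j : ℕ, Integrable (fun v => ‖v‖ ^ k * ‖iteratedFDeriv ℝ j g v‖) := by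
    intro k j
    have hc : Continuous fun v => ‖v‖ ^ k * ‖iteratedFDeriv ℝ j g v‖ :=
      (continuous_norm.pow k).mul
        (hgC.continuous_iteratedFDeriv (m := j) (by exact_mod_cast le_top)).norm
    exact hc.integrable_of_hasCompactSupport (hcs.iteratedFDeriv j).norm.mul_left
  let ℓ : (Fin 3 → ℝ) →L[ℝ] ℝ := ∑ j, η j • ContinuousLinearMap.proj j
  let L : (Fin 3 → ℝ) →L[ℝ] ℝ →L[ℝ] ℝ := ℓ.smulRight (ContinuousLinearMap.id ℝ ℝ)
  have hL : ∀ v : Fin 3 → ℝ, L v 1 = ∑ j, η j * v j := by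
    intro v
    simp [L, ℓ]
  have key := VectorFourier.pow_mul_norm_iteratedFDeriv_fourierIntegral_le L (f := g)
    (μ := (volume : Measure (Fin 3 → ℝ))) (K := 0) (N := n)
    (hgC.of_le (by exact_mod_cast le_top)) (fun k j _ _ => hInt k j) (k := 0) (n := n) le_rfl le_rfl
    (Pi.single i 1) 1
  rw [norm_iteratedFDeriv_zero, hL] at key
  have e1 : VectorFourier.fourierIntegral Real.fourierChar volume L.toLinearMap₁₂ g 1
      = ∫ x : Fin 3 → ℝ, ee (-(∑ j, η j * x j)) * g x := by
    rw [VectorFourier.fourierIntegral]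
    refine integral_congr_ae (ae_of_all _ fun x => ?_)
    beta_reduce
    rw [show (L.toLinearMap₁₂ x) 1 = ∑ j, η j * x j from hL x, Circle.smul_def, smul_eq_mul,
      Real.fourierChar_apply, ee]
    congr 2
    push_cast
    ring
  have e2 : ∑ j, η j * (Pi.single i 1 : Fin 3 → ℝ) j = η i := by
    simp [Pi.single_apply]
  rw [e1, e2] at key
  refine key.trans ?_
  have e3 : ∀ p ∈ Finset.range 1 ×ˢ Finset.range (n + 1),
      ∫ v, ‖v‖ ^ p.1 * ‖iteratedFDeriv ℝ p.2 g v‖ ≤ C * A * V := by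
    intro p hp
    rw [Finset.mem_product, Finset.mem_range, Finset.mem_range] at hp
    have hp1 : p.1 = 0 := by omega
    rw [hp1]
    calc _ ≤ ∫ v, {x : Fin 3 → ℝ | bodyGauge ρ x ≤ 3 / 2}.indicator (fun _ => C * A) v := by
          refine integral_mono (by exact hInt 0 p.2) ?_ fun v => ?_
          · exact (integrable_indicator_iff hbody.measurableSet).2
              (integrableOn_const hbody.measure_lt_top.ne)
          · simpa using hnorm p.2 (by omega) v
      _ = C * A * V := by
          rw [integral_indicator hbody.measurableSet, setIntegral_const, smul_eq_mul, mul_comm]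
  have e4 := Finset.sum_le_card_nsmul _ _ _ e3
  have e5 : ‖(Pi.single i 1 : Fin 3 → ℝ)‖ = 1 := by rw [Pi.norm_single, norm_one]
  rw [e5]
  rw [Finset.card_product, Finset.card_range, Finset.card_range, nsmul_eq_mul] at e4
  push_cast [zero_add] at e4
  calc _ = 2 ^ n * ∑ p ∈ Finset.range 1 ×ˢ Finset.range (n + 1),
        ∫ v, ‖v‖ ^ p.1 * ‖iteratedFDeriv ℝ p.2 g v‖ := by simp
    _ ≤ 2 ^ n * (1 * (n + 1) * (C * A * V)) :=
        mul_le_mul_of_nonneg_left e4 (by positivity)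
    _ ≤ _ := by nlinarith

/-- The supremum norm of an integer vector. -/
def supNorm (m : Fin 3 → ℤ) : ℕ := Finset.univ.sup fun i => (m i).natAbs

theorem natAbs_le_supNorm (m : Fin 3 → ℤ) (i : Fin 3) : (m i).natAbs ≤ supNorm m :=
  Finset.le_sup (f := fun i => (m i).natAbs) (Finset.mem_univ i)

theorem supNorm_le_iff {m : Fin 3 → ℤ} {k : ℕ} : supNorm m ≤ k ↔ ∀ i, (m i).natAbs ≤ k := by
  simp [supNorm, Finset.sup_le_iff]

theorem exists_natAbs_eq_supNorm (m : Fin 3 → ℤ) : ∃ i, (m i).natAbs = supNorm m := by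
  obtain ⟨i, -, hi⟩ := Finset.exists_mem_eq_sup Finset.univ Finset.univ_nonempty
    fun i => (m i).natAbs
  exact ⟨i, hi.symm⟩

theorem one_le_supNorm {m : Fin 3 → ℤ} (hm : m ≠ 0) : 1 ≤ supNorm m := by
  by_contra! h
  refine hm (funext fun i => ?_)
  have := natAbs_le_supNorm m i
  simp only [Pi.zero_apply]
  omega

theorem abs_le_supNorm (m : Fin 3 → ℤ) (i : Fin 3) : |(m i : ℝ)| ≤ supNorm m := by
  rw [← Int.cast_abs, Int.abs_eq_natAbs]
  exact_mod_cast natAbs_le_supNorm m i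

theorem exists_abs_eq_supNorm (m : Fin 3 → ℤ) : ∃ i, |(m i : ℝ)| = supNorm m := by
  obtain ⟨i, hi⟩ := exists_natAbs_eq_supNorm m
  refine ⟨i, ?_⟩
  rw [← Int.cast_abs, Int.abs_eq_natAbs, hi]
  simp

theorem norm_intVec (m : Fin 3 → ℤ) : ‖intVec m‖ = supNorm m := by
  refine le_antisymm ((pi_norm_le_iff_of_nonneg (by positivity)).2 fun i => ?_) ?_
  · exact abs_le_supNorm m i
  · obtain ⟨i, hi⟩ := exists_abs_eq_supNorm m
    rw [← hi]
    exact norm_le_pi_norm (intVec m) i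

/-- The integer vectors of supremum norm at most `k`. -/
noncomputable def intBox (k : ℕ) : Finset (Fin 3 → ℤ) :=
  Fintype.piFinset fun _ => Finset.Icc (-(k : ℤ)) k

theorem mem_intBox {k : ℕ} {m : Fin 3 → ℤ} : m ∈ intBox k ↔ supNorm m ≤ k := by
  rw [intBox, Fintype.mem_piFinset, supNorm_le_iff]
  refine forall_congr' fun i => ?_
  rw [Finset.mem_Icc]; omega

theorem card_intBox (k : ℕ) : (intBox k).card = (2 * k + 1) ^ 3 := by
  rw [intBox, Fintype.card_piFinset]
  simp only [Int.card_Icc, Finset.prod_const, Finset.card_univ, Fintype.card_fin]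
  congr 1
  omega

theorem card_filter_supNorm_le (F : Finset (Fin 3 → ℤ)) {k : ℕ} (hk : 1 ≤ k) :
    ((F.filter fun m => supNorm m = k).card : ℝ) ≤ 26 * (k : ℝ) ^ 2 := by
  obtain ⟨j, rfl⟩ := Nat.exists_eq_add_of_le' hk
  have hsub : (F.filter fun m => supNorm m = j + 1) ⊆ intBox (j + 1) \ intBox j := by
    intro m hm
    rw [Finset.mem_filter] at hm
    rw [Finset.mem_sdiff, mem_intBox, mem_intBox]
    omega
  have hb : intBox j ⊆ intBox (j + 1) := fun m hm => by
    rw [mem_intBox] at hm ⊢; omega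
  have h1 := Finset.card_le_card hsub
  have h2 := Finset.card_sdiff_add_card_eq_card hb
  rw [card_intBox, card_intBox] at h2
  have h3 : (((intBox (j + 1) \ intBox j).card : ℕ) : ℝ) + (2 * j + 1) ^ 3
      = (2 * (j + 1) + 1) ^ 3 := by exact_mod_cast h2
  have h4 : ((F.filter fun m => supNorm m = j + 1).card : ℝ)
      ≤ (intBox (j + 1) \ intBox j).card := by exact_mod_cast h1
  have hj : (0 : ℝ) ≤ j := by positivity
  push_cast
  nlinarith

theorem sum_supNorm_le (F : Finset (Fin 3 → ℤ)) (hF : ∀ m ∈ F, m ≠ 0) {f : ℕ → ℝ}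
    (hf : ∀ k, 0 ≤ f k) {B : ℝ}
    (hB : ∀ K : ℕ, ∑ k ∈ Finset.Icc 1 K, (k : ℝ) ^ 2 * f k ≤ B) :
    ∑ m ∈ F, f (supNorm m) ≤ 26 * B := by
  set K := F.sup supNorm with hK
  have hmaps : ∀ m ∈ F, supNorm m ∈ Finset.Icc 1 K := fun m hm =>
    Finset.mem_Icc.2 ⟨one_le_supNorm (hF m hm), Finset.le_sup hm⟩
  rw [← Finset.sum_fiberwise_of_maps_to hmaps]
  calc _ ≤ ∑ k ∈ Finset.Icc 1 K, 26 * ((k : ℝ) ^ 2 * f k) := by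
        refine Finset.sum_le_sum fun k hk => ?_
        rw [Finset.sum_congr rfl fun m hm => by rw [(Finset.mem_filter.1 hm).2],
          Finset.sum_const, nsmul_eq_mul, ← mul_assoc]
        exact mul_le_mul_of_nonneg_right
          (card_filter_supNorm_le F (Finset.mem_Icc.1 hk).1) (hf k)
    _ ≤ 26 * B := by
        rw [← Finset.mul_sum]
        exact mul_le_mul_of_nonneg_left (hB K) (by norm_num)

theorem sum_min_le {N : ℝ} (hN : 1 ≤ N) (K : ℕ) :
    ∑ k ∈ Finset.Icc 1 K, min 1 (N ^ 2 / (k : ℝ) ^ 2) ≤ 4 * N := by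
  have key : ∑ k ∈ Finset.Icc 1 K, min 1 (N ^ 2 / (k : ℝ) ^ 2)
      ≤ 4 * N ^ 2 * (1 / N - 1 / (K + N)) := by
    induction K with
    | zero => simp
    | succ K ih =>
      rw [Finset.sum_Icc_succ_top (by omega)]
      have hK : (0 : ℝ) ≤ K := by positivity
      have h1 : min 1 (N ^ 2 / ((K + 1 : ℕ) : ℝ) ^ 2)
          ≤ 4 * N ^ 2 * (1 / (K + N) - 1 / ((K + 1 : ℕ) + N)) := by
        push_cast
        have e : 4 * N ^ 2 * (1 / (K + N) - 1 / ((K : ℝ) + 1 + N))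
            = 4 * N ^ 2 / ((K + N) * (K + 1 + N)) := by
          field_simp; ring
        rw [e]
        rcases le_total ((K : ℝ) + 1) N with h | h
        · refine (min_le_left _ _).trans ?_
          rw [one_le_div (by positivity)]
          nlinarith
        · refine (min_le_right _ _).trans ?_
          rw [div_le_div_iff₀ (by positivity) (by positivity)]
          have : (K + N) * (K + 1 + N) ≤ 4 * ((K : ℝ) + 1) ^ 2 := by nlinarith
          nlinarith [mul_le_mul_of_nonneg_left this (sq_nonneg N)]
      linarith
  refine key.trans ?_
  have : 0 ≤ 4 * N ^ 2 * (1 / (K + N)) := by positivity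
  have e : 4 * N ^ 2 * (1 / N) = 4 * N := by field_simp
  rw [mul_sub, e]; linarith

theorem sum_min_supNorm_le {N : ℝ} (hN : 1 ≤ N) (F : Finset (Fin 3 → ℤ)) (hF : ∀ m ∈ F, m ≠ 0) :
    ∑ m ∈ F, min 1 (N ^ 2 / (supNorm m : ℝ) ^ 2) / (supNorm m : ℝ) ^ 2 ≤ 104 * N := by
  have := sum_supNorm_le F hF (f := fun k => min 1 (N ^ 2 / (k : ℝ) ^ 2) / (k : ℝ) ^ 2)
    (fun k => by positivity) (B := 4 * N) (fun K => by
      refine le_trans (le_of_eq (Finset.sum_congr rfl fun k hk => ?_)) (sum_min_le hN K)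
      have : (0 : ℝ) < k := by exact_mod_cast (Finset.mem_Icc.1 hk).1
      field_simp)
  linarith

theorem summable_supNorm : Summable fun m : Fin 3 → ℤ => ((supNorm m : ℝ) ^ 3 * √(supNorm m))⁻¹ := by
  have hs : Summable fun k : ℕ => 1 / (k : ℝ) ^ (3 / 2 : ℝ) :=
    Real.summable_one_div_nat_rpow.2 (by norm_num)
  refine summable_of_sum_le (c := 26 * ∑' k : ℕ, 1 / (k : ℝ) ^ (3 / 2 : ℝ))
    (fun m => by positivity) fun F => ?_
  have h0 : ((supNorm 0 : ℝ) ^ 3 * √(supNorm 0))⁻¹ = 0 := by simp [supNorm]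
  have h1 : ∑ m ∈ F, ((supNorm m : ℝ) ^ 3 * √(supNorm m))⁻¹
      = ∑ m ∈ F.erase 0, ((supNorm m : ℝ) ^ 3 * √(supNorm m))⁻¹ :=
    (Finset.sum_erase F h0).symm
  rw [h1]
  refine sum_supNorm_le _ (fun m hm => Finset.ne_of_mem_erase hm)
    (f := fun k => ((k : ℝ) ^ 3 * √k)⁻¹) (fun k => by positivity) fun K => ?_
  refine le_trans (Finset.sum_le_sum fun k hk => ?_)
    (hs.sum_le_tsum (Finset.Icc 1 K) fun k _ => by positivity)
  have hk : (0 : ℝ) < k := by exact_mod_cast (Finset.mem_Icc.1 hk).1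
  have e : (k : ℝ) ^ (3 / 2 : ℝ) = k * √k := by
    rw [show (3 / 2 : ℝ) = 1 + 1 / 2 by norm_num, rpow_add hk, rpow_one, sqrt_eq_rpow]
  rw [e]
  have : 0 < √(k : ℝ) := sqrt_pos.2 hk
  generalize √(k : ℝ) = s at *
  apply le_of_eq
  field_simp

theorem summable_axis : Summable fun m : Fin 3 → ℤ =>
    if (m 0 : ℝ) ^ 2 + (m 1 : ℝ) ^ 2 = 0 then ((m 2 : ℝ) ^ 2)⁻¹ else 0 := by
  have hinj : Function.Injective fun k : ℤ => (![0, 0, k] : Fin 3 → ℤ) := fun a b hab => by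
    simpa using congrFun hab 2
  refine (hinj.summable_iff fun m hm => ?_).1 ?_
  · rw [if_neg]
    intro h0
    refine hm ⟨m 2, ?_⟩
    have h1 : (m 0 : ℝ) = 0 := by nlinarith [sq_nonneg (m 0 : ℝ), sq_nonneg (m 1 : ℝ)]
    have h2 : (m 1 : ℝ) = 0 := by nlinarith [sq_nonneg (m 0 : ℝ), sq_nonneg (m 1 : ℝ)]
    funext i
    fin_cases i
    · simpa using (by exact_mod_cast h1.symm)
    · simpa using (by exact_mod_cast h2.symm)
    · simp
  · have := (Real.summable_one_div_int_pow (p := 2)).2 (by norm_num)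
    refine this.congr fun k => ?_
    simp

/-- The kernel rescaled to width `1 / N` and recentred at `X`. -/
noncomputable def bumpAt (N X u : ℝ) : ℝ := N * kernel (N * (u - X))

/-- A smooth approximation of the indicator function of `X` times the body. -/
noncomputable def smoothBody (ρ : ℝ → ℝ) (N X : ℝ) (x : Fin 3 → ℝ) : ℂ :=
  (smoothStep (N * (bodyGauge ρ x - X)) : ℝ)

theorem bumpAt_nonneg {N : ℝ} (hN : 0 ≤ N) (X u : ℝ) : 0 ≤ bumpAt N X u :=
  mul_nonneg hN (kernel_nonneg _)

theorem continuous_bumpAt (N X : ℝ) : Continuous (bumpAt N X) := by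
  have := contDiff_kernel.continuous
  unfold bumpAt
  fun_prop

theorem bumpAt_eq_zero {N X u : ℝ} (hN : 1 ≤ N) (hu : 1 ≤ |u - X|) : bumpAt N X u = 0 := by
  rw [bumpAt, kernel_eq_zero, mul_zero]
  rw [abs_mul, abs_of_pos (by linarith)]
  nlinarith

theorem integrable_bumpAt {N : ℝ} (hN : 0 < N) (X : ℝ) : Integrable (bumpAt N X) :=
  ((integrable_kernel.comp_mul_left' hN.ne').comp_sub_right X).const_mul N

theorem integral_bumpAt_mul_ee {N : ℝ} (hN : 0 < N) (X s : ℝ) :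
    ∫ u, (bumpAt N X u : ℂ) * ee (s * u) = ((halfKernelFT (s / N) ^ 2 : ℝ) : ℂ) * ee (s * X) := by
  have h1 : ∀ u, (bumpAt N X u : ℂ) * ee (s * u)
      = (N * ee (s * X)) * (fun v => (kernel v : ℂ) * ee (s / N * v)) (N * (u - X)) := by
    intro u
    have : s * u = s * X + s / N * (N * (u - X)) := by field_simp; ring
    simp only [bumpAt]
    rw [this, ee_add]
    push_cast
    ring
  simp_rw [h1]
  rw [integral_const_mul, integral_sub_right_eq_self
    (fun u => (fun v => (kernel v : ℂ) * ee (s / N * v)) (N * u)) X,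
    Measure.integral_comp_mul_left (fun v => (kernel v : ℂ) * ee (s / N * v)) N,
    integral_kernel_mul_ee, abs_of_pos (by positivity), Complex.real_smul]
  have : (N : ℂ) ≠ 0 := by exact_mod_cast hN.ne'
  push_cast
  field_simp

theorem integral_bumpAt {N : ℝ} (hN : 0 < N) (X : ℝ) : ∫ u, bumpAt N X u = 1 := by
  unfold bumpAt
  rw [integral_const_mul, integral_sub_right_eq_self (fun u => kernel (N * u)) X,
    Measure.integral_comp_mul_left kernel N, integral_kernel, abs_of_pos (by positivity)]
  simp [hN.ne']

namespace IsProfile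

variable {ρ : ℝ → ℝ}

theorem exists_fourierAt_smoothBody_le (h : IsProfile ρ) (n : ℕ) :
    ∃ C, 0 < C ∧ ∀ N X : ℝ, 1 ≤ N → 2 ≤ X → ∀ m : Fin 3 → ℤ,
      (supNorm m : ℝ) ^ n * ‖fourierAt (smoothBody ρ N X) m‖ ≤ C * (X ^ 3 * N ^ n) := by
  obtain ⟨C, hC, hF⟩ := h.exists_fourier_comp_bodyGauge_le n
  obtain ⟨B, hB1, hB⟩ := exists_iteratedDeriv_smoothStep_scaled_le n
  refine ⟨C * B, by positivity, fun N X hN hX m => ?_⟩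
  have hX0 : 0 < X := by linarith
  have hNX : 2 ≤ N * X := by nlinarith
  obtain ⟨i, hi⟩ := exists_abs_eq_supNorm m
  have key := hF (fun v => smoothStep (N * X * (v - 1))) (B * (N * X) ^ n)
    (contDiff_smoothStep.comp (by fun_prop))
    (fun v hv => smoothStep_of_le (by nlinarith)) (fun v hv => smoothStep_of_ge (by nlinarith))
    (hB (N * X) (by linarith)) (fun j => X * m j) i
  have e : fourierAt (smoothBody ρ N X) m = X ^ 3 * ∫ x : Fin 3 → ℝ, ee (-(∑ j, X * m j * x j)) *
      (smoothStep (N * X * (bodyGauge ρ x - 1)) : ℂ) := by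
    have := Measure.integral_comp_smul (volume : Measure (Fin 3 → ℝ))
      (fun x => ee (-(∑ j, m j * x j)) * smoothBody ρ N X x) X
    rw [Module.finrank_fin_fun, abs_of_pos (by positivity), Complex.real_smul] at this
    have hX3 : (X : ℂ) ≠ 0 := by exact_mod_cast hX0.ne'
    have e2 : fourierAt (smoothBody ρ N X) m = X ^ 3 * ∫ x : Fin 3 → ℝ,
        ee (-(∑ j, m j * (X • x) j)) * smoothBody ρ N X (X • x) := by
      rw [this, fourierAt]; push_cast; field_simp
    rw [e2]
    congr 2
    funext x
    have s1 : ∑ j, (m j : ℝ) * (X • x) j = ∑ j, X * m j * x j :=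
      Finset.sum_congr rfl fun j _ => by rw [Pi.smul_apply, smul_eq_mul]; ring
    have s2 : N * (bodyGauge ρ (X • x) - X) = N * X * (bodyGauge ρ x - 1) := by
      rw [bodyGauge_smul hX0.le]; ring
    rw [s1, smoothBody, s2]
  rw [e, norm_mul, norm_pow, Complex.norm_real, norm_of_nonneg hX0.le]
  rw [abs_mul, abs_of_pos hX0, hi] at key
  set I := ‖∫ x : Fin 3 → ℝ, ee (-(∑ j, X * m j * x j)) *
      (smoothStep (N * X * (bodyGauge ρ x - 1)) : ℂ)‖
  have k2 : X ^ n * ((supNorm m : ℝ) ^ n * I) ≤ X ^ n * (C * B * N ^ n) := by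
    rw [mul_pow, mul_pow] at key
    linarith
  have k3 := le_of_mul_le_mul_left k2 (by positivity)
  nlinarith [mul_le_mul_of_nonneg_left k3 (show 0 ≤ X ^ 3 by positivity)]

theorem continuous_smoothBody (h : IsProfile ρ) (N X : ℝ) : Continuous (smoothBody ρ N X) := by
  have h1 := contDiff_smoothStep.continuous
  have h2 := h.continuous_bodyGauge
  unfold smoothBody
  fun_prop

theorem smoothBody_eq_zero {N X : ℝ} (hN : 1 ≤ N) {x : Fin 3 → ℝ} (hx : X + 1 ≤ bodyGauge ρ x) :
    smoothBody ρ N X x = 0 := by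
  rw [smoothBody, smoothStep_of_ge (by nlinarith), Complex.ofReal_zero]

theorem integrable_prod_bumpAt (h : IsProfile ρ) {N : ℝ} (hN : 1 ≤ N) (X : ℝ) (ξ : Fin 3 → ℝ) :
    Integrable (fun p : (Fin 3 → ℝ) × ℝ => ee (-(∑ i, ξ i * p.1 i)) *
      ((if bodyGauge ρ p.1 ≤ p.2 then bumpAt N X p.2 else 0 : ℝ) : ℂ)) := by
  have hK := h.isCompact_body (X + 1)
  have h1 : Integrable ({x | bodyGauge ρ x ≤ X + 1}.indicator fun _ => (1 : ℝ)) := by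
    rw [integrable_indicator_iff hK.measurableSet]
    exact continuousOn_const.integrableOn_compact hK
  have h2 := h1.mul_prod (integrable_bumpAt (by linarith : 0 < N) X)
  have hc := h.continuous_bodyGauge
  refine h2.mono' ?_ (Filter.Eventually.of_forall fun p => ?_)
  · refine AEStronglyMeasurable.mul ?_ ?_
    · exact (continuous_ee.comp (by fun_prop)).aestronglyMeasurable
    · refine Measurable.aestronglyMeasurable ?_
      refine Complex.measurable_ofReal.comp (Measurable.ite ?_ ?_ measurable_const)
      · exact (isClosed_le (hc.comp continuous_fst) continuous_snd).measurableSet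
      · exact ((continuous_bumpAt N X).comp continuous_snd).measurable
  · rw [norm_mul, norm_ee, one_mul, Complex.norm_real]
    have hb := bumpAt_nonneg (by linarith : 0 ≤ N) X p.2
    by_cases hp : bodyGauge ρ p.1 ≤ X + 1
    · rw [Set.indicator_of_mem (by exact hp), one_mul]
      split_ifs
      · rw [norm_of_nonneg hb]
      · rwa [norm_zero]
    · rw [Set.indicator_of_notMem (by exact hp), zero_mul]
      split_ifs with h3
      · rw [bumpAt_eq_zero hN, norm_zero]
        rw [le_abs]; left; linarith
      · rw [norm_zero]

theorem integral_body_bumpAt (h : IsProfile ρ) (N X : ℝ) (ξ : Fin 3 → ℝ) (u : ℝ) :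
    ∫ x : Fin 3 → ℝ, ee (-(∑ i, ξ i * x i)) *
      ((if bodyGauge ρ x ≤ u then bumpAt N X u else 0 : ℝ) : ℂ)
      = (bumpAt N X u : ℂ) * bodyFT ρ u ξ := by
  rw [bodyFT, ← integral_indicator (h.isCompact_body u).measurableSet, ← integral_const_mul]
  congr 1
  funext x
  by_cases hx : bodyGauge ρ x ≤ u
  · rw [if_pos hx, Set.indicator_of_mem (by exact hx), mul_comm]
  · rw [if_neg hx, Set.indicator_of_notMem (by exact hx)]; simp

theorem integrable_bumpAt_mul_bodyFT (h : IsProfile ρ) {N : ℝ} (hN : 1 ≤ N) (X : ℝ)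
    (ξ : Fin 3 → ℝ) : Integrable fun u => (bumpAt N X u : ℂ) * bodyFT ρ u ξ := by
  have := (h.integrable_prod_bumpAt hN X ξ).integral_prod_right
  simpa only [h.integral_body_bumpAt] using this

theorem fourierAt_smoothBody_eq (h : IsProfile ρ) {N : ℝ} (hN : 1 ≤ N) (X : ℝ) (m : Fin 3 → ℤ) :
    fourierAt (smoothBody ρ N X) m = ∫ u, (bumpAt N X u : ℂ) * bodyFT ρ u (intVec m) := by
  have hs := integral_integral_swap (f := fun (x : Fin 3 → ℝ) (u : ℝ) =>
    ee (-(∑ i, intVec m i * x i)) * ((if bodyGauge ρ x ≤ u then bumpAt N X u else 0 : ℝ) : ℂ))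
    (h.integrable_prod_bumpAt hN X (intVec m))
  simp only [h.integral_body_bumpAt] at hs
  rw [← hs, fourierAt]
  congr 1
  funext x
  rw [integral_const_mul, integral_complex_ofReal]
  congr 1
  exact congrArg Complex.ofReal (smoothStep_eq_integral N X (bodyGauge ρ x) (by linarith)).symm

theorem summable_fourierAt_smoothBody (h : IsProfile ρ) {N X : ℝ} (hN : 1 ≤ N) (hX : 2 ≤ X) :
    Summable (fourierAt (smoothBody ρ N X)) := by
  obtain ⟨C, hC, hF⟩ := h.exists_fourierAt_smoothBody_le 4
  refine Summable.of_norm_bounded_eventually (summable_supNorm.mul_left (C * (X ^ 3 * N ^ 4))) ?_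
  filter_upwards [(Set.finite_singleton (0 : Fin 3 → ℤ)).compl_mem_cofinite] with m hm
  have h1 : (1 : ℝ) ≤ supNorm m := by exact_mod_cast one_le_supNorm hm
  have h2 := hF N X hN hX m
  rw [← div_eq_mul_inv, le_div_iff₀ (by positivity)]
  refine le_trans ?_ h2
  rw [mul_comm, pow_succ _ 3]
  have : √(supNorm m : ℝ) ≤ supNorm m := Real.sqrt_le_self_iff.2 (Or.inr h1) 
  gcongr

theorem exists_norm_le_of_smoothBody_ne_zero (h : IsProfile ρ) {N : ℝ} (hN : 1 ≤ N) (X : ℝ) :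
    ∃ R, ∀ x, smoothBody ρ N X x ≠ 0 → ‖x‖ ≤ R := by
  obtain ⟨R, hR⟩ := (h.isCompact_body (X + 1)).isBounded.exists_norm_le
  refine ⟨R, fun x hx => hR x ?_⟩
  by_contra hc
  exact hx (smoothBody_eq_zero hN (not_le.1 hc).le)

theorem finite_lattice_body (h : IsProfile ρ) (u : ℝ) :
    {m : Fin 3 → ℤ | bodyGauge ρ (intVec m) ≤ u}.Finite := by
  obtain ⟨R, hR⟩ := (h.isCompact_body u).isBounded.exists_norm_le
  refine (intBox ⌊R⌋₊).finite_toSet.subset fun m hm => ?_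
  have := hR _ hm
  rw [norm_intVec] at this
  exact mem_intBox.2 (Nat.le_floor this)

end IsProfile

/-- Number of lattice points minus volume, for the body dilated linearly by `u`. -/
noncomputable def bodyDisc (ρ : ℝ → ℝ) (u : ℝ) : ℝ :=
  (Nat.card {m : Fin 3 → ℤ // bodyGauge ρ (intVec m) ≤ u} : ℝ)
    - volume.real {x : Fin 3 → ℝ | bodyGauge ρ x ≤ u}

namespace IsProfile

variable {ρ : ℝ → ℝ}

theorem bodyFT_zero (u : ℝ) : bodyFT ρ u (intVec 0) = (volume.real {x | bodyGauge ρ x ≤ u} : ℝ) := by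
  simp [bodyFT, intVec, ee_zero]

theorem tsum_smoothBody (h : IsProfile ρ) {N : ℝ} (hN : 1 ≤ N) (X : ℝ) :
    (Integrable fun u => bumpAt N X u * Nat.card {m : Fin 3 → ℤ // bodyGauge ρ (intVec m) ≤ u}) ∧
    ∑' m, smoothBody ρ N X (intVec m) = ((∫ u, bumpAt N X u *
      Nat.card {m : Fin 3 → ℤ // bodyGauge ρ (intVec m) ≤ u} : ℝ) : ℂ) := by
  classical
  set F := (h.finite_lattice_body (X + 1)).toFinset with hF
  have hmem : ∀ m, m ∈ F ↔ bodyGauge ρ (intVec m) ≤ X + 1 := fun m => by simp [hF]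
  have e1 : ∀ u, bumpAt N X u * Nat.card {m : Fin 3 → ℤ // bodyGauge ρ (intVec m) ≤ u}
      = ∑ m ∈ F, if bodyGauge ρ (intVec m) ≤ u then bumpAt N X u else 0 := by
    intro u
    by_cases hu : u ≤ X + 1
    · have : Nat.card {m : Fin 3 → ℤ // bodyGauge ρ (intVec m) ≤ u}
          = (F.filter fun m => bodyGauge ρ (intVec m) ≤ u).card := by
        refine Nat.subtype_card _ fun m => ?_
        rw [Finset.mem_filter, hmem]
        exact ⟨fun hm => hm.2, fun hm => ⟨hm.trans hu, hm⟩⟩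
      rw [this, ← Finset.sum_filter, Finset.sum_const, nsmul_eq_mul, mul_comm]
    · rw [bumpAt_eq_zero hN (by rw [le_abs]; left; linarith)]
      simp
  have hi : ∀ m : Fin 3 → ℤ, Integrable fun u =>
      if bodyGauge ρ (intVec m) ≤ u then bumpAt N X u else 0 := fun m => by
    have := (integrable_bumpAt (by linarith : 0 < N) X).indicator
      (measurableSet_Ici (a := bodyGauge ρ (intVec m)))
    refine this.congr (Filter.Eventually.of_forall fun u => ?_)
    simp [Set.indicator_apply]
  simp_rw [e1]
  refine ⟨integrable_finsetSum _ fun m _ => hi m, ?_⟩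
  rw [integral_finsetSum _ fun m _ => hi m, tsum_eq_sum (s := F)]
  · push_cast
    refine Finset.sum_congr rfl fun m _ => ?_
    rw [smoothBody, ← smoothStep_eq_integral N X _ (by linarith)]
    rfl
  · intro m hm
    rw [hmem, not_le] at hm
    exact smoothBody_eq_zero hN hm.le

theorem exists_bodyDisc_le (h : IsProfile ρ) {N X : ℝ} (hN : 1 ≤ N) (hX : 2 ≤ X) :
    ∃ u ∈ Set.Icc (X - 1) (X + 1), bodyDisc ρ u ≤
      1 + (∑' m, if m = 0 then 0 else fourierAt (smoothBody ρ N X) m).re := by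
  have hN0 : 0 < N := by linarith
  obtain ⟨hi1, hs⟩ := h.tsum_smoothBody hN X
  obtain ⟨R, hR⟩ := h.exists_norm_le_of_smoothBody_ne_zero hN X
  have hsum := h.summable_fourierAt_smoothBody hN hX
  rw [poisson_summation (h.continuous_smoothBody N X) hR hsum, hsum.tsum_eq_add_tsum_ite 0,
    h.fourierAt_smoothBody_eq hN X 0] at hs
  have hi2 := h.integrable_bumpAt_mul_bodyFT hN X (intVec 0)
  simp only [bodyFT_zero, ← Complex.ofReal_mul] at hs hi2
  rw [integral_complex_ofReal] at hs
  have hi2' : Integrable fun u => bumpAt N X u * volume.real {x | bodyGauge ρ x ≤ u} := by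
    simpa using hi2.re
  set S := ∑' m, if m = 0 then 0 else fourierAt (smoothBody ρ N X) m with hS
  by_contra! hcon
  have hD : ∫ u, bumpAt N X u * bodyDisc ρ u = S.re := by
    simp only [bodyDisc, mul_sub]
    rw [integral_sub hi1 hi2']
    have := congrArg Complex.re hs
    rw [Complex.add_re, Complex.ofReal_re, Complex.ofReal_re] at this
    linarith
  have hge : ∫ u, bumpAt N X u * (1 + S.re) ≤ ∫ u, bumpAt N X u * bodyDisc ρ u := by
    refine integral_mono ((integrable_bumpAt hN0 X).mul_const _) ?_ fun u => ?_
    · simp only [bodyDisc, mul_sub]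
      exact hi1.sub hi2'
    · beta_reduce
      by_cases hu : u ∈ Set.Icc (X - 1) (X + 1)
      · exact mul_le_mul_of_nonneg_left (hcon u hu).le (bumpAt_nonneg hN0.le X u)
      · rw [bumpAt_eq_zero hN, zero_mul, zero_mul]
        rw [Set.mem_Icc, not_and_or] at hu
        rw [le_abs]
        rcases hu with hu | hu
        · right; linarith
        · left; linarith
  rw [integral_mul_const, integral_bumpAt hN0, hD] at hge
  linarith

end IsProfile

/-- The reflection of an integer vector in the equatorial plane. -/
def flipVec (m : Fin 3 → ℤ) : Fin 3 → ℤ := ![m 0, m 1, -m 2]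

theorem flipVec_flipVec (m : Fin 3 → ℤ) : flipVec (flipVec m) = m := by
  funext i
  fin_cases i <;> simp [flipVec]

theorem supNorm_flipVec (m : Fin 3 → ℤ) : supNorm (flipVec m) = supNorm m := by
  have : ∀ m, supNorm (flipVec m) ≤ supNorm m := fun m => by
    rw [supNorm_le_iff]
    intro i
    have := natAbs_le_supNorm m i
    fin_cases i <;> simpa [flipVec] using this
  refine le_antisymm (this m) ?_
  conv_lhs => rw [← flipVec_flipVec m]
  exact this _

theorem halfKernelFT_neg (s : ℝ) : halfKernelFT (-s) = halfKernelFT s := by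
  unfold halfKernelFT
  congr 1
  funext v
  rw [show 2 * π * (-s * v) = -(2 * π * (s * v)) by ring, cos_neg]

theorem supNorm_le_euNorm (m : Fin 3 → ℤ) : (supNorm m : ℝ) ≤ euNorm (intVec m) := by
  rw [← norm_intVec]; exact norm_le_euNorm _

theorem euNorm_intVec_le (m : Fin 3 → ℤ) : euNorm (intVec m) ≤ 2 * supNorm m := by
  rw [← norm_intVec]; exact euNorm_le _

theorem exists_halfKernelFT_sq_le : ∃ C, 1 ≤ C ∧ ∀ s t : ℝ, 0 < t → t ≤ s →
    halfKernelFT s ^ 2 ≤ C * min 1 (1 / t ^ 2) := by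
  obtain ⟨C, hC, hb⟩ := exists_abs_halfKernelFT_le
  refine ⟨C ^ 2 + 1, by nlinarith, fun s t ht hs => ?_⟩
  have hs0 : 0 < s := by linarith
  have h1 : halfKernelFT s ^ 2 ≤ 1 := by
    rw [← sq_abs]
    exact pow_le_one₀ (abs_nonneg _) (abs_halfKernelFT_le_one s)
  have h2 : halfKernelFT s ^ 2 ≤ C ^ 2 * (1 / t ^ 2) := by
    rw [← sq_abs]
    calc |halfKernelFT s| ^ 2 ≤ (C / |s|) ^ 2 := by gcongr; exact hb s hs0.ne'
      _ ≤ (C / t) ^ 2 := by rw [abs_of_pos hs0]; gcongr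
      _ = _ := by field_simp
  have h3 : 0 < 1 / t ^ 2 := by positivity
  rcases le_total 1 (1 / t ^ 2) with h | h
  · rw [min_eq_left h]; nlinarith
  · rw [min_eq_right h]; nlinarith

theorem half_le_halfKernelFT_sq {s : ℝ} (h0 : 0 ≤ s) (h1 : s ≤ 1 / 16) :
    1 / 2 ≤ halfKernelFT s ^ 2 := by
  have := one_sub_le_halfKernelFT s
  rw [abs_of_nonneg h0] at this
  have hp := pi_lt_d2
  have hp0 := pi_pos
  have : 3 / 4 ≤ halfKernelFT s := by nlinarith
  nlinarith

theorem norm_integral_bumpAt_sub_le {N X : ℝ} (hN : 1 ≤ N) {f : ℝ → ℂ} {E : ℝ}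
    (hb : ∀ u ∈ Set.Icc (X - 1) (X + 1), ‖f u‖ ≤ E) :
    ‖∫ u, (bumpAt N X u : ℂ) * f u‖ ≤ E := by
  have hN0 : 0 < N := by linarith
  calc _ ≤ ∫ u, bumpAt N X u * E := by
        refine norm_integral_le_of_norm_le ((integrable_bumpAt hN0 X).mul_const E)
          (Filter.Eventually.of_forall fun u => ?_)
        rw [norm_mul, Complex.norm_real, norm_of_nonneg (bumpAt_nonneg hN0.le X u)]
        by_cases hu : u ∈ Set.Icc (X - 1) (X + 1)
        · exact mul_le_mul_of_nonneg_left (hb u hu) (bumpAt_nonneg hN0.le X u)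
        · rw [bumpAt_eq_zero hN, zero_mul, zero_mul]
          rw [Set.mem_Icc, not_and_or] at hu
          rw [le_abs]
          rcases hu with hu | hu
          · right; linarith
          · left; linarith
    _ = E := by rw [integral_mul_const, integral_bumpAt hN0, one_mul]

/-- Smoothing a sum of two oscillating terms against the kernel. -/
theorem norm_integral_bumpAt_add_le {N X : ℝ} (hN : 1 ≤ N) {f : ℝ → ℂ}
    (hf : Integrable fun u => (bumpAt N X u : ℂ) * f u) {a b s t E : ℝ}
    (hb : ∀ u ∈ Set.Icc (X - 1) (X + 1),
      ‖f u + X * (a * ee (-(u * s)) + b * ee (u * t))‖ ≤ E) :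
    ‖(∫ u, (bumpAt N X u : ℂ) * f u) + X * (((a * halfKernelFT (s / N) ^ 2 : ℝ) : ℂ) * ee (-(X * s))
      + ((b * halfKernelFT (t / N) ^ 2 : ℝ) : ℂ) * ee (X * t))‖ ≤ E := by
  have hN0 : 0 < N := by linarith
  have hi : ∀ r : ℝ, Integrable fun u => (bumpAt N X u : ℂ) * ee (r * u) := fun r => by
    refine (integrable_bumpAt hN0 X).ofReal.mul_bdd (c := 1) ?_ ?_
    · exact (continuous_ee.comp (by fun_prop)).aestronglyMeasurable
    · exact Filter.Eventually.of_forall fun u => (norm_ee _).le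
  have e : ∀ u, (bumpAt N X u : ℂ) * (f u + X * (a * ee (-(u * s)) + b * ee (u * t)))
      = (bumpAt N X u : ℂ) * f u + ((X * a) * ((bumpAt N X u : ℂ) * ee (-s * u))
        + (X * b) * ((bumpAt N X u : ℂ) * ee (t * u))) := fun u => by
    rw [show -(u * s) = -s * u by ring, mul_comm u t]; ring
  have h1 := norm_integral_bumpAt_sub_le hN hb
  simp_rw [e] at h1
  rw [integral_add hf (by exact ((hi (-s)).const_mul (X * a)).add ((hi t).const_mul (X * b))),
    integral_add ((hi _).const_mul _) ((hi _).const_mul _), integral_const_mul,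
    integral_const_mul, integral_bumpAt_mul_ee hN0, integral_bumpAt_mul_ee hN0, neg_div,
    halfKernelFT_neg] at h1
  convert h1 using 2
  rw [show -(X * s) = -s * X by ring, mul_comm X t]
  push_cast
  ring

theorem rpow_two_fifths_ge {X y u : ℝ} (hy : 0 < y) (hX : X = y ^ 100) (hu : X / 2 ≤ u) :
    y ^ 40 / 2 ≤ u ^ (2 / 5 : ℝ) := by
  have hX0 : 0 < X := by rw [hX]; positivity
  calc y ^ 40 / 2 = X ^ (2 / 5 : ℝ) / 2 := by
        rw [hX, ← rpow_natCast, ← rpow_natCast, ← rpow_mul hy.le]; norm_num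
    _ ≤ X ^ (2 / 5 : ℝ) / 2 ^ (2 / 5 : ℝ) := by
        refine div_le_div_of_nonneg_left (by positivity) (by positivity) ?_
        calc (2 : ℝ) ^ (2 / 5 : ℝ) ≤ 2 ^ (1 : ℝ) :=
              rpow_le_rpow_of_exponent_le (by norm_num) (by norm_num)
          _ = 2 := rpow_one 2
    _ = (X / 2) ^ (2 / 5 : ℝ) := (div_rpow hX0.le (by norm_num) _).symm
    _ ≤ _ := rpow_le_rpow (by positivity) hu (by norm_num)

theorem rpow_nine_tenths_le {X y u : ℝ} (hy : 0 < y) (hX : X = y ^ 100) (hu0 : 0 ≤ u)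
    (hu : u ≤ 2 * X) : u ^ (9 / 10 : ℝ) ≤ 2 * y ^ 90 := by
  have hX0 : 0 < X := by rw [hX]; positivity
  calc _ ≤ (2 * X) ^ (9 / 10 : ℝ) := rpow_le_rpow hu0 hu (by norm_num)
    _ = 2 ^ (9 / 10 : ℝ) * X ^ (9 / 10 : ℝ) := mul_rpow (by norm_num) hX0.le
    _ ≤ 2 ^ (1 : ℝ) * X ^ (9 / 10 : ℝ) := by
        gcongr
        · norm_num
        · norm_num
    _ = 2 * y ^ 90 := by
        rw [rpow_one, hX, ← rpow_natCast, ← rpow_natCast, ← rpow_mul hy.le]; norm_num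

namespace IsProfile

variable {ρ : ℝ → ℝ}

theorem exists_fourierAt_low (h : IsProfile ρ) : ∃ (a H : ℝ → ℝ → ℝ) (c C : ℝ), 0 < c ∧ 0 < C ∧
    (∀ m : Fin 3 → ℤ, 1 ≤ (m 0 : ℝ) ^ 2 + (m 1 : ℝ) ^ 2 →
      c / (supNorm m : ℝ) ^ 2 ≤ a ((m 0 : ℝ) ^ 2 + (m 1 : ℝ) ^ 2) (m 2) ∧
      a ((m 0 : ℝ) ^ 2 + (m 1 : ℝ) ^ 2) (m 2) ≤ C / (supNorm m : ℝ) ^ 2 ∧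
      c * supNorm m ≤ H ((m 0 : ℝ) ^ 2 + (m 1 : ℝ) ^ 2) (m 2) ∧
      H ((m 0 : ℝ) ^ 2 + (m 1 : ℝ) ^ 2) (m 2) ≤ C * supNorm m) ∧
    ∀ N y : ℝ, 1 ≤ N → C ≤ y → ∀ m : Fin 3 → ℤ, 1 ≤ (m 0 : ℝ) ^ 2 + (m 1 : ℝ) ^ 2 →
      (supNorm m : ℝ) ≤ y →
      ‖fourierAt (smoothBody ρ N (y ^ 100)) m + (y ^ 100 : ℝ) *
        (((a ((m 0 : ℝ) ^ 2 + (m 1 : ℝ) ^ 2) (m 2) *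
            halfKernelFT (H ((m 0 : ℝ) ^ 2 + (m 1 : ℝ) ^ 2) (m 2) / N) ^ 2 : ℝ) : ℂ) *
          ee (-(y ^ 100 * H ((m 0 : ℝ) ^ 2 + (m 1 : ℝ) ^ 2) (m 2)))
        + ((a ((m 0 : ℝ) ^ 2 + (m 1 : ℝ) ^ 2) (-m 2) *
            halfKernelFT (H ((m 0 : ℝ) ^ 2 + (m 1 : ℝ) ^ 2) (-m 2) / N) ^ 2 : ℝ) : ℂ) *
          ee (y ^ 100 * H ((m 0 : ℝ) ^ 2 + (m 1 : ℝ) ^ 2) (-m 2)))‖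
      ≤ C * (y ^ 100 / (supNorm m : ℝ) ^ 4) := by
  obtain ⟨a, H, c, C, hc, hC, hF⟩ := h.exists_bodyFT_asymptotic
  have hk1 : ∀ m : Fin 3 → ℤ, 1 ≤ (m 0 : ℝ) ^ 2 + (m 1 : ℝ) ^ 2 → (1 : ℝ) ≤ supNorm m := by
    intro m hm
    have : m ≠ 0 := by rintro rfl; simp at hm; linarith
    exact_mod_cast one_le_supNorm this
  have hb : ∀ m : Fin 3 → ℤ, 1 ≤ (m 0 : ℝ) ^ 2 + (m 1 : ℝ) ^ 2 →
      c / 4 / (supNorm m : ℝ) ^ 2 ≤ a ((m 0 : ℝ) ^ 2 + (m 1 : ℝ) ^ 2) (m 2) ∧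
      a ((m 0 : ℝ) ^ 2 + (m 1 : ℝ) ^ 2) (m 2) ≤ C / (supNorm m : ℝ) ^ 2 ∧
      c / 4 * supNorm m ≤ H ((m 0 : ℝ) ^ 2 + (m 1 : ℝ) ^ 2) (m 2) ∧
      H ((m 0 : ℝ) ^ 2 + (m 1 : ℝ) ^ 2) (m 2) ≤ 2 * C * supNorm m := by
    intro m hm
    obtain ⟨h1, h2, h3, h4, -⟩ := hF (intVec m) hm
    have hk := hk1 m hm
    have e1 := supNorm_le_euNorm m
    have e2 := euNorm_intVec_le m
    have e0 : 0 < euNorm (intVec m) := by linarith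
    refine ⟨le_trans ?_ h1, h2.trans ?_, le_trans ?_ h3, h4.trans ?_⟩
    · rw [div_div]
      refine div_le_div_of_nonneg_left hc.le (by positivity) ?_
      nlinarith
    · gcongr
    · nlinarith
    · nlinarith
  have hflip : ∀ m : Fin 3 → ℤ, 1 ≤ (m 0 : ℝ) ^ 2 + (m 1 : ℝ) ^ 2 →
      0 ≤ a ((m 0 : ℝ) ^ 2 + (m 1 : ℝ) ^ 2) (m 2) ∧ a ((m 0 : ℝ) ^ 2 + (m 1 : ℝ) ^ 2) (m 2) ≤ C ∧
      0 ≤ a ((m 0 : ℝ) ^ 2 + (m 1 : ℝ) ^ 2) (-m 2) ∧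
      a ((m 0 : ℝ) ^ 2 + (m 1 : ℝ) ^ 2) (-m 2) ≤ C := by
    have : ∀ m : Fin 3 → ℤ, 1 ≤ (m 0 : ℝ) ^ 2 + (m 1 : ℝ) ^ 2 →
        0 ≤ a ((m 0 : ℝ) ^ 2 + (m 1 : ℝ) ^ 2) (m 2) ∧
        a ((m 0 : ℝ) ^ 2 + (m 1 : ℝ) ^ 2) (m 2) ≤ C := fun m hm => by
      obtain ⟨h1, h2, -⟩ := hb m hm
      have hk := hk1 m hm
      exact ⟨le_trans (by positivity) h1, h2.trans (div_le_self hC.le (by nlinarith))⟩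
    intro m hm
    have h1 := this (flipVec m) (by simpa [flipVec] using hm)
    simp [flipVec] at h1
    exact ⟨(this m hm).1, (this m hm).2, h1.1, h1.2⟩
  refine ⟨a, H, c / 4, 10 * C + 4 / c + 2, by positivity, by positivity, fun m hm => ?_,
    fun N y hN hy m hm hmy => ?_⟩
  · obtain ⟨h1, h2, h3, h4⟩ := hb m hm
    have : 0 < 4 / c := by positivity
    refine ⟨h1, h2.trans ?_, h3, h4.trans ?_⟩
    · gcongr; linarith
    · gcongr; linarith
  have hc4 : 0 < 4 / c := by positivity
  have hy1 : 2 ≤ y := by linarith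
  have hyc : 4 ≤ c * y := by
    have : 4 / c ≤ y := by linarith
    rwa [div_le_iff₀ hc, mul_comm] at this
  have hk := hk1 m hm
  set k : ℝ := (supNorm m : ℝ)
  obtain ⟨-, -, -, -, hA⟩ := hF (intVec m) hm
  obtain ⟨a0, a1, b0, b1⟩ := hflip m hm
  have e1 := supNorm_le_euNorm m
  have e2 := euNorm_intVec_le m
  set Q := (m 0 : ℝ) ^ 2 + (m 1 : ℝ) ^ 2
  have hyX : 2 ≤ y ^ 100 := by
    calc (2 : ℝ) ≤ y := hy1
      _ ≤ y ^ 100 := le_self_pow₀ (by linarith) (by norm_num)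
  rw [h.fourierAt_smoothBody_eq hN]
  refine norm_integral_bumpAt_add_le hN (h.integrable_bumpAt_mul_bodyFT hN _ _) fun u hu => ?_
  set X := y ^ 100 with hX
  have hu1 : 1 ≤ u := by linarith [hu.1]
  have g1 := hA u hu1 (by
    have := rpow_two_fifths_ge (by linarith) hX (show X / 2 ≤ u by linarith [hu.1])
    have h39 : y ≤ y ^ 39 := le_self_pow₀ (by linarith) (by norm_num)
    have h40 : 4 * y ≤ c * y ^ 40 := by
      calc 4 * y ≤ (c * y) * y ^ 39 := by gcongr
        _ = _ := by ring
    calc euNorm (intVec m) ≤ 2 * y := by linarith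
      _ ≤ c * (y ^ 40 / 2) := by linarith
      _ ≤ _ := by gcongr)
  have g2 := rpow_nine_tenths_le (by linarith) hX (by linarith) (show u ≤ 2 * X by linarith [hu.2])
  set z1 := ee (-(u * H Q (m 2)))
  set z2 := ee (u * H Q (-m 2))
  have hz : ‖(a Q (m 2) : ℂ) * z1 + a Q (-m 2) * z2‖ ≤ 2 * C := by
    refine (norm_add_le _ _).trans ?_
    rw [norm_mul, norm_mul, norm_ee, norm_ee, Complex.norm_real, Complex.norm_real,
      norm_of_nonneg a0, norm_of_nonneg b0]
    linarith
  have hXu : ‖((X - u : ℝ) : ℂ)‖ ≤ 1 := by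
    rw [Complex.norm_real, Real.norm_eq_abs, abs_le]
    constructor <;> linarith [hu.1, hu.2]
  have g3 : ‖bodyFT ρ u (intVec m) + X * (a Q (m 2) * z1 + a Q (-m 2) * z2)‖
      ≤ C * (2 * y ^ 90 * (4 * k ^ 2)) + 2 * C := by
    calc _ = ‖(bodyFT ρ u (intVec m) + u * (a Q (m 2) * z1 + a Q (-m 2) * z2))
          + ((X - u : ℝ) : ℂ) * (a Q (m 2) * z1 + a Q (-m 2) * z2)‖ := by
          congr 1; push_cast; ring
      _ ≤ C * (u ^ (9 / 10 : ℝ) * euNorm (intVec m) ^ 2) + 1 * (2 * C) := by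
          refine (norm_add_le _ _).trans (add_le_add g1 ?_)
          rw [norm_mul]
          gcongr
      _ ≤ _ := by
          rw [one_mul]
          gcongr
          calc euNorm (intVec m) ^ 2 ≤ (2 * k) ^ 2 := by
                gcongr
                exact euNorm_nonneg _
            _ = _ := by ring
  refine g3.trans ?_
  have p1 : 1 ≤ y ^ 90 * k ^ 2 := one_le_mul_of_one_le_of_one_le
    (one_le_pow₀ (by linarith)) (one_le_pow₀ hk)
  have p2 : y ^ 90 * k ^ 2 ≤ X / k ^ 4 := by
    rw [le_div_iff₀ (by positivity)]
    calc y ^ 90 * k ^ 2 * k ^ 4 = y ^ 90 * k ^ 6 := by ring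
      _ ≤ y ^ 90 * y ^ 6 := by gcongr
      _ = y ^ 96 := by ring
      _ ≤ y ^ 100 := pow_le_pow_right₀ (by linarith) (by norm_num)
  calc _ ≤ 10 * C * (y ^ 90 * k ^ 2) := by nlinarith
    _ ≤ (10 * C + 4 / c + 2) * (X / k ^ 4) := by
        gcongr
        linarith

end IsProfile

/-- A summable majorant for the error terms in the Fourier expansion of the discrepancy. -/
noncomputable def tailWeight (m : Fin 3 → ℤ) : ℝ :=
  ((supNorm m : ℝ) ^ 3 * √(supNorm m))⁻¹
    + if (m 0 : ℝ) ^ 2 + (m 1 : ℝ) ^ 2 = 0 then ((m 2 : ℝ) ^ 2)⁻¹ else 0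

theorem tailWeight_nonneg (m : Fin 3 → ℤ) : 0 ≤ tailWeight m := by
  unfold tailWeight
  split_ifs <;> positivity

theorem summable_tailWeight : Summable tailWeight := summable_supNorm.add summable_axis

theorem inv_pow_four_le_tailWeight {m : Fin 3 → ℤ} (hm : m ≠ 0) :
    1 / (supNorm m : ℝ) ^ 4 ≤ tailWeight m := by
  have h1 : (1 : ℝ) ≤ supNorm m := by exact_mod_cast one_le_supNorm hm
  have h2 : √(supNorm m : ℝ) ≤ supNorm m := Real.sqrt_le_self_iff.2 (Or.inr h1)
  have h3 : 1 / (supNorm m : ℝ) ^ 4 ≤ ((supNorm m : ℝ) ^ 3 * √(supNorm m))⁻¹ := by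
    rw [← one_div]
    refine one_div_le_one_div_of_le (by positivity) ?_
    rw [pow_succ _ 3]
    gcongr
  unfold tailWeight
  split_ifs
  · have : 0 ≤ ((m 2 : ℝ) ^ 2)⁻¹ := by positivity
    linarith
  · linarith

theorem sq_div_pow_four_le_tailWeight {m : Fin 3 → ℤ} {N : ℝ} (hN : 1 ≤ N)
    (hm : N ^ 4 ≤ supNorm m) : N ^ 2 / (supNorm m : ℝ) ^ 4 ≤ tailWeight m := by
  have h1 : (1 : ℝ) ≤ supNorm m := (one_le_pow₀ hN).trans hm
  have h2 : N ^ 2 ≤ √(supNorm m : ℝ) := Real.le_sqrt_of_sq_le (by linarith [show (N ^ 2) ^ 2 = N ^ 4 by ring])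
  have h3 : N ^ 2 / (supNorm m : ℝ) ^ 4 ≤ ((supNorm m : ℝ) ^ 3 * √(supNorm m))⁻¹ := by
    rw [← one_div, div_le_div_iff₀ (by positivity) (by positivity), one_mul]
    have h4 := Real.mul_self_sqrt (show (0 : ℝ) ≤ supNorm m by linarith)
    calc _ ≤ √(supNorm m : ℝ) * ((supNorm m : ℝ) ^ 3 * √(supNorm m)) := by gcongr
      _ = _ := by rw [pow_succ _ 3]; nth_rewrite 5 [← h4]; ring
  unfold tailWeight
  split_ifs
  · have : 0 ≤ ((m 2 : ℝ) ^ 2)⁻¹ := by positivity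
    linarith
  · linarith

namespace IsProfile

variable {ρ : ℝ → ℝ}

theorem exists_fourierAt_axis (h : IsProfile ρ) : ∃ C, 0 < C ∧ ∀ N X : ℝ, 1 ≤ N → 2 ≤ X →
    ∀ m : Fin 3 → ℤ, m ≠ 0 → (m 0 : ℝ) ^ 2 + (m 1 : ℝ) ^ 2 = 0 →
    ‖fourierAt (smoothBody ρ N X) m‖ ≤ C * (X * tailWeight m) := by
  obtain ⟨C, hC, hb⟩ := h.exists_bodyFT_axis_le
  refine ⟨2 * C, by positivity, fun N X hN hX m hm hQ => ?_⟩
  have hm2 : (m 2 : ℝ) ≠ 0 := by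
    intro h2
    have h0 : (m 0 : ℝ) = 0 := by nlinarith [sq_nonneg (m 0 : ℝ), sq_nonneg (m 1 : ℝ)]
    have h1 : (m 1 : ℝ) = 0 := by nlinarith [sq_nonneg (m 0 : ℝ), sq_nonneg (m 1 : ℝ)]
    refine hm (funext fun i => ?_)
    fin_cases i
    · exact_mod_cast h0
    · exact_mod_cast h1
    · exact_mod_cast h2
  have hT : ((m 2 : ℝ) ^ 2)⁻¹ ≤ tailWeight m := by
    unfold tailWeight
    rw [if_pos hQ]
    have : 0 ≤ ((supNorm m : ℝ) ^ 3 * √(supNorm m))⁻¹ := by positivity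
    linarith
  rw [h.fourierAt_smoothBody_eq hN]
  refine norm_integral_bumpAt_sub_le hN fun u hu => ?_
  refine (hb (intVec m) hQ hm2 u (by linarith [hu.1])).trans ?_
  calc C * u / intVec m 2 ^ 2 ≤ C * (2 * X) / intVec m 2 ^ 2 := by
        gcongr; linarith [hu.2]
    _ = 2 * C * (X * ((m 2 : ℝ) ^ 2)⁻¹) := by rw [div_eq_mul_inv]; simp only [intVec]; ring
    _ ≤ _ := by gcongr

theorem exists_fourierAt_high (h : IsProfile ρ) : ∃ C, 0 < C ∧ ∀ N y : ℝ, 1 ≤ N → 2 ≤ y →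
    N ^ 4 ≤ y → ∀ m : Fin 3 → ℤ, y ≤ supNorm m →
    ‖fourierAt (smoothBody ρ N (y ^ 100)) m‖ ≤ C * (y ^ 100 / (supNorm m : ℝ) ^ 4) := by
  obtain ⟨C, hC, hb⟩ := h.exists_fourierAt_smoothBody_le 280
  refine ⟨C, hC, fun N y hN hy hNy m hm => ?_⟩
  have hX : 2 ≤ y ^ 100 := hy.trans (le_self_pow₀ (by linarith) (by norm_num))
  have h1 := hb N (y ^ 100) hN hX m
  set k : ℝ := (supNorm m : ℝ)
  have hk : 1 ≤ k := by linarith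
  have h2 : (y ^ 100) ^ 3 * N ^ 280 ≤ y ^ 100 * k ^ 276 := by
    calc (y ^ 100) ^ 3 * N ^ 280 = y ^ 100 * (y ^ 200 * (N ^ 4) ^ 70) := by ring
      _ ≤ y ^ 100 * (k ^ 200 * k ^ 70) := by gcongr; linarith
      _ = y ^ 100 * k ^ 270 := by ring
      _ ≤ _ := by
          gcongr
          norm_num
  rw [mul_div_assoc', le_div_iff₀ (by positivity)]
  refine le_of_mul_le_mul_left (a := k ^ 276) ?_ (by positivity)
  calc _ = k ^ 280 * ‖fourierAt (smoothBody ρ N (y ^ 100)) m‖ := by ring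
    _ ≤ C * ((y ^ 100) ^ 3 * N ^ 280) := h1
    _ ≤ C * (y ^ 100 * k ^ 276) := by gcongr
    _ = _ := by ring

end IsProfile

theorem sum_flipVec {Ξ : Finset (Fin 3 → ℤ)} (hΞ : ∀ m ∈ Ξ, flipVec m ∈ Ξ) (g : (Fin 3 → ℤ) → ℝ) :
    ∑ m ∈ Ξ, g (flipVec m) = ∑ m ∈ Ξ, g m :=
  Finset.sum_bij' (fun m _ => flipVec m) (fun m _ => flipVec m) hΞ hΞ
    (fun m _ => flipVec_flipVec m) (fun m _ => flipVec_flipVec m) (fun _ _ => rfl)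

/-- Real part of a trigonometric sum that is symmetric under the equatorial reflection. -/
theorem re_sum_flipVec {Ξ : Finset (Fin 3 → ℤ)} (hΞ : ∀ m ∈ Ξ, flipVec m ∈ Ξ)
    (b l : (Fin 3 → ℤ) → ℝ) (X : ℝ) :
    (∑ m ∈ Ξ, ((b m : ℂ) * ee (-(X * l m)) + b (flipVec m) * ee (X * l (flipVec m)))).re
      = 2 * ∑ m ∈ Ξ, b m * cos (2 * π * (X * l m)) := by
  rw [Complex.re_sum]
  have : ∀ m, ((b m : ℂ) * ee (-(X * l m)) + b (flipVec m) * ee (X * l (flipVec m))).re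
      = b m * cos (2 * π * (X * l m))
        + (fun m => b m * cos (2 * π * (X * l m))) (flipVec m) := fun m => by
    rw [Complex.add_re, Complex.re_ofReal_mul, Complex.re_ofReal_mul, ee_re, ee_re, mul_neg,
      cos_neg]
  simp_rw [this]
  rw [Finset.sum_add_distrib, sum_flipVec hΞ (fun m => b m * cos (2 * π * (X * l m)))]
  ring

/-- Replacing the Fourier series by finitely many main terms. -/
theorem norm_tsum_add_le {ι : Type*} [DecidableEq ι] {f : ι → ℂ} (hf : Summable f) (Ξ : Finset ι)
    (g : ι → ℂ) {w : ι → ℝ} (hw : Summable w) {B : ℝ}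
    (hb : ∀ m, ‖f m + if m ∈ Ξ then g m else 0‖ ≤ B * w m) :
    ‖∑' m, f m + ∑ m ∈ Ξ, g m‖ ≤ B * ∑' m, w m := by
  have hg : Summable fun m => if m ∈ Ξ then g m else 0 :=
    summable_of_ne_finset_zero (s := Ξ) fun m hm => if_neg hm
  have e : ∑ m ∈ Ξ, g m = ∑' m, if m ∈ Ξ then g m else 0 := by
    rw [tsum_eq_sum (s := Ξ) fun m hm => if_neg hm]
    exact Finset.sum_congr rfl fun m hm => (if_pos hm).symm
  rw [e, ← hf.tsum_add hg, ← tsum_mul_left]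
  exact tsum_of_norm_bounded (hw.mul_left B).hasSum hb

namespace IsProfile

variable {ρ : ℝ → ℝ}

theorem exists_weights (h : IsProfile ρ) : ∃ (l : ℝ → ℝ → ℝ) (c C : ℝ), 0 < c ∧ 0 < C ∧
    ∀ N : ℝ, 1 ≤ N → ∃ b : ℝ → ℝ → ℝ,
    (∀ m : Fin 3 → ℤ, 1 ≤ (m 0 : ℝ) ^ 2 + (m 1 : ℝ) ^ 2 →
      0 ≤ b ((m 0 : ℝ) ^ 2 + (m 1 : ℝ) ^ 2) (m 2) ∧
      b ((m 0 : ℝ) ^ 2 + (m 1 : ℝ) ^ 2) (m 2)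
        ≤ C * (min 1 (N ^ 2 / (supNorm m : ℝ) ^ 2) / (supNorm m : ℝ) ^ 2) ∧
      ((supNorm m : ℝ) ≤ c * N → c / N ^ 2 ≤ b ((m 0 : ℝ) ^ 2 + (m 1 : ℝ) ^ 2) (m 2))) ∧
    ∀ y : ℝ, C ≤ y → ∀ m : Fin 3 → ℤ, 1 ≤ (m 0 : ℝ) ^ 2 + (m 1 : ℝ) ^ 2 →
      (supNorm m : ℝ) ≤ y →
      ‖fourierAt (smoothBody ρ N (y ^ 100)) m + (y ^ 100 : ℝ) *
        ((b ((m 0 : ℝ) ^ 2 + (m 1 : ℝ) ^ 2) (m 2) : ℂ) *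
          ee (-(y ^ 100 * l ((m 0 : ℝ) ^ 2 + (m 1 : ℝ) ^ 2) (m 2)))
        + (b ((m 0 : ℝ) ^ 2 + (m 1 : ℝ) ^ 2) (-m 2) : ℂ) *
          ee (y ^ 100 * l ((m 0 : ℝ) ^ 2 + (m 1 : ℝ) ^ 2) (-m 2)))‖
      ≤ C * (y ^ 100 / (supNorm m : ℝ) ^ 4) := by
  obtain ⟨a, H, c, C, hc, hC, hb, hF⟩ := h.exists_fourierAt_low
  obtain ⟨K, hK1, hK⟩ := exists_halfKernelFT_sq_le
  set K' := C * (K * (1 + 1 / c ^ 2)) with hK'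
  have hK'0 : 0 < K' := by positivity
  set c' := min 1 (min (1 / (16 * C)) (c / 2)) with hc'
  have hc'0 : 0 < c' := by positivity
  have c1 : c' ≤ 1 := min_le_left _ _
  have c2 : c' ≤ 1 / (16 * C) := (min_le_right _ _).trans (min_le_left _ _)
  have c3 : c' ≤ c / 2 := (min_le_right _ _).trans (min_le_right _ _)
  refine ⟨H, c', C + K', hc'0, by positivity, fun N hN =>
    ⟨fun q t => a q t * halfKernelFT (H q t / N) ^ 2, fun m hm => ?_, fun y hy m hm hmy => ?_⟩⟩
  · obtain ⟨h1, h2, h3, h4⟩ := hb m hm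
    have hm0 : m ≠ 0 := by rintro rfl; simp at hm; linarith
    have hk : (1 : ℝ) ≤ supNorm m := by exact_mod_cast one_le_supNorm hm0
    beta_reduce
    set A := a ((m 0 : ℝ) ^ 2 + (m 1 : ℝ) ^ 2) (m 2)
    set L := H ((m 0 : ℝ) ^ 2 + (m 1 : ℝ) ^ 2) (m 2)
    set k : ℝ := (supNorm m : ℝ)
    have hA : 0 ≤ A := le_trans (by positivity) h1
    refine ⟨by positivity, ?_, fun hkN => ?_⟩
    · have g1 := hK (L / N) (c * k / N) (by positivity) (by gcongr)
      have g2 : min 1 (1 / (c * k / N) ^ 2) ≤ (1 + 1 / c ^ 2) * min 1 (N ^ 2 / k ^ 2) := by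
        have e : 1 / (c * k / N) ^ 2 = 1 / c ^ 2 * (N ^ 2 / k ^ 2) := by field_simp
        have hc2 : 0 < 1 / c ^ 2 := by positivity
        have hN2 : 0 < N ^ 2 / k ^ 2 := by positivity
        rw [e]
        rcases le_total 1 (N ^ 2 / k ^ 2) with hh | hh
        · rw [min_eq_left hh]
          exact (min_le_left _ _).trans (by linarith)
        · rw [min_eq_right hh]
          exact (min_le_right _ _).trans (by nlinarith)
      have hmin : 0 ≤ min 1 (N ^ 2 / k ^ 2) := by positivity
      calc A * halfKernelFT (L / N) ^ 2
          ≤ C / k ^ 2 * (K * ((1 + 1 / c ^ 2) * min 1 (N ^ 2 / k ^ 2))) := by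
            gcongr
            exact g1.trans (by gcongr)
        _ = K' * (min 1 (N ^ 2 / k ^ 2) / k ^ 2) := by rw [hK']; ring
        _ ≤ _ := by gcongr; linarith
    · have hL0 : 0 ≤ L := le_trans (by positivity) h3
      have g1 : L / N ≤ 1 / 16 := by
        rw [div_le_iff₀ (by linarith)]
        calc L ≤ C * k := h4
          _ ≤ C * (1 / (16 * C) * N) := by gcongr; exact hkN.trans (by gcongr)
          _ = _ := by field_simp
      have g2 := half_le_halfKernelFT_sq (by positivity) g1
      have hkN' : k ≤ N := hkN.trans (by nlinarith)
      calc c' / N ^ 2 ≤ c / 2 / N ^ 2 := by gcongr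
        _ ≤ c / 2 / k ^ 2 := by gcongr
        _ = c / k ^ 2 * (1 / 2) := by ring
        _ ≤ _ := by gcongr
  · refine (hF N y hN (by linarith) m hm hmy).trans ?_
    gcongr
    linarith

theorem exists_bodyDisc_expansion (h : IsProfile ρ) :
    ∃ (l : ℝ → ℝ → ℝ) (c C : ℝ), 0 < c ∧ 0 < C ∧ ∀ N : ℝ, 1 ≤ N →
    ∃ (Ξ : Finset (Fin 3 → ℤ)) (a : (Fin 3 → ℤ) → ℝ), (∀ m ∈ Ξ, 0 ≤ a m) ∧
      ∑ m ∈ Ξ, a m ≤ C * N ∧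
      (∀ m : Fin 3 → ℤ, 1 ≤ (m 0 : ℝ) ^ 2 + (m 1 : ℝ) ^ 2 → (supNorm m : ℝ) ≤ c * N →
        m ∈ Ξ ∧ c / N ^ 2 ≤ a m) ∧
      ∀ y : ℝ, C ≤ y → N ^ 4 ≤ y → ∃ u ∈ Set.Icc (y ^ 100 - 1) (y ^ 100 + 1),
        bodyDisc ρ u ≤ -(y ^ 100 * ∑ m ∈ Ξ, a m *
          cos (2 * π * (y ^ 100 * l ((m 0 : ℝ) ^ 2 + (m 1 : ℝ) ^ 2) (m 2)))) + C * y ^ 100 := by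
  classical
  obtain ⟨l, c, C, hc, hC, hW⟩ := h.exists_weights
  obtain ⟨C1, hC1, hax⟩ := h.exists_fourierAt_axis
  obtain ⟨C2, hC2, hhi⟩ := h.exists_fourierAt_high
  set B := 3 * C + C1 + C2 with hB
  set W := ∑' m, tailWeight m with hWdef
  have hW0 : 0 ≤ W := tsum_nonneg tailWeight_nonneg
  refine ⟨l, min c 1, 208 * C + (1 + B * W) + (C + 2), by positivity, by positivity,
    fun N hN => ?_⟩
  obtain ⟨b, hb, hF⟩ := hW N hN
  set q : (Fin 3 → ℤ) → ℝ := fun m => (m 0 : ℝ) ^ 2 + (m 1 : ℝ) ^ 2 with hq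
  have hqf : ∀ m, q (flipVec m) = q m := fun m => rfl
  set Ξ := (intBox ⌊N ^ 4⌋₊).filter fun m => 1 ≤ q m with hΞ
  have hmem : ∀ m, m ∈ Ξ ↔ (supNorm m : ℝ) ≤ N ^ 4 ∧ 1 ≤ q m := fun m => by
    rw [hΞ, Finset.mem_filter, mem_intBox, Nat.le_floor_iff (by positivity)]
  have hne : ∀ m, 1 ≤ q m → m ≠ 0 := by
    rintro m hm rfl
    simp [hq] at hm
    linarith
  have hflip : ∀ m ∈ Ξ, flipVec m ∈ Ξ := fun m hm => by
    rw [hmem] at hm ⊢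
    rwa [supNorm_flipVec, hqf]
  set bb : (Fin 3 → ℤ) → ℝ := fun m => b (q m) (m 2) with hbb
  set ll : (Fin 3 → ℤ) → ℝ := fun m => l (q m) (m 2) with hll
  refine ⟨Ξ, fun m => 2 * bb m, fun m hm => ?_, ?_, fun m hm hmN => ⟨?_, ?_⟩, fun y hy hNy => ?_⟩
  · have := (hb m ((hmem m).1 hm).2).1
    simp only [hbb]
    linarith
  · have := sum_min_supNorm_le hN Ξ fun m hm => hne m ((hmem m).1 hm).2
    calc ∑ m ∈ Ξ, 2 * bb m
        ≤ ∑ m ∈ Ξ, 2 * C * (min 1 (N ^ 2 / (supNorm m : ℝ) ^ 2) / (supNorm m : ℝ) ^ 2) := by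
          refine Finset.sum_le_sum fun m hm => ?_
          have := (hb m ((hmem m).1 hm).2).2.1
          simp only [hbb]
          linarith
      _ ≤ 2 * C * (104 * N) := by
          rw [← Finset.mul_sum]
          gcongr
      _ ≤ _ := by
          have : 0 ≤ B * W := by positivity
          nlinarith
  · refine (hmem m).2 ⟨hmN.trans ?_, hm⟩
    calc min c 1 * N ≤ 1 * N := by gcongr; exact min_le_right _ _
      _ ≤ N ^ 4 := by rw [one_mul]; exact le_self_pow₀ hN (by norm_num)
  · have := (hb m hm).2.2 (hmN.trans (by gcongr; exact min_le_left _ _))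
    have h0 : min c 1 / N ^ 2 ≤ c / N ^ 2 := by gcongr; exact min_le_left _ _
    have := (hb m hm).1
    simp only [hbb]
    linarith
  have hBW : 0 ≤ B * W := by positivity
  have hy2 : 2 ≤ y := by linarith
  have hX2 : 2 ≤ y ^ 100 := hy2.trans (le_self_pow₀ (by linarith) (by norm_num))
  obtain ⟨u, hu, hD⟩ := h.exists_bodyDisc_le hN hX2
  refine ⟨u, hu, hD.trans ?_⟩
  set f : (Fin 3 → ℤ) → ℂ := fun m => if m = 0 then 0 else fourierAt (smoothBody ρ N (y ^ 100)) m
    with hf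
  have hfs : Summable f := by
    refine Summable.of_norm_bounded (h.summable_fourierAt_smoothBody hN hX2).norm fun m => ?_
    simp only [hf]
    split_ifs
    · simp
    · exact le_rfl
  have key := norm_tsum_add_le hfs Ξ (fun m => ((y ^ 100 : ℝ) : ℂ) * ((bb m : ℂ) *
      ee (-(y ^ 100 * ll m)) + bb (flipVec m) * ee (y ^ 100 * ll (flipVec m))))
    summable_tailWeight (B := B * y ^ 100) ?_
  · rw [← Finset.mul_sum] at key
    have h1 := (Complex.re_le_norm _).trans key
    rw [Complex.add_re, Complex.re_ofReal_mul, re_sum_flipVec hflip] at h1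
    have e : ∑ m ∈ Ξ, 2 * bb m * cos (2 * π * (y ^ 100 * ll m))
        = 2 * ∑ m ∈ Ξ, bb m * cos (2 * π * (y ^ 100 * ll m)) := by
      rw [Finset.mul_sum]
      exact Finset.sum_congr rfl fun m _ => by ring
    simp only [hll, hq] at e h1 ⊢
    rw [e]
    nlinarith
  · intro m
    set X := y ^ 100 with hX
    have hX0 : 0 ≤ X := by linarith
    clear_value X
    have hT := tailWeight_nonneg m
    have hXT : 0 ≤ X * tailWeight m := by positivity
    by_cases hm : m = 0
    · have hmΞ : m ∉ Ξ := fun hc => hne m ((hmem m).1 hc).2 hm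
      rw [if_neg hmΞ, add_zero]
      simp only [hf, if_pos hm, norm_zero]
      positivity
    have h4 := inv_pow_four_le_tailWeight hm
    have h4' : X / (supNorm m : ℝ) ^ 4 ≤ X * tailWeight m := by
      rw [div_eq_mul_one_div]; exact mul_le_mul_of_nonneg_left h4 hX0
    have hfl : ((flipVec m 2 : ℤ) : ℝ) = -m 2 := by simp [flipVec]
    simp only [hf, if_neg hm]
    rw [mul_assoc]
    by_cases hQ : 1 ≤ q m
    · rcases le_or_gt (supNorm m : ℝ) y with hmy | hmy
      · have g1 := hF y (by linarith) m hQ hmy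
        rw [← hX] at g1
        replace g1 := g1.trans (mul_le_mul_of_nonneg_left h4' hC.le)
        by_cases hmΞ : m ∈ Ξ
        · rw [if_pos hmΞ]
          have e1 : bb (flipVec m) = b (q m) (-m 2) := by simp only [hbb, hqf, hfl]
          have e2 : ll (flipVec m) = l (q m) (-m 2) := by simp only [hll, hqf, hfl]
          rw [e1, e2]
          refine g1.trans ?_
          gcongr
          linarith
        · rw [if_neg hmΞ, add_zero]
          have hNm : N ^ 4 ≤ supNorm m := by
            by_contra! hc
            exact hmΞ ((hmem m).2 ⟨hc.le, hQ⟩)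
          have hbT : ∀ n, 1 ≤ q n → supNorm n = supNorm m →
              ‖(b (q n) (n 2) : ℂ)‖ ≤ C * tailWeight m := by
            intro n hn hnm
            obtain ⟨b0, b1, -⟩ := hb n hn
            rw [Complex.norm_real, norm_of_nonneg b0]
            refine b1.trans ?_
            rw [hnm]
            gcongr
            refine le_trans ?_ (sq_div_pow_four_le_tailWeight hN hNm)
            calc _ ≤ N ^ 2 / (supNorm m : ℝ) ^ 2 / (supNorm m : ℝ) ^ 2 := by
                  gcongr; exact min_le_right _ _
              _ = _ := by rw [div_div]; ring_nf
          have hb1 := hbT m hQ rfl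
          have hb2 := hbT (flipVec m) hQ (supNorm_flipVec m)
          rw [hqf, hfl] at hb2
          refine le_trans (norm_le_add_norm_add _ _)
            (le_trans (add_le_add g1 (?_ : _ ≤ 2 * C * (X * tailWeight m))) ?_)
          · rw [norm_mul, Complex.norm_real, norm_of_nonneg hX0]
            calc _ ≤ X * (C * tailWeight m + C * tailWeight m) := by
                  refine mul_le_mul_of_nonneg_left ((norm_add_le _ _).trans ?_) hX0
                  rw [norm_mul, norm_mul, norm_ee, norm_ee, mul_one, mul_one]
                  exact add_le_add hb1 hb2
              _ = _ := by ring
          · nlinarith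
      · have hmΞ : m ∉ Ξ := fun hc => by
          have := ((hmem m).1 hc).1
          linarith
        rw [if_neg hmΞ, add_zero]
        have g1 := hhi N y hN hy2 hNy m hmy.le
        rw [← hX] at g1
        nlinarith
    · have hmΞ : m ∉ Ξ := fun hc => hQ ((hmem m).1 hc).2
      rw [if_neg hmΞ, add_zero]
      have hQ0 : (m 0 : ℝ) ^ 2 + (m 1 : ℝ) ^ 2 = 0 := by
        have h1 : ¬ (1 : ℤ) ≤ m 0 ^ 2 + m 1 ^ 2 := fun hh => hQ (by
          simp only [hq]; exact_mod_cast hh)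
        have h2 : m 0 ^ 2 + m 1 ^ 2 = 0 := by
          have := sq_nonneg (m 0); have := sq_nonneg (m 1); omega
        exact_mod_cast h2
      have g1 := hax N X hN hX2 m hm hQ0
      nlinarith

end IsProfile

theorem latticeDiscrepancy_sq (ρ : ℝ → ℝ) {u : ℝ} (hu : 0 < u) :
    latticeDiscrepancy {x | bodyGauge ρ x ≤ 1} (u ^ 2) = bodyDisc ρ u := by
  have hmem : ∀ x : Fin 3 → ℝ, x ∈ u • {x | bodyGauge ρ x ≤ 1} ↔ bodyGauge ρ x ≤ u := by
    intro x
    rw [Set.mem_smul_set_iff_inv_smul_mem₀ hu.ne', Set.mem_ofPred_eq,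
      IsProfile.bodyGauge_smul (inv_nonneg.2 hu.le), inv_mul_le_iff₀ hu, mul_one]
  have hset : {x | bodyGauge ρ x ≤ u} = u • {x | bodyGauge ρ x ≤ 1} :=
    Set.ext fun x => (hmem x).symm
  have hpow : (u ^ 2) ^ (3 / 2 : ℝ) = u ^ 3 := by
    rw [← rpow_natCast, ← rpow_mul hu.le, ← rpow_natCast]
    norm_num
  have hvol : volume.real {x : Fin 3 → ℝ | bodyGauge ρ x ≤ u}
      = (volume {x : Fin 3 → ℝ | bodyGauge ρ x ≤ 1}).toReal * u ^ 3 := by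
    rw [hset, measureReal_def, Measure.addHaar_smul, ENNReal.toReal_mul, mul_comm]
    rw [Module.finrank_fin_fun, abs_of_pos (by positivity), ENNReal.toReal_ofReal (by positivity)]
  unfold latticeDiscrepancy bodyDisc
  rw [Real.sqrt_sq hu.le, hpow, hvol]
  simp only [hmem]
  rfl

/-- Many lattice points in a box with few distinct pairs of squared radius and height. -/
theorem exists_lattice_points {r K : ℕ} (S : Finset ℕ)
    (hS : ∀ n ∈ S, 1 ≤ n ∧ n ≤ K ^ 2 ∧ HasManyReps r n) :
    ∃ M : Finset (Fin 3 → ℤ),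
      (∀ m ∈ M, 1 ≤ (m 0 : ℝ) ^ 2 + (m 1 : ℝ) ^ 2 ∧ supNorm m ≤ K) ∧
      M.card = S.card * 2 ^ r * K ∧
      ∀ l : ℝ → ℝ → ℝ,
        (M.image fun m => l ((m 0 : ℝ) ^ 2 + (m 1 : ℝ) ^ 2) (m 2)).card ≤ S.card * K := by
  classical
  choose! F hF using fun n hn => (hS n hn).2.2
  set D := (S.sigma F) ×ˢ Finset.Icc 1 K with hD
  set f : (Σ _ : ℕ, ℤ × ℤ) × ℕ → (Fin 3 → ℤ) := fun p => ![p.1.2.1, p.1.2.2, (p.2 : ℤ)] with hf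
  have key : ∀ p ∈ D, p.1.1 ∈ S ∧ p.1.2.1 ^ 2 + p.1.2.2 ^ 2 = (p.1.1 : ℤ) ∧ 1 ≤ p.2 ∧ p.2 ≤ K := by
    intro p hp
    rw [hD, Finset.mem_product, Finset.mem_sigma, Finset.mem_Icc] at hp
    exact ⟨hp.1.1, (hF _ hp.1.1).2 _ hp.1.2, hp.2⟩
  refine ⟨D.image f, ?_, ?_, ?_⟩
  · intro m hm
    obtain ⟨p, hp, rfl⟩ := Finset.mem_image.1 hm
    obtain ⟨h1, h2, h3, h4⟩ := key p hp
    obtain ⟨h5, h6, -⟩ := hS _ h1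
    have h6' : (p.1.1 : ℤ) ≤ (K : ℤ) ^ 2 := by exact_mod_cast h6
    constructor
    · have : (1 : ℤ) ≤ (f p 0) ^ 2 + (f p 1) ^ 2 := by
        simp only [hf, Matrix.cons_val_zero, Matrix.cons_val_one]
        rw [h2]; exact_mod_cast h5
      exact_mod_cast this
    · rw [supNorm_le_iff]
      intro i
      zify
      fin_cases i
      · exact abs_le_of_sq_le_sq (by simp only [hf]; simp; nlinarith [sq_nonneg p.1.2.2]) (by positivity)
      · exact abs_le_of_sq_le_sq (by simp only [hf]; simp; nlinarith [sq_nonneg p.1.2.1]) (by positivity)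
      · simp [hf, h4]
  · rw [Finset.card_image_of_injOn, hD, Finset.card_product, Finset.card_sigma,
      Finset.sum_congr rfl fun n hn => (hF n hn).1, Finset.sum_const, smul_eq_mul, Nat.card_Icc,
      Nat.add_sub_cancel]
    rintro ⟨⟨n, z⟩, k⟩ hp ⟨⟨n', z'⟩, k'⟩ hp' he
    have g1 := (key _ hp).2.1
    have g2 := (key _ hp').2.1
    have e0 := congrFun he 0
    have e1 := congrFun he 1
    have e2 := congrFun he 2
    simp only [hf, Matrix.cons_val_zero, Matrix.cons_val_one, Matrix.cons_val] at e0 e1 e2 g1 g2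
    have hn : n = n' := by
      rw [e0, e1, g2] at g1
      exact_mod_cast g1.symm
    have hz : z = z' := Prod.ext e0 e1
    have hk : k = k' := by exact_mod_cast e2
    rw [hn, hz, hk]
  · intro l
    refine (Finset.card_le_card (t := (S ×ˢ Finset.Icc 1 K).image fun p => l p.1 p.2) ?_).trans
      (Finset.card_image_le.trans (by simp))
    intro w hw
    rw [Finset.image_image] at hw
    obtain ⟨p, hp, rfl⟩ := Finset.mem_image.1 hw
    obtain ⟨h1, h2, h3, h4⟩ := key p hp
    refine Finset.mem_image.2 ⟨(p.1.1, p.2), by simp [h1, h3, h4], ?_⟩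
    have : ((p.1.2.1 : ℝ) ^ 2 + (p.1.2.2 : ℝ) ^ 2) = p.1.1 := by exact_mod_cast h2
    simp [hf, this]

namespace IsProfile

variable {ρ : ℝ → ℝ}

theorem exists_bodyDisc_le_of_reps (h : IsProfile ρ) :
    ∃ κ C : ℝ, 0 < κ ∧ 0 < C ∧ ∀ (K r L : ℕ) (S : Finset ℕ) (T : ℝ), 1 ≤ K → 2 ≤ L →
      (∀ n ∈ S, 1 ≤ n ∧ n ≤ K ^ 2 ∧ HasManyReps r n) → 0 < T →
      C ≤ T ^ (1 / 100 : ℝ) → (C * K) ^ 4 ≤ T ^ (1 / 100 : ℝ) →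
      ∃ X u : ℝ, T ≤ X ∧ X ≤ L * (T * (6 * L) ^ (S.card * K)) ∧ u ∈ Set.Icc (X - 1) (X + 1) ∧
        bodyDisc ρ u ≤ -(X * (κ * (S.card * 2 ^ r / K) - C * K / (L - 1) - C)) := by
  classical
  obtain ⟨l, c, C, hc, hC, H⟩ := h.exists_bodyDisc_expansion
  set c₁ := min c 1 with hc₁
  have hc₁0 : 0 < c₁ := lt_min hc one_pos
  refine ⟨c * c₁ ^ 2 / 4, C + 1 / c₁ + C / c₁, by positivity, by positivity, ?_⟩
  intro K r L S T hK hL hS hT hT1 hT2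
  have hK1 : (1 : ℝ) ≤ K := by exact_mod_cast hK
  have hL1 : (2 : ℝ) ≤ L := by exact_mod_cast hL
  have hN : (1 : ℝ) ≤ K / c₁ := by
    rw [le_div_iff₀ hc₁0, one_mul]; exact (min_le_right _ _).trans hK1
  obtain ⟨Ξ, a, ha, hsum, hlow, hdisc⟩ := H (K / c₁) hN
  obtain ⟨M, hM1, hM2, hM3⟩ := exists_lattice_points S hS
  have hMm : ∀ m ∈ M, m ∈ Ξ ∧ c / (K / c₁) ^ 2 ≤ a m := fun m hm => by
    refine hlow m (hM1 m hm).1 ?_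
    calc (supNorm m : ℝ) ≤ K := by exact_mod_cast (hM1 m hm).2
      _ = c₁ * (K / c₁) := by field_simp
      _ ≤ c * (K / c₁) := by gcongr; exact min_le_left _ _
  obtain ⟨X, hX1, hX2, hX3⟩ := exists_cos_sum_large Ξ M (fun m hm => (hMm m hm).1) a
    (fun m => l ((m 0 : ℝ) ^ 2 + (m 1 : ℝ) ^ 2) (m 2)) ha T hT L hL _ (hM3 l)
  have hX0 : 0 < X := hT.trans_le hX1
  set y := X ^ (1 / 100 : ℝ) with hy
  have hyX : y ^ 100 = X := by
    rw [hy, ← rpow_natCast, ← rpow_mul hX0.le]; norm_num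
  have hTy : T ^ (1 / 100 : ℝ) ≤ y := rpow_le_rpow hT.le hX1 (by norm_num)
  clear_value y
  have hyC : C ≤ y := by
    refine le_trans ?_ (hT1.trans hTy)
    rw [add_assoc, le_add_iff_nonneg_right]
    positivity
  have hyN : (K / c₁ : ℝ) ^ 4 ≤ y := by
    refine le_trans (pow_le_pow_left₀ (by positivity) ?_ _) (hT2.trans hTy)
    rw [div_eq_inv_mul, ← one_div]
    gcongr
    have : 0 ≤ C / c₁ := by positivity
    linarith
  obtain ⟨u, hu, hd⟩ := hdisc y hyC hyN
  rw [hyX] at hu hd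
  refine ⟨X, u, hX1, hX2, hu, hd.trans ?_⟩
  have hsumM : c * c₁ ^ 2 * (S.card * 2 ^ r / K) ≤ ∑ m ∈ M, a m := by
    calc _ = M.card • (c / (K / c₁) ^ 2) := by
          rw [hM2, nsmul_eq_mul]; push_cast; field_simp
      _ ≤ _ := Finset.card_nsmul_le_sum _ _ _ fun m hm => (hMm m hm).2
  have hdiv : (∑ m ∈ Ξ, a m) / ((L : ℝ) - 1) ≤ (C + 1 / c₁ + C / c₁) * K / (L - 1) := by
    refine div_le_div_of_nonneg_right (hsum.trans ?_) (by linarith)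
    rw [mul_div_assoc', mul_div_right_comm]
    gcongr
    have : 0 ≤ 1 / c₁ := by positivity
    linarith
  have hCC : C ≤ C + 1 / c₁ + C / c₁ := by rw [add_assoc, le_add_iff_nonneg_right]; positivity
  nlinarith [mul_le_mul_of_nonneg_left (hX3) hX0.le, mul_le_mul_of_nonneg_left hsumM hX0.le,
    mul_le_mul_of_nonneg_left hdiv hX0.le, mul_le_mul_of_nonneg_left hCC hX0.le]

end IsProfile

/-- The exponent of `log N` in the density of the integers up to `N ^ 2` with many
representations as a sum of two squares. -/
noncomputable def repExponent : ℝ := √2 * (1 - 3 / 2 * log 2) - 1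

theorem repExponent_bounds :
    -2 ≤ repExponent ∧ repExponent ≤ 0 ∧ -(1 / 2) ≤ repExponent + √2 * log 2 := by
  have h1 : √2 ≤ 1.42 := by rw [sqrt_le_left (by norm_num)]; norm_num
  have h2 : 1.41 ≤ √2 := le_sqrt_of_sq_le (by norm_num)
  have h3 := log_two_gt_d9
  have h4 := log_two_lt_d9
  unfold repExponent
  refine ⟨?_, ?_, ?_⟩ <;> nlinarith

theorem eventually_mul_pow_le_exp (W : ℝ) (n : ℕ) :
    ∀ᶠ x : ℝ in Filter.atTop, W * x ^ n ≤ exp x := by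
  filter_upwards [(tendsto_exp_div_pow_atTop n).eventually_ge_atTop W,
    Filter.eventually_gt_atTop 0] with x hx hx0
  rwa [le_div_iff₀ (by positivity)] at hx

theorem eventually_one_le_log : ∀ᶠ x : ℝ in Filter.atTop, 1 ≤ log x :=
  tendsto_log_atTop.eventually_ge_atTop 1

theorem eventually_one_le_density {c : ℝ} (hc : 0 < c) :
    ∀ᶠ x : ℝ in Filter.atTop,
      1 ≤ c * exp x ^ 2 * (x ^ repExponent * (log x) ^ (-(1 / 2) : ℝ)) := by
  filter_upwards [eventually_mul_pow_le_exp (1 / c) 3, eventually_one_le_log,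
    Filter.eventually_ge_atTop 1] with x h1 hw hx
  have hx0 : 0 < x := by linarith
  have hw0 : 0 < log x := by linarith
  have e1 : x ^ (-2 : ℝ) ≤ x ^ repExponent := rpow_le_rpow_of_exponent_le hx repExponent_bounds.1
  have e2 : x ^ (-1 : ℝ) ≤ (log x) ^ (-(1 / 2) : ℝ) :=
    calc x ^ (-1 : ℝ) ≤ (log x) ^ (-1 : ℝ) :=
          rpow_le_rpow_of_nonpos hw0 (log_le_self hx0.le) (by norm_num)
      _ ≤ _ := rpow_le_rpow_of_exponent_le hw (by norm_num)
  have e3 : x ^ (-2 : ℝ) * x ^ (-1 : ℝ) = (x ^ 3)⁻¹ := by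
    rw [← rpow_add hx0, ← rpow_natCast, ← rpow_neg hx0.le]; norm_num
  have e4 : exp x ≤ exp x ^ 2 := le_self_pow₀ (one_le_exp hx0.le) (by norm_num)
  calc (1 : ℝ) = c * (1 / c * x ^ 3) * (x ^ 3)⁻¹ := by field_simp
    _ ≤ c * exp x ^ 2 * (x ^ (-2 : ℝ) * x ^ (-1 : ℝ)) := by
        rw [e3]; gcongr; exact h1.trans e4
    _ ≤ _ := by gcongr

theorem eventually_le_rpow_mul_log (W : ℝ) :
    ∀ᶠ x : ℝ in Filter.atTop,
      W ≤ x * (x ^ (repExponent + √2 * log 2) * (log x) ^ (-(1 / 2) : ℝ)) := by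
  filter_upwards [(tendsto_rpow_atTop (by norm_num : (0 : ℝ) < 1 / 4)).eventually_ge_atTop W,
    (isLittleO_log_rpow_atTop (by norm_num : (0 : ℝ) < 1 / 2)).bound one_pos,
    eventually_one_le_log, Filter.eventually_ge_atTop 1] with x h1 h2 hw hx
  have hx0 : 0 < x := by linarith
  have hw0 : 0 < log x := by linarith
  rw [norm_of_nonneg hw0.le, norm_of_nonneg (by positivity), one_mul] at h2
  calc W ≤ x ^ (1 / 4 : ℝ) := h1
    _ = x * (x ^ (-(1 / 2) : ℝ) * (x ^ (1 / 2 : ℝ)) ^ (-(1 / 2) : ℝ)) := by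
        rw [← rpow_mul hx0.le, ← rpow_add hx0]
        nth_rw 2 [← rpow_one x]
        rw [← rpow_add hx0]
        norm_num
    _ ≤ _ := by
        gcongr x * (?_ * ?_)
        · exact rpow_le_rpow_of_exponent_le hx repExponent_bounds.2.2
        · exact rpow_le_rpow_of_nonpos hw0 h2 (by norm_num)

theorem eventually_iterated_log_le {W : ℝ} (hW : 0 < W) :
    ∀ᶠ x : ℝ in Filter.atTop, ∀ v : ℝ, exp x ≤ v →
      v ≤ W * (exp x ^ 3 * x ^ repExponent * (log x) ^ (1 / 2 : ℝ)) →
      v ^ (1 / 3 : ℝ) * (log v) ^ ((2 / 3) * (√2 - 1)) * (log (log v)) ^ (-(2 / 3) : ℝ) ≤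
        W ^ (1 / 3 : ℝ) * 4 ^ ((2 / 3) * (√2 - 1)) *
          (exp x * x ^ (repExponent + √2 * log 2) * (log x) ^ (-(1 / 2) : ℝ)) := by
  filter_upwards [eventually_mul_pow_le_exp W 1, eventually_one_le_log,
    Filter.eventually_ge_atTop 1] with x h1 hw hx v hv1 hv2
  have hx0 : 0 < x := by linarith
  have hw0 : 0 < log x := by linarith
  have hv0 : 0 < v := (exp_pos x).trans_le hv1
  have hε : 0 ≤ (2 / 3) * (√2 - 1) := by
    have : 1 ≤ √2 := one_le_sqrt.2 (by norm_num)
    linarith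
  have hlv : x ≤ log v := (le_log_iff_exp_le hv0).2 hv1
  have hv4 : v ≤ exp (4 * x) := by
    have a1 : x ^ repExponent ≤ 1 := rpow_le_one_of_one_le_of_nonpos hx repExponent_bounds.2.1
    have a2 : (log x) ^ (1 / 2 : ℝ) ≤ x := by
      calc _ ≤ (log x) ^ (1 : ℝ) := rpow_le_rpow_of_exponent_le hw (by norm_num)
        _ ≤ x := by rw [rpow_one]; exact log_le_self hx0.le
    calc v ≤ W * (exp x ^ 3 * 1 * x) := hv2.trans (by gcongr)
      _ = exp x ^ 3 * (W * x ^ 1) := by ring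
      _ ≤ exp x ^ 3 * exp x := by gcongr
      _ = exp (4 * x) := by rw [← pow_succ, ← exp_nat_mul]; norm_num
  have b1 : v ^ (1 / 3 : ℝ) ≤
      W ^ (1 / 3 : ℝ) * (exp x * x ^ (repExponent / 3) * (log x) ^ (1 / 6 : ℝ)) := by
    refine (rpow_le_rpow hv0.le hv2 (by norm_num)).trans_eq ?_
    rw [mul_rpow hW.le (by positivity), mul_rpow (by positivity) (by positivity),
      mul_rpow (by positivity) (by positivity), ← rpow_mul hx0.le, ← rpow_mul hw0.le,
      ← rpow_natCast (exp x), ← rpow_mul (exp_pos x).le]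
    norm_num
    left; left
    rw [mul_one_div]
  have b2 : (log v) ^ ((2 / 3) * (√2 - 1)) ≤
      4 ^ ((2 / 3) * (√2 - 1)) * x ^ ((2 / 3) * (√2 - 1)) := by
    rw [← mul_rpow (by norm_num) hx0.le]
    refine rpow_le_rpow (by linarith) ?_ hε
    exact (log_le_iff_le_exp hv0).2 hv4
  have b3 : (log (log v)) ^ (-(2 / 3) : ℝ) ≤ (log x) ^ (-(2 / 3) : ℝ) :=
    rpow_le_rpow_of_nonpos hw0 (log_le_log hx0 hlv) (by norm_num)
  have b4 : x ^ (repExponent / 3) * x ^ ((2 / 3) * (√2 - 1)) = x ^ (repExponent + √2 * log 2) := by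
    rw [← rpow_add hx0]
    congr 1
    unfold repExponent
    ring
  have b5 : (log x) ^ (1 / 6 : ℝ) * (log x) ^ (-(2 / 3) : ℝ) = (log x) ^ (-(1 / 2) : ℝ) := by
    rw [← rpow_add hw0]; norm_num
  have hlv0 : 0 < log v := hx0.trans_le hlv
  have hllv0 : 0 ≤ log (log v) := hw0.le.trans (log_le_log hx0 hlv)
  calc _ ≤ W ^ (1 / 3 : ℝ) * (exp x * x ^ (repExponent / 3) * (log x) ^ (1 / 6 : ℝ)) *
        (4 ^ ((2 / 3) * (√2 - 1)) * x ^ ((2 / 3) * (√2 - 1))) * (log x) ^ (-(2 / 3) : ℝ) := by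
        gcongr
    _ = _ := by rw [← b4, ← b5]; ring

/-- The logarithm of the height produced by Dirichlet approximation, in terms of `x = log K`. -/
theorem log_height_le {c x X u : ℝ} {s K L : ℕ} (hK : exp x = K) (hw : 1 ≤ log x) (hx : 9 ≤ x)
    (hs : (s : ℝ) ≤ 2 * (c * exp x ^ 2 * (x ^ repExponent * (log x) ^ (-(1 / 2) : ℝ))))
    (hL1 : 2 ≤ L) (hL : (L : ℝ) ≤ x + 3) (hX : 2 ≤ X)
    (hXL : X ≤ L * (exp K * (6 * L) ^ (s * K))) (hu0 : 0 < u) (hu : u ≤ 2 * X) :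
    log (u ^ 2) ≤
      (8 * c + 8) * (exp x ^ 3 * x ^ repExponent * (log x) ^ (1 / 2 : ℝ)) := by
  set w := log x with hwdef
  have hx0 : 0 < x := by linarith
  have hw0 : 0 < w := by linarith
  have hL0 : (2 : ℝ) ≤ L := by exact_mod_cast hL1
  have hlog6 : log (6 * L) ≤ 2 * w := by
    rw [hwdef, ← Nat.cast_two, ← log_pow]
    exact log_le_log (by linarith) (by nlinarith)
  have hlogL : log L ≤ 2 * w := (log_le_log (by linarith) (by linarith)).trans hlog6
  have hlogX : log X ≤ 2 * w + (K + s * K * (2 * w)) := by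
    refine (log_le_log (by linarith) hXL).trans ?_
    rw [log_mul (by positivity) (by positivity), log_mul (by positivity) (by positivity),
      log_exp, log_pow]
    push_cast
    gcongr
  have hlogu : log u ≤ log 2 + log X := by
    rw [← log_mul (by norm_num) (by linarith)]
    exact log_le_log hu0 hu
  have hlog2 : log 2 ≤ 1 := by linarith [log_two_lt_d9]
  have hwK : w ≤ K := by
    rw [← hK]
    linarith [log_le_self hx0.le, add_one_le_exp x]
  have hKw : (K : ℝ) ≤ exp x ^ 3 * x ^ repExponent * w ^ (1 / 2 : ℝ) := by
    have e1 : x ^ (-2 : ℝ) ≤ x ^ repExponent :=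
      rpow_le_rpow_of_exponent_le (by linarith) repExponent_bounds.1
    have e2 : 1 ≤ w ^ (1 / 2 : ℝ) := one_le_rpow hw (by norm_num)
    have e3 : x ^ 2 ≤ exp x ^ 2 :=
      pow_le_pow_left₀ hx0.le (by linarith [add_one_le_exp x]) _
    have e4 : x ^ (-2 : ℝ) = (x ^ 2)⁻¹ := by
      rw [rpow_neg hx0.le]; norm_num
    calc (K : ℝ) = exp x * (x ^ 2 * (x ^ 2)⁻¹) * 1 := by
          rw [mul_inv_cancel₀ (by positivity), hK]; ring
      _ ≤ exp x * (exp x ^ 2 * x ^ repExponent) * w ^ (1 / 2 : ℝ) := by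
          rw [← e4]; gcongr
      _ = _ := by ring
  have hsK : s * K * w ≤ 2 * c * (exp x ^ 3 * x ^ repExponent * w ^ (1 / 2 : ℝ)) := by
    have e1 : w ^ (-(1 / 2) : ℝ) * w = w ^ (1 / 2 : ℝ) := by
      nth_rw 2 [← rpow_one w]
      rw [← rpow_add hw0]; norm_num
    rw [← hK, ← e1]
    calc _ ≤ 2 * (c * exp x ^ 2 * (x ^ repExponent * w ^ (-(1 / 2) : ℝ))) * exp x * w := by
          gcongr
      _ = _ := by ring
  have hK1 : (1 : ℝ) ≤ K := by rw [← hK]; exact one_le_exp hx0.le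
  rw [log_pow]
  push_cast
  nlinarith

/-- The main term dominates the errors from truncation and from Dirichlet approximation. -/
theorem main_term_le {κ c C K x s q L : ℝ} (hκ : 0 < κ) (hc : 0 < c) (hC : 0 < C) (hK : 2 ≤ K)
    (hKx : exp x = K) (hx0 : 0 < x) (hw0 : 0 < log x)
    (hs : c * exp x ^ 2 * (x ^ repExponent * (log x) ^ (-(1 / 2) : ℝ)) ≤ s)
    (hq : c * x ^ (√2 * log 2) ≤ q) (hL : x ≤ L - 1)
    (hW : 4 * C / (κ * c ^ 2) ≤
      x * (x ^ (repExponent + √2 * log 2) * (log x) ^ (-(1 / 2) : ℝ))) :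
    κ * c ^ 2 / 2 * (K * x ^ (repExponent + √2 * log 2) * (log x) ^ (-(1 / 2) : ℝ)) ≤
      κ * (s * q / K) - C * K / (L - 1) - C := by
  set E := K * x ^ (repExponent + √2 * log 2) * (log x) ^ (-(1 / 2) : ℝ) with hE
  have g1 : c ^ 2 * E ≤ s * q / K := by
    rw [le_div_iff₀ (by linarith)]
    calc _ = c * exp x ^ 2 * (x ^ repExponent * (log x) ^ (-(1 / 2) : ℝ)) *
          (c * x ^ (√2 * log 2)) := by
          rw [hE, rpow_add hx0, hKx]; ring
      _ ≤ _ := by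
          have : 0 ≤ s := le_trans (by positivity) hs
          gcongr
  have g2 : C * K / x ≤ κ * c ^ 2 * E / 4 := by
    rw [div_le_iff₀ hx0]
    rw [div_le_iff₀ (by positivity)] at hW
    calc C * K = 4 * C * (K / 4) := by ring
      _ ≤ _ := mul_le_mul_of_nonneg_right hW (by linarith)
      _ = _ := by rw [hE]; ring
  have g3 : C * K / (L - 1) ≤ C * K / x := by gcongr
  have g4 : C ≤ C * K / x := by
    rw [le_div_iff₀ hx0]
    gcongr
    rw [← hKx]
    linarith [add_one_le_exp x]
  have := mul_le_mul_of_nonneg_left g1 hκ.le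
  linarith

namespace IsProfile

variable {ρ : ℝ → ℝ}

theorem exists_bodyDisc_large (h : IsProfile ρ) :
    ∃ κ W : ℝ, 0 < κ ∧ 0 < W ∧ ∀ᶠ K : ℕ in Filter.atTop, ∃ u : ℝ, 1 ≤ u ∧ K ≤ log (u ^ 2) ∧
      log (u ^ 2) ≤ W * ((K : ℝ) ^ 3 * (log K) ^ repExponent * (log (log K)) ^ (1 / 2 : ℝ)) ∧
      bodyDisc ρ u ≤ -(κ * u * (K * (log K) ^ (repExponent + √2 * log 2) *
        (log (log K)) ^ (-(1 / 2) : ℝ))) := by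
  obtain ⟨κ, C, hκ, hC, hdisc⟩ := h.exists_bodyDisc_le_of_reps
  obtain ⟨c, hc, N₀, hreps⟩ := exists_many_reps_set
  have hlogK : Filter.Tendsto (fun K : ℕ => log (K : ℝ)) Filter.atTop Filter.atTop :=
    tendsto_log_atTop.comp tendsto_natCast_atTop_atTop
  have hK100 : Filter.Tendsto (fun K : ℕ => (K : ℝ) * (1 / 100)) Filter.atTop Filter.atTop :=
    tendsto_natCast_atTop_atTop.atTop_mul_const (by norm_num)
  refine ⟨κ * c ^ 2 / 4, 8 * c + 8, by positivity, by positivity, ?_⟩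
  filter_upwards [hlogK.eventually (eventually_one_le_density hc),
    hlogK.eventually (eventually_le_rpow_mul_log (4 * C / (κ * c ^ 2))),
    hlogK.eventually eventually_one_le_log, hlogK.eventually_ge_atTop 9,
    hK100.eventually (eventually_mul_pow_le_exp ((100 * C) ^ 4) 4),
    hK100.eventually (eventually_mul_pow_le_exp C 0),
    Filter.eventually_ge_atTop N₀, Filter.eventually_ge_atTop 2] with K h1 h2 hw hx h3 h4 hN hK2
  obtain ⟨r, S, hS, hcard, hr⟩ := hreps K hN
  have hK2' : (2 : ℝ) ≤ K := by exact_mod_cast hK2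
  have hKx : exp (log K) = K := exp_log (by linarith)
  set x := log (K : ℝ) with hxdef
  change 1 ≤ log x at hw
  have hx0 : 0 < x := by linarith
  have hw0 : 0 < log x := by linarith
  set A := x ^ repExponent * (log x) ^ (-(1 / 2) : ℝ) with hA
  set s := ⌈c * exp x ^ 2 * A⌉₊ with hs
  have hs1 : c * exp x ^ 2 * A ≤ s := Nat.le_ceil _
  have hs2 : (s : ℝ) ≤ 2 * (c * exp x ^ 2 * A) := by
    have := Nat.ceil_lt_add_one (zero_le_one.trans h1)
    linarith
  obtain ⟨S', hS'S, hS'⟩ := Finset.exists_subset_card_eq (s := S) (n := s) (by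
    refine Nat.ceil_le.2 (le_trans (le_of_eq ?_) hcard)
    rw [hA, hKx]
    unfold repExponent
    ring)
  set L := ⌈x⌉₊ + 2 with hL
  have hL1 : x ≤ (L : ℝ) - 1 := by
    have := Nat.le_ceil x
    push_cast [hL]; linarith
  have hL2 : (L : ℝ) ≤ x + 3 := by
    have := Nat.ceil_lt_add_one hx0.le
    push_cast [hL]; linarith
  obtain ⟨X, u, hX1, hX2, hu, hd⟩ := hdisc K r L S' (exp K) (by omega) (by omega)
    (fun n hn => hS n (hS'S hn)) (exp_pos _)
    (by rw [← exp_mul]; linarith) (by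
      rw [← exp_mul]
      refine le_trans (le_of_eq ?_) h3
      ring)
  rw [hS'] at hX2 hd
  have hKe : (1 : ℝ) ≤ K / 2 := by linarith
  have hexp2 : 2 ≤ exp (K / 2 : ℝ) := by linarith [add_one_le_exp (K / 2 : ℝ)]
  have hexpK : exp (K : ℝ) = exp (K / 2 : ℝ) ^ 2 := by
    rw [← exp_nat_mul]; congr 1; push_cast; ring
  have hue : exp (K / 2 : ℝ) ≤ u := by
    have := hu.1
    nlinarith
  have hX3 : 4 ≤ X := by nlinarith
  have hu0 : 0 < u := by linarith
  have hu2 : u ≤ 2 * X := by linarith [hu.2]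
  refine ⟨u, by linarith, ?_, ?_, ?_⟩
  · rw [log_pow]
    have := (le_log_iff_exp_le hu0).2 hue
    push_cast; linarith
  · have := log_height_le hKx hw hx hs2 (by omega) hL2 (by linarith) hX2 hu0 hu2
    rwa [hKx] at this
  · set E := (K : ℝ) * x ^ (repExponent + √2 * log 2) * (log x) ^ (-(1 / 2) : ℝ) with hE
    have hE0 : 0 ≤ E := by positivity
    have g5 := main_term_le hκ hc hC hK2' hKx hx0 hw0 hs1 hr hL1 h2
    have g6 : u * (κ * c ^ 2 / 4 * E) ≤ 2 * X * (κ * c ^ 2 / 4 * E) := by gcongr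
    have g7 := mul_le_mul_of_nonneg_left g5 (by linarith : 0 ≤ X)
    linarith

end IsProfile

theorem stmt_0 (ρ : ℝ → ℝ)
    (hρ_even : ∀ θ : ℝ, ρ (-θ) = ρ θ)
    (hρ_per : Function.Periodic ρ (2 * Real.pi))
    (hρ_pos : ∀ θ : ℝ, 0 < ρ θ)
    (hρ_smooth : ContDiff ℝ (⊤ : ℕ∞) ρ)
    (hρ_curv : ∀ θ : ℝ, ρ θ * deriv (deriv ρ) θ - 2 * (deriv ρ θ) ^ 2 - (ρ θ) ^ 2 ≠ 0)
    (B : Set (Fin 3 → ℝ))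
    (hB : B = {x : Fin 3 → ℝ | ∃ θ φ r : ℝ,
      0 ≤ θ ∧ θ ≤ Real.pi ∧ 0 ≤ φ ∧ φ ≤ 2 * Real.pi ∧ 0 ≤ r ∧ r ≤ ρ θ ∧
      x = ![r * (Real.sin θ * Real.cos φ), r * (Real.sin θ * Real.sin φ),
            r * Real.cos θ]}) :
    ∃ c : ℝ, 0 < c ∧ ∀ T : ℝ, ∃ t : ℝ, T ≤ t ∧
      latticeDiscrepancy B t ≤
        -(c * t ^ (1 / 2 : ℝ) * (Real.log t) ^ (1 / 3 : ℝ) *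
          (Real.log (Real.log t)) ^ ((2 / 3) * (Real.sqrt 2 - 1)) *
          (Real.log (Real.log (Real.log t))) ^ (-(2 / 3) : ℝ)) := by
  have h : IsProfile ρ := ⟨hρ_even, hρ_per, hρ_pos, hρ_smooth, hρ_curv⟩
  rw [hB, h.body_eq]
  obtain ⟨κ, W, hκ, hW, hlarge⟩ := h.exists_bodyDisc_large
  set V := W ^ (1 / 3 : ℝ) * 4 ^ ((2 / 3) * (√2 - 1)) with hV
  have hV0 : 0 < V := by positivity
  refine ⟨κ / V, by positivity, fun T => ?_⟩
  have hlogK : Filter.Tendsto (fun K : ℕ => log (K : ℝ)) Filter.atTop Filter.atTop :=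
    tendsto_log_atTop.comp tendsto_natCast_atTop_atTop
  obtain ⟨K, ⟨u, hu1, hKu, hu2, hd⟩, hiter, hKT, hK1⟩ := (hlarge.and <|
    (hlogK.eventually (eventually_iterated_log_le hW)).and <|
    (tendsto_natCast_atTop_atTop.eventually_ge_atTop T).and
      (Filter.eventually_ge_atTop 1)).exists
  have hu0 : 0 < u := by linarith
  have hK1' : (1 : ℝ) ≤ K := by exact_mod_cast hK1
  rw [exp_log (by linarith)] at hiter
  refine ⟨u ^ 2, ?_, ?_⟩
  · exact (hKT.trans hKu).trans (log_le_self (by positivity))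
  · have hpow : (u ^ 2) ^ (1 / 2 : ℝ) = u := by
      rw [← sqrt_eq_rpow, sqrt_sq hu0.le]
    have hfin := hiter _ hKu hu2
    rw [latticeDiscrepancy_sq ρ hu0, hpow]
    refine hd.trans (neg_le_neg ?_)
    calc _ = κ / V * u * ((log (u ^ 2)) ^ (1 / 3 : ℝ) *
          (log (log (u ^ 2))) ^ ((2 / 3) * (√2 - 1)) *
          (log (log (log (u ^ 2)))) ^ (-(2 / 3) : ℝ)) := by ring
      _ ≤ κ / V * u * (V * (K * (log K) ^ (repExponent + √2 * log 2) *
          (log (log K)) ^ (-(1 / 2) : ℝ))) := by gcongr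
      _ = _ := by field_simp
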